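/- Suppose assumptions (A1)–(A4) hold. Then the terminal-value problem ∂θ/∂t + Σ_{i,j=1}^n a_{ij}(t,x,θ) ∂²θ/∂x_i∂x_j + ⟨∇θ, b(t,x,θ)⟩ + b̂(t,x,θ) = 0 in (0,T)×ℝⁿ, θ(T,x) = g(x) on ℝⁿ, admits a unique classical solution θ(t,x), and θ, ∂θ/∂t, ∇θ and Δθ are bounded on (0,T)×ℝⁿ. -/

import Mathlib

noncomputable section

open Set Matrix

attribute [local instance] Matrix.normedAddCommGroup Matrix.normedSpace

/-- `ES n` is the Euclidean space `ℝⁿ`. -/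
abbrev ES (n : ℕ) : Type := EuclideanSpace ℝ (Fin n)

/-- Partial derivative of `f : ℝⁿ → ℝ` in the `i`-th coordinate direction. -/
def pd {n : ℕ} (i : Fin n) (f : ES n → ℝ) (x : ES n) : ℝ :=
  fderiv ℝ f x (EuclideanSpace.single i 1)

/-- Second-order partial derivative `∂²f/∂x_i∂x_j`. -/
def pd2 {n : ℕ} (i j : Fin n) (f : ES n → ℝ) (x : ES n) : ℝ :=
  pd i (pd j f) x

/-- `f` is a `C¹` function with bounded derivative. -/
def C1Bdd {E F : Type*} [NormedAddCommGroup E] [NormedSpace ℝ E]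
    [NormedAddCommGroup F] [NormedSpace ℝ F] (f : E → F) : Prop :=
  ContDiff ℝ 1 f ∧ ∃ K : ℝ, ∀ x, ‖fderiv ℝ f x‖ ≤ K

/-- `g` is bounded in `C^{2+δ}(ℝⁿ)`. -/
def BddC2Holder {n m : ℕ} (δ : ℝ) (g : ES n → ES m) : Prop :=
  ContDiff ℝ 2 g ∧ ∃ K : ℝ,
    (∀ x, ‖g x‖ ≤ K ∧ ‖fderiv ℝ g x‖ ≤ K ∧ ‖fderiv ℝ (fderiv ℝ g) x‖ ≤ K) ∧
    ∀ x y, ‖fderiv ℝ (fderiv ℝ g) x - fderiv ℝ (fderiv ℝ g) y‖ ≤ K * ‖x - y‖ ^ δ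

/-- `θ` is `C¹` in time and `C²` in space at the point `(t,x)`. -/
def RegAt {n m : ℕ} (θ : ℝ → ES n → ES m) (t : ℝ) (x : ES n) : Prop :=
  ∀ k : Fin m,
    DifferentiableAt ℝ (fun s => θ s x k) t ∧
    DifferentiableAt ℝ (fun x' => θ t x' k) x ∧
    ∀ j : Fin n, DifferentiableAt ℝ (pd j (fun x' => θ t x' k)) x

/-- `θ` satisfies, at the point `(t,x)`, the quasilinear parabolic system
`∂θ/∂t + Σ aᵢⱼ(t,x,θ) ∂²θ/∂xᵢ∂xⱼ + ⟨∇θ, b(t,x,θ)⟩ + b̂(t,x,θ) = 0` (componentwise). -/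
def SatPDEAt {n m : ℕ} (a : ℝ → ES n → ES m → Matrix (Fin n) (Fin n) ℝ)
    (b : ℝ → ES n → ES m → ES n) (bh : ℝ → ES n → ES m → ES m)
    (θ : ℝ → ES n → ES m) (t : ℝ) (x : ES n) : Prop :=
  ∀ k : Fin m,
    deriv (fun s => θ s x k) t
      + ∑ i, ∑ j, a t x (θ t x) i j * pd2 i j (fun x' => θ t x' k) x
      + ∑ i, pd i (fun x' => θ t x' k) x * (b t x (θ t x)) i
      + bh t x (θ t x) k = 0

/-- `θ` is a classical solution of the quasilinear parabolic system on `(0,T) × Q`: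
it is continuous on `[0,T] × Q̄` and pointwise regular and satisfies the PDE inside. -/
def IsSolOn {n m : ℕ} (T : ℝ) (a : ℝ → ES n → ES m → Matrix (Fin n) (Fin n) ℝ)
    (b : ℝ → ES n → ES m → ES n) (bh : ℝ → ES n → ES m → ES m)
    (Q : Set (ES n)) (θ : ℝ → ES n → ES m) : Prop :=
  ContinuousOn (fun p : ℝ × ES n => θ p.1 p.2) (Icc 0 T ×ˢ closure Q) ∧
  ∀ t ∈ Ioo 0 T, ∀ x ∈ Q, RegAt θ t x ∧ SatPDEAt a b bh θ t x

/-- `θ`, `∂θ/∂t`, `∇θ` and `Δθ` are all bounded on `(0,T) × Q`. -/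
def DerivBdd {n m : ℕ} (T : ℝ) (Q : Set (ES n)) (θ : ℝ → ES n → ES m) : Prop :=
  ∃ K : ℝ, ∀ t ∈ Ioo 0 T, ∀ x ∈ Q, ∀ k : Fin m,
    ‖θ t x‖ ≤ K ∧ |deriv (fun s => θ s x k) t| ≤ K ∧
    (∀ i, |pd i (fun x' => θ t x' k) x| ≤ K) ∧
    |∑ i, pd2 i i (fun x' => θ t x' k) x| ≤ K

/-- The coefficient matrix `a = ½ σ σᵀ`. -/
def halfSigmaSigmaT {n m d : ℕ} (σ : ℝ → ES n → ES m → Matrix (Fin n) (Fin d) ℝ) :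
    ℝ → ES n → ES m → Matrix (Fin n) (Fin n) ℝ :=
  fun t x y => (2 : ℝ)⁻¹ • (σ t x y * (σ t x y)ᵀ)

/-- Assumption (A1): the coefficients are `C¹` with bounded partial derivatives and
`g` is bounded in `C^{2+δ}`. -/
def AssumptionA1 {n m d : ℕ} (b : ℝ → ES n → ES m → ES n)
    (σ : ℝ → ES n → ES m → Matrix (Fin n) (Fin d) ℝ)
    (bh : ℝ → ES n → ES m → ES m)
    (σh : ℝ → ES n → ES m → Matrix (Fin m) (Fin d) ℝ → Matrix (Fin m) (Fin d) ℝ)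
    (g : ES n → ES m) (δ : ℝ) : Prop :=
  C1Bdd (fun p : ℝ × ES n × ES m => b p.1 p.2.1 p.2.2) ∧
  C1Bdd (fun p : ℝ × ES n × ES m => bh p.1 p.2.1 p.2.2) ∧
  C1Bdd (fun p : ℝ × ES n × ES m => σ p.1 p.2.1 p.2.2) ∧
  C1Bdd (fun p : (ℝ × ES n × ES m) × Matrix (Fin m) (Fin d) ℝ =>
    σh p.1.1 p.1.2.1 p.1.2.2 p.2) ∧
  C1Bdd g ∧ δ ∈ Ioo (0 : ℝ) 1 ∧ BddC2Holder δ g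

/-- Assumption (A2): `σ` is bounded and `σσᵀ ≥ ν(|y|) I` uniformly. -/
def AssumptionA2 {n m d : ℕ} (T : ℝ) (σ : ℝ → ES n → ES m → Matrix (Fin n) (Fin d) ℝ)
    (ν : ℝ → ℝ) (C : ℝ) : Prop :=
  0 < C ∧ Continuous ν ∧ (∀ r, 0 < ν r) ∧
  ∀ t ∈ Icc (0 : ℝ) T, ∀ (x : ES n) (y : ES m),
    ‖σ t x y‖ ≤ C ∧
    (σ t x y * (σ t x y)ᵀ - ν ‖y‖ • (1 : Matrix (Fin n) (Fin n) ℝ)).PosSemidef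

/-- Assumption (A3): kernel bound, bijectivity of `z ↦ σ̂(t,x,y,z)` with jointly
continuous inverse `σinv` satisfying an `α`-Hölder estimate. -/
def AssumptionA3 {n m d : ℕ} (T : ℝ)
    (σh σinv : ℝ → ES n → ES m → Matrix (Fin m) (Fin d) ℝ → Matrix (Fin m) (Fin d) ℝ)
    (κ lam : ℝ → ℝ) (α : ℝ) : Prop :=
  Continuous κ ∧ (∀ r, 0 < κ r) ∧
  (∀ t ∈ Icc (0 : ℝ) T, ∀ (x : ES n) (y : ES m) (z : Matrix (Fin m) (Fin d) ℝ),
    σh t x y z = 0 → ‖z‖ ≤ κ ‖y‖) ∧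
  (∀ (t : ℝ) (x : ES n) (y : ES m), Function.Bijective (σh t x y)) ∧
  (∀ (t : ℝ) (x : ES n) (y : ES m) (z : Matrix (Fin m) (Fin d) ℝ),
    σinv t x y (σh t x y z) = z) ∧
  (∀ (t : ℝ) (x : ES n) (y : ES m) (ζ : Matrix (Fin m) (Fin d) ℝ),
    σh t x y (σinv t x y ζ) = ζ) ∧
  Continuous (fun p : ℝ × ES n × ES m × Matrix (Fin m) (Fin d) ℝ =>
    σinv p.1 p.2.1 p.2.2.1 p.2.2.2) ∧
  Continuous lam ∧ (∀ r, 0 ≤ lam r) ∧ 1 ≤ α ∧ α < 2 ∧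
  ∀ t ∈ Icc (0 : ℝ) T, ∀ (x : ES n) (y : ES m) (ζ ζ' : Matrix (Fin m) (Fin d) ℝ),
    ‖σinv t x y ζ - σinv t x y ζ'‖ ≤ lam ‖y‖ * ‖ζ - ζ'‖ ^ α

/-- Assumption (A4): `|b(t,x,y)| ≤ η(|y|)` and `|b̂(t,x,0)| ≤ C`. -/
def AssumptionA4 {n m : ℕ} (T : ℝ) (b : ℝ → ES n → ES m → ES n)
    (bh : ℝ → ES n → ES m → ES m) (η : ℝ → ℝ) (C : ℝ) : Prop :=
  (∀ r, 0 < η r) ∧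
  (∀ t ∈ Icc (0 : ℝ) T, ∀ (x : ES n) (y : ES m), ‖b t x y‖ ≤ η ‖y‖) ∧
  ∀ t ∈ Icc (0 : ℝ) T, ∀ x : ES n, ‖bh t x 0‖ ≤ C

/-- Assumption (A5): each component `b̂ᵏ` vanishes when `y_k = 0` and is
decreasing in `y_k`. -/
def AssumptionA5 {n m : ℕ} (T : ℝ) (bh : ℝ → ES n → ES m → ES m) : Prop :=
  ∀ k : Fin m,
    (∀ t ∈ Icc (0 : ℝ) T, ∀ (x : ES n) (y : ES m), y k = 0 → bh t x y k = 0) ∧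
    ∀ t ∈ Icc (0 : ℝ) T, ∀ (x : ES n) (y y' : ES m),
      (∀ j, j ≠ k → y j = y' j) → y k ≤ y' k → bh t x y' k ≤ bh t x y k

/-- `θ` is a bounded classical solution of the decoupling terminal-value problem on
`(0,T) × ℝⁿ` with terminal data `g`, with `θ`, `∂θ/∂t`, `∇θ`, `Δθ` bounded. -/
def IsFullSpaceSolution {n m d : ℕ} (T : ℝ) (b : ℝ → ES n → ES m → ES n)
    (σ : ℝ → ES n → ES m → Matrix (Fin n) (Fin d) ℝ)
    (bh : ℝ → ES n → ES m → ES m) (g : ES n → ES m)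
    (θ : ℝ → ES n → ES m) : Prop :=
  IsSolOn T (halfSigmaSigmaT σ) b bh (univ : Set (ES n)) θ ∧
  (∀ x : ES n, θ T x = g x) ∧
  DerivBdd T (univ : Set (ES n)) θ

set_option linter.unusedVariables false
set_option linter.unusedSectionVars false
set_option linter.unusedSimpArgs false
set_option synthInstance.maxHeartbeats 200000

namespace QP
open MeasureTheory Filter Topology Metric

/-- bilinear forms -/
abbrev Bil (n : ℕ) : Type := ES n →L[ℝ] ES n →L[ℝ] ℝ

/-- standard basis vector -/
def ee {n : ℕ} (i : Fin n) : ES n := EuclideanSpace.single i 1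

lemma norm_ee {n : ℕ} (i : Fin n) : ‖(ee i : ES n)‖ = 1 := by simp [ee]

lemma sum_ee {n : ℕ} (x : ES n) : x = ∑ i, x i • (ee i : ES n) := by
  have := (EuclideanSpace.basisFun (Fin n) ℝ).sum_repr x
  simp only [EuclideanSpace.basisFun_repr, EuclideanSpace.basisFun_apply] at this
  exact this.symm

/-- the second order operator `∑ S_ij q_ij` -/
def Lop {n : ℕ} (S : ES n →L[ℝ] ES n) (q : Bil n) : ℝ := ∑ i, q (S (ee i)) (ee i)

lemma Lop_add {n : ℕ} (S : ES n →L[ℝ] ES n) (q q' : Bil n) :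
    Lop S (q + q') = Lop S q + Lop S q' := by
  simp [Lop, Finset.sum_add_distrib]

lemma Lop_sub {n : ℕ} (S : ES n →L[ℝ] ES n) (q q' : Bil n) :
    Lop S (q - q') = Lop S q - Lop S q' := by
  simp [Lop, Finset.sum_sub_distrib]

lemma Lop_smul {n : ℕ} (S : ES n →L[ℝ] ES n) (c : ℝ) (q : Bil n) :
    Lop S (c • q) = c * Lop S q := by
  simp [Lop, Finset.mul_sum]

lemma Lop_neg {n : ℕ} (S : ES n →L[ℝ] ES n) (q : Bil n) :
    Lop S (-q) = - Lop S q := by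
  simp [Lop]

lemma Lop_add_left {n : ℕ} (S S' : ES n →L[ℝ] ES n) (q : Bil n) :
    Lop (S + S') q = Lop S q + Lop S' q := by
  simp [Lop, Finset.sum_add_distrib]

lemma Lop_sub_left {n : ℕ} (S S' : ES n →L[ℝ] ES n) (q : Bil n) :
    Lop (S - S') q = Lop S q - Lop S' q := by
  simp [Lop, Finset.sum_sub_distrib]

lemma Lop_smul_left {n : ℕ} (c : ℝ) (S : ES n →L[ℝ] ES n) (q : Bil n) :
    Lop (c • S) q = c * Lop S q := by
  simp [Lop, Finset.mul_sum]

lemma abs_Lop_le {n : ℕ} (S : ES n →L[ℝ] ES n) (q : Bil n) :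
    |Lop S q| ≤ n * ‖S‖ * ‖q‖ := by
  unfold Lop
  refine (Finset.abs_sum_le_sum_abs _ _).trans ?_
  have : ∀ i ∈ (Finset.univ : Finset (Fin n)), |q (S (ee i)) (ee i)| ≤ ‖S‖ * ‖q‖ := by
    intro i _
    have h1 := q.le_opNorm₂ (S (ee i)) (ee i)
    have h2 := S.le_opNorm (ee i)
    rw [norm_ee] at h1 h2
    rw [Real.norm_eq_abs] at h1
    nlinarith [norm_nonneg q]
  refine (Finset.sum_le_card_nsmul _ _ _ this).trans ?_
  simp [mul_assoc]

/-- symmetric operators with bounds -/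
structure Ell {n : ℕ} (ν Λ : ℝ) (S : ES n →L[ℝ] ES n) : Prop where
  sym : ∀ v w, inner ℝ (S v) w = inner ℝ v (S w)
  lo : ∀ v, ν * ‖v‖ ^ 2 ≤ inner ℝ (S v) v
  hi : ∀ v, inner ℝ (S v) v ≤ Λ * ‖v‖ ^ 2

/-- Factorization of an elliptic operator. -/
lemma Ell.factor {n : ℕ} {ν Λ : ℝ} {S : ES n →L[ℝ] ES n} (h : Ell ν Λ S) (hν : 0 ≤ ν) :
    ∃ (v : OrthonormalBasis (Fin n) ℝ (ES n)) (l : Fin n → ℝ),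
      (∀ k, ν ≤ l k ∧ l k ≤ Λ) ∧ ∀ q : Bil n, Lop S q = ∑ k, l k * q (v k) (v k) := by
  have hs : (S : ES n →ₗ[ℝ] ES n).IsSymmetric := fun v w => h.sym v w
  have hn : Module.finrank ℝ (ES n) = n := by simp
  let v := hs.eigenvectorBasis hn
  let l := hs.eigenvalues hn
  have hv : ∀ k, S (v k) = l k • v k := fun k => by
    exact hs.apply_eigenvectorBasis hn k
  refine ⟨v, l, ?_, ?_⟩
  · intro k
    have h1 := h.lo (v k)
    have h2 := h.hi (v k)
    have hnk : ‖v k‖ = 1 := v.orthonormal.1 k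
    rw [hv, inner_smul_left, real_inner_self_eq_norm_sq, hnk] at h1 h2
    simpa using And.intro h1 h2
  · intro q
    have key : ∀ x : ES n, S x = ∑ k, (l k * inner ℝ (v k) x) • v k := by
      intro x
      conv_lhs => rw [← v.sum_repr' x]
      rw [map_sum]
      refine Finset.sum_congr rfl fun k _ => ?_
      rw [map_smul, hv, smul_smul, mul_comm]
    unfold Lop
    have e1 : ∀ i : Fin n, q (S (ee i)) (ee i)
        = ∑ k, l k * ((v k) i * q (v k) (ee i)) := by
      intro i
      rw [key, map_sum, _root_.sum_apply]
      refine Finset.sum_congr rfl fun k _ => ?_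
      have : inner ℝ (v k) (ee i) = (v k) i := by
        simp [ee, EuclideanSpace.inner_single_right]
      rw [map_smul, this]
      simp [mul_assoc]
    rw [Finset.sum_congr rfl fun i _ => e1 i, Finset.sum_comm]
    refine Finset.sum_congr rfl fun k _ => ?_
    rw [← Finset.mul_sum]
    congr 1
    have h9 : q (v k) (v k) = q (v k) (∑ i, (v k) i • (ee i : ES n)) := by rw [← sum_ee]
    rw [h9, map_sum]
    simp

lemma Ell.Lop_nonneg {n : ℕ} {Λ : ℝ} {S : ES n →L[ℝ] ES n} (h : Ell 0 Λ S) {q : Bil n}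
    (hq : ∀ v, 0 ≤ q v v) : 0 ≤ Lop S q := by
  obtain ⟨v, l, hl, hL⟩ := h.factor le_rfl
  rw [hL]
  exact Finset.sum_nonneg fun k _ => mul_nonneg (hl k).1 (hq _)

lemma Ell.mono {n : ℕ} {ν Λ ν' Λ' : ℝ} {S : ES n →L[ℝ] ES n} (h : Ell ν Λ S) (h1 : ν' ≤ ν)
    (h2 : Λ ≤ Λ') : Ell ν' Λ' S :=
  ⟨h.sym, fun v => (mul_le_mul_of_nonneg_right h1 (sq_nonneg _)).trans (h.lo v),
    fun v => (h.hi v).trans (mul_le_mul_of_nonneg_right h2 (sq_nonneg _))⟩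

lemma Ell.Lop_ge {n : ℕ} {ν Λ : ℝ} {S : ES n →L[ℝ] ES n} (h : Ell ν Λ S) (hν : 0 ≤ ν) {q : Bil n}
    (hq : ∀ v, 0 ≤ q v v) (w : ES n) (hw : ‖w‖ = 1) : ν * q w w ≤ Lop S q := by
  let R : ES n →L[ℝ] ES n := (innerSL ℝ w).smulRight w
  have hR : ∀ x, R x = (inner ℝ w x) • w := fun x => rfl
  have hE : Ell 0 Λ (S - ν • R) := by
    refine ⟨?_, ?_, ?_⟩
    · intro x y
      simp only [_root_.sub_apply, _root_.smul_apply, hR, inner_sub_left,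
        inner_sub_right, h.sym, inner_smul_left, inner_smul_right]
      rw [real_inner_comm w x]; simp only [conj_trivial]; ring
    · intro x
      have := h.lo x
      simp only [_root_.sub_apply, _root_.smul_apply, hR, inner_sub_left,
        inner_smul_left]
      have h3 := abs_real_inner_le_norm w x
      rw [hw, one_mul] at h3
      have h4 : (inner ℝ w x) ^ 2 ≤ ‖x‖ ^ 2 := by
        rw [← sq_abs]; gcongr
      simp only [conj_trivial]
      nlinarith
    · intro x
      have := h.hi x
      simp only [_root_.sub_apply, _root_.smul_apply, hR, inner_sub_left,
        inner_smul_left]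
      simp only [conj_trivial]
      nlinarith [mul_nonneg hν (sq_nonneg (inner ℝ w x))]
  have h0 := hE.Lop_nonneg hq
  have hRq : Lop R q = q w w := by
    unfold Lop
    conv_rhs => arg 2; rw [sum_ee w]
    rw [map_sum]
    refine Finset.sum_congr rfl fun i _ => ?_
    rw [hR, map_smul, map_smul]
    simp [ee, EuclideanSpace.inner_single_right]
  rw [Lop_sub_left, Lop_smul_left, hRq] at h0
  linarith

/-- second derivative test -/
lemma second_test {n : ℕ} {φ : ES n → ℝ} {p : ES n → (ES n →L[ℝ] ℝ)} {q : Bil n} {x : ES n}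
    (hp : ∀ y, HasFDerivAt φ (p y) y) (hq : HasFDerivAt p q x) (hm : IsLocalMax φ x) :
    p x = 0 ∧ ∀ v, q v v ≤ 0 := by
  have h0 : p x = 0 := hm.hasFDerivAt_eq_zero (hp x)
  refine ⟨h0, fun v => ?_⟩
  by_contra hcon
  push Not at hcon
  let l : ℝ → ES n := fun s => x + s • v
  have hl : ∀ s, HasDerivAt l v s := fun s => by
    have h1 := ((hasDerivAt_id s).smul_const v).const_add x
    rw [one_smul] at h1
    exact h1
  have hl0 : l 0 = x := by simp [l]
  let h : ℝ → ℝ := fun s => φ (l s)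
  have hh : ∀ s, HasDerivAt h (p (l s) v) s := fun s => (hp (l s)).comp_hasDerivAt s (hl s)
  have hd : deriv h = fun s => p (l s) v := funext fun s => (hh s).deriv
  have hd2 : HasDerivAt (fun s => p (l s) v) (q v v) 0 := by
    have h1 : HasDerivAt (fun s => p (l s)) (q v) 0 := by
      have hq' : HasFDerivAt p q (l 0) := by rwa [hl0]
      exact hq'.comp_hasDerivAt 0 (hl 0)
    have := h1.clm_apply (hasDerivAt_const (0:ℝ) v)
    simpa using this
  have hmin : IsLocalMin h 0 := by
    apply isLocalMin_of_deriv_deriv_pos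
    · rw [hd, hd2.deriv]; exact hcon
    · rw [hd]; simp [hl0, h0]
    · exact (hh 0).continuousAt
  have hmax : IsLocalMax h 0 := by
    have hc : ContinuousAt l 0 := (hl 0).continuousAt
    have : Tendsto l (𝓝 0) (𝓝 x) := by simpa [hl0] using hc.tendsto
    have h2 := this.eventually hm
    filter_upwards [h2] with s hs
    simpa [h, hl0] using hs
  have hconst : h =ᶠ[𝓝 0] fun _ => h 0 := by
    filter_upwards [hmin, hmax] with s h1 h2
    exact le_antisymm h2 h1
  have e1 : deriv h =ᶠ[𝓝 0] deriv (fun _ : ℝ => h 0) := hconst.deriv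
  have e2 : deriv (deriv h) 0 = deriv (deriv (fun _ : ℝ => h 0)) 0 := e1.deriv_eq
  rw [hd, hd2.deriv] at e2
  simp at e2
  linarith

end QP

namespace QP
open MeasureTheory Filter Topology Metric

/-- the inner product as a bilinear form -/
def ib (n : ℕ) : Bil n := LinearMap.mkContinuous₂ (innerₗ (ES n)) 1 (fun x y => by
  simpa using norm_inner_le_norm (𝕜 := ℝ) x y)

lemma ib_apply {n : ℕ} (x y : ES n) : ib n x y = inner ℝ x y := rfl

lemma Lop_ib {n : ℕ} {ν Λ : ℝ} {S : ES n →L[ℝ] ES n} (h : Ell ν Λ S) :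
    Lop S (ib n) ≤ n * Λ := by
  unfold Lop
  have : ∀ i ∈ (Finset.univ : Finset (Fin n)), ib n (S (ee i)) (ee i) ≤ Λ := by
    intro i _
    have := h.hi (ee i)
    rw [norm_ee] at this
    rw [ib_apply]; linarith
  refine (Finset.sum_le_card_nsmul _ _ _ this).trans ?_
  simp

lemma hasFDerivAt_normSq {n : ℕ} (x : ES n) :
    HasFDerivAt (fun y : ES n => ‖y‖ ^ 2) ((2:ℝ) • ib n x) x := by
  have h := (hasStrictFDerivAt_norm_sq x).hasFDerivAt
  have e : (2:ℝ) • ib n x = 2 • (innerSL ℝ x) := by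
    ext v; simp [ib_apply, two_mul, innerSL_apply_apply]
  rw [e]; exact h

/-- local maximum principle -/
lemma lmp {n : ℕ} {t0 t1 R : ℝ} {x0 : ES n} {z : ℝ → ES n → ℝ}
    (hc : ContinuousOn (fun a : ℝ × ES n => z a.1 a.2) (Icc t0 t1 ×ˢ closedBall x0 R))
    (hb : ∀ t ∈ Icc t0 t1, ∀ x ∈ closedBall x0 R, (t = t0 ∨ dist x x0 = R) → z t x ≤ 0)
    (h : ∀ t ∈ Ioo t0 t1, ∀ x ∈ ball x0 R, 0 < z t x → IsLocalMax (z t) x →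
      ∃ d < 0, HasDerivAt (fun s => z s x) d t) :
    ∀ t ∈ Icc t0 t1, ∀ x ∈ closedBall x0 R, z t x ≤ 0 := by
  have key : ∀ t ∈ Ico t0 t1, ∀ x ∈ closedBall x0 R, z t x ≤ 0 := by
    intro t ht x hx
    by_contra hcon
    push Not at hcon
    have hK : IsCompact (Icc t0 t ×ˢ closedBall x0 R) :=
      isCompact_Icc.prod (isCompact_closedBall _ _)
    have hsub : Icc t0 t ×ˢ closedBall x0 R ⊆ Icc t0 t1 ×ˢ closedBall x0 R :=
      prod_mono (Icc_subset_Icc le_rfl ht.2.le) le_rfl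
    obtain ⟨⟨s, y⟩, ⟨hs, hy⟩, hmax⟩ := hK.exists_isMaxOn
      ⟨(t, x), ⟨⟨ht.1, le_rfl⟩, hx⟩⟩ (hc.mono hsub)
    simp only at hs hy
    have hpos : 0 < z s y := lt_of_lt_of_le hcon (hmax (show (t, x) ∈ _ from ⟨⟨ht.1, le_rfl⟩, hx⟩))
    have hs1 : s ∈ Icc t0 t1 := ⟨hs.1, hs.2.trans ht.2.le⟩
    have hs0 : s ≠ t0 := fun e => absurd (hb s hs1 y hy (Or.inl e)) (not_le.2 hpos)
    have hyR : dist y x0 ≠ R := fun e => absurd (hb s hs1 y hy (Or.inr e)) (not_le.2 hpos)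
    have hs2 : s ∈ Ioo t0 t1 := ⟨lt_of_le_of_ne hs.1 (Ne.symm hs0), lt_of_le_of_lt hs.2 ht.2⟩
    have hy2 : y ∈ ball x0 R := lt_of_le_of_ne hy hyR
    obtain ⟨d, hd, hder⟩ := h s hs2 y hy2 hpos (by
      filter_upwards [isOpen_ball.mem_nhds hy2] with y' hy'
      exact hmax (show (s, y') ∈ _ from ⟨hs, ball_subset_closedBall hy'⟩))
    have h1 : Tendsto (slope (fun s => z s y) s) (𝓝[<] s) (𝓝 d) :=
      (hasDerivAt_iff_tendsto_slope.1 hder).mono_left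
        (nhdsWithin_mono _ (fun a ha => ne_of_lt ha))
    have h2 : ∀ᶠ a in 𝓝[<] s, 0 ≤ slope (fun s => z s y) s a := by
      have : Ioo t0 s ∈ 𝓝[<] s := Ioo_mem_nhdsLT hs2.1
      filter_upwards [this] with a ha
      have h3 : z a y ≤ z s y :=
        hmax (show (a, y) ∈ _ from ⟨⟨ha.1.le, ha.2.le.trans hs.2⟩, hy⟩)
      rw [slope_def_field]
      apply div_nonneg_of_nonpos
      · linarith
      · linarith [ha.2]
    have := ge_of_tendsto h1 h2
    linarith
  intro t ht x hx
  rcases eq_or_lt_of_le ht.2 with e | hlt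
  · rcases eq_or_lt_of_le ht.1 with e' | hlt'
    · exact hb t ht x hx (Or.inl e'.symm)
    · have hcx : ContinuousOn (fun s => z s x) (Icc t0 t1) :=
        hc.comp (f := fun s : ℝ => (s, x)) (by fun_prop) (fun s hs => ⟨hs, hx⟩)
      have h1 : Tendsto (fun s => z s x) (𝓝[Ioo t0 t] t) (𝓝 (z t x)) :=
        (hcx t ht).mono_left (nhdsWithin_mono _ (fun a ha => ⟨ha.1.le, by linarith [ha.2]⟩))
      have : (𝓝[Ioo t0 t] t).NeBot := by
        rw [nhdsWithin_Ioo_eq_nhdsLT hlt']; infer_instance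
      refine le_of_tendsto h1 ?_
      filter_upwards [self_mem_nhdsWithin] with a ha
      exact key a ⟨ha.1.le, by linarith [ha.2]⟩ x hx
  · exact key t ⟨ht.1, hlt⟩ x hx

/-- differential data at a point -/
def DD {n : ℕ} (z : ℝ → ES n → ℝ) (t : ℝ) (x : ES n) (p : ES n → (ES n →L[ℝ] ℝ)) (q : Bil n)
    (zt : ℝ) : Prop :=
  (∀ y, HasFDerivAt (z t) (p y) y) ∧ HasFDerivAt p q x ∧ HasDerivAt (fun s => z s x) zt t

lemma DD.sub {n : ℕ} {z z' : ℝ → ES n → ℝ} {t : ℝ} {x : ES n} {p p' q q' zt zt'}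
    (h : DD z t x p q zt) (h' : DD z' t x p' q' zt') :
    DD (fun t x => z t x - z' t x) t x (fun y => p y - p' y) (q - q') (zt - zt') :=
  ⟨fun y => (h.1 y).sub (h'.1 y), h.2.1.sub h'.2.1, h.2.2.sub h'.2.2⟩

lemma DD.add {n : ℕ} {z z' : ℝ → ES n → ℝ} {t : ℝ} {x : ES n} {p p' q q' zt zt'}
    (h : DD z t x p q zt) (h' : DD z' t x p' q' zt') :
    DD (fun t x => z t x + z' t x) t x (fun y => p y + p' y) (q + q') (zt + zt') :=
  ⟨fun y => (h.1 y).add (h'.1 y), h.2.1.add h'.2.1, h.2.2.add h'.2.2⟩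

lemma DD.const_mul {n : ℕ} {z : ℝ → ES n → ℝ} {t : ℝ} {x : ES n} {p q zt} (c : ℝ)
    (h : DD z t x p q zt) :
    DD (fun t x => c * z t x) t x (fun y => c • p y) (c • q) (c * zt) :=
  ⟨fun y => (h.1 y).const_mul c, h.2.1.const_smul c, h.2.2.const_mul c⟩

lemma DD.time {n : ℕ} {a : ℝ → ℝ} {a' t : ℝ} (x : ES n) (h : HasDerivAt a a' t) :
    DD (fun s (_ : ES n) => a s) t x (fun _ => 0) 0 a' :=
  ⟨fun y => hasFDerivAt_const _ _, hasFDerivAt_const _ _, h⟩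

/-- at a spatial local maximum -/
lemma DD.max {n : ℕ} {z : ℝ → ES n → ℝ} {t : ℝ} {x : ES n} {p q zt} {Λ : ℝ}
    (h : DD z t x p q zt) (hm : IsLocalMax (z t) x) {S : ES n →L[ℝ] ES n} (hS : Ell 0 Λ S) :
    p x = 0 ∧ Lop S q ≤ 0 := by
  obtain ⟨h1, h2⟩ := second_test h.1 h.2.1 hm
  refine ⟨h1, ?_⟩
  have := hS.Lop_nonneg (q := -q) (fun v => by simpa using h2 v)
  rw [Lop_neg] at this
  linarith

lemma DD.expquad {n : ℕ} (κ : ℝ) (t : ℝ) (x : ES n) :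
    DD (fun s y => Real.exp (κ * s) * (1 + ‖y‖ ^ 2)) t x
      (fun y => (Real.exp (κ * t) * 2) • ib n y) ((Real.exp (κ * t) * 2) • ib n)
      (κ * Real.exp (κ * t) * (1 + ‖x‖ ^ 2)) := by
  refine ⟨fun y => ?_, ?_, ?_⟩
  · have := ((hasFDerivAt_normSq y).const_add 1).const_mul (Real.exp (κ * t))
    rwa [smul_smul] at this
  · exact (ib n).hasFDerivAt.const_smul (Real.exp (κ * t) * 2)
  · have h1 : HasDerivAt (fun s => Real.exp (κ * s)) (Real.exp (κ * t) * (κ * 1)) t :=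
      ((hasDerivAt_id t).const_mul κ).exp
    have := h1.mul_const (1 + ‖x‖ ^ 2)
    exact this.congr_deriv (by ring)

/-- global weak maximum principle -/
lemma wmp {n : ℕ} {T Λ B K : ℝ} {z : ℝ → ES n → ℝ}
    (hc : ContinuousOn (fun a : ℝ × ES n => z a.1 a.2) (Icc 0 T ×ˢ univ))
    (hK : ∀ t ∈ Icc 0 T, ∀ x, z t x ≤ K) (h0 : ∀ x, z 0 x ≤ 0)
    (h : ∀ t ∈ Ioo 0 T, ∀ x, 0 < z t x → ∃ p q zt S b, DD z t x p q zt ∧ Ell 0 Λ S ∧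
      ‖b‖ ≤ B ∧ zt ≤ Lop S q + p x b) :
    ∀ t ∈ Icc 0 T, ∀ x, z t x ≤ 0 := by
  intro t ht x
  wlog hΛ : 0 ≤ Λ ∧ 0 ≤ B ∧ 0 ≤ K generalizing Λ B K with H
  · refine H (Λ := max Λ 0) (B := max B 0) (K := max K 0)
      (fun t ht x => (hK t ht x).trans (le_max_left _ _)) ?_
      ⟨le_max_right _ _, le_max_right _ _, le_max_right _ _⟩
    intro t ht x hx
    obtain ⟨p, q, zt, S, b, h1, h2, h3, h4⟩ := h t ht x hx
    exact ⟨p, q, zt, S, b, h1, h2.mono le_rfl (le_max_left _ _), h3.trans (le_max_left _ _), h4⟩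
  obtain ⟨hΛ, hB, hK0⟩ := hΛ
  set κ : ℝ := 2 * n * Λ + B + 1 with hκ
  have hκ0 : 0 ≤ κ := by positivity
  have main : ∀ ε > 0, z t x - ε * (Real.exp (κ * t) * (1 + ‖x‖ ^ 2)) ≤ 0 := by
    intro ε hε
    set R : ℝ := ‖x‖ + K / ε + 1 with hR
    have hKe : 0 ≤ K / ε := by positivity
    have hR1 : 1 ≤ R := by have := norm_nonneg x; linarith
    have hZ := lmp (t0 := 0) (t1 := T) (R := R) (x0 := (0 : ES n))
      (z := fun t x => z t x - ε * (Real.exp (κ * t) * (1 + ‖x‖ ^ 2))) ?_ ?_ ?_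
    · exact hZ t ht x (by simp only [mem_closedBall, dist_zero_right]; linarith)
    · refine (hc.mono (prod_mono le_rfl (subset_univ _))).sub ?_
      fun_prop
    · rintro s hs y hy (rfl | hy')
      · have := h0 y
        have : 0 ≤ ε * (Real.exp (κ * 0) * (1 + ‖y‖ ^ 2)) := by positivity
        linarith [h0 y]
      · rw [dist_zero_right] at hy'
        have h1 := hK s hs y
        have h2 : 1 ≤ Real.exp (κ * s) := Real.one_le_exp (mul_nonneg hκ0 hs.1)
        have h3 : K / ε ≤ 1 + ‖y‖ ^ 2 := by
          rw [hy']; nlinarith [norm_nonneg x]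
        have h4 : K ≤ ε * (1 + ‖y‖ ^ 2) := by
          rw [div_le_iff₀ hε] at h3; linarith
        have h5 : (1 + ‖y‖ ^ 2) ≤ Real.exp (κ * s) * (1 + ‖y‖ ^ 2) :=
          le_mul_of_one_le_left (by positivity) h2
        have := mul_le_mul_of_nonneg_left h5 hε.le
        linarith
    · intro s hs y hy hpos hmax
      have hpos' : 0 < z s y := by
        have : 0 ≤ ε * (Real.exp (κ * s) * (1 + ‖y‖ ^ 2)) := by positivity
        linarith
      obtain ⟨p, q, zt, S, b, h1, h2, h3, h4⟩ := h s hs y hpos'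
      have hD := h1.sub ((DD.expquad κ s y).const_mul ε)
      obtain ⟨g1, g2⟩ := hD.max hmax h2
      refine ⟨_, ?_, hD.2.2⟩
      rw [Lop_sub, Lop_smul, Lop_smul] at g2
      have g3 := Lop_ib h2
      have g4 : p y = ε • (Real.exp (κ * s) * 2) • ib n y := sub_eq_zero.1 g1
      have g5 : p y b = ε * ((Real.exp (κ * s) * 2) * inner ℝ y b) := by rw [g4]; rfl
      have g6 : inner ℝ y b ≤ ‖y‖ * B :=
        (real_inner_le_norm y b).trans (mul_le_mul_of_nonneg_left h3 (norm_nonneg _))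
      set e := Real.exp (κ * s)
      have he : 0 < e := Real.exp_pos _
      have hεe : 0 < ε * e := by positivity
      have g7 : 2 * (n * Λ) + 2 * (‖y‖ * B) < κ * (1 + ‖y‖ ^ 2) := by
        have e1 : 2 * (‖y‖ * B) ≤ B * (1 + ‖y‖ ^ 2) := by nlinarith [sq_nonneg (‖y‖ - 1)]
        have e2 : 0 ≤ 2 * (n:ℝ) * Λ * ‖y‖ ^ 2 := by positivity
        have e3 : 0 ≤ ‖y‖ ^ 2 := by positivity
        rw [hκ]; linarith
      have g8 := mul_lt_mul_of_pos_left g7 hεe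
      have g9 := mul_le_mul_of_nonneg_left g3 hεe.le
      have g10 := mul_le_mul_of_nonneg_left g6 hεe.le
      nlinarith
  by_contra hcon
  push Not at hcon
  set A := Real.exp (κ * t) * (1 + ‖x‖ ^ 2)
  have hA : 0 < A := by positivity
  have := main (z t x / (2 * A)) (by positivity)
  have e : z t x / (2 * A) * A = z t x / 2 := by field_simp
  rw [e] at this
  linarith

end QP

namespace QP
open MeasureTheory Filter Topology Metric

variable {n : ℕ} {F : Type*} [NormedAddCommGroup F] [NormedSpace ℝ F]

/-- decaying weight -/
def wt (N : ℕ) (z : ES n) : ℝ := ((1 + ‖z‖) ^ N)⁻¹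

lemma wt_pos (N : ℕ) (z : ES n) : 0 < wt N z := by
  have := norm_nonneg z
  unfold wt; positivity

lemma wt_cont (N : ℕ) : Continuous (wt N : ES n → ℝ) := by
  unfold wt
  refine Continuous.inv₀ (by fun_prop) (fun z => ?_)
  have := norm_nonneg z
  positivity

lemma wt_integrable {N : ℕ} (hN : n < N) : Integrable (wt N : ES n → ℝ) := by
  have h := integrable_one_add_norm (E := ES n) (μ := volume) (r := (N:ℝ)) (by simpa using hN)
  refine h.congr (Eventually.of_forall fun z => ?_)
  have := norm_nonneg z
  simp only [wt]
  rw [Real.rpow_neg (by positivity), Real.rpow_natCast]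

lemma wt_succ (N : ℕ) (z : ES n) : (1 + ‖z‖) * wt (N+1) z = wt N z := by
  have := norm_nonneg z
  unfold wt
  rw [pow_succ]
  have : 1 + ‖z‖ ≠ 0 := by positivity
  field_simp

lemma wt_anti {N M : ℕ} (h : N ≤ M) (z : ES n) : wt M z ≤ wt N z := by
  have := norm_nonneg z
  unfold wt
  apply inv_anti₀ (by positivity)
  exact pow_le_pow_right₀ (by linarith) h

lemma wt_shift {N : ℕ} {z z' : ES n} {c : ℝ} (hc : 0 < c) (h : 1 + ‖z'‖ ≤ c * (1 + ‖z‖)) :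
    wt N z ≤ c ^ N * wt N z' := by
  have h1 := norm_nonneg z
  have h2 := norm_nonneg z'
  unfold wt
  have h3 : 0 < (1 + ‖z'‖) ^ N := by positivity
  have h4 : 0 < (1 + ‖z‖) ^ N := by positivity
  rw [← div_eq_mul_inv, le_div_iff₀ h3, inv_mul_le_iff₀ h4]
  calc (1 + ‖z'‖) ^ N ≤ (c * (1 + ‖z‖)) ^ N := by gcongr
    _ = _ := by rw [mul_pow, mul_comm]

/-- a kernel together with its derivative -/
structure Ker (k : ES n → F) (k' : ES n → (ES n →L[ℝ] F)) : Prop where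
  hd : ∀ z, HasFDerivAt k (k' z) z
  hc : Continuous k'
  dec : ∃ C, 0 ≤ C ∧ ∀ z, ‖k z‖ ≤ C * wt (n+3) z ∧ ‖k' z‖ ≤ C * wt (n+3) z

lemma Ker.cont {k : ES n → F} {k'} (h : Ker k k') : Continuous k :=
  continuous_iff_continuousAt.2 fun z => (h.hd z).continuousAt

/-- integrability helper -/
lemma int_of_dec {G : ES n → F} (hG : Continuous G) {C : ℝ} {N : ℕ} (hN : n < N)
    (h : ∀ z, ‖G z‖ ≤ C * wt N z) : Integrable G :=
  ((wt_integrable hN).const_mul C).mono' hG.aestronglyMeasurable (Eventually.of_forall h)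

lemma int_affine (h : ES n → F) (x : ES n) {r : ℝ} (hr : r ≠ 0) :
    ∫ z, h (x + r • z) = |(r ^ n)⁻¹| • ∫ y, h y := by
  have h1 := Measure.integral_comp_smul (volume : Measure (ES n)) (fun y => h (x + y)) r
  rw [h1, integral_add_left_eq_self (μ := volume) h x]
  simp

/-- Derivative of a convolution with a kernel. -/
lemma Ker.hasFDerivAt [CompleteSpace F] {k : ES n → F} {k'} (h : Ker k k') {f : ES n → ℝ}
    (hf : Continuous f) {K : ℝ} (hK : ∀ x, |f x| ≤ K) {ρ : ℝ} (hρ : 0 < ρ) (x0 : ES n) :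
    HasFDerivAt (fun x => ∫ z, f (x + ρ • z) • k z)
      (-(ρ⁻¹) • ∫ z, f (x0 + ρ • z) • k' z) x0 := by
  obtain ⟨C, hC0, hC⟩ := h.dec
  have hK0 : 0 ≤ K := (abs_nonneg _).trans (hK 0)
  have e1 : ∀ x, ∫ z, f (x + ρ • z) • k z
      = |(ρ ^ n)⁻¹| • ∫ y, f y • k (ρ⁻¹ • (y - x)) := by
    intro x
    rw [← int_affine (fun y => f y • k (ρ⁻¹ • (y - x))) x hρ.ne']
    congr 1; ext z
    simp [smul_smul, hρ.ne']
  have e2 : ∫ z, f (x0 + ρ • z) • k' z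
      = |(ρ ^ n)⁻¹| • ∫ y, f y • k' (ρ⁻¹ • (y - x0)) := by
    rw [← int_affine (fun y => f y • k' (ρ⁻¹ • (y - x0))) x0 hρ.ne']
    congr 1; ext z
    simp [smul_smul, hρ.ne']
  rw [e2, smul_comm, ← integral_smul]
  simp_rw [e1]
  refine HasFDerivAt.const_smul ?_ _
  have hck := h.cont
  have hck' := h.hc
  have hbd : Integrable (fun y : ES n => K * (ρ⁻¹ * (C * (2 ^ (n+3) * wt (n+3) (ρ⁻¹ • (y - x0)))))) := by
    have : Integrable (fun y : ES n => wt (n+3) (ρ⁻¹ • (y - x0))) :=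
      ((wt_integrable (n := n) (N := n+3) (by omega)).comp_smul (inv_ne_zero hρ.ne')).comp_sub_right x0
    exact (((this.const_mul _).const_mul _).const_mul _).const_mul _
  refine hasFDerivAt_integral_of_dominated_of_fderiv_le (s := ball x0 ρ)
    (F' := fun x y => (-ρ⁻¹) • f y • k' (ρ⁻¹ • (y - x))) (ball_mem_nhds _ hρ) ?_ ?_ ?_ ?_ hbd ?_
  · exact Eventually.of_forall fun x => Continuous.aestronglyMeasurable (by fun_prop)
  · have : Integrable (fun y : ES n => K * (C * wt (n+3) (ρ⁻¹ • (y - x0)))) := by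
      have : Integrable (fun y : ES n => wt (n+3) (ρ⁻¹ • (y - x0))) :=
        ((wt_integrable (n := n) (N := n+3) (by omega)).comp_smul (inv_ne_zero hρ.ne')).comp_sub_right x0
      exact (this.const_mul _).const_mul _
    refine this.mono' (Continuous.aestronglyMeasurable (by fun_prop)) (Eventually.of_forall fun y => ?_)
    rw [norm_smul, Real.norm_eq_abs]
    exact mul_le_mul (hK y) (hC _).1 (norm_nonneg _) hK0
  · exact Continuous.aestronglyMeasurable (by fun_prop)
  · refine Eventually.of_forall fun y x hx => ?_
    rw [norm_smul, norm_smul, norm_neg, norm_inv, Real.norm_eq_abs, Real.norm_eq_abs, abs_of_pos hρ]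
    have h1 : wt (n+3) (ρ⁻¹ • (y - x)) ≤ 2 ^ (n+3) * wt (n+3) (ρ⁻¹ • (y - x0)) := by
      apply wt_shift two_pos
      rw [mem_ball, dist_eq_norm] at hx
      have : ρ⁻¹ • (y - x0) = ρ⁻¹ • (y - x) + ρ⁻¹ • (x - x0) := by rw [← smul_add]; congr 1; abel
      rw [this]
      have h2 := norm_add_le (ρ⁻¹ • (y - x)) (ρ⁻¹ • (x - x0))
      have h3 : ‖ρ⁻¹ • (x - x0)‖ ≤ 1 := by
        rw [norm_smul, norm_inv, Real.norm_eq_abs, abs_of_pos hρ, inv_mul_le_iff₀ hρ]; linarith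
      linarith [norm_nonneg (ρ⁻¹ • (y - x))]
    calc ρ⁻¹ * (|f y| * ‖k' (ρ⁻¹ • (y - x))‖)
        ≤ ρ⁻¹ * (K * (C * (2 ^ (n+3) * wt (n+3) (ρ⁻¹ • (y - x0))))) := by
          gcongr
          · exact hK y
          · exact (hC _).2.trans (by gcongr)
      _ = _ := by ring
  · refine Eventually.of_forall fun y x hx => ?_
    have h1 : HasFDerivAt (fun x : ES n => ρ⁻¹ • (y - x)) (ρ⁻¹ • (-(ContinuousLinearMap.id ℝ (ES n)))) x :=
      ((hasFDerivAt_id x).const_sub y).const_smul ρ⁻¹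
    have h2 := ((h.hd (ρ⁻¹ • (y - x))).comp x h1).const_smul (f y)
    refine h2.congr_fderiv ?_
    ext v
    simp [smul_smul]
    ring_nf

/-- the derivative kernel has zero mean -/
lemma Ker.mean_zero [CompleteSpace F] {k : ES n → F} {k'} (h : Ker k k') : ∫ z, k' z = 0 := by
  have h1 := h.hasFDerivAt (f := fun _ => 1) continuous_const (K := 1) (by simp) one_pos 0
  have h2 : HasFDerivAt (fun x : ES n => ∫ z, (1:ℝ) • k z) (0 : ES n →L[ℝ] F) 0 := hasFDerivAt_const _ _
  have := h1.unique h2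
  simpa using this

/-- derivative in the scale parameter -/
lemma Ker.hasDerivAt [CompleteSpace F] {k : ES n → F} {k'} (h : Ker k k') {f : ES n → ℝ}
    (hf : Continuous f) {K : ℝ} (hK : ∀ x, |f x| ≤ K) {r0 : ℝ} (hr : 0 < r0) (x : ES n) :
    HasDerivAt (fun r : ℝ => ∫ z, f (x + r⁻¹ • z) • k z)
      (r0⁻¹ • ∫ z, f (x + r0⁻¹ • z) • ((n:ℝ) • k z + k' z z)) r0 := by
  obtain ⟨C, hC0, hC⟩ := h.dec
  have hK0 : 0 ≤ K := (abs_nonneg _).trans (hK 0)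
  have hcont := h.cont
  have hck' := h.hc
  have e1 : ∀ r : ℝ, r > 0 → ∀ G : ES n → F, ∫ z, f (x + r⁻¹ • z) • G z = r ^ n • ∫ y, f (x + y) • G (r • y) := by
    intro r hr G
    have := int_affine (fun y => f (x + y) • G (r • y)) 0 (inv_ne_zero hr.ne')
    simp only [zero_add, smul_smul, mul_inv_cancel₀ hr.ne', one_smul] at this
    rw [this, inv_pow, inv_inv, abs_of_pos (by positivity)]
  have hI : HasDerivAt (fun r : ℝ => ∫ y, f (x + y) • k (r • y)) (∫ y, f (x + y) • k' (r0 • y) y) r0 := by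
    have hbi : Integrable (fun y : ES n => K * (C * (2 ^ (n+3) * (r0⁻¹ * wt (n+2) (r0 • y))))) := by
      have : Integrable (fun y : ES n => wt (n+2) (r0 • y)) :=
        (wt_integrable (n := n) (N := n+2) (by omega)).comp_smul hr.ne'
      exact (((this.const_mul _).const_mul _).const_mul _).const_mul _
    refine (hasDerivAt_integral_of_dominated_loc_of_deriv_le (s := Ioo (r0/2) (2*r0))
      (F' := fun r y => f (x + y) • k' (r • y) y) (Ioo_mem_nhds (by linarith) (by linarith)) ?_ ?_ ?_ ?_ hbi ?_).2
    · exact Eventually.of_forall fun r => Continuous.aestronglyMeasurable (by fun_prop)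
    · have : Integrable (fun y : ES n => K * (C * wt (n+3) (r0 • y))) := by
        have : Integrable (fun y : ES n => wt (n+3) (r0 • y)) :=
          (wt_integrable (n := n) (N := n+3) (by omega)).comp_smul hr.ne'
        exact (this.const_mul _).const_mul _
      refine this.mono' (Continuous.aestronglyMeasurable (by fun_prop)) (Eventually.of_forall fun y => ?_)
      rw [norm_smul, Real.norm_eq_abs]
      exact mul_le_mul (hK _) (hC _).1 (norm_nonneg _) hK0
    · exact Continuous.aestronglyMeasurable (by fun_prop)
    · refine Eventually.of_forall fun y r hr' => ?_
      rw [norm_smul, Real.norm_eq_abs]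
      have hr0 : 0 < r := by linarith [hr'.1]
      have h1 : ‖k' (r • y) y‖ ≤ C * (2 ^ (n+3) * (r0⁻¹ * wt (n+2) (r0 • y))) := by
        have a1 : wt (n+3) (r • y) ≤ 2 ^ (n+3) * wt (n+3) (r0 • y) := by
          apply wt_shift two_pos
          rw [norm_smul, norm_smul, Real.norm_eq_abs, Real.norm_eq_abs, abs_of_pos hr, abs_of_pos hr0]
          nlinarith [norm_nonneg y, hr'.1]
        have a2 : wt (n+3) (r0 • y) * ‖y‖ ≤ r0⁻¹ * wt (n+2) (r0 • y) := by
          rw [← wt_succ (n+2) (r0 • y), norm_smul, Real.norm_eq_abs, abs_of_pos hr]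
          have := wt_pos (n+3) (r0 • y)
          have e : r0⁻¹ * ((1 + r0 * ‖y‖) * wt (n+2+1) (r0 • y))
            = r0⁻¹ * wt (n+3) (r0 • y) + wt (n+3) (r0 • y) * ‖y‖ := by field_simp
          rw [e]
          have : 0 ≤ r0⁻¹ * wt (n+3) (r0 • y) := by positivity
          linarith
        calc ‖k' (r • y) y‖ ≤ ‖k' (r • y)‖ * ‖y‖ := (k' (r • y)).le_opNorm y
          _ ≤ (C * (2 ^ (n+3) * wt (n+3) (r0 • y))) * ‖y‖ := by
            gcongr
            exact (hC _).2.trans (by gcongr)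
          _ = C * (2 ^ (n+3) * (wt (n+3) (r0 • y) * ‖y‖)) := by ring
          _ ≤ _ := by gcongr
      exact mul_le_mul (hK _) h1 (norm_nonneg _) hK0
    · refine Eventually.of_forall fun y r hr' => ?_
      have h1 : HasDerivAt (fun r : ℝ => r • y) y r := by
        have := (hasDerivAt_id r).smul_const y
        rw [one_smul] at this; exact this
      exact ((h.hd (r • y)).comp_hasDerivAt r h1).const_smul (f (x + y))
  have hP : HasDerivAt (fun r : ℝ => r ^ n • ∫ y, f (x + y) • k (r • y))
      (r0 ^ n • (∫ y, f (x + y) • k' (r0 • y) y) + ((n:ℝ) * r0 ^ (n-1)) • ∫ y, f (x + y) • k (r0 • y)) r0 :=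
    (hasDerivAt_pow n r0).smul hI
  have hP' := hP.congr_of_eventuallyEq (f₁ := fun r : ℝ => ∫ z, f (x + r⁻¹ • z) • k z) (by
    filter_upwards [lt_mem_nhds hr] with r hr
    exact e1 r hr k)
  refine hP'.congr_deriv ?_
  have i1 : Integrable (fun y : ES n => f (x + y) • ((n:ℝ) • k (r0 • y))) := by
    have h3 : Integrable (fun y : ES n => K * ((n:ℝ) * (C * wt (n+3) (r0 • y)))) :=
      ((((wt_integrable (n := n) (N := n+3) (by omega)).comp_smul hr.ne').const_mul _).const_mul _).const_mul _
    refine h3.mono' (Continuous.aestronglyMeasurable (by fun_prop)) (Eventually.of_forall fun y => ?_)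
    rw [norm_smul, norm_smul, Real.norm_eq_abs, Real.norm_natCast]
    exact mul_le_mul (hK _) (mul_le_mul_of_nonneg_left (hC _).1 (by positivity)) (by positivity) hK0
  have i2 : Integrable (fun y : ES n => f (x + y) • k' (r0 • y) (r0 • y)) := by
    have h3 : Integrable (fun y : ES n => K * ((C * wt (n+2) (r0 • y)))) :=
      (((wt_integrable (n := n) (N := n+2) (by omega)).comp_smul hr.ne').const_mul _).const_mul _
    refine h3.mono' (Continuous.aestronglyMeasurable (by fun_prop)) (Eventually.of_forall fun y => ?_)
    rw [norm_smul, Real.norm_eq_abs]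
    refine mul_le_mul (hK _) ?_ (by positivity) hK0
    refine ((k' (r0 • y)).le_opNorm _).trans ?_
    rw [← wt_succ (n+2)]
    have h4 := (hC (r0 • y)).2
    have h5 : 0 ≤ C * wt (n+3) (r0 • y) := mul_nonneg hC0 (wt_pos _ _).le
    calc ‖k' (r0 • y)‖ * ‖r0 • y‖ ≤ (C * wt (n+3) (r0 • y)) * (1 + ‖r0 • y‖) := by gcongr; linarith
      _ = _ := by ring
  rw [e1 r0 hr]
  simp_rw [smul_add]
  rw [integral_add i1 i2]
  simp only [map_smul, smul_comm _ r0, smul_comm _ (n:ℝ)]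
  rw [integral_smul, integral_smul]
  simp only [smul_add, smul_smul]
  rw [add_comm]
  congr 1
  · rcases Nat.eq_zero_or_pos n with h0 | h0
    · subst h0; simp
    · congr 1
      have : r0 ^ n = r0 ^ (n-1) * r0 := by rw [← pow_succ]; congr 1; omega
      rw [this]; field_simp
  · congr 1; field_simp

end QP

namespace QP
open MeasureTheory Filter Topology Metric

variable {n : ℕ} {F : Type*} [NormedAddCommGroup F] [NormedSpace ℝ F]

/-- normalising constant -/
def gc (n : ℕ) : ℝ := (∫ z : ES n, Real.exp (-(1/2) * ‖z‖ ^ 2))⁻¹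

lemma gc_pos (n : ℕ) : 0 < gc n := by
  unfold gc
  rw [GaussianFourier.integral_rexp_neg_mul_sq_norm (by norm_num)]
  positivity

/-- standard Gaussian density -/
def gs (z : ES n) : ℝ := gc n * Real.exp (-(1/2) * ‖z‖ ^ 2)

lemma gs_pos (z : ES n) : 0 < gs z := mul_pos (gc_pos n) (Real.exp_pos _)

lemma gs_int : ∫ z : ES n, gs z = 1 := by
  unfold gs
  rw [integral_const_mul]
  have := gc_pos n
  unfold gc at *
  exact inv_mul_cancel₀ (fun e => by rw [e] at this; simp at this)

lemma gs_hasFDerivAt (z : ES n) : HasFDerivAt (gs : ES n → ℝ) (-(gs z) • ib n z) z := by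
  have h := (((hasFDerivAt_normSq z).const_mul (-(1/2))).exp).const_mul (gc n)
  refine h.congr_fderiv ?_
  ext v
  simp [gs]
  ring

lemma gs_cont : Continuous (gs : ES n → ℝ) :=
  continuous_iff_continuousAt.2 fun z => (gs_hasFDerivAt z).continuousAt

lemma gs_dec (k N : ℕ) : ∃ C, 0 ≤ C ∧ ∀ z : ES n, gs z * (1 + ‖z‖) ^ k ≤ C * wt N z := by
  refine ⟨gc n * ((k+N).factorial * (Real.exp 1 * Real.exp 1)), by have := gc_pos n; positivity, fun z => ?_⟩
  have hz := norm_nonneg z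
  have hp : 0 < (1 + ‖z‖) ^ N := by positivity
  unfold wt gs
  rw [← div_eq_mul_inv, le_div_iff₀ hp, mul_assoc, mul_assoc, ← pow_add]
  apply mul_le_mul_of_nonneg_left _ (gc_pos n).le
  have h1 := Real.pow_div_factorial_le_exp (1 + ‖z‖) (by positivity) (k+N)
  rw [div_le_iff₀ (by positivity)] at h1
  calc Real.exp (-(1/2) * ‖z‖ ^ 2) * (1 + ‖z‖) ^ (k+N)
      ≤ Real.exp (-(1/2) * ‖z‖ ^ 2) * (Real.exp (1 + ‖z‖) * (k+N).factorial) := by gcongr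
    _ = (k+N).factorial * Real.exp (-(1/2) * ‖z‖ ^ 2 + (1 + ‖z‖)) := by rw [Real.exp_add (-(1/2) * ‖z‖ ^ 2) (1 + ‖z‖)]; ring
    _ ≤ (k+N).factorial * Real.exp (1 + 1) := by
      apply mul_le_mul_of_nonneg_left _ (by positivity)
      exact Real.exp_le_exp.2 (by nlinarith [sq_nonneg (‖z‖ - 1)])
    _ = _ := by rw [Real.exp_add]

lemma temp_fderiv {P : ES n → F} (h : P.HasTemperateGrowth) : (fderiv ℝ P).HasTemperateGrowth := by
  refine ⟨h.1.fderiv_right (by simp), fun N => ?_⟩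
  obtain ⟨k, C, hC⟩ := h.2 (N+1)
  refine ⟨k, C, fun x => ?_⟩
  rw [norm_iteratedFDeriv_fderiv]
  exact hC x

/-- the polynomial part of the derivative of `gs • P` -/
def dP (P : ES n → F) (z : ES n) : ES n →L[ℝ] F :=
  fderiv ℝ P z - ContinuousLinearMap.smulRight (ib n z) (P z)

lemma dP_temp {P : ES n → F} (h : P.HasTemperateGrowth) : (dP P).HasTemperateGrowth := by
  refine (temp_fderiv h).sub ?_
  have h1 : (fun z : ES n => ib n z).HasTemperateGrowth := (ib n).hasTemperateGrowth
  exact (ContinuousLinearMap.smulRightL ℝ (ES n) F).bilinear_hasTemperateGrowth h1 h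

lemma ker_of_temp {P : ES n → F} (h : P.HasTemperateGrowth) :
    Ker (fun z => gs z • P z) (fun z => gs z • dP P z) := by
  have h' := dP_temp h
  refine ⟨fun z => ?_, ?_, ?_⟩
  · have h1 : HasFDerivAt P (fderiv ℝ P z) z :=
      (h.1.differentiable (by simp) z).hasFDerivAt
    refine ((gs_hasFDerivAt z).smul h1).congr_fderiv ?_
    ext v
    simp [dP, smul_sub, smul_smul]
    abel
  · exact gs_cont.smul h'.1.continuous
  · obtain ⟨k, C, hC⟩ := h.2 0
    obtain ⟨k', C', hC'⟩ := h'.2 0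
    obtain ⟨D, hD, hD'⟩ := gs_dec (n := n) k (n+3)
    obtain ⟨D2, hD2, hD2'⟩ := gs_dec (n := n) k' (n+3)
    simp only [norm_iteratedFDeriv_zero] at hC hC'
    have c1 : 0 ≤ |C| * D := by positivity
    have c2 : 0 ≤ |C'| * D2 := by positivity
    refine ⟨|C| * D + |C'| * D2, by positivity, fun z => ?_⟩
    have w := wt_pos (n+3) z
    have hz := norm_nonneg z
    constructor
    · rw [norm_smul, Real.norm_eq_abs, abs_of_pos (gs_pos z)]
      calc gs z * ‖P z‖ ≤ gs z * (|C| * (1 + ‖z‖) ^ k) := by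
            gcongr
            · exact (gs_pos z).le
            · exact (hC z).trans (by gcongr; exact le_abs_self C)
        _ = |C| * (gs z * (1 + ‖z‖) ^ k) := by ring
        _ ≤ |C| * (D * wt (n+3) z) := mul_le_mul_of_nonneg_left (hD' z) (abs_nonneg _)
        _ ≤ _ := by nlinarith
    · rw [norm_smul, Real.norm_eq_abs, abs_of_pos (gs_pos z)]
      calc gs z * ‖dP P z‖ ≤ gs z * (|C'| * (1 + ‖z‖) ^ k') := by
            gcongr
            · exact (gs_pos z).le
            · exact (hC' z).trans (by gcongr; exact le_abs_self C')
        _ = |C'| * (gs z * (1 + ‖z‖) ^ k') := by ring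
        _ ≤ |C'| * (D2 * wt (n+3) z) := mul_le_mul_of_nonneg_left (hD2' z) (abs_nonneg _)
        _ ≤ _ := by nlinarith

instance instBilN : NormedAddCommGroup (Bil n) := inferInstance
instance instBilS : NormedSpace ℝ (Bil n) := inferInstance
instance instBilC : CompleteSpace (Bil n) := inferInstance
instance instTriN : NormedAddCommGroup (ES n →L[ℝ] Bil n) := inferInstance
instance instTriS : NormedSpace ℝ (ES n →L[ℝ] Bil n) := inferInstance
instance instTriC : CompleteSpace (ES n →L[ℝ] Bil n) := inferInstance

/-- Gaussian kernels -/
def Q0 : ES n → ℝ := fun _ => 1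
def k0 (z : ES n) : ℝ := gs z • Q0 z
def k1 (z : ES n) : ES n →L[ℝ] ℝ := gs z • dP Q0 z
def k2 (z : ES n) : Bil n := gs z • dP (dP Q0) z
def k3 (z : ES n) : ES n →L[ℝ] Bil n := gs z • dP (dP (dP Q0)) z

lemma Q0_temp : (Q0 : ES n → ℝ).HasTemperateGrowth := Function.HasTemperateGrowth.const 1
lemma ker01 : Ker (k0 : ES n → ℝ) k1 := ker_of_temp Q0_temp
lemma ker12 : Ker (k1 : ES n → _) k2 := ker_of_temp (dP_temp Q0_temp)
lemma ker23 : Ker (k2 : ES n → _) k3 := ker_of_temp (dP_temp (dP_temp Q0_temp))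

lemma dQ0 (z : ES n) : dP Q0 z = - ib n z := by
  have : fderiv ℝ (Q0 : ES n → ℝ) z = 0 := by unfold Q0; simp
  ext v
  simp [dP, this, Q0]

lemma ddQ0 (z v w : ES n) : dP (dP Q0) z v w = - inner ℝ v w + inner ℝ z v * inner ℝ z w := by
  have e : (dP Q0 : ES n → _) = fun z => - ib n z := funext dQ0
  have h : fderiv ℝ (dP Q0 : ES n → _) z = - ib n := by
    rw [e]; exact ((ib n).hasFDerivAt (x := z)).neg.fderiv
  simp [dP, h, ib_apply]
  rw [show fderiv ℝ (Q0 : ES n → ℝ) z = 0 by unfold Q0; simp]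
  simp [Q0, ib_apply]

lemma Lop_one (q : Bil n) : Lop (1 : ES n →L[ℝ] ES n) q = ∑ i, q (ee i) (ee i) := rfl

/-- the Gaussian identity -/
lemma gauss_id (z : ES n) : (n:ℝ) • k0 z + k1 z z = - Lop 1 (k2 z) := by
  have h1 : ∑ i, (inner ℝ z (ee i : ES n)) * (inner ℝ z (ee i : ES n)) = ‖z‖ ^ 2 := by
    rw [EuclideanSpace.norm_sq_eq]
    refine Finset.sum_congr rfl fun i _ => ?_
    simp [ee, EuclideanSpace.inner_single_right, sq]
  have h2 : ∀ i : Fin n, k2 z (ee i) (ee i)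
      = gs z * (- 1 + inner ℝ z (ee i : ES n) * inner ℝ z (ee i : ES n)) := by
    intro i
    have : k2 z (ee i) (ee i) = gs z * (dP (dP Q0) z (ee i) (ee i)) := rfl
    rw [this, ddQ0, real_inner_self_eq_norm_sq, norm_ee]
    norm_num
  rw [Lop_one, Finset.sum_congr rfl fun i _ => h2 i, ← Finset.mul_sum, Finset.sum_add_distrib, h1]
  have h3 : k1 z z = gs z * (dP Q0 z z) := rfl
  rw [h3, dQ0]
  simp [k0, Q0, ib_apply]
  ring

/-- general smoothing operator -/
def J (k : ES n → F) (τ : ℝ) (f : ES n → ℝ) (x : ES n) : F :=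
  ∫ z, f (x + Real.sqrt (2 * τ) • z) • k z

def P0 (τ : ℝ) (f : ES n → ℝ) (x : ES n) : ℝ := J k0 τ f x
def P1 (τ : ℝ) (f : ES n → ℝ) (x : ES n) : ES n →L[ℝ] ℝ := -(Real.sqrt (2 * τ))⁻¹ • J k1 τ f x
def P2 (τ : ℝ) (f : ES n → ℝ) (x : ES n) : Bil n :=
  -(Real.sqrt (2 * τ))⁻¹ • -(Real.sqrt (2 * τ))⁻¹ • J k2 τ f x
def P3 (τ : ℝ) (f : ES n → ℝ) (x : ES n) : ES n →L[ℝ] Bil n :=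
  -(Real.sqrt (2 * τ))⁻¹ • -(Real.sqrt (2 * τ))⁻¹ • -(Real.sqrt (2 * τ))⁻¹ • J k3 τ f x

lemma sq2_pos {τ : ℝ} (hτ : 0 < τ) : 0 < Real.sqrt (2 * τ) := Real.sqrt_pos.2 (by positivity)

lemma P0_deriv {f : ES n → ℝ} (hf : Continuous f) {K : ℝ} (hK : ∀ x, |f x| ≤ K) {τ : ℝ}
    (hτ : 0 < τ) (x : ES n) : HasFDerivAt (P0 τ f) (P1 τ f x) x :=
  ker01.hasFDerivAt hf hK (sq2_pos hτ) x

lemma P1_deriv {f : ES n → ℝ} (hf : Continuous f) {K : ℝ} (hK : ∀ x, |f x| ≤ K) {τ : ℝ}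
    (hτ : 0 < τ) (x : ES n) : HasFDerivAt (P1 τ f) (P2 τ f x) x :=
  (ker12.hasFDerivAt hf hK (sq2_pos hτ) x).const_smul (-(Real.sqrt (2 * τ))⁻¹)

lemma P2_deriv {f : ES n → ℝ} (hf : Continuous f) {K : ℝ} (hK : ∀ x, |f x| ≤ K) {τ : ℝ}
    (hτ : 0 < τ) (x : ES n) : HasFDerivAt (P2 τ f) (P3 τ f x) x :=
  ((ker23.hasFDerivAt hf hK (sq2_pos hτ) x).const_smul (-(Real.sqrt (2 * τ))⁻¹)).const_smul
    (-(Real.sqrt (2 * τ))⁻¹)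

end QP

namespace QP
open MeasureTheory Filter Topology Metric
variable {n : ℕ} {F : Type*} [NormedAddCommGroup F] [NormedSpace ℝ F]

/-- decaying continuous kernel -/
structure Kd (k : ES n → F) : Prop where
  cont : Continuous k
  dec : ∃ C, 0 ≤ C ∧ ∀ z, ‖k z‖ ≤ C * wt (n+3) z

lemma Ker.kd {k : ES n → F} {k'} (h : Ker k k') : Kd k := by
  obtain ⟨C, h0, h1⟩ := h.dec
  exact ⟨h.cont, C, h0, fun z => (h1 z).1⟩

lemma Ker.kd' {k : ES n → F} {k'} (h : Ker k k') : Kd k' := by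
  obtain ⟨C, h0, h1⟩ := h.dec
  exact ⟨h.hc, C, h0, fun z => (h1 z).2⟩

/-- first moment -/
def mom (k : ES n → F) : ℝ := ∫ z, (1 + ‖z‖) * ‖k z‖

lemma mom_nonneg (k : ES n → F) : 0 ≤ mom k :=
  integral_nonneg fun z => by have := norm_nonneg z; positivity

lemma Kd.mom_int {k : ES n → F} (h : Kd k) : Integrable fun z => (1 + ‖z‖) * ‖k z‖ := by
  obtain ⟨C, h0, h1⟩ := h.dec
  have := h.cont
  refine int_of_dec (C := C) (N := n+2) (by fun_prop) (by omega) fun z => ?_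
  have hz := norm_nonneg z
  rw [Real.norm_of_nonneg (by positivity), ← wt_succ]
  nlinarith [h1 z]

lemma Kd.int {k : ES n → F} (h : Kd k) : Integrable k := by
  obtain ⟨C, h0, h1⟩ := h.dec
  exact int_of_dec h.cont (by omega) h1

lemma Kd.int_mul {k : ES n → F} (h : Kd k) {f : ES n → ℝ} (hf : Continuous f) {K : ℝ}
    (hK : ∀ z, |f z| ≤ K) : Integrable fun z => f z • k z := by
  obtain ⟨C, h0, h1⟩ := h.dec
  have := h.cont
  refine int_of_dec (C := K * C) (N := n+3) (by fun_prop) (by omega) fun z => ?_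
  rw [norm_smul, mul_assoc]
  exact mul_le_mul (hK z) (h1 z) (norm_nonneg _) ((abs_nonneg _).trans (hK z))

lemma J_bound0 {k : ES n → F} (h : Kd k) {f : ES n → ℝ} {τ L : ℝ} {x : ES n} 
    (hL : ∀ z : ES n, |f (x + Real.sqrt (2*τ) • z)| ≤ L * (1 + ‖z‖)) :
    ‖J k τ f x‖ ≤ L * mom k := by
  unfold J mom
  rw [← integral_const_mul]
  refine norm_integral_le_of_norm_le (h.mom_int.const_mul L) (Eventually.of_forall fun z => ?_)
  rw [norm_smul, ← mul_assoc]
  exact mul_le_mul_of_nonneg_right (hL z) (norm_nonneg _)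

lemma J_sub_const {k : ES n → F} (h : Kd k) (hm : ∫ z, k z = 0) {f : ES n → ℝ}
    (hf : Continuous f) {K : ℝ} (hK : ∀ z, |f z| ≤ K) (τ c : ℝ) (x : ES n) :
    J k τ f x = J k τ (fun y => f y - c) x := by
  unfold J
  simp only [sub_smul]
  rw [integral_sub, integral_smul, hm]
  · simp
  · exact h.int_mul (by fun_prop) (fun z => hK _)
  · exact h.int.smul c

lemma J_bound {k : ES n → F} (h : Kd k) (hm : ∫ z, k z = 0) {f : ES n → ℝ}
    (hf : Continuous f) {K : ℝ} (hK : ∀ z, |f z| ≤ K) {τ L c : ℝ} {x : ES n} 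
    (hL : ∀ z : ES n, |f (x + Real.sqrt (2*τ) • z) - c| ≤ L * (1 + ‖z‖)) :
    ‖J k τ f x‖ ≤ L * mom k := by
  rw [J_sub_const h hm hf hK τ c]
  exact J_bound0 h hL

lemma J_cont {k : ES n → F} (h : Kd k) {X : Type*} [TopologicalSpace X]
    [FirstCountableTopology X] {τ s : X → ℝ} {x : X → ES n} (hτ : Continuous τ) (hs : Continuous s)
    (hx : Continuous x) {f : ℝ → ES n → ℝ} (hf : Continuous (Function.uncurry f)) {K : ℝ}
    (hK : ∀ t z, |f t z| ≤ K) : Continuous fun a => J k (τ a) (f (s a)) (x a) := by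
  obtain ⟨C, h0, h1⟩ := h.dec
  have hk := h.cont
  unfold J
  have hf' : Continuous fun p : ℝ × ES n => f p.1 p.2 := hf
  refine continuous_of_dominated (bound := fun z => K * (C * wt (n+3) z)) ?_ ?_ ?_ ?_
  · intro a
    refine Continuous.aestronglyMeasurable (Continuous.smul ?_ hk)
    exact hf'.comp (f := fun z : ES n => (s a, x a + Real.sqrt (2 * τ a) • z)) (by fun_prop)
  · intro a
    refine Eventually.of_forall fun z => ?_
    rw [norm_smul]
    exact mul_le_mul (hK _ _) (h1 z) (norm_nonneg _) ((abs_nonneg _).trans (hK 0 0))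
  · exact ((wt_integrable (by omega)).const_mul C).const_mul K
  · refine Eventually.of_forall fun z => Continuous.smul ?_ continuous_const
    exact hf'.comp (f := fun a : X => (s a, x a + Real.sqrt (2 * τ a) • z)) (by fun_prop)

/-- constant controlling all kernels -/
def cM (n : ℕ) : ℝ := 1 + mom (k0 : ES n → ℝ) + mom (k1 : ES n → _) + mom (k2 : ES n → _) + mom (k3 : ES n → _)

lemma cM_pos (n : ℕ) : 0 < cM n := by
  have := mom_nonneg (k0 : ES n → ℝ); have := mom_nonneg (k1 : ES n → _)
  have := mom_nonneg (k2 : ES n → _); have := mom_nonneg (k3 : ES n → _)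
  unfold cM; linarith

lemma mom_le (n : ℕ) : mom (k0 : ES n → ℝ) ≤ cM n ∧ mom (k1 : ES n → _) ≤ cM n ∧
    mom (k2 : ES n → _) ≤ cM n ∧ mom (k3 : ES n → _) ≤ cM n := by
  have := mom_nonneg (k0 : ES n → ℝ); have := mom_nonneg (k1 : ES n → _)
  have := mom_nonneg (k2 : ES n → _); have := mom_nonneg (k3 : ES n → _)
  unfold cM; refine ⟨?_, ?_, ?_, ?_⟩ <;> linarith

lemma P0_le {f : ES n → ℝ} {K : ℝ} (hK : ∀ z, |f z| ≤ K) (τ : ℝ) (x : ES n) :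
    |P0 τ f x| ≤ K * cM n := by
  have h0 := (abs_nonneg _).trans (hK 0)
  refine (J_bound0 (ker01 (n := n)).kd (L := K) (fun z => (hK _).trans ?_)).trans ?_
  · have := norm_nonneg z; nlinarith
  · exact mul_le_mul_of_nonneg_left (mom_le n).1 h0

section
variable {f : ES n → ℝ} (hf : Continuous f) {K : ℝ} (hK : ∀ z, |f z| ≤ K)  {τ L c : ℝ} {x : ES n}

lemma L_nonneg (hL : ∀ z : ES n, |f (x + Real.sqrt (2*τ) • z) - c| ≤ L * (1 + ‖z‖)) : 0 ≤ L := by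
  have := (abs_nonneg _).trans (hL 0); simpa using this

lemma sq2_inv_le {τ : ℝ} (hτ : 0 < τ) : (Real.sqrt (2 * τ))⁻¹ ≤ τ ^ (-(1/2) : ℝ) := by
  rw [Real.rpow_neg hτ.le, ← Real.sqrt_eq_rpow]
  exact inv_anti₀ (Real.sqrt_pos.2 hτ) (Real.sqrt_le_sqrt (by linarith))

lemma P1_le (hf : Continuous f) (hK : ∀ z, |f z| ≤ K) (hτ : 0 < τ)
    (hL : ∀ z : ES n, |f (x + Real.sqrt (2*τ) • z) - c| ≤ L * (1 + ‖z‖)) :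
    ‖P1 τ f x‖ ≤ cM n * L * τ ^ (-(1/2) : ℝ) := by
  have h0 := L_nonneg hL
  have hc := cM_pos n
  have h := J_bound (ker01 (n := n)).kd' ker01.mean_zero hf hK hL
  have h2 : ‖J k1 τ f x‖ ≤ L * cM n := h.trans (mul_le_mul_of_nonneg_left (mom_le n).2.1 h0)
  unfold P1
  rw [norm_smul, norm_neg, norm_inv, Real.norm_of_nonneg (Real.sqrt_nonneg _)]
  calc _ ≤ τ ^ (-(1/2) : ℝ) * (L * cM n) :=
        mul_le_mul (sq2_inv_le hτ) h2 (norm_nonneg _) (by positivity)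
    _ = _ := by ring

lemma P2_le (hf : Continuous f) (hK : ∀ z, |f z| ≤ K) (hτ : 0 < τ)
    (hL : ∀ z : ES n, |f (x + Real.sqrt (2*τ) • z) - c| ≤ L * (1 + ‖z‖)) :
    ‖P2 τ f x‖ ≤ cM n * L * τ ^ (-1 : ℝ) := by
  have h0 := L_nonneg hL
  have hc := cM_pos n
  have h := J_bound (ker12 (n := n)).kd' ker12.mean_zero hf hK hL
  have h2 : ‖J k2 τ f x‖ ≤ L * cM n := h.trans (mul_le_mul_of_nonneg_left (mom_le n).2.2.1 h0)
  unfold P2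
  rw [norm_smul, norm_smul, norm_neg, norm_inv, Real.norm_of_nonneg (Real.sqrt_nonneg _)]
  have e : τ ^ (-1 : ℝ) = τ ^ (-(1/2) : ℝ) * τ ^ (-(1/2) : ℝ) := by
    rw [← Real.rpow_add hτ]; norm_num
  have s := sq2_inv_le hτ
  have s0 : 0 ≤ (Real.sqrt (2 * τ))⁻¹ := by positivity
  calc _ ≤ τ ^ (-(1/2) : ℝ) * (τ ^ (-(1/2) : ℝ) * (L * cM n)) := by
        refine mul_le_mul s (mul_le_mul s h2 (norm_nonneg _) (by positivity)) (by positivity) (by positivity)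
    _ = _ := by rw [e]; ring

lemma P3_le (hf : Continuous f) (hK : ∀ z, |f z| ≤ K) (hτ : 0 < τ)
    (hL : ∀ z : ES n, |f (x + Real.sqrt (2*τ) • z) - c| ≤ L * (1 + ‖z‖)) :
    ‖P3 τ f x‖ ≤ cM n * L * τ ^ (-(3/2) : ℝ) := by
  have h0 := L_nonneg hL
  have hc := cM_pos n
  have h := J_bound (ker23 (n := n)).kd' ker23.mean_zero hf hK hL
  have h2 : ‖J k3 τ f x‖ ≤ L * cM n := h.trans (mul_le_mul_of_nonneg_left (mom_le n).2.2.2 h0)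
  unfold P3
  rw [norm_smul, norm_smul, norm_smul, norm_neg, norm_inv, Real.norm_of_nonneg (Real.sqrt_nonneg _)]
  have e : τ ^ (-(3/2) : ℝ) = τ ^ (-(1/2) : ℝ) * (τ ^ (-(1/2) : ℝ) * τ ^ (-(1/2) : ℝ)) := by
    rw [← Real.rpow_add hτ, ← Real.rpow_add hτ]; norm_num
  have s := sq2_inv_le hτ
  have s0 : 0 ≤ (Real.sqrt (2 * τ))⁻¹ := by positivity
  calc _ ≤ τ ^ (-(1/2) : ℝ) * (τ ^ (-(1/2) : ℝ) * (τ ^ (-(1/2) : ℝ) * (L * cM n))) := by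
        refine mul_le_mul s (mul_le_mul s (mul_le_mul s h2 (norm_nonneg _) (by positivity))
          (by positivity) (by positivity)) (by positivity) (by positivity)
    _ = _ := by rw [e]; ring
end

lemma P0_zero (f : ES n → ℝ) (x : ES n) : P0 0 f x = f x := by
  unfold P0 J k0 Q0
  simp [integral_const_mul, gs_int]

/-- `Lop S` as a continuous linear map -/
def LopL (S : ES n →L[ℝ] ES n) : Bil n →L[ℝ] ℝ :=
  LinearMap.mkContinuous
    { toFun := fun q => Lop S q
      map_add' := fun a b => Lop_add _ _ _
      map_smul' := fun a b => Lop_smul _ _ _ } (n * ‖S‖) (fun q => abs_Lop_le _ _)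

lemma LopL_apply (S : ES n →L[ℝ] ES n) (q : Bil n) : LopL S q = Lop S q := rfl

lemma P0_time {f : ES n → ℝ} (hf : Continuous f) {K : ℝ} (hK : ∀ x, |f x| ≤ K) {τ : ℝ}
    (hτ : 0 < τ) (x : ES n) : HasDerivAt (fun τ => P0 τ f x) (Lop 1 (P2 τ f x)) τ := by
  have s := sq2_pos hτ
  have h1 := ker01.hasDerivAt hf hK (r0 := (Real.sqrt (2 * τ))⁻¹) (by positivity) x
  have h2 : HasDerivAt (fun τ : ℝ => Real.sqrt (2 * τ)) (2 / (2 * Real.sqrt (2 * τ))) τ := by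
    have := ((hasDerivAt_id τ).const_mul 2).sqrt (by simp; positivity)
    simpa using this
  have h3 := h2.inv s.ne'
  have h4 := HasDerivAt.scomp τ h1 h3
  have e : (fun r : ℝ => ∫ z, f (x + r⁻¹ • z) • k0 z) ∘ (fun τ => Real.sqrt (2 * τ))⁻¹
      = fun τ => P0 τ f x := by
    ext τ; simp [P0, J]
  rw [e] at h4
  refine h4.congr_deriv ?_
  have e2 : ∫ z, f (x + Real.sqrt (2*τ) • z) • ((n:ℝ) • k0 z + k1 z z) = - Lop 1 (J k2 τ f x) := by
    simp only [gauss_id]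
    unfold J
    rw [← LopL_apply, ← ContinuousLinearMap.integral_comp_comm, ← integral_neg]
    · refine integral_congr_ae (Eventually.of_forall fun z => ?_)
      simp [LopL_apply, Lop_smul]
    · exact ker12.kd'.int_mul (by fun_prop) (fun z => hK _)
  simp only [inv_inv]
  rw [e2]
  unfold P2
  rw [Lop_smul, Lop_smul]
  simp only [smul_eq_mul]
  field_simp
end QP

namespace QP
open MeasureTheory Filter Topology Metric
variable {n : ℕ} {G : Type*} [NormedAddCommGroup G] [NormedSpace ℝ G]

/-- singular time kernel -/
structure Sg (φ : ℝ → ℝ → ES n → G) (C γ : ℝ) : Prop where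
  cont : ContinuousOn (fun p : ℝ × ℝ × ES n => φ p.1 p.2.1 p.2.2) {p | 0 < p.1}
  bd : ∀ τ > 0, ∀ s x, ‖φ τ s x‖ ≤ C * τ ^ (γ - 1)
  pos : 0 < γ
  C0 : 0 ≤ C

/-- Duhamel type integral -/
def Du (φ : ℝ → ℝ → ES n → G) (t : ℝ) (x : ES n) : G :=
  ∫ θ in (0:ℝ)..1, (max t 0) • φ (max t 0 * θ) (max t 0 * (1 - θ)) x

lemma Du_zero (φ : ℝ → ℝ → ES n → G) {t : ℝ} (ht : t ≤ 0) (x : ES n) : Du φ t x = 0 := by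
  unfold Du; simp [max_eq_right ht]

lemma Sg.bd' {φ : ℝ → ℝ → ES n → G} {C γ : ℝ} (h : Sg φ C γ) (t : ℝ) {θ : ℝ} (hθ : 0 < θ) (s : ℝ) (x : ES n) :
    ‖(max t 0) • φ (max t 0 * θ) s x‖ ≤ C * (max t 0) ^ γ * θ ^ (γ - 1) := by
  have hC := h.C0
  rcases le_or_gt t 0 with ht | ht
  · rw [max_eq_right ht]; simp; positivity
  · rw [max_eq_left ht.le, norm_smul, Real.norm_of_nonneg ht.le]
    refine (mul_le_mul_of_nonneg_left (h.bd _ (by positivity) _ _) ht.le).trans (le_of_eq ?_)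
    rw [Real.mul_rpow ht.le hθ.le]
    have : t ^ γ = t * t ^ (γ - 1) := by
      rw [← Real.rpow_one_add' ht.le (by have := h.pos; ring_nf; exact this.ne')]; ring_nf
    rw [this]; ring

lemma Sg.cont_slice {φ : ℝ → ℝ → ES n → G} {C γ : ℝ} (h : Sg φ C γ) (t : ℝ) (x : ES n) :
    ContinuousOn (fun θ : ℝ => (max t 0) • φ (max t 0 * θ) (max t 0 * (1 - θ)) x) (Ioi 0) := by
  rcases le_or_gt t 0 with ht | ht
  · simp [max_eq_right ht]
    exact continuousOn_const
  · rw [max_eq_left ht.le]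
    refine ContinuousOn.const_smul ?_ t
    exact h.cont.comp (f := fun θ : ℝ => (t * θ, t * (1 - θ), x)) (by fun_prop)
      (fun θ hθ => by have : 0 < θ := hθ; simp; positivity)

lemma Sg.meas {φ : ℝ → ℝ → ES n → G} {C γ : ℝ} (h : Sg φ C γ) (t : ℝ) (x : ES n) :
    AEStronglyMeasurable (fun θ : ℝ => (max t 0) • φ (max t 0 * θ) (max t 0 * (1 - θ)) x)
      (volume.restrict (uIoc 0 1)) := by
  rw [uIoc_of_le zero_le_one]
  exact ((h.cont_slice t x).mono (fun θ hθ => hθ.1)).aestronglyMeasurable measurableSet_Ioc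

lemma Sg.bint {φ : ℝ → ℝ → ES n → G} {C γ : ℝ} (h : Sg φ C γ) (D : ℝ) :
    IntervalIntegrable (fun θ : ℝ => D * θ ^ (γ - 1)) volume 0 1 :=
  (intervalIntegral.intervalIntegrable_rpow' (by linarith [h.pos])).const_mul D

lemma Sg.Du_int {φ : ℝ → ℝ → ES n → G} {C γ : ℝ} (h : Sg φ C γ) (t : ℝ) (x : ES n) :
    IntervalIntegrable (fun θ : ℝ => (max t 0) • φ (max t 0 * θ) (max t 0 * (1 - θ)) x) volume 0 1 := by
  refine (h.bint (C * (max t 0) ^ γ)).mono_fun' (h.meas t x) ?_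
  rw [uIoc_of_le zero_le_one]
  exact (ae_restrict_iff' measurableSet_Ioc).2 (Eventually.of_forall fun θ hθ => h.bd' t hθ.1 _ x)

lemma Sg.Du_le {φ : ℝ → ℝ → ES n → G} {C γ : ℝ} (h : Sg φ C γ) (t : ℝ) (x : ES n) :
    ‖Du φ t x‖ ≤ C * (max t 0) ^ γ / γ := by
  have h1 := intervalIntegral.norm_integral_le_of_norm_le (f := fun θ : ℝ => (max t 0) • φ (max t 0 * θ) (max t 0 * (1 - θ)) x) zero_le_one (Eventually.of_forall fun θ hθ => h.bd' t hθ.1 _ x)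
    (h.bint (C * (max t 0) ^ γ))
  refine h1.trans (le_of_eq ?_)
  rw [intervalIntegral.integral_const_mul, integral_rpow (Or.inl (by linarith [h.pos]))]
  have := h.pos.ne'
  simp [Real.zero_rpow this]; ring

lemma Sg.pt_cont {φ : ℝ → ℝ → ES n → G} {C γ : ℝ} (h : Sg φ C γ) {θ : ℝ} (hθ : 0 < θ) :
    Continuous fun p : ℝ × ES n => (max p.1 0) • φ (max p.1 0 * θ) (max p.1 0 * (1 - θ)) p.2 := by
  rw [continuous_iff_continuousAt]
  rintro ⟨t, x⟩
  rcases le_or_gt t 0 with ht | ht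
  · have e : (max t 0) • φ (max t 0 * θ) (max t 0 * (1 - θ)) x = 0 := by simp [max_eq_right ht]
    unfold ContinuousAt
    simp only
    rw [e]
    refine squeeze_zero_norm (fun p => h.bd' p.1 hθ _ p.2) ?_
    have : Continuous fun p : ℝ × ES n => C * (max p.1 0) ^ γ * θ ^ (γ - 1) := by
      refine Continuous.mul (continuous_const.mul ?_) continuous_const
      exact (by fun_prop : Continuous fun p : ℝ × ES n => max p.1 0).rpow_const (fun _ => Or.inr h.pos.le)
    have := this.tendsto (t, x)
    simpa [max_eq_right ht, Real.zero_rpow h.pos.ne'] using this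
  · refine ContinuousAt.smul (by fun_prop) ?_
    have hop : IsOpen {p : ℝ × ℝ × ES n | 0 < p.1} := isOpen_lt continuous_const continuous_fst
    have h2 := h.cont.continuousAt (x := (max t 0 * θ, max t 0 * (1 - θ), x)) (hop.mem_nhds (by
      simp [max_eq_left ht.le]; positivity))
    exact ContinuousAt.comp (f := fun p : ℝ × ES n => (max p.1 0 * θ, max p.1 0 * (1 - θ), p.2)) (g := fun p : ℝ × ℝ × ES n => φ p.1 p.2.1 p.2.2)
      (x := (t, x)) h2 (by fun_prop)

lemma Sg.Du_cont {φ : ℝ → ℝ → ES n → G} {C γ : ℝ} (h : Sg φ C γ) :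
    Continuous (Function.uncurry (Du φ)) := by
  rw [continuous_iff_continuousAt]
  rintro ⟨t, x⟩
  have hC := h.C0
  unfold Function.uncurry Du
  refine intervalIntegral.continuousAt_of_dominated_interval
    (bound := fun θ => (C * (|t|+1) ^ γ) * θ ^ (γ - 1)) ?_ ?_ (h.bint _) ?_
  · exact Eventually.of_forall fun p => h.meas p.1 p.2
  · have : ∀ᶠ p : ℝ × ES n in 𝓝 (t, x), p.1 < |t| + 1 :=
      (continuous_fst.tendsto (t, x)).eventually_lt_const (by simp; linarith [le_abs_self t])
    filter_upwards [this] with p hp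
    refine Eventually.of_forall fun θ hθ => ?_
    rw [uIoc_of_le zero_le_one] at hθ
    refine (h.bd' p.1 hθ.1 _ p.2).trans ?_
    have := hθ.1
    have : 0 ≤ θ ^ (γ - 1) := by positivity
    refine mul_le_mul_of_nonneg_right (mul_le_mul_of_nonneg_left ?_ hC) this
    exact Real.rpow_le_rpow (by simp) (max_le hp.le (by positivity)) h.pos.le
  · refine Eventually.of_forall fun θ hθ => ?_
    rw [uIoc_of_le zero_le_one] at hθ
    exact (h.pt_cont hθ.1).continuousAt

lemma Sg.Du_fderiv {φ : ℝ → ℝ → ES n → G} {φ' : ℝ → ℝ → ES n → (ES n →L[ℝ] G)}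
    {C γ C' γ' : ℝ} (h : Sg φ C γ) (h' : Sg φ' C' γ')
    (hd : ∀ τ > 0, ∀ s x, HasFDerivAt (φ τ s) (φ' τ s x) x) (t : ℝ) (x : ES n) :
    HasFDerivAt (Du φ t) (Du φ' t x) x := by
  rcases le_or_gt t 0 with ht | ht
  · have : Du φ t = fun _ => 0 := funext fun x => Du_zero φ ht x
    rw [this, Du_zero φ' ht]
    exact hasFDerivAt_const _ _
  unfold Du
  refine intervalIntegral.hasFDerivAt_integral_of_dominated_of_fderiv_le (s := univ)
    (F := fun y θ => (max t 0) • φ (max t 0 * θ) (max t 0 * (1 - θ)) y)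
    (F' := fun y θ => (max t 0) • φ' (max t 0 * θ) (max t 0 * (1 - θ)) y)
    (bound := fun θ => (C' * (max t 0) ^ γ') * θ ^ (γ' - 1)) univ_mem ?_ (h.Du_int t x) (h'.meas t x)
    ?_ (h'.bint _) ?_
  · exact Eventually.of_forall fun y => h.meas t y
  · refine Eventually.of_forall fun θ hθ y _ => ?_
    rw [uIoc_of_le zero_le_one] at hθ
    exact h'.bd' t hθ.1 _ y
  · refine Eventually.of_forall fun θ hθ y _ => ?_
    rw [uIoc_of_le zero_le_one] at hθ
    have := hθ.1
    exact (hd (max t 0 * θ) (by rw [max_eq_left ht.le]; positivity) (max t 0 * (1 - θ)) y).const_smul (max t 0)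

lemma Du_eq (φ : ℝ → ℝ → ES n → G) {t : ℝ} (ht : 0 < t) (x : ES n) :
    Du φ t x = ∫ τ in (0:ℝ)..t, φ τ (t - τ) x := by
  unfold Du
  rw [max_eq_left ht.le, intervalIntegral.integral_smul]
  have := intervalIntegral.smul_integral_comp_mul_left (a := 0) (b := 1) (fun τ => φ τ (t - τ) x) t
  simp only [mul_zero, mul_one] at this
  rw [← this]
  simp only [mul_sub, mul_one]

lemma Du_eq' (φ : ℝ → ℝ → ES n → G) {t : ℝ} (ht : 0 < t) (x : ES n) :
    Du φ t x = ∫ s in (0:ℝ)..t, φ (t - s) s x := by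
  have := intervalIntegral.integral_comp_sub_left (a := 0) (b := t) (fun τ => φ τ (t - τ) x) t
  simp only [sub_sub_cancel, sub_self, sub_zero] at this
  rw [Du_eq φ ht, ← this]

lemma Sg.int' {φ : ℝ → ℝ → ES n → G} {C γ : ℝ} (h : Sg φ C γ) {t : ℝ} (ht : 0 < t) (x : ES n) :
    IntervalIntegrable (fun τ => φ τ (t - τ) x) volume 0 t := by
  have h1 : IntervalIntegrable (fun τ : ℝ => C * τ ^ (γ - 1)) volume 0 t :=
    (intervalIntegral.intervalIntegrable_rpow' (by linarith [h.pos])).const_mul C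
  refine h1.mono_fun' ?_ ?_
  · rw [uIoc_of_le ht.le]
    refine ContinuousOn.aestronglyMeasurable ?_ measurableSet_Ioc
    exact h.cont.comp (f := fun τ : ℝ => (τ, t - τ, x)) (by fun_prop) (fun θ hθ => hθ.1)
  · rw [uIoc_of_le ht.le]
    exact (ae_restrict_iff' measurableSet_Ioc).2 (Eventually.of_forall fun θ hθ => h.bd _ hθ.1 _ x)

/-- the time derivative of the Duhamel integral -/
lemma Du_time {φ : ℝ → ℝ → ES n → ℝ} {ψ : ℝ → ℝ → ES n → ℝ} {C C' γ γ' : ℝ}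
    (h : Sg φ C γ) (h' : Sg ψ C' γ') (x : ES n)
    (hd : ∀ τ > 0, ∀ s, HasDerivAt (fun τ => φ τ s x) (ψ τ s x) τ)
    (hc : ∀ s, ContinuousOn (fun τ => φ τ s x) (Ici 0))
    (h0 : Continuous fun s => φ 0 s x) {t : ℝ} (ht : 0 < t) :
    HasDerivAt (fun s => Du φ s x) (φ 0 t x + Du ψ t x) t := by
  have hcψ : Continuous fun s => Du ψ s x := h'.Du_cont.comp (f := fun s => (s, x)) (by fun_prop)
  have key : ∀ t > 0, Du φ t x = ∫ s in (0:ℝ)..t, (φ 0 s x + Du ψ s x) := by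
    intro t ht
    rw [intervalIntegral.integral_add (h0.intervalIntegrable _ _) (hcψ.intervalIntegrable _ _)]
    set μ := (volume : Measure ℝ).restrict (Ioc 0 t) with hμ
    set Φ : ℝ → ℝ → ℝ := fun s r => (Iio s).indicator (fun r => ψ (s - r) r x) r with hΦ
    have hop : MeasurableSet {p : ℝ × ℝ | p.2 < p.1} := measurableSet_lt measurable_snd measurable_fst
    have e1 : ∫ s in (0:ℝ)..t, Du ψ s x = ∫ s, ∫ r, Φ s r ∂μ ∂μ := by
      rw [intervalIntegral.integral_of_le ht.le]
      refine setIntegral_congr_fun measurableSet_Ioc fun s hs => ?_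
      simp only [hΦ]
      rw [Du_eq' ψ hs.1, intervalIntegral.integral_of_le hs.1.le, integral_indicator measurableSet_Iio, hμ,
        Measure.restrict_restrict measurableSet_Iio, integral_Ioc_eq_integral_Ioo]
      congr 2
      ext r; simp only [mem_inter_iff, mem_Iio, mem_Ioo, mem_Ioc]
      constructor
      · rintro ⟨a, b⟩; exact ⟨b, a, (b.trans_le hs.2).le⟩
      · rintro ⟨a, b, _⟩; exact ⟨b, a⟩
    have hmeas : AEStronglyMeasurable (Function.uncurry Φ) (μ.prod μ) := by
      have : Function.uncurry Φ = {p : ℝ × ℝ | p.2 < p.1}.indicator (fun p => ψ (p.1 - p.2) p.2 x) := by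
        ext ⟨s, r⟩; simp [Φ, indicator]
      rw [this]
      rw [aestronglyMeasurable_indicator_iff hop]
      refine ContinuousOn.aestronglyMeasurable ?_ hop
      exact h'.cont.comp (f := fun p : ℝ × ℝ => (p.1 - p.2, p.2, x)) (by fun_prop)
        (fun p hp => by simpa using hp)
    have hbd : ∀ s r, ‖Φ s r‖ ≤ (Iio s).indicator (fun r => C' * (s - r) ^ (γ' - 1)) r := by
      intro s r
      by_cases hr : r < s
      · simp only [Φ, indicator, mem_Iio, hr, if_true]
        exact h'.bd _ (by linarith) _ _
      · simp [Φ, indicator, hr]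
    have hint0 : ∀ s ∈ Ioc 0 t, IntegrableOn (fun r => (s - r) ^ (γ' - 1)) (Ioo 0 s) := by
      intro s hs
      have h1 : IntervalIntegrable (fun τ : ℝ => τ ^ (γ' - 1)) volume 0 s :=
        (intervalIntegral.intervalIntegrable_rpow' (by linarith [h'.pos]))
      have h2 := (h1.comp_sub_left s).symm
      simp only [sub_self, sub_zero] at h2
      rw [intervalIntegrable_iff_integrableOn_Ioo_of_le hs.1.le] at h2
      exact h2
    have hset : ∀ s ∈ Ioc 0 t, Iio s ∩ Ioc 0 t = Ioo 0 s := by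
      intro s hs
      ext r; simp only [mem_inter_iff, mem_Iio, mem_Ioo, mem_Ioc]
      constructor
      · rintro ⟨a, b, _⟩; exact ⟨b, a⟩
      · rintro ⟨a, b⟩; exact ⟨b, a, (b.trans_le hs.2).le⟩
    have hintg1 : ∀ s ∈ Ioc 0 t, Integrable (fun r => (Iio s).indicator (fun r => C' * (s - r) ^ (γ' - 1)) r) μ := by
      intro s hs
      rw [integrable_indicator_iff measurableSet_Iio, IntegrableOn, hμ, Measure.restrict_restrict measurableSet_Iio, hset s hs]
      exact (hint0 s hs).const_mul C'
    have hintg : Integrable (Function.uncurry Φ) (μ.prod μ) := by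
      rw [integrable_prod_iff hmeas]
      have hslice : ∀ᵐ s ∂μ, AEStronglyMeasurable (Φ s) μ := hmeas.prodMk_left
      have hin : ∀ᵐ s ∂μ, s ∈ Ioc 0 t := ae_restrict_mem measurableSet_Ioc
      have A : ∀ᵐ s ∂μ, Integrable (Φ s) μ := by
        filter_upwards [hslice, hin] with s h1 hs
        exact (hintg1 s hs).mono' h1 (Eventually.of_forall (hbd s))
      refine ⟨A, ?_⟩
      have : IsFiniteMeasure μ := by rw [hμ]; infer_instance
      refine Integrable.of_bound (C := C' * (t ^ γ' / γ')) hmeas.norm.integral_prod_right' ?_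
      filter_upwards [A, hin] with s h1 hs
      rw [Real.norm_of_nonneg (integral_nonneg fun _ => norm_nonneg _)]
      calc ∫ r, ‖Φ s r‖ ∂μ ≤ ∫ r, (Iio s).indicator (fun r => C' * (s - r) ^ (γ' - 1)) r ∂μ :=
            integral_mono h1.norm (hintg1 s hs) (hbd s)
        _ = C' * ∫ r in Ioo 0 s, (s - r) ^ (γ' - 1) := by
            rw [integral_indicator measurableSet_Iio, hμ, Measure.restrict_restrict measurableSet_Iio, hset s hs, integral_const_mul]
        _ = C' * (s ^ γ' / γ') := by
            rw [← integral_Ioc_eq_integral_Ioo, ← intervalIntegral.integral_of_le hs.1.le,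
              intervalIntegral.integral_comp_sub_left (fun τ => τ ^ (γ' - 1)) s]
            simp only [sub_self, sub_zero]
            rw [integral_rpow (Or.inl (by linarith [h'.pos]))]
            simp [Real.zero_rpow h'.pos.ne']
        _ ≤ _ := by
            have := h'.pos
            have := h'.C0
            have := hs.1.le
            have := Real.rpow_le_rpow hs.1.le hs.2 h'.pos.le
            gcongr
    rw [e1, integral_integral_swap hintg]
    have e2 : ∫ r, ∫ s, Φ s r ∂μ ∂μ = ∫ r in (0:ℝ)..t, (φ (t - r) r x - φ 0 r x) := by
      rw [intervalIntegral.integral_of_le ht.le, integral_Ioc_eq_integral_Ioo, hμ, integral_Ioc_eq_integral_Ioo]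
      refine setIntegral_congr_fun measurableSet_Ioo fun r hr => ?_
      have e3 : ∀ s, Φ s r = (Ioi r).indicator (fun s => ψ (s - r) r x) s := by
        intro s; simp [Φ, indicator]
      simp only [e3]
      have hset' : Ioi r ∩ Ioc 0 t = Ioc r t := by
        ext s; simp only [mem_inter_iff, mem_Ioi, mem_Ioc]
        constructor
        · rintro ⟨a, b, c⟩; exact ⟨a, c⟩
        · rintro ⟨a, b⟩; exact ⟨a, hr.1.trans a, b⟩
      rw [integral_indicator measurableSet_Ioi, Measure.restrict_restrict measurableSet_Ioi, hset',
        ← intervalIntegral.integral_of_le hr.2.le]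
      have h3 := intervalIntegral.integral_eq_sub_of_hasDerivAt_of_le (a := r) (b := t)
        (f := fun s => φ (s - r) r x) (f' := fun s => ψ (s - r) r x) hr.2.le ?_ ?_ ?_
      · rw [h3]; simp
      · exact (hc r).comp (by fun_prop) (fun s hs => by simpa using hs.1)
      · intro s hs
        exact HasDerivAt.comp_sub_const s r (hd (s - r) (by linarith [hs.1]) r)
      · have h1 : IntervalIntegrable (fun τ : ℝ => C' * τ ^ (γ' - 1)) volume 0 (t - r) :=
          (intervalIntegral.intervalIntegrable_rpow' (by linarith [h'.pos])).const_mul C'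
        have h2 := h1.comp_sub_right r
        simp only [zero_add, sub_add_cancel] at h2
        refine h2.mono_fun' ?_ ?_
        · rw [uIoc_of_le hr.2.le]
          refine ContinuousOn.aestronglyMeasurable ?_ measurableSet_Ioc
          exact h'.cont.comp (f := fun s : ℝ => (s - r, r, x)) (by fun_prop) (fun θ hθ => by simpa using hθ.1)
        · rw [uIoc_of_le hr.2.le]
          exact (ae_restrict_iff' measurableSet_Ioc).2 (Eventually.of_forall fun θ hθ => h'.bd _ (by linarith [hθ.1]) _ x)
    rw [e2, intervalIntegral.integral_sub, Du_eq' φ ht]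
    · ring
    · have := (h.int' ht x).comp_sub_left t
      simp only [sub_sub_cancel, sub_zero, sub_self] at this
      exact this.symm
    · exact h0.intervalIntegrable _ _
  have h5 : HasDerivAt (fun t => ∫ s in (0:ℝ)..t, (φ 0 s x + Du ψ s x)) (φ 0 t x + Du ψ t x) t := by
    have hcc : Continuous fun s => φ 0 s x + Du ψ s x := h0.add hcψ
    exact intervalIntegral.integral_hasDerivAt_right (hcc.intervalIntegrable _ _)
      hcc.aestronglyMeasurable.stronglyMeasurableAtFilter hcc.continuousAt
  refine h5.congr_of_eventuallyEq ?_
  filter_upwards [Ioi_mem_nhds ht] with s hs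
  exact key s hs
end QP

namespace QP
open MeasureTheory Filter Topology Metric
variable {n : ℕ} {G : Type*} [NormedAddCommGroup G] [NormedSpace ℝ G]

/-- bounded continuous functions, Hölder in space -/
structure HB (β K H : ℝ) (f : ℝ → ES n → G) : Prop where
  cont : Continuous (Function.uncurry f)
  bd : ∀ t x, ‖f t x‖ ≤ K
  hol : ∀ t x y, ‖f t x - f t y‖ ≤ H * ‖x - y‖ ^ β

lemma HB.K0 {β K H : ℝ} {f : ℝ → ES n → G} (h : HB β K H f) : 0 ≤ K := (norm_nonneg _).trans (h.bd 0 0)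

lemma HB.slice {β K H : ℝ} {f : ℝ → ES n → G} (h : HB β K H f) (t : ℝ) : Continuous (f t) :=
  h.cont.comp (f := fun x => (t, x)) (by fun_prop)

lemma inc_le {β τ : ℝ} (hβ : 0 < β) (hβ1 : β ≤ 1) (hτ : 0 ≤ τ) (z : ES n) :
    ‖Real.sqrt (2*τ) • z‖ ^ β ≤ 2 * τ ^ (β/2) * (1 + ‖z‖) := by
  have hz := norm_nonneg z
  rw [norm_smul, Real.norm_of_nonneg (Real.sqrt_nonneg _), Real.mul_rpow (Real.sqrt_nonneg _) hz,
    Real.sqrt_eq_rpow, ← Real.rpow_mul (by positivity), Real.mul_rpow (by norm_num) hτ]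
  have e : 1 / 2 * β = β / 2 := by ring
  rw [e]
  have h1 : (2:ℝ) ^ (β/2) ≤ 2 := by
    calc (2:ℝ) ^ (β/2) ≤ 2 ^ (1:ℝ) := Real.rpow_le_rpow_of_exponent_le (by norm_num) (by linarith)
      _ = 2 := by simp
  have h2 : ‖z‖ ^ β ≤ 1 + ‖z‖ := by
    calc ‖z‖ ^ β ≤ (1 + ‖z‖) ^ β := Real.rpow_le_rpow hz (by linarith) hβ.le
      _ ≤ (1 + ‖z‖) ^ (1:ℝ) := Real.rpow_le_rpow_of_exponent_le (by linarith) hβ1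
      _ = _ := by simp
  have : 0 ≤ τ ^ (β/2) := by positivity
  gcongr

/-- heat kernels applied to a time dependent function -/
def h0 (f : ℝ → ES n → ℝ) (τ s : ℝ) (x : ES n) : ℝ := P0 τ (f s) x
def h1 (f : ℝ → ES n → ℝ) (τ s : ℝ) (x : ES n) : ES n →L[ℝ] ℝ := P1 τ (f s) x
def h2 (f : ℝ → ES n → ℝ) (τ s : ℝ) (x : ES n) : Bil n := P2 τ (f s) x

section
variable {β K H : ℝ} {f : ℝ → ES n → ℝ}

lemma sqinv_cont : ContinuousOn (fun p : ℝ × ℝ × ES n => -(Real.sqrt (2 * p.1))⁻¹) {p | 0 < p.1} := by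
  refine ContinuousOn.neg (ContinuousOn.inv₀ (by fun_prop) ?_)
  intro p hp
  exact (sq2_pos hp).ne'

lemma J_cont' {F : Type*} [NormedAddCommGroup F] [NormedSpace ℝ F] {k : ES n → F} (hk : Kd k) (hf : HB β K H f) :
    Continuous (fun p : ℝ × ℝ × ES n => J k p.1 (f p.2.1) p.2.2) :=
  J_cont hk (by fun_prop) (by fun_prop) (by fun_prop) hf.cont hf.bd

lemma h0_sg (hf : HB β K H f) : Sg (h0 f) (K * cM n) 1 where
  cont := (J_cont' ker01.kd hf).continuousOn
  bd := fun τ hτ s x => by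
    rw [sub_self, Real.rpow_zero, mul_one]; exact P0_le (hf.bd s) τ x
  pos := one_pos
  C0 := mul_nonneg hf.K0 (cM_pos n).le

lemma h1_sg (hf : HB β K H f) : Sg (h1 f) (cM n * K) (1/2) where
  cont := sqinv_cont.smul (J_cont' ker01.kd' hf).continuousOn
  bd := fun τ hτ s x => by
    have h := P1_le (τ := τ) (x := x) (c := 0) (L := K) (hf.slice s) (hf.bd s) hτ ?_
    · refine h.trans (le_of_eq ?_); norm_num
    · intro z
      have := hf.bd s (x + Real.sqrt (2*τ) • z)
      have := hf.K0; have := norm_nonneg z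
      rw [sub_zero]; rw [Real.norm_eq_abs] at *; nlinarith
  pos := by norm_num
  C0 := mul_nonneg (cM_pos n).le hf.K0

lemma rpow_combine {τ : ℝ} (hτ : 0 < τ) (c L a b : ℝ) :
    c * (L * τ ^ a) * τ ^ b = c * L * τ ^ (a + b) := by
  rw [Real.rpow_add hτ]; ring

lemma HB.H0 (hf : HB β K H f) (hn : 0 < n) : 0 ≤ H := by
  have := (norm_nonneg _).trans (hf.hol 0 (ee ⟨0, hn⟩) 0)
  rw [sub_zero, norm_ee] at this
  simpa using this

lemma h2_sg (hβ : 0 < β) (hβ1 : β ≤ 1) (hH : 0 ≤ H) (hf : HB β K H f) : Sg (h2 f) (cM n * (2 * H)) (β/2) where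
  cont := by
    have := (sqinv_cont (n := n)).smul (sqinv_cont.smul (J_cont' ker12.kd' hf).continuousOn)
    exact this
  bd := fun τ hτ s x => by
    have h := P2_le (τ := τ) (x := x) (c := f s x) (L := 2 * H * τ ^ (β/2)) (hf.slice s) (hf.bd s) hτ ?_
    · refine h.trans (le_of_eq ?_)
      rw [rpow_combine hτ]; congr 1
    · intro z
      refine (hf.hol s _ _).trans ?_
      rw [add_sub_cancel_left]
      calc _ ≤ H * (2 * τ ^ (β/2) * (1 + ‖z‖)) := mul_le_mul_of_nonneg_left (inc_le hβ hβ1 hτ.le z) hH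
        _ = _ := by ring
  pos := by positivity
  C0 := mul_nonneg (cM_pos n).le (by positivity)

lemma Du0_fderiv (hf : HB β K H f) (t : ℝ) (x : ES n) :
    HasFDerivAt (Du (h0 f) t) (Du (h1 f) t x) x :=
  (h0_sg hf).Du_fderiv (h1_sg hf) (fun τ hτ s x => P0_deriv (hf.slice s) (hf.bd s) hτ x) t x

lemma Du1_fderiv (hβ : 0 < β) (hβ1 : β ≤ 1) (hH : 0 ≤ H) (hf : HB β K H f) (t : ℝ) (x : ES n) :
    HasFDerivAt (Du (h1 f) t) (Du (h2 f) t x) x :=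
  (h1_sg hf).Du_fderiv (h2_sg hβ hβ1 hH hf) (fun τ hτ s x => P1_deriv (hf.slice s) (hf.bd s) hτ x) t x

lemma Du0_time (hβ : 0 < β) (hβ1 : β ≤ 1) (hH : 0 ≤ H) (hf : HB β K H f) {t : ℝ} (ht : 0 < t) (x : ES n) :
    HasDerivAt (fun s => Du (h0 f) s x) (Lop 1 (Du (h2 f) t x) + f t x) t := by
  have s2 := h2_sg hβ hβ1 hH hf
  have h3 : Sg (fun τ s x => Lop 1 (h2 f τ s x)) (‖LopL (1 : ES n →L[ℝ] ES n)‖ * (cM n * (2 * H))) (β/2) := by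
    refine ⟨?_, ?_, s2.pos, mul_nonneg (norm_nonneg _) s2.C0⟩
    · exact (LopL 1).continuous.comp_continuousOn s2.cont
    · intro τ hτ s x
      rw [mul_assoc]
      exact ((LopL 1).le_opNorm _).trans (mul_le_mul_of_nonneg_left (s2.bd τ hτ s x) (norm_nonneg _))
  have e0 : ∀ s, h0 f 0 s x = f s x := fun s => P0_zero _ _
  have := Du_time (h0_sg hf) h3 x (fun τ hτ s => P0_time (hf.slice s) (hf.bd s) hτ x) ?_ ?_ ht
  · refine this.congr_deriv ?_
    rw [e0, add_comm]
    congr 1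
    unfold Du
    rw [← LopL_apply, ← ContinuousLinearMap.intervalIntegral_comp_comm _ (s2.Du_int t x)]
    simp only [map_smul, LopL_apply]
  · intro s
    exact ((J_cont' ker01.kd hf).comp (f := fun τ : ℝ => (τ, s, x)) (by fun_prop)).continuousOn
  · simp only [e0]
    exact hf.cont.comp (f := fun s : ℝ => (s, x)) (by fun_prop)

/-- exponential weights -/
lemma Du_exp {φ : ℝ → ℝ → ES n → G} {C γ lam t : ℝ} (hγ : 0 < γ) (hl : 0 < lam) (hC : 0 ≤ C) (ht : 0 < t) {x : ES n}
    (h : ∀ τ ∈ Ioo 0 t, ‖φ τ (t - τ) x‖ ≤ C * τ ^ (γ - 1) * Real.exp (-(lam * τ))) :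
    ‖Du φ t x‖ ≤ C * ((1/lam) ^ γ * Real.Gamma γ) := by
  have hi : IntegrableOn (fun τ => τ ^ (γ - 1) * Real.exp (-(lam * τ))) (Ioi 0) := by
    by_contra hcon
    have := Real.integral_rpow_mul_exp_neg_mul_Ioi hγ hl
    rw [integral_undef hcon] at this
    have h1 := Real.Gamma_pos_of_pos hγ
    have : 0 < (1/lam) ^ γ * Real.Gamma γ := by positivity
    linarith
  rw [Du_eq φ ht, intervalIntegral.integral_of_le ht.le, integral_Ioc_eq_integral_Ioo]
  have hi2 : IntegrableOn (fun τ => C * τ ^ (γ - 1) * Real.exp (-(lam * τ))) (Ioi 0) := by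
    have := hi.const_mul C
    simp only [← mul_assoc] at this
    exact this
  calc _ ≤ ∫ τ in Ioo 0 t, C * τ ^ (γ - 1) * Real.exp (-(lam * τ)) := by
        refine norm_integral_le_of_norm_le (hi2.mono_set Ioo_subset_Ioi_self) ?_
        exact (ae_restrict_iff' measurableSet_Ioo).2 (Eventually.of_forall h)
    _ ≤ ∫ τ in Ioi 0, C * τ ^ (γ - 1) * Real.exp (-(lam * τ)) := by
        refine setIntegral_mono_set hi2 ?_ Ioo_subset_Ioi_self.eventuallyLE
        refine (ae_restrict_iff' measurableSet_Ioi).2 (Eventually.of_forall fun τ hτ => ?_)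
        have : 0 < τ := hτ
        simp only [Pi.zero_apply]
        positivity
    _ = _ := by
        rw [← Real.integral_rpow_mul_exp_neg_mul_Ioi hγ hl, ← integral_const_mul]
        simp only [mul_assoc]

/-- Hölder estimate for the second derivative of Duhamel integrals -/
lemma Du2_holder (hβ : 0 < β) (hβ1 : β < 1) (hH : 0 ≤ H) (hf : HB β K H f) {t : ℝ} (ht : 0 < t)
    {y0 y1 : ES n} {r L1 L2 : ℝ} (hr : 0 < r) (hy : ‖y0 - y1‖ ≤ r) (hL1 : 0 ≤ L1) (hL2 : 0 ≤ L2)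
    (near0 : ∀ τ ∈ Ioo 0 t, τ ≤ r^2 → ∀ z, |f (t - τ) (y0 + Real.sqrt (2*τ) • z) - f (t - τ) y0| ≤ L1 * τ ^ (β/2) * (1 + ‖z‖))
    (near1 : ∀ τ ∈ Ioo 0 t, τ ≤ r^2 → ∀ z, |f (t - τ) (y1 + Real.sqrt (2*τ) • z) - f (t - τ) y1| ≤ L1 * τ ^ (β/2) * (1 + ‖z‖))
    (far : ∀ τ ∈ Ioo 0 t, r^2 < τ → ∃ c, ∀ y ∈ segment ℝ y0 y1, ∀ z, |f (t - τ) (y + Real.sqrt (2*τ) • z) - c| ≤ L2 * τ ^ (β/2) * (1 + ‖z‖)) :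
    ‖Du (h2 f) t y0 - Du (h2 f) t y1‖ ≤ cM n * (4/β + 2/(1-β)) * (L1 + L2) * r ^ β := by
  have s2 := h2_sg hβ hβ1.le hH hf
  have hc := cM_pos n
  have hr2 : 0 < r^2 := by positivity
  rw [Du_eq _ ht, Du_eq _ ht, ← intervalIntegral.integral_sub (s2.int' ht _) (s2.int' ht _),
    intervalIntegral.integral_of_le ht.le, integral_Ioc_eq_integral_Ioo]
  set B1 : ℝ → ℝ := fun τ => 2 * (cM n * L1) * τ ^ (β/2 - 1) with hB1
  set B2 : ℝ → ℝ := fun τ => r * (cM n * L2) * τ ^ (β/2 - 3/2) with hB2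
  have i1 : IntegrableOn B1 (Ioc 0 (r^2)) := by
    have : IntervalIntegrable B1 volume 0 (r^2) :=
      (intervalIntegral.intervalIntegrable_rpow' (by linarith)).const_mul _
    rwa [intervalIntegrable_iff_integrableOn_Ioc_of_le hr2.le] at this
  have i2 : IntegrableOn B2 (Ioi (r^2)) :=
    (integrableOn_Ioi_rpow_of_lt (by linarith) hr2).const_mul _
  set B : ℝ → ℝ := fun τ => if τ ≤ r^2 then B1 τ else B2 τ with hB
  have j1 : IntegrableOn B (Ioc 0 (r^2)) :=
    i1.congr_fun (fun τ hτ => by simp [hB, hτ.2]) measurableSet_Ioc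
  have j2 : IntegrableOn B (Ioi (r^2)) :=
    i2.congr_fun (fun τ hτ => by simp [hB, not_le.2 (mem_Ioi.1 hτ)]) measurableSet_Ioi
  have hun : Ioc 0 (r^2) ∪ Ioi (r^2) = Ioi 0 := Ioc_union_Ioi_eq_Ioi hr2.le
  have j : IntegrableOn B (Ioi 0) := hun ▸ j1.union j2
  calc _ ≤ ∫ τ in Ioo 0 t, B τ := by
        refine norm_integral_le_of_norm_le (j.mono_set Ioo_subset_Ioi_self) ?_
        refine (ae_restrict_iff' measurableSet_Ioo).2 (Eventually.of_forall fun τ hτ => ?_)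
        have hτ0 : 0 < τ := hτ.1
        by_cases hle : τ ≤ r^2
        · simp only [hB, hle, if_true, hB1]
          have a0 := P2_le (hf.slice _) (hf.bd _) hτ.1 (near0 τ hτ hle)
          have a1 := P2_le (hf.slice _) (hf.bd _) hτ.1 (near1 τ hτ hle)
          rw [rpow_combine hτ0] at a0 a1
          refine (norm_sub_le _ _).trans ?_
          have e : β / 2 + -1 = β/2 - 1 := by ring
          rw [e] at a0 a1
          have : ‖h2 f τ (t - τ) y0‖ + ‖h2 f τ (t - τ) y1‖ ≤ _ := add_le_add a0 a1
          linarith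
        · simp only [hB, hle, if_false, hB2]
          obtain ⟨c, hcc⟩ := far τ hτ (not_le.1 hle)
          have b : ∀ y ∈ segment ℝ y0 y1, ‖P3 τ (f (t - τ)) y‖ ≤ cM n * L2 * τ ^ (β/2 - 3/2) := by
            intro y hy
            have a0 := P3_le (hf.slice _) (hf.bd _) hτ.1 (hcc y hy)
            rw [rpow_combine hτ0] at a0
            convert a0 using 3; ring
          have m := (convex_segment y0 y1).norm_image_sub_le_of_norm_hasFDerivWithin_le
            (f := P2 τ (f (t - τ))) (f' := P3 τ (f (t - τ)))
            (fun y _ => (P2_deriv (hf.slice _) (hf.bd _) hτ.1 y).hasFDerivWithinAt) b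
            (right_mem_segment ℝ y0 y1) (left_mem_segment ℝ y0 y1)
          refine m.trans ?_
          calc _ ≤ cM n * L2 * τ ^ (β/2 - 3/2) * r := mul_le_mul_of_nonneg_left hy (by positivity)
            _ = _ := by ring
    _ ≤ ∫ τ in Ioi 0, B τ := by
        refine setIntegral_mono_set j ?_ Ioo_subset_Ioi_self.eventuallyLE
        refine (ae_restrict_iff' measurableSet_Ioi).2 (Eventually.of_forall fun τ hτ => ?_)
        have : 0 < τ := hτ
        simp only [Pi.zero_apply, hB]
        split_ifs
        · simp only [hB1]; positivity
        · simp only [hB2]; positivity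
    _ = (∫ τ in Ioc 0 (r^2), B1 τ) + ∫ τ in Ioi (r^2), B2 τ := by
        rw [← hun, setIntegral_union (by
          rw [Set.disjoint_left]; intro a ha hb; exact absurd ha.2 (not_le.2 hb)) measurableSet_Ioi j1 j2]
        congr 1
        · exact setIntegral_congr_fun measurableSet_Ioc (fun τ hτ => by simp [hB, hτ.2])
        · exact setIntegral_congr_fun measurableSet_Ioi (fun τ hτ => by simp [hB, not_le.2 (mem_Ioi.1 hτ)])
    _ = 2 * (cM n * L1) * (r ^ β / (β/2)) + r * (cM n * L2) * (r ^ (β - 1) * (2/(1-β))) := by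
        simp only [hB1, hB2]
        rw [integral_const_mul, integral_const_mul, ← intervalIntegral.integral_of_le hr2.le,
          integral_rpow (Or.inl (by linarith)), integral_Ioi_rpow_of_lt (by linarith) hr2]
        have e1 : ∀ a : ℝ, (r^2) ^ a = r ^ (2*a) := by
          intro a
          rw [← Real.rpow_natCast, ← Real.rpow_mul hr.le]; norm_num
        rw [e1, e1]
        have e3 : β / 2 - 1 + 1 ≠ 0 := by linarith
        rw [Real.zero_rpow e3]
        have e4 : 1 - β ≠ 0 := by linarith
        have e5 : β / 2 - 3/2 + 1 = -((1-β)/2) := by ring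
        have e6 : 2 * (β / 2 - 1 + 1) = β := by ring
        have e7 : 2 * (-((1-β)/2)) = β - 1 := by ring
        rw [e6, e5, e7]
        have e8 : β / 2 - 1 + 1 = β/2 := by ring
        rw [e8]
        congr 1
        · ring
        · congr 1
          field_simp
    _ ≤ _ := by
        have e : r * r ^ (β - 1) = r ^ β := by
          rw [← Real.rpow_one_add' hr.le (by simpa using hβ.ne')]; ring_nf
        have : r * (cM n * L2) * (r ^ (β - 1) * (2/(1-β))) = cM n * L2 * (2/(1-β)) * r ^ β := by
          rw [← e]; ring
        rw [this]
        have hb : 0 < 1 - β := by linarith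
        have e2 : 2 * (cM n * L1) * (r ^ β / (β/2)) = cM n * L1 * (4/β) * r^β := by
          field_simp; ring
        rw [e2]
        have p1 : 0 ≤ cM n * L1 * (2/(1-β)) * r ^ β := by positivity
        have p2 : 0 ≤ cM n * L2 * (4/β) * r ^ β := by positivity
        nlinarith
end
end QP

namespace QP
open MeasureTheory Filter Topology Metric
variable {n : ℕ}

/-- regularity class -/
structure Reg (T β : ℝ) (u : ℝ → ES n → ℝ) (p : ℝ → ES n → (ES n →L[ℝ] ℝ)) (q : ℝ → ES n → Bil n) : Prop where
  cu : Continuous (Function.uncurry u)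
  cp : Continuous (Function.uncurry p)
  cq : Continuous (Function.uncurry q)
  du : ∀ t x, HasFDerivAt (u t) (p t x) x
  dp : ∀ t x, HasFDerivAt (p t) (q t x) x
  zero : ∀ t ≤ 0, ∀ x, u t x = 0
  halt : ∀ t, T ≤ t → u t = u T
  bd : ∃ K, ∀ t x, |u t x| ≤ K ∧ ‖p t x‖ ≤ K ∧ ‖q t x‖ ≤ K
  hol : ∃ H, 0 ≤ H ∧ ∀ t x y, ‖q t x - q t y‖ ≤ H * ‖x - y‖ ^ β

/-- the linear equation -/
def Pde (T : ℝ) (S : ℝ → ES n → (ES n →L[ℝ] ES n)) (b : ℝ → ES n → ES n) (f : ℝ → ES n → ℝ)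
    (u : ℝ → ES n → ℝ) (p : ℝ → ES n → (ES n →L[ℝ] ℝ)) (q : ℝ → ES n → Bil n) : Prop :=
  ∀ t ∈ Ioo 0 T, ∀ x, HasDerivAt (fun s => u s x) (Lop (S t x) (q t x) + p t x (b t x) + f t x) t

/-- coefficients -/
structure Coef (ν Λ β Q : ℝ) (S : ℝ → ES n → (ES n →L[ℝ] ES n)) (b : ℝ → ES n → ES n) : Prop where
  cS : Continuous (Function.uncurry S)
  cb : Continuous (Function.uncurry b)
  ell : ∀ t x, Ell ν Λ (S t x)
  bb : ∀ t x, ‖b t x‖ ≤ Q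
  hS : ∀ t x s y, ‖S t x - S s y‖ ≤ Q * (‖x - y‖ ^ β + |t - s| ^ (β/2))
  hb : ∀ t x y, ‖b t x - b t y‖ ≤ Q * ‖x - y‖ ^ β

section
variable {T β : ℝ} {u : ℝ → ES n → ℝ} {p : ℝ → ES n → (ES n →L[ℝ] ℝ)} {q : ℝ → ES n → Bil n}

lemma Reg.pzero (h : Reg T β u p q) {t : ℝ} (ht : t ≤ 0) (x : ES n) : p t x = 0 := by
  have : u t = fun _ => 0 := funext fun x => h.zero t ht x
  have h1 := h.du t x
  rw [this] at h1
  exact h1.unique (hasFDerivAt_const _ _)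

lemma Reg.qzero (h : Reg T β u p q) {t : ℝ} (ht : t ≤ 0) (x : ES n) : q t x = 0 := by
  have : p t = fun _ => 0 := funext fun x => h.pzero ht x
  have h1 := h.dp t x
  rw [this] at h1
  exact h1.unique (hasFDerivAt_const _ _)

lemma Reg.phalt (h : Reg T β u p q) {t : ℝ} (ht : T ≤ t) : p t = p T := by
  ext1 x
  have h1 := h.du t x
  rw [h.halt t ht] at h1
  exact h1.unique (h.du T x)

lemma Reg.qhalt (h : Reg T β u p q) {t : ℝ} (ht : T ≤ t) : q t = q T := by
  ext1 x
  have h1 := h.dp t x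
  rw [h.phalt ht] at h1
  exact h1.unique (h.dp T x)

lemma Reg.ext_p {p' q'} (h : Reg T β u p q) (h' : Reg T β u p' q') : p = p' ∧ q = q' := by
  have e : p = p' := by
    ext1 t; ext1 x; exact (h.du t x).unique (h'.du t x)
  subst e
  exact ⟨rfl, by ext1 t; ext1 x; exact (h.dp t x).unique (h'.dp t x)⟩

/-- one sided sup bound -/
lemma sup_le {ν Λ Q K : ℝ} (hν : 0 ≤ ν) (hT : 0 < T) {S b f} (hK : ∀ t x, |f t x| ≤ K)
    (ell : ∀ t x, Ell ν Λ (S t x)) (bb : ∀ t x, ‖b t x‖ ≤ Q)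
    (h : Reg T β u p q) (hp : Pde T S b f u p q) : ∀ t x, |u t x| ≤ K * max t 0 := by
  have hK0 : 0 ≤ K := (abs_nonneg _).trans (hK 0 0)
  obtain ⟨K1, hK1⟩ := h.bd
  have one : ∀ σ : ℝ, |σ| = 1 → ∀ t ∈ Icc 0 T, ∀ x, σ * u t x - K * t ≤ 0 := by
    intro σ hσ
    refine wmp (Λ := Λ) (B := Q) (K := K1) ?_ ?_ ?_ ?_
    · have := h.cu
      have : Continuous fun a : ℝ × ES n => u a.1 a.2 := this
      exact (by fun_prop : Continuous fun a : ℝ × ES n => σ * u a.1 a.2 - K * a.1).continuousOn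
    · intro t ht x
      have h1 := (hK1 t x).1
      have : σ * u t x ≤ |u t x| := by
        refine (le_abs_self _).trans ?_
        rw [abs_mul, hσ, one_mul]
      have : 0 ≤ K * t := mul_nonneg hK0 ht.1
      linarith
    · intro x; simp [h.zero 0 le_rfl x]
    · intro t ht x _
      have d1 : DD u t x (p t) (q t x) _ := ⟨h.du t, h.dp t x, hp t ht x⟩
      have d2 := (d1.const_mul σ).sub (DD.time x ((hasDerivAt_id t).const_mul K))
      refine ⟨_, _, _, S t x, b t x, d2, (ell t x).mono hν le_rfl, bb t x, ?_⟩
      simp only [sub_zero, Lop_smul, _root_.smul_apply, smul_eq_mul, mul_one]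
      have : σ * f t x ≤ K := by
        refine (le_abs_self _).trans ?_
        rw [abs_mul, hσ, one_mul]; exact hK t x
      nlinarith
  have main : ∀ t ∈ Icc 0 T, ∀ x, |u t x| ≤ K * t := by
    intro t ht x
    have a := one 1 (by simp) t ht x
    have b := one (-1) (by simp) t ht x
    rw [abs_le]; constructor <;> linarith
  intro t x
  rcases le_or_gt t 0 with h0 | h0
  · rw [h.zero t h0, max_eq_right h0]; simp
  rw [max_eq_left h0.le]
  rcases le_or_gt t T with h1 | h1
  · exact main t ⟨h0.le, h1⟩ x
  · rw [h.halt t h1.le]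
    exact (main T ⟨hT.le, le_rfl⟩ x).trans (mul_le_mul_of_nonneg_left h1.le hK0)

lemma Reg.sub {u' p' q'} (h : Reg T β u p q) (h' : Reg T β u' p' q') :
    Reg T β (fun t x => u t x - u' t x) (fun t x => p t x - p' t x) (fun t x => q t x - q' t x) := by
  obtain ⟨K, hK⟩ := h.bd
  obtain ⟨K', hK'⟩ := h'.bd
  obtain ⟨H, h0, hH⟩ := h.hol
  obtain ⟨H', h0', hH'⟩ := h'.hol
  refine ⟨h.cu.sub h'.cu, h.cp.sub h'.cp, h.cq.sub h'.cq, fun t x => (h.du t x).sub (h'.du t x),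
    fun t x => (h.dp t x).sub (h'.dp t x), fun t ht x => by rw [h.zero t ht, h'.zero t ht, sub_zero],
    fun t ht => by simp only [h.halt t ht, h'.halt t ht], ⟨K + K', fun t x => ?_⟩, ⟨H + H', by positivity, fun t x y => ?_⟩⟩
  · exact ⟨(abs_sub _ _).trans (add_le_add (hK t x).1 (hK' t x).1),
      (norm_sub_le _ _).trans (add_le_add (hK t x).2.1 (hK' t x).2.1),
      (norm_sub_le _ _).trans (add_le_add (hK t x).2.2 (hK' t x).2.2)⟩
  · rw [sub_sub_sub_comm, add_mul]
    exact (norm_sub_le _ _).trans (add_le_add (hH t x y) (hH' t x y))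

lemma Pde.sub {S b f f' u' p' q'} (h : Pde T S b f u p q) (h' : Pde T S b f' u' p' q') :
    Pde T S b (fun t x => f t x - f' t x) (fun t x => u t x - u' t x) (fun t x => p t x - p' t x) (fun t x => q t x - q' t x) := by
  intro t ht x
  refine ((h t ht x).sub (h' t ht x)).congr_deriv ?_
  rw [Lop_sub, _root_.sub_apply]; ring

lemma lin_unique {ν Λ Q : ℝ} (hν : 0 ≤ ν) (hT : 0 < T) {S b f u' p' q'} 
    (ell : ∀ t x, Ell ν Λ (S t x)) (bb : ∀ t x, ‖b t x‖ ≤ Q)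
    (h : Reg T β u p q) (hp : Pde T S b f u p q) (h' : Reg T β u' p' q') (hp' : Pde T S b f u' p' q') :
    u = u' ∧ p = p' ∧ q = q' := by
  have := sup_le (K := 0) hν hT (by simp) ell bb (h.sub h') (hp.sub hp')
  have e : u = u' := by
    ext t x
    have h1 := this t x
    rw [zero_mul] at h1
    have := abs_nonpos_iff.1 h1
    linarith
  subst e
  exact ⟨rfl, h.ext_p h'⟩

/-- the heat equation -/
lemma heat_sol {K H : ℝ} (hT : 0 < T) (hβ : 0 < β) (hβ1 : β < 1) (hH : 0 ≤ H) {f : ℝ → ES n → ℝ} (hf : HB β K H f) :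
    Reg T β (fun t x => Du (h0 f) (min t T) x) (fun t x => Du (h1 f) (min t T) x) (fun t x => Du (h2 f) (min t T) x) ∧
    Pde T (fun _ _ => 1) (fun _ _ => 0) f (fun t x => Du (h0 f) (min t T) x) (fun t x => Du (h1 f) (min t T) x) (fun t x => Du (h2 f) (min t T) x) := by
  have s0 := h0_sg hf
  have s1 := h1_sg hf
  have s2 := h2_sg hβ hβ1.le hH hf
  have hmc : Continuous fun a : ℝ × ES n => (min a.1 T, a.2) := by fun_prop
  have hTT : ∀ t : ℝ, max (min t T) 0 ≤ T := fun t => max_le (min_le_right _ _) hT.le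
  have aux : ∀ {G : Type} [NormedAddCommGroup G] [NormedSpace ℝ G] {φ : ℝ → ℝ → ES n → G} {C γ : ℝ} (h : Sg φ C γ) (t : ℝ) (x : ES n),
      ‖Du φ (min t T) x‖ ≤ C * T ^ γ / γ := by
    intro G _ _ φ C γ h t x
    refine (h.Du_le _ _).trans ?_
    have := h.C0
    have := h.pos
    have := Real.rpow_le_rpow (le_max_right _ _) (hTT t) h.pos.le
    gcongr
  refine ⟨⟨s0.Du_cont.comp hmc, s1.Du_cont.comp hmc, s2.Du_cont.comp hmc, fun t x => Du0_fderiv hf _ x,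
    fun t x => Du1_fderiv hβ hβ1.le hH hf _ x, fun t ht x => Du_zero _ ((min_le_left _ _).trans ht) x,
    fun t ht => by simp [min_eq_right ht], ?_, ?_⟩, ?_⟩
  · refine ⟨max (K * cM n * T ^ (1:ℝ) / 1) (max (cM n * K * T ^ (1/2:ℝ) / (1/2)) (cM n * (2*H) * T ^ (β/2) / (β/2))), fun t x => ?_⟩
    exact ⟨(aux s0 t x).trans (le_max_left _ _), (aux s1 t x).trans ((le_max_left _ _).trans (le_max_right _ _)),
      (aux s2 t x).trans ((le_max_right _ _).trans (le_max_right _ _))⟩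
  · have hc := cM_pos n
    have hb : 0 < 1 - β := by linarith
    refine ⟨cM n * (4/β + 2/(1-β)) * (2*H + 4*H), by positivity, fun t x y => ?_⟩
    rcases le_or_gt (min t T) 0 with h0 | h0
    · simp only [Du_zero _ h0, sub_zero, norm_zero]; positivity
    rcases eq_or_ne x y with rfl | hxy
    · simp [Real.zero_rpow hβ.ne']
    have hr : 0 < ‖x - y‖ := norm_pos_iff.2 (sub_ne_zero.2 hxy)
    have inc : ∀ s τ, 0 < τ → ∀ y z : ES n, |f s (y + Real.sqrt (2*τ) • z) - f s y| ≤ 2 * H * τ ^ (β/2) * (1 + ‖z‖) := by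
      intro s τ hτ y z
      refine (hf.hol s _ _).trans ?_
      rw [add_sub_cancel_left]
      calc _ ≤ H * (2 * τ ^ (β/2) * (1 + ‖z‖)) := mul_le_mul_of_nonneg_left (inc_le hβ hβ1.le hτ.le z) hH
        _ = _ := by ring
    refine Du2_holder hβ hβ1 hH hf h0 hr le_rfl (by positivity) (by positivity) 
      (fun τ hτ _ z => inc _ τ hτ.1 _ z) (fun τ hτ _ z => inc _ τ hτ.1 _ z) (fun τ hτ hr2 => ?_)
    refine ⟨f (min t T - τ) x, fun w hw z => ?_⟩
    have d : ‖w - x‖ ≤ ‖x - y‖ := by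
      have := norm_sub_le_of_mem_segment hw
      rwa [norm_sub_rev x y]
    have h5 : ‖w - x‖ ^ β ≤ τ ^ (β/2) := by
      calc _ ≤ ‖x - y‖ ^ β := Real.rpow_le_rpow (norm_nonneg _) d hβ.le
        _ = (‖x-y‖^2) ^ (β/2) := by
          rw [← Real.rpow_natCast, ← Real.rpow_mul hr.le]; congr 1; push_cast; ring
        _ ≤ _ := Real.rpow_le_rpow (by positivity) hr2.le (by positivity)
    have h6 := inc (min t T - τ) τ hτ.1 w z
    have h7 := hf.hol (min t T - τ) w x
    have h8 : H * ‖w - x‖ ^ β ≤ H * τ ^ (β/2) := mul_le_mul_of_nonneg_left h5 hH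
    have hτ0 := hτ.1
    have h9 : 0 ≤ H * τ ^ (β/2) := by positivity
    have h10 : 0 ≤ H * τ ^ (β/2) * ‖z‖ := by positivity
    rw [Real.norm_eq_abs] at h7
    calc _ ≤ |f (min t T - τ) (w + Real.sqrt (2*τ) • z) - f (min t T - τ) w| + |f (min t T - τ) w - f (min t T - τ) x| := abs_sub_le _ _ _
      _ ≤ _ := by nlinarith
  · intro t ht x
    have hd := Du0_time hβ hβ1.le hH hf ht.1 x
    show HasDerivAt (fun s => Du (QP.h0 f) (min s T) x) (Lop 1 (Du (QP.h2 f) (min t T) x) + Du (QP.h1 f) (min t T) x 0 + f t x) t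
    rw [min_eq_left ht.2.le, map_zero, add_zero]
    refine hd.congr_of_eventuallyEq ?_
    filter_upwards [Iio_mem_nhds ht.2] with s hs
    rw [min_eq_left (le_of_lt hs)]
end

/-- absorption -/
lemma absorb {ι : Type*} {a w : ι → ℝ} {C : ℝ} (h0 : ∃ H, ∀ i, a i ≤ H * w i)
    (h : ∀ H, 0 ≤ H → (∀ i, a i ≤ H * w i) → ∀ i, a i ≤ (H / 2 + C) * w i) (hC : 0 ≤ C) (hw : ∀ i, 0 ≤ w i) :
    ∀ i, a i ≤ 2 * C * w i := by
  obtain ⟨H, hH⟩ := h0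
  have hH' : ∀ i, a i ≤ |H| * w i := fun i => (hH i).trans (mul_le_mul_of_nonneg_right (le_abs_self H) (hw i))
  have key : ∀ k : ℕ, ∀ i, a i ≤ (|H| * (1/2)^k + 2 * C) * w i := by
    intro k
    induction k with
    | zero => intro i; have := hH' i; have := hw i; simp; nlinarith
    | succ k ih =>
      intro i
      refine (h _ (by positivity) ih i).trans (le_of_eq ?_)
      rw [pow_succ]; ring
  intro i
  have ht : Tendsto (fun k : ℕ => (|H| * (1/2:ℝ)^k + 2 * C) * w i) atTop (𝓝 ((|H| * 0 + 2 * C) * w i)) := by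
    refine Tendsto.mul_const _ (Tendsto.add_const _ (Tendsto.const_mul _ ?_))
    exact tendsto_pow_atTop_nhds_zero_of_lt_one (by norm_num) (by norm_num)
  have := ge_of_tendsto' ht (fun k => key k i)
  simpa using this
end QP

namespace QP
open MeasureTheory Filter Topology Metric
variable {n : ℕ}

def dg (c : Fin n → ℝ) : ES n →L[ℝ] ES n :=
  LinearMap.toContinuousLinearMap
    { toFun := fun y => WithLp.toLp 2 (fun k => c k * y k)
      map_add' := fun x y => by ext k; simp [mul_add]
      map_smul' := fun r y => by ext k; simp [mul_left_comm] }

lemma dg_apply (c : Fin n → ℝ) (y : ES n) (k : Fin n) : dg c y k = c k * y k := rfl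

lemma dg_norm {c : Fin n → ℝ} {C : ℝ} (hC : 0 ≤ C) (h : ∀ k, |c k| ≤ C) (y : ES n) : ‖dg c y‖ ≤ C * ‖y‖ := by
  rw [EuclideanSpace.norm_eq, EuclideanSpace.norm_eq]
  conv_rhs => rw [← Real.sqrt_sq hC, ← Real.sqrt_mul (sq_nonneg C), Finset.mul_sum]
  refine Real.sqrt_le_sqrt (Finset.sum_le_sum fun k _ => ?_)
  rw [dg_apply, norm_mul, mul_pow, Real.norm_eq_abs]
  have := pow_le_pow_left₀ (abs_nonneg _) (h k) 2
  gcongr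

def cE (ν Λ : ℝ) : ℝ := 1 + Real.sqrt Λ + (Real.sqrt ν)⁻¹

lemma cE_ge (ν Λ : ℝ) : 1 ≤ cE ν Λ := by
  have := Real.sqrt_nonneg Λ
  have : 0 ≤ (Real.sqrt ν)⁻¹ := by positivity
  unfold cE; linarith

/-- factorization of an elliptic operator -/
lemma factorM {ν Λ : ℝ} {A : ES n →L[ℝ] ES n} (hν : 0 < ν) (h : Ell ν Λ A) :
    ∃ M N : ES n →L[ℝ] ES n, (∀ y, N (M y) = y) ∧ (∀ y, M (N y) = y) ∧ ‖M‖ ≤ cE ν Λ ∧ ‖N‖ ≤ cE ν Λ ∧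
      ∀ q : Bil n, Lop A q = Lop 1 (q.bilinearComp M M) := by
  obtain ⟨v, l, hl, hL⟩ := h.factor hν.le
  have hl0 : ∀ k, 0 < l k := fun k => hν.trans_le (hl k).1
  let R : ES n ≃ₗᵢ[ℝ] ES n := v.repr
  have c0 : (0:ℝ) ≤ cE ν Λ := zero_le_one.trans (cE_ge _ _)
  have i1 : ∀ k, |Real.sqrt (l k)| ≤ cE ν Λ := by
    intro k
    rw [abs_of_nonneg (Real.sqrt_nonneg _)]
    have := Real.sqrt_le_sqrt (hl k).2
    have : 0 ≤ (Real.sqrt ν)⁻¹ := by positivity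
    unfold cE; linarith
  have i2 : ∀ k, |(Real.sqrt (l k))⁻¹| ≤ cE ν Λ := by
    intro k
    rw [abs_of_nonneg (by positivity)]
    have h1 := Real.sqrt_le_sqrt (hl k).1
    have : (Real.sqrt (l k))⁻¹ ≤ (Real.sqrt ν)⁻¹ := inv_anti₀ (Real.sqrt_pos.2 hν) h1
    have := Real.sqrt_nonneg Λ
    unfold cE; linarith
  let M : ES n →L[ℝ] ES n := (R.symm.toContinuousLinearEquiv : ES n →L[ℝ] ES n).comp (dg fun k => Real.sqrt (l k))
  let N : ES n →L[ℝ] ES n := (dg fun k => (Real.sqrt (l k))⁻¹).comp (R.toContinuousLinearEquiv : ES n →L[ℝ] ES n)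
  have hM : ∀ y, M y = R.symm (dg (fun k => Real.sqrt (l k)) y) := fun y => rfl
  have hN : ∀ y, N y = dg (fun k => (Real.sqrt (l k))⁻¹) (R y) := fun y => rfl
  refine ⟨M, N, fun y => ?_, fun y => ?_, ?_, ?_, fun q => ?_⟩
  · rw [hN, hM, R.apply_symm_apply]
    ext k
    rw [dg_apply, dg_apply, ← mul_assoc, inv_mul_cancel₀ (Real.sqrt_pos.2 (hl0 k)).ne', one_mul]
  · rw [hN, hM]
    have : dg (fun k => Real.sqrt (l k)) (dg (fun k => (Real.sqrt (l k))⁻¹) (R y)) = R y := by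
      ext k
      rw [dg_apply, dg_apply, ← mul_assoc, mul_inv_cancel₀ (Real.sqrt_pos.2 (hl0 k)).ne', one_mul]
    rw [this, R.symm_apply_apply]
  · refine ContinuousLinearMap.opNorm_le_bound _ c0 fun y => ?_
    rw [hM, R.symm.norm_map]; exact dg_norm c0 i1 y
  · refine ContinuousLinearMap.opNorm_le_bound _ c0 fun y => ?_
    rw [hN]
    exact (dg_norm c0 i2 _).trans (by rw [R.norm_map])
  · rw [hL]
    unfold Lop
    refine Finset.sum_congr rfl fun k _ => ?_
    have e : M (ee k) = Real.sqrt (l k) • v k := by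
      rw [hM]
      have : dg (fun k => Real.sqrt (l k)) (ee k) = Real.sqrt (l k) • (ee k : ES n) := by
        ext j
        rw [dg_apply]
        by_cases hj : j = k
        · subst hj; simp [ee]
        · simp [ee, hj]
      rw [this, map_smul]
      congr 1
      exact v.repr_symm_single k
    simp only [ContinuousLinearMap.bilinearComp_apply, one_apply_eq_self, e, map_smul, _root_.smul_apply, smul_eq_mul]
    rw [← mul_assoc, Real.mul_self_sqrt (hl0 k).le]

lemma bilin_norm (q : Bil n) (M : ES n →L[ℝ] ES n) {c : ℝ} (hM : ‖M‖ ≤ c) : ‖q.bilinearComp M M‖ ≤ ‖q‖ * c ^ 2 := by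
  have c0 : 0 ≤ c := (norm_nonneg _).trans hM
  refine ContinuousLinearMap.opNorm_le_bound _ (by positivity) fun x => ?_
  refine ContinuousLinearMap.opNorm_le_bound _ (by positivity) fun y => ?_
  rw [ContinuousLinearMap.bilinearComp_apply]
  calc _ ≤ ‖q‖ * ‖M x‖ * ‖M y‖ := ContinuousLinearMap.le_opNorm₂ _ _ _
    _ ≤ ‖q‖ * (c * ‖x‖) * (c * ‖y‖) := by
      have h1 := M.le_of_opNorm_le hM x
      have h2 := M.le_of_opNorm_le hM y
      gcongr
    _ = _ := by ring

lemma Ell.Lop_abs {ν Λ : ℝ} {S : ES n →L[ℝ] ES n} (h : Ell ν Λ S) (hν : 0 ≤ ν) (q : Bil n) : |Lop S q| ≤ n * Λ * ‖q‖ := by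
  obtain ⟨v, l, hl, hL⟩ := h.factor hν
  rw [hL]
  refine (Finset.abs_sum_le_sum_abs _ _).trans ?_
  calc _ ≤ ∑ k : Fin n, Λ * ‖q‖ := by
        refine Finset.sum_le_sum fun k _ => ?_
        rw [abs_mul, abs_of_nonneg (hν.trans (hl k).1)]
        have := q.le_opNorm₂ (v k) (v k)
        rw [v.norm_eq_one k, mul_one, mul_one, Real.norm_eq_abs] at this
        exact mul_le_mul (hl k).2 this (abs_nonneg _) ((hν.trans (hl k).1).trans (hl k).2)
    _ = _ := by simp; ring

lemma min_pow {β a r N : ℝ} (hβ : 0 < β) (hβ1 : β ≤ 1) (hN : 0 ≤ N) (hr : 0 ≤ r) (h1 : a ≤ N * r) (h2 : a ≤ 2 * N) : a ≤ 2 * N * r ^ β := by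
  rcases le_or_gt r 1 with h | h
  · have : r ≤ r ^ β := by
      rcases hr.eq_or_lt with rfl | h0
      · rw [Real.zero_rpow hβ.ne']
      · simpa using Real.rpow_le_rpow_of_exponent_ge h0 h hβ1
    nlinarith
  · have : 1 ≤ r ^ β := Real.one_le_rpow h.le hβ.le
    nlinarith

variable {T β ν Λ Q K H : ℝ} {u : ℝ → ES n → ℝ} {p : ℝ → ES n → (ES n →L[ℝ] ℝ)} {q : ℝ → ES n → Bil n}
  {S : ℝ → ES n → (ES n →L[ℝ] ES n)} {b : ℝ → ES n → ES n} {f : ℝ → ES n → ℝ}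

lemma Reg.plip (h : Reg T β u p q) (hβ : 0 < β) (hβ1 : β ≤ 1) {N t : ℝ} (hp : ∀ x, ‖p t x‖ ≤ N) (hq : ∀ x, ‖q t x‖ ≤ N) (x y : ES n) :
    ‖p t x - p t y‖ ≤ 2 * N * ‖x - y‖ ^ β := by
  have hN : 0 ≤ N := (norm_nonneg _).trans (hp x)
  refine min_pow hβ hβ1 hN (norm_nonneg _) ?_ ?_
  · exact convex_univ.norm_image_sub_le_of_norm_hasFDerivWithin_le (fun z _ => (h.dp t z).hasFDerivWithinAt) (fun z _ => hq z) (mem_univ y) (mem_univ x)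
  · exact (norm_sub_le _ _).trans (by linarith [hp x, hp y])

/-- increments of the lower order part -/
lemma low_inc (h : Reg T β u p q) (hβ : 0 < β) (hβ1 : β ≤ 1) (hc : Coef ν Λ β Q S b) (hf : HB β K H f) {N t : ℝ}
    (hp : ∀ x, ‖p t x‖ ≤ N) (hq : ∀ x, ‖q t x‖ ≤ N) (x y : ES n) :
    |(p t x (b t x) + f t x) - (p t y (b t y) + f t y)| ≤ (3 * Q * N + H) * ‖x - y‖ ^ β := by
  have hN : 0 ≤ N := (norm_nonneg _).trans (hp x)
  have hr : 0 ≤ ‖x - y‖ ^ β := by positivity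
  have e : (p t x (b t x) + f t x) - (p t y (b t y) + f t y) = (p t x - p t y) (b t x) + p t y (b t x - b t y) + (f t x - f t y) := by
    rw [_root_.sub_apply, map_sub]; ring
  have h1 := (p t x - p t y).le_opNorm (b t x)
  have h2 := (p t y).le_opNorm (b t x - b t y)
  have h3 := hf.hol t x y
  have h4 := h.plip hβ hβ1 hp hq x y
  rw [Real.norm_eq_abs] at h1 h2 h3
  have h5 := hc.bb t x
  have h6 := hc.hb t x y
  have h7 := mul_le_mul h4 h5 (norm_nonneg _) (by positivity)
  have h8 := mul_le_mul (hp y) h6 (norm_nonneg _) hN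
  rw [e]
  refine (abs_add_le _ _).trans ((add_le_add_left (abs_add_le _ _) _).trans ?_)
  linarith

/-- frozen right hand side -/
def Fz (A : ES n →L[ℝ] ES n) (S : ℝ → ES n → (ES n →L[ℝ] ES n)) (b : ℝ → ES n → ES n) (f : ℝ → ES n → ℝ)
    (p : ℝ → ES n → (ES n →L[ℝ] ℝ)) (q : ℝ → ES n → Bil n) (t : ℝ) (x : ES n) : ℝ :=
  Lop (S t x - A) (q t x) + (p t x (b t x) + f t x)

lemma Lop_cont : Continuous fun a : (ES n →L[ℝ] ES n) × Bil n => Lop a.1 a.2 := by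
  unfold Lop; fun_prop

lemma Fz_cont (h : Reg T β u p q) (hc : Coef ν Λ β Q S b) (hf : HB β K H f) (A) : Continuous (Function.uncurry (Fz A S b f p q)) := by
  have h1 := h.cq
  have h2 := h.cp
  have h3 := hc.cS
  have h4 := hc.cb
  have h5 := hf.cont
  have e : Function.uncurry (Fz A S b f p q) = fun a => Lop (Function.uncurry S a - A) (Function.uncurry q a) + (Function.uncurry p a (Function.uncurry b a) + Function.uncurry f a) := by
    ext ⟨t, x⟩; rfl
  rw [e]
  exact (Lop_cont.comp ((h3.sub continuous_const).prodMk h1)).add ((h2.clm_apply h4).add h5)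

lemma Fz_HB (h : Reg T β u p q) (hν : 0 < ν) (hβ : 0 < β) (hβ1 : β ≤ 1) (hc : Coef ν Λ β Q S b) (hf : HB β K H f) {A} (hA : Ell ν Λ A)
    (hH : 0 ≤ H) (hQ : 0 ≤ Q) (hΛ : 0 ≤ Λ) :
    ∃ K' H', 0 ≤ H' ∧ HB β K' H' (Fz A S b f p q) := by
  obtain ⟨N, hN⟩ := h.bd
  obtain ⟨Hq, hq0, hq⟩ := h.hol
  have hN0 : 0 ≤ N := (abs_nonneg _).trans (hN 0 0).1
  refine ⟨2 * (n * Λ * N) + (N * Q + K), (n * Q * N + 2 * (n * Λ) * Hq) + (3 * Q * N + H), by positivity, Fz_cont h hc hf A, fun t x => ?_, fun t x y => ?_⟩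
  · unfold Fz
    rw [Lop_sub_left, Real.norm_eq_abs]
    have h1 := (hc.ell t x).Lop_abs hν.le (q t x)
    have h2 := hA.Lop_abs hν.le (q t x)
    have h3 := mul_le_mul_of_nonneg_left (hN t x).2.2 (by positivity : 0 ≤ n * Λ)
    have h4 := ((p t x).le_opNorm (b t x)).trans (mul_le_mul (hN t x).2.1 (hc.bb t x) (norm_nonneg _) hN0)
    have h5 := hf.bd t x
    rw [Real.norm_eq_abs] at h4 h5
    refine (abs_add_le _ _).trans (add_le_add ((abs_sub _ _).trans (by linarith)) ((abs_add_le _ _).trans (by linarith)))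
  · have e : Fz A S b f p q t x - Fz A S b f p q t y = Lop (S t x - S t y) (q t x) + (Lop (S t y) (q t x - q t y) - Lop A (q t x - q t y)) + ((p t x (b t x) + f t x) - (p t y (b t y) + f t y)) := by
      unfold Fz; simp only [Lop_sub_left, Lop_sub]; ring
    have hr : 0 ≤ ‖x - y‖ ^ β := by positivity
    have h1 := abs_Lop_le (S t x - S t y) (q t x)
    have h1' := hc.hS t x t y
    rw [sub_self, abs_zero, Real.zero_rpow (by positivity), add_zero] at h1'
    have h1'' : (n:ℝ) * ‖S t x - S t y‖ * ‖q t x‖ ≤ n * (Q * ‖x - y‖ ^ β) * N := by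
      have := (hN t x).2.2
      gcongr
    have h2 := (hc.ell t y).Lop_abs hν.le (q t x - q t y)
    have h3 := hA.Lop_abs hν.le (q t x - q t y)
    have h4 := mul_le_mul_of_nonneg_left (hq t x y) (by positivity : 0 ≤ n * Λ)
    have h5 := low_inc h hβ hβ1 hc hf (fun x => (hN t x).2.1) (fun x => (hN t x).2.2) x y
    rw [e, Real.norm_eq_abs]
    refine (abs_add_le _ _).trans (le_trans (add_le_add ((abs_add_le _ _).trans (add_le_add (h1.trans h1'') ((abs_sub _ _).trans (add_le_add (h2.trans h4) (h3.trans h4))))) h5) (le_of_eq (by ring)))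

/-- representation after freezing -/
lemma frozen_rep (h : Reg T β u p q) (hT : 0 < T) (hν : 0 < ν) (hβ : 0 < β) (hβ1 : β < 1) (hc : Coef ν Λ β Q S b) (hf : HB β K H f) {A} (hA : Ell ν Λ A)
    (hH : 0 ≤ H) (hQ : 0 ≤ Q) (hΛ : 0 ≤ Λ) (hp : Pde T S b f u p q) (x0 : ES n)
    {M N : ES n →L[ℝ] ES n} (hMN : ∀ y, M (N y) = y) (hMc : ‖M‖ ≤ cE ν Λ) (hNc : ‖N‖ ≤ cE ν Λ)
    (hM : ∀ q : Bil n, Lop A q = Lop 1 (q.bilinearComp M M)) :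
    ∃ K' H', 0 ≤ H' ∧ HB β K' H' (fun t y => Fz A S b f p q t (x0 + M y)) ∧
      ∀ t ∈ Ioc 0 T, ∀ y, p t (x0 + M y) = (Du (h1 fun t y => Fz A S b f p q t (x0 + M y)) t y).comp N ∧
        q t (x0 + M y) = (Du (h2 fun t y => Fz A S b f p q t (x0 + M y)) t y).bilinearComp N N := by
  obtain ⟨K', H', hH', hF⟩ := Fz_HB h hν hβ hβ1.le hc hf hA hH hQ hΛ
  have c1 := cE_ge ν Λ
  have c0 : (0:ℝ) ≤ cE ν Λ := zero_le_one.trans c1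
  have hMy : ∀ y y' : ES n, ‖(x0 + M y) - (x0 + M y')‖ ^ β ≤ cE ν Λ ^ β * ‖y - y'‖ ^ β := by
    intro y y'
    rw [add_sub_add_left_eq_sub, ← map_sub, ← Real.mul_rpow c0 (norm_nonneg _)]
    exact Real.rpow_le_rpow (norm_nonneg _) (M.le_of_opNorm_le hMc _) hβ.le
  have hcm : Continuous fun a : ℝ × ES n => (a.1, x0 + M a.2) := by fun_prop
  have hG : HB β K' (H' * cE ν Λ ^ β) (fun t y => Fz A S b f p q t (x0 + M y)) := by
    refine ⟨hF.cont.comp hcm, fun t y => hF.bd _ _, fun t y y' => (hF.hol _ _ _).trans ?_⟩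
    rw [mul_assoc]; exact mul_le_mul_of_nonneg_left (hMy y y') hH'
  have hH2 : 0 ≤ H' * cE ν Λ ^ β := by positivity
  refine ⟨K', _, hH2, hG, ?_⟩
  have hs := heat_sol hT hβ hβ1 hH2 hG
  have daff : ∀ y, HasFDerivAt (fun y => x0 + M y) M y := fun y => M.hasFDerivAt.const_add x0
  have hR : Reg T β (fun t y => u t (x0 + M y)) (fun t y => (p t (x0 + M y)).comp M) (fun t y => (q t (x0 + M y)).bilinearComp M M) := by
    obtain ⟨K1, hK1⟩ := h.bd
    obtain ⟨Hq, hq0, hq⟩ := h.hol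
    have hK0 : 0 ≤ K1 := (abs_nonneg _).trans (hK1 0 0).1
    have cB : Continuous fun q : Bil n => q.bilinearComp M M := by
      have e : (fun q : Bil n => q.bilinearComp M M) = fun q => ((ContinuousLinearMap.compL ℝ (ES n) (ES n) ℝ).flip M).comp (q.comp M) := by
        ext q x y; simp
      rw [e]
      fun_prop
    refine ⟨h.cu.comp hcm, ?_, ?_, fun t y => (h.du t _).comp y (daff y), fun t y => ?_, fun t ht y => h.zero t ht _,
      fun t ht => by simp only [h.halt t ht], ?_, ?_⟩
    · have : Continuous fun a : ℝ × ES n => Function.uncurry p (a.1, x0 + M a.2) := h.cp.comp hcm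
      exact this.clm_comp continuous_const
    · exact cB.comp (h.cq.comp hcm)
    · have h1 := ((ContinuousLinearMap.compL ℝ (ES n) (ES n) ℝ).flip M).hasFDerivAt.comp y ((h.dp t _).comp y (daff y))
      refine h1.congr_fderiv ?_
      ext v w; simp
    · refine ⟨max K1 (max (K1 * cE ν Λ) (K1 * cE ν Λ ^ 2)), fun t y => ⟨(hK1 t _).1.trans (le_max_left _ _), ?_, ?_⟩⟩
      · refine le_trans ?_ ((le_max_left _ _).trans (le_max_right _ _))
        exact (ContinuousLinearMap.opNorm_comp_le _ _).trans (mul_le_mul (hK1 t _).2.1 hMc (norm_nonneg _) hK0)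
      · refine le_trans ?_ ((le_max_right _ _).trans (le_max_right _ _))
        exact (bilin_norm _ _ hMc).trans (mul_le_mul_of_nonneg_right (hK1 t _).2.2 (by positivity))
    · refine ⟨Hq * cE ν Λ ^ β * cE ν Λ ^ 2, by positivity, fun t y y' => ?_⟩
      have e : (q t (x0 + M y)).bilinearComp M M - (q t (x0 + M y')).bilinearComp M M = (q t (x0 + M y) - q t (x0 + M y')).bilinearComp M M := by
        ext v w; simp
      rw [e]
      refine (bilin_norm _ _ hMc).trans ?_
      have := (hq t (x0 + M y) (x0 + M y')).trans (mul_le_mul_of_nonneg_left (hMy y y') hq0)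
      calc _ ≤ (Hq * (cE ν Λ ^ β * ‖y - y'‖ ^ β)) * cE ν Λ ^ 2 := mul_le_mul_of_nonneg_right this (by positivity)
        _ = _ := by ring
  have hP : Pde T (fun _ _ => 1) (fun _ _ => 0) (fun t y => Fz A S b f p q t (x0 + M y)) (fun t y => u t (x0 + M y)) (fun t y => (p t (x0 + M y)).comp M) (fun t y => (q t (x0 + M y)).bilinearComp M M) := by
    intro t ht y
    refine (hp t ht (x0 + M y)).congr_deriv ?_
    rw [map_zero, ← hM]
    unfold Fz
    beta_reduce
    rw [Lop_sub_left]; ring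
  have one_ell : ∀ (t : ℝ) (x : ES n), Ell 0 1 (1 : ES n →L[ℝ] ES n) := fun _ _ =>
    ⟨fun v w => rfl, fun v => by simp, fun v => by simp [real_inner_self_eq_norm_sq]⟩
  obtain ⟨_, e1, e2⟩ := lin_unique (Q := 0) le_rfl hT one_ell (by simp) hR hP hs.1 hs.2
  intro t ht y
  have e1 := congrFun (congrFun e1 t) y
  have e2 := congrFun (congrFun e2 t) y
  simp only [min_eq_left ht.2] at e1 e2
  rw [← e1, ← e2]
  constructor
  · ext v; simp [hMN]
  · ext v w; simp [hMN]
end QP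

namespace QP
open MeasureTheory Filter Topology Metric
variable {n : ℕ}
variable {T β ν Λ Q K H : ℝ} {u : ℝ → ES n → ℝ} {p : ℝ → ES n → (ES n →L[ℝ] ℝ)} {q : ℝ → ES n → Bil n}
  {S : ℝ → ES n → (ES n →L[ℝ] ES n)} {b : ℝ → ES n → ES n} {f : ℝ → ES n → ℝ}

lemma disp_le {M : ES n →L[ℝ] ES n} (hM : ‖M‖ ≤ cE ν Λ) (hβ : 0 < β) (hβ1 : β ≤ 1) {τ : ℝ} (hτ : 0 ≤ τ) (z : ES n) :
    ‖M (Real.sqrt (2*τ) • z)‖ ^ β ≤ 2 * cE ν Λ * τ ^ (β/2) * (1 + ‖z‖) := by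
  have c1 := cE_ge ν Λ
  have c0 : (0:ℝ) ≤ cE ν Λ := zero_le_one.trans c1
  have h1 : cE ν Λ ^ β ≤ cE ν Λ := by simpa using Real.rpow_le_rpow_of_exponent_le c1 hβ1
  calc _ ≤ (cE ν Λ * ‖Real.sqrt (2*τ) • z‖) ^ β := Real.rpow_le_rpow (norm_nonneg _) (M.le_of_opNorm_le hM _) hβ.le
    _ = cE ν Λ ^ β * ‖Real.sqrt (2*τ) • z‖ ^ β := Real.mul_rpow c0 (norm_nonneg _)
    _ ≤ cE ν Λ * (2*τ^(β/2)*(1+‖z‖)) := mul_le_mul h1 (inc_le hβ hβ1 hτ z) (by positivity) c0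
    _ = _ := by ring

/-- deviation of the frozen right hand side from its lower order part at the centre -/
lemma Fz_dev (h : Reg T β u p q) (hβ : 0 < β) (hβ1 : β ≤ 1) (hc : Coef ν Λ β Q S b) (hf : HB β K H f) (hQ : 0 ≤ Q) (hH : 0 ≤ H)
    {N s t0 ω : ℝ} (hp : ∀ x, ‖p s x‖ ≤ N) (hq : ∀ x, ‖q s x‖ ≤ N) (x0 x : ES n) (hω : ‖x - x0‖ ^ β + |s - t0| ^ (β/2) ≤ ω) :
    |Fz (S t0 x0) S b f p q s x - (p s x0 (b s x0) + f s x0)| ≤ ((n + 3) * Q * N + H) * ω := by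
  have hN : 0 ≤ N := (norm_nonneg _).trans (hp x)
  have h1 := low_inc h hβ hβ1 hc hf hp hq x x0
  have h2 := abs_Lop_le (S s x - S t0 x0) (q s x)
  have h3 := hc.hS s x t0 x0
  have h4 : (n:ℝ) * ‖S s x - S t0 x0‖ * ‖q s x‖ ≤ n * (Q * ω) * N := by
    have := hq x
    have h5 := h3.trans (mul_le_mul_of_nonneg_left hω hQ)
    have hω0 : 0 ≤ ω := le_trans (by positivity) hω
    gcongr
  have h6 : (3 * Q * N + H) * ‖x - x0‖ ^ β ≤ (3 * Q * N + H) * ω := by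
    have : 0 ≤ |s - t0| ^ (β/2) := by positivity
    exact mul_le_mul_of_nonneg_left (by linarith) (by positivity)
  unfold Fz
  rw [add_sub_assoc]
  refine (abs_add_le _ _).trans ?_
  calc _ ≤ n * (Q * ω) * N + (3 * Q * N + H) * ω := add_le_add (h2.trans h4) (h1.trans h6)
    _ = _ := by ring

lemma exists_lam {γ G ε : ℝ} (hγ : 0 < γ) (hε : 0 < ε) : ∃ L0 : ℝ, ∀ lam ≥ L0, G * (1/lam) ^ γ ≤ ε := by
  have h1 : Tendsto (fun l : ℝ => G * (1/l) ^ γ) atTop (𝓝 (G * 0)) := by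
    refine Tendsto.const_mul _ ?_
    have h2 := tendsto_rpow_neg_atTop hγ
    refine h2.congr' ?_
    filter_upwards [eventually_gt_atTop 0] with l hl
    rw [one_div, Real.inv_rpow hl.le, Real.rpow_neg hl.le]
  rw [mul_zero] at h1
  obtain ⟨L0, hL⟩ := eventually_atTop.1 (h1.eventually_le_const hε)
  exact ⟨L0, hL⟩

lemma apriori_sup (n : ℕ) (T : ℝ) {β ν Λ Q : ℝ} (hT : 0 < T) (hβ : 0 < β) (hβ1 : β < 1) (hν : 0 < ν) (hQ : 0 ≤ Q) (hΛ : 0 ≤ Λ) :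
    ∃ C : ℝ, 0 ≤ C ∧ ∀ (S : ℝ → ES n → (ES n →L[ℝ] ES n)) (b : ℝ → ES n → ES n) (f u : ℝ → ES n → ℝ) 
      (p : ℝ → ES n → (ES n →L[ℝ] ℝ)) (q : ℝ → ES n → Bil n) (K H : ℝ), 0 ≤ H → Coef ν Λ β Q S b → HB β K H f → Reg T β u p q →
      Pde T S b f u p q → ∀ t x, ‖p t x‖ ≤ C * H ∧ ‖q t x‖ ≤ C * H := by
  have c1 := cE_ge ν Λ
  have c0 : (0:ℝ) ≤ cE ν Λ := zero_le_one.trans c1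
  have hcM := cM_pos n
  set B := 3 * cE ν Λ with hB
  have hB0 : 0 ≤ B := by positivity
  have hε : 0 < 1 / (2 * ((n + 3) * (Q + 1))) := by positivity
  obtain ⟨La, hLa⟩ := exists_lam (G := cE ν Λ * (cM n * B * Real.Gamma ((β+1)/2))) (γ := (β+1)/2) (by positivity) hε
  obtain ⟨Lb, hLb⟩ := exists_lam (G := cE ν Λ ^ 2 * (cM n * B * Real.Gamma (β/2))) (γ := β/2) (by positivity) hε
  set lam := max 1 (max La Lb) with hlam
  have hl0 : 0 < lam := zero_lt_one.trans_le (le_max_left _ _)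
  have hLa := hLa lam ((le_max_left _ _).trans (le_max_right _ _))
  have hLb := hLb lam ((le_max_right _ _).trans (le_max_right _ _))
  refine ⟨2 * Real.exp (lam * T), by positivity, ?_⟩
  intro S b f u p q K H hH hc hf h hp
  let ι := {t : ℝ // t ∈ Icc 0 T} × ES n
  let a : ι → ℝ := fun i => max ‖p i.1 i.2‖ ‖q i.1 i.2‖
  let w : ι → ℝ := fun i => Real.exp (lam * i.1)
  have key : ∀ i, a i ≤ 2 * H * w i := by
    refine absorb ?_ ?_ hH (fun i => (Real.exp_pos _).le)
    · obtain ⟨K1, hK1⟩ := h.bd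
      refine ⟨K1, fun i => ?_⟩
      have hK0 : 0 ≤ K1 := (abs_nonneg _).trans (hK1 0 0).1
      have : 1 ≤ w i := Real.one_le_exp (mul_nonneg hl0.le i.1.2.1)
      have := max_le (hK1 i.1 i.2).2.1 (hK1 i.1 i.2).2.2
      simp only [a]
      nlinarith
    · intro N hN hN' ⟨⟨t0, ht0⟩, x0⟩
      simp only [a, w]
      rcases ht0.1.eq_or_lt with e | ht0'
      · subst e
        rw [h.pzero le_rfl, h.qzero le_rfl]
        simp only [norm_zero, max_self]
        positivity
      have hbp : ∀ s ∈ Icc 0 T, ∀ x, ‖p s x‖ ≤ N * Real.exp (lam * s) := fun s hs x => (le_max_left _ _).trans (hN' (⟨s, hs⟩, x))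
      have hbq : ∀ s ∈ Icc 0 T, ∀ x, ‖q s x‖ ≤ N * Real.exp (lam * s) := fun s hs x => (le_max_right _ _).trans (hN' (⟨s, hs⟩, x))
      obtain ⟨M, Nn, hNM, hMN, hMc, hNc, hML⟩ := factorM hν (hc.ell t0 x0)
      obtain ⟨K', H', hH', hF, hrep⟩ := frozen_rep h hT hν hβ hβ1 hc hf (hc.ell t0 x0) hH hQ hΛ hp x0 hMN hMc hNc hML
      obtain ⟨e1, e2⟩ := hrep t0 ⟨ht0', ht0.2⟩ 0
      rw [map_zero, add_zero] at e1 e2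
      set F := fun t y => Fz (S t0 x0) S b f p q t (x0 + M y) with hFd
      set D := (n + 3) * Q * N + H with hD
      have hD0 : 0 ≤ D := by positivity
      have dev : ∀ τ ∈ Ioo 0 t0, ∀ z, |F (t0 - τ) (0 + Real.sqrt (2*τ) • z) - (p (t0-τ) x0 (b (t0-τ) x0) + f (t0-τ) x0)| ≤ (D * Real.exp (lam * t0) * Real.exp (-(lam*τ)) * B * τ ^ (β/2)) * (1 + ‖z‖) := by
        intro τ hτ z
        have hs : t0 - τ ∈ Icc 0 T := ⟨by linarith [hτ.2], by linarith [hτ.1, ht0.2]⟩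
        have hω : ‖(x0 + M (0 + Real.sqrt (2*τ) • z)) - x0‖ ^ β + |(t0 - τ) - t0| ^ (β/2) ≤ B * τ ^ (β/2) * (1 + ‖z‖) := by
          rw [add_sub_cancel_left, zero_add, sub_sub_cancel_left, abs_neg, abs_of_pos hτ.1]
          have h1 := disp_le (β := β) hMc hβ hβ1.le hτ.1.le z
          have h3 : 0 ≤ τ ^ (β/2) := Real.rpow_nonneg hτ.1.le _
          have h2 : τ ^ (β/2) ≤ cE ν Λ * τ ^ (β/2) * (1 + ‖z‖) := by
            have : 1 ≤ cE ν Λ * (1 + ‖z‖) := one_le_mul_of_one_le_of_one_le c1 (by linarith [norm_nonneg z])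
            nlinarith
          calc _ ≤ 2 * cE ν Λ * τ ^ (β/2) * (1 + ‖z‖) + cE ν Λ * τ ^ (β/2) * (1 + ‖z‖) := add_le_add h1 h2
            _ = _ := by rw [hB]; ring
        refine (Fz_dev h hβ hβ1.le hc hf hQ hH (hbp _ hs) (hbq _ hs) x0 _ hω).trans ?_
        have e : Real.exp (lam * t0) * Real.exp (-(lam*τ)) = Real.exp (lam * (t0 - τ)) := by rw [← Real.exp_add]; congr 1; ring
        have h1 : 1 ≤ Real.exp (lam * (t0 - τ)) := Real.one_le_exp (mul_nonneg hl0.le hs.1)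
        have h2 : (n + 3) * Q * (N * Real.exp (lam * (t0 - τ))) + H ≤ D * (Real.exp (lam * t0) * Real.exp (-(lam*τ))) := by
          rw [e, hD]; nlinarith
        have h3 : 0 ≤ τ ^ (β/2) := Real.rpow_nonneg hτ.1.le _
        calc _ ≤ D * (Real.exp (lam * t0) * Real.exp (-(lam*τ))) * (B * τ ^ (β/2) * (1 + ‖z‖)) := mul_le_mul_of_nonneg_right h2 (by positivity)
          _ = _ := by ring
      have r1 : ‖Du (QP.h1 F) t0 0‖ ≤ (cM n * B * D * Real.exp (lam * t0)) * ((1/lam) ^ ((β+1)/2) * Real.Gamma ((β+1)/2)) := by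
        refine Du_exp (by positivity) hl0 (by positivity) ht0' fun τ hτ => ?_
        refine (P1_le (hF.slice (t0 - τ)) (hF.bd (t0 - τ)) hτ.1 (dev τ hτ)).trans (le_of_eq ?_)
        have : τ ^ ((β+1)/2 - 1) = τ ^ (β/2) * τ ^ (-(1/2):ℝ) := by
          rw [← Real.rpow_add hτ.1]; congr 1; ring
        rw [this]; ring
      have r2 : ‖Du (QP.h2 F) t0 0‖ ≤ (cM n * B * D * Real.exp (lam * t0)) * ((1/lam) ^ (β/2) * Real.Gamma (β/2)) := by
        refine Du_exp (by positivity) hl0 (by positivity) ht0' fun τ hτ => ?_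
        refine (P2_le (hF.slice (t0 - τ)) (hF.bd (t0 - τ)) hτ.1 (dev τ hτ)).trans (le_of_eq ?_)
        have : τ ^ (β/2 - 1) = τ ^ (β/2) * τ ^ (-1:ℝ) := by
          rw [← Real.rpow_add hτ.1]; congr 1
        rw [this]; ring
      have fin : 1 / (2 * ((n + 3) * (Q + 1))) * D ≤ N / 2 + H := by
        rw [div_mul_eq_mul_div, one_mul, div_le_iff₀ (by positivity), hD]
        have h1 : (1:ℝ) ≤ (n + 3) * (Q + 1) := one_le_mul_of_one_le_of_one_le (by linarith [(Nat.cast_nonneg n : (0:ℝ) ≤ n)]) (by linarith)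
        have h2 : 0 ≤ ((n:ℝ)+3) * N := by positivity
        nlinarith
      have fin' : 1 / (2 * ((n + 3) * (Q + 1))) * D * Real.exp (lam * t0) ≤ (N / 2 + H) * Real.exp (lam * t0) := mul_le_mul_of_nonneg_right fin (Real.exp_pos _).le
      refine max_le ?_ ?_
      · rw [e1]
        refine (ContinuousLinearMap.opNorm_comp_le _ _).trans ((mul_le_mul r1 hNc (norm_nonneg _) ?_).trans ?_)
        · have := Real.Gamma_pos_of_pos (by positivity : 0 < (β+1)/2); positivity
        refine le_trans ?_ fin'
        have := mul_le_mul_of_nonneg_right hLa (by positivity : 0 ≤ D * Real.exp (lam * t0))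
        refine le_trans (le_of_eq ?_) (this.trans (le_of_eq ?_)) <;> ring
      · rw [e2]
        refine (bilin_norm _ _ hNc).trans ((mul_le_mul_of_nonneg_right r2 (by positivity)).trans ?_)
        refine le_trans ?_ fin'
        have := mul_le_mul_of_nonneg_right hLb (by positivity : 0 ≤ D * Real.exp (lam * t0))
        refine le_trans (le_of_eq ?_) (this.trans (le_of_eq ?_)) <;> ring
  have key2 : ∀ t ∈ Icc 0 T, ∀ x, max ‖p t x‖ ‖q t x‖ ≤ 2 * Real.exp (lam * T) * H := by
    intro t ht x
    refine (key (⟨t, ht⟩, x)).trans ?_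
    have : Real.exp (lam * t) ≤ Real.exp (lam * T) := Real.exp_le_exp.2 (mul_le_mul_of_nonneg_left ht.2 hl0.le)
    show 2 * H * Real.exp (lam * t) ≤ _
    nlinarith
  intro t x
  rcases le_or_gt t 0 with ht | ht
  · rw [h.pzero ht, h.qzero ht, norm_zero, norm_zero]
    constructor <;> positivity
  rcases le_or_gt t T with ht' | ht'
  · exact max_le_iff.1 (key2 t ⟨ht.le, ht'⟩ x)
  · rw [h.phalt ht'.le, h.qhalt ht'.le]
    exact max_le_iff.1 (key2 T ⟨hT.le, le_rfl⟩ x)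

set_option maxHeartbeats 1000000 in
lemma apriori_hol (n : ℕ) (T : ℝ) {β ν Λ Q : ℝ} (hT : 0 < T) (hβ : 0 < β) (hβ1 : β < 1) (hν : 0 < ν) (hQ : 0 ≤ Q) (hΛ : 0 ≤ Λ) :
    ∃ C : ℝ, 0 ≤ C ∧ ∀ (S : ℝ → ES n → (ES n →L[ℝ] ES n)) (b : ℝ → ES n → ES n) (f u : ℝ → ES n → ℝ) 
      (p : ℝ → ES n → (ES n →L[ℝ] ℝ)) (q : ℝ → ES n → Bil n) (K H : ℝ), 0 ≤ H → Coef ν Λ β Q S b → HB β K H f → Reg T β u p q →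
      Pde T S b f u p q → ∀ t x y, ‖q t x - q t y‖ ≤ C * H * ‖x - y‖ ^ β := by
  obtain ⟨C0, hC0, hsup⟩ := apriori_sup n T hT hβ hβ1 hν hQ hΛ
  have c1 := cE_ge ν Λ
  have c0 : (0:ℝ) ≤ cE ν Λ := zero_le_one.trans c1
  have hcM := cM_pos n
  have hb : 0 < 1 - β := by linarith
  set c := cE ν Λ with hcdef
  set G := c ^ 2 * (cM n * (4/β + 2/(1-β))) * c ^ β with hG
  have hG0 : 0 ≤ G := by positivity
  obtain ⟨r0, hr0, hr0'⟩ : ∃ r0 : ℝ, 0 < r0 ∧ G * (4 * n * Q * c * c ^ β) * r0 ^ β ≤ 1/2 := by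
    obtain ⟨L0, hL⟩ := exists_lam (G := G * (4 * n * Q * c * c ^ β)) hβ (by norm_num : (0:ℝ) < 1/2)
    exact ⟨1 / max 1 L0, by positivity, hL _ (le_max_right _ _)⟩
  set D := (n + 3) * Q * C0 + 1 with hD
  have hD0 : 0 ≤ D := by positivity
  set C1 := G * (6 * c * D) + 2 * C0 / r0 ^ β with hC1
  have hC10 : 0 ≤ C1 := by positivity
  refine ⟨2 * C1, by positivity, ?_⟩
  intro S b f u p q K H hH hc hf h hp
  have hs := hsup S b f u p q K H hH hc hf h hp
  have hC0H : 0 ≤ C0 * H := by positivity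
  let ι := ℝ × ES n × ES n
  let a : ι → ℝ := fun i => ‖q i.1 i.2.1 - q i.1 i.2.2‖
  let w : ι → ℝ := fun i => ‖i.2.1 - i.2.2‖ ^ β
  have key : ∀ i, a i ≤ 2 * (C1 * H) * w i := by
    refine absorb ?_ ?_ (by positivity) (fun i => by positivity)
    · obtain ⟨Hq, _, hq⟩ := h.hol
      exact ⟨Hq, fun i => hq i.1 i.2.1 i.2.2⟩
    · intro Hq hHq hq ⟨t, x0, x1⟩
      simp only [a, w]
      have hq' : ∀ t x y, ‖q t x - q t y‖ ≤ Hq * ‖x - y‖ ^ β := fun t x y => hq (t, x, y)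
      have main : ∀ t0 ∈ Ioc 0 T, ‖q t0 x0 - q t0 x1‖ ≤ (Hq/2 + C1 * H) * ‖x0 - x1‖ ^ β := by
        intro t0 ht0
        rcases eq_or_ne x0 x1 with rfl | hne
        · rw [sub_self, norm_zero]; positivity
        have hρ : 0 < ‖x0 - x1‖ := norm_pos_iff.2 (sub_ne_zero.2 hne)
        have hρβ : 0 < ‖x0 - x1‖ ^ β := by positivity
        have hw0 : 0 ≤ G * (6 * c * D) * H := by positivity
        rcases le_or_gt r0 ‖x0 - x1‖ with hfar | hnear
        · have h1 : ‖q t0 x0 - q t0 x1‖ ≤ 2 * (C0 * H) := (norm_sub_le _ _).trans (by linarith [(hs t0 x0).2, (hs t0 x1).2])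
          have h2 : r0 ^ β ≤ ‖x0 - x1‖ ^ β := Real.rpow_le_rpow hr0.le hfar hβ.le
          have h3 : 0 < r0 ^ β := by positivity
          have h4 : 2 * (C0 * H) ≤ 2 * C0 / r0 ^ β * H * ‖x0 - x1‖ ^ β := by
            calc 2 * (C0 * H) = 2 * C0 / r0 ^ β * H * r0 ^ β := by field_simp
              _ ≤ _ := mul_le_mul_of_nonneg_left h2 (by positivity)
          refine h1.trans (h4.trans (mul_le_mul_of_nonneg_right ?_ hρβ.le))
          rw [hC1, add_mul]; linarith
        obtain ⟨M, Nn, hNM, hMN, hMc, hNc, hML⟩ := factorM hν (hc.ell t0 x0)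
        obtain ⟨K', H', hH', hF, hrep⟩ := frozen_rep h hT hν hβ hβ1 hc hf (hc.ell t0 x0) hH hQ hΛ hp x0 hMN hMc hNc hML
        obtain ⟨-, e1⟩ := hrep t0 ht0 0
        obtain ⟨-, e2⟩ := hrep t0 ht0 (Nn (x1 - x0))
        rw [map_zero, add_zero] at e1
        rw [hMN, add_sub_cancel] at e2
        set F := fun t y => Fz (S t0 x0) S b f p q t (x0 + M y) with hFd
        set y1 := Nn (x1 - x0) with hy1
        have hMy1 : M y1 = x1 - x0 := hMN _
        set r := c * ‖x0 - x1‖ with hr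
        have hrpos : 0 < r := by positivity
        have hρr : ‖x0 - x1‖ ≤ r := le_mul_of_one_le_left hρ.le c1
        have hsl : ∀ s, (∀ x, ‖p s x‖ ≤ C0 * H) ∧ (∀ x, ‖q s x‖ ≤ C0 * H) := fun s => ⟨fun x => (hs s x).1, fun x => (hs s x).2⟩
        have hDH : (n + 3) * Q * (C0 * H) + H = D * H := by rw [hD]; ring
        have rp : ∀ τ : ℝ, 0 ≤ τ → τ ≤ r ^ 2 → τ ^ (β/2) ≤ r ^ β := by
          intro τ h0 h1
          calc _ ≤ (r^2) ^ (β/2) := Real.rpow_le_rpow h0 h1 (by positivity)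
            _ = _ := by rw [← Real.rpow_natCast, ← Real.rpow_mul hrpos.le]; congr 1; push_cast; ring
        have rp' : ∀ τ : ℝ, r ^ 2 ≤ τ → r ^ β ≤ τ ^ (β/2) := by
          intro τ h1
          calc r ^ β = (r^2) ^ (β/2) := by rw [← Real.rpow_natCast, ← Real.rpow_mul hrpos.le]; congr 1; push_cast; ring
            _ ≤ _ := Real.rpow_le_rpow (by positivity) h1 (by positivity)
        set L1 := 2 * c * (D * H + 2 * n * Q * r ^ β * Hq) with hL1
        set L2 := 4 * c * (D * H) with hL2
        have near : ∀ y : ES n, ‖M y‖ ≤ r → ∀ τ ∈ Ioo 0 t0, τ ≤ r^2 → ∀ z, |F (t0 - τ) (y + Real.sqrt (2*τ) • z) - F (t0 - τ) y| ≤ L1 * τ ^ (β/2) * (1 + ‖z‖) := by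
          intro y hy τ hτ hτr z
          set s := t0 - τ with hsd
          set x := x0 + M (y + Real.sqrt (2*τ) • z) with hx
          set xi := x0 + M y with hxi
          have hxx : ‖x - xi‖ ^ β ≤ 2 * c * τ ^ (β/2) * (1 + ‖z‖) := by
            have : x - xi = M (Real.sqrt (2*τ) • z) := by rw [hx, hxi, map_add]; abel
            rw [this]; exact disp_le (β := β) hMc hβ hβ1.le hτ.1.le z
          set ω := 2 * c * τ ^ (β/2) * (1 + ‖z‖) with hω
          have e : F s (y + Real.sqrt (2*τ) • z) - F s y = Lop (S s x - S s xi) (q s x) + Lop (S s xi - S t0 x0) (q s x - q s xi) + ((p s x (b s x) + f s x) - (p s xi (b s xi) + f s xi)) := by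
            simp only [hFd, Fz, Lop_sub_left, Lop_sub]; ring
          have a1 := low_inc h hβ hβ1.le hc hf (hsl s).1 (hsl s).2 x xi
          have a2 := abs_Lop_le (S s x - S s xi) (q s x)
          have a3 := abs_Lop_le (S s xi - S t0 x0) (q s x - q s xi)
          have a4 := hc.hS s x s xi
          rw [sub_self, abs_zero, Real.zero_rpow (by positivity), add_zero] at a4
          have a5 := hc.hS s xi t0 x0
          have a6 : ‖xi - x0‖ ^ β + |s - t0| ^ (β/2) ≤ 2 * r ^ β := by
            have i1 : ‖xi - x0‖ ^ β ≤ r ^ β := by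
              rw [hxi, add_sub_cancel_left]; exact Real.rpow_le_rpow (norm_nonneg _) hy hβ.le
            have i2 := rp τ hτ.1.le hτr
            rw [hsd, sub_sub_cancel_left, abs_neg, abs_of_pos hτ.1]
            linarith
          have a7 := hq' s x xi
          have a8 : (n:ℝ) * ‖S s x - S s xi‖ * ‖q s x‖ ≤ n * (Q * ω) * (C0 * H) := by
            have i1 := a4.trans (mul_le_mul_of_nonneg_left hxx hQ)
            have i2 := (hs s x).2
            have hω0 : 0 ≤ ω := le_trans (by positivity) hxx
            gcongr
          have a9 : (n:ℝ) * ‖S s xi - S t0 x0‖ * ‖q s x - q s xi‖ ≤ n * (Q * (2 * r ^ β)) * (Hq * ω) := by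
            have i1 := a5.trans (mul_le_mul_of_nonneg_left a6 hQ)
            have i2 := a7.trans (mul_le_mul_of_nonneg_left hxx hHq)
            have hω0 : 0 ≤ ω := le_trans (by positivity) hxx
            gcongr
          have a10 : (3 * Q * (C0 * H) + H) * ‖x - xi‖ ^ β ≤ (3 * Q * (C0 * H) + H) * ω := mul_le_mul_of_nonneg_left hxx (by positivity)
          rw [e]
          refine (abs_add_le _ _).trans ((add_le_add ((abs_add_le _ _).trans (add_le_add (a2.trans a8) (a3.trans a9))) (a1.trans a10)).trans (le_of_eq ?_))
          rw [hL1, hω, hD]; ring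
        have hMy1' : ‖M y1‖ ≤ r := by rw [hMy1, norm_sub_rev]; exact hρr
        have hq2 : ‖Du (QP.h2 F) t0 0 - Du (QP.h2 F) t0 y1‖ ≤ cM n * (4/β + 2/(1-β)) * (L1 + L2) * r ^ β := by
          refine Du2_holder hβ hβ1 hH' hF ht0.1 hrpos ?_ (by positivity) (by positivity) (near 0 (by simp [hrpos.le])) (near y1 hMy1') ?_
          · rw [zero_sub, norm_neg, hr, norm_sub_rev]; exact Nn.le_of_opNorm_le hNc _
          · intro τ hτ hτr
            refine ⟨p (t0-τ) x0 (b (t0-τ) x0) + f (t0-τ) x0, fun y hy z => ?_⟩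
            have hMy : ‖M y‖ ≤ r := by
              obtain ⟨s, ⟨hs0, hs1⟩, rfl⟩ := (segment_eq_image ℝ (0:ES n) y1 ▸ hy : y ∈ (fun θ : ℝ => (1 - θ) • (0:ES n) + θ • y1) '' Icc 0 1)
              simp only [smul_zero, zero_add, map_smul, norm_smul, Real.norm_eq_abs, abs_of_nonneg hs0]
              nlinarith [norm_nonneg (M y1)]
            have hτ0 : 0 ≤ τ ^ (β/2) := Real.rpow_nonneg hτ.1.le _
            have hω : ‖(x0 + M (y + Real.sqrt (2*τ) • z)) - x0‖ ^ β + |(t0 - τ) - t0| ^ (β/2) ≤ 4 * c * τ ^ (β/2) * (1 + ‖z‖) := by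
              rw [add_sub_cancel_left, sub_sub_cancel_left, abs_neg, abs_of_pos hτ.1, map_add]
              have i1 := disp_le (β := β) hMc hβ hβ1.le hτ.1.le z
              have i2 : ‖M y‖ ^ β ≤ τ ^ (β/2) := (Real.rpow_le_rpow (norm_nonneg _) hMy hβ.le).trans (rp' τ hτr.le)
              have i3 : ‖M y + M (Real.sqrt (2*τ) • z)‖ ^ β ≤ ‖M y‖ ^ β + ‖M (Real.sqrt (2*τ) • z)‖ ^ β :=
                (Real.rpow_le_rpow (norm_nonneg _) (norm_add_le _ _) hβ.le).trans (Real.rpow_add_le_add_rpow (norm_nonneg _) (norm_nonneg _) hβ.le hβ1.le)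
              have i4 : τ ^ (β/2) ≤ c * τ ^ (β/2) * (1 + ‖z‖) := by
                have : 1 ≤ c * (1 + ‖z‖) := one_le_mul_of_one_le_of_one_le c1 (by linarith [norm_nonneg z])
                nlinarith
              linarith
            refine (Fz_dev h hβ hβ1.le hc hf hQ hH (hsl _).1 (hsl _).2 x0 _ hω).trans (le_of_eq ?_)
            rw [hDH, hL2]; ring
        have e3 : q t0 x0 - q t0 x1 = (Du (QP.h2 F) t0 0 - Du (QP.h2 F) t0 y1).bilinearComp Nn Nn := by
          rw [e1, e2]; ext v w; simp
        rw [e3]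
        refine (bilin_norm _ _ hNc).trans ((mul_le_mul_of_nonneg_right hq2 (by positivity)).trans ?_)
        have hrb : r ^ β = c ^ β * ‖x0 - x1‖ ^ β := Real.mul_rpow c0 hρ.le
        have hn2 : ‖x0 - x1‖ ^ β ≤ r0 ^ β := Real.rpow_le_rpow hρ.le hnear.le hβ.le
        have f1 : G * (4 * n * Q * c * c ^ β) * ‖x0 - x1‖ ^ β ≤ 1/2 := le_trans (mul_le_mul_of_nonneg_left hn2 (by positivity)) hr0'
        have f2 : cM n * (4/β + 2/(1-β)) * (L1 + L2) * r ^ β * c ^ 2 = (G * (6 * c * D) * H + (G * (4 * n * Q * c * c ^ β) * ‖x0 - x1‖ ^ β) * Hq) * ‖x0 - x1‖ ^ β := by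
          rw [hL1, hL2, hrb, hG]; ring
        rw [f2]
        refine mul_le_mul_of_nonneg_right ?_ hρβ.le
        have f3 := mul_le_mul_of_nonneg_right f1 hHq
        have f4 : 0 ≤ 2 * C0 / r0 ^ β * H := by positivity
        rw [hC1, add_mul]; linarith
      rcases le_or_gt t 0 with ht | ht
      · rw [h.qzero ht, h.qzero ht, sub_self, norm_zero]; positivity
      rcases le_or_gt t T with ht' | ht'
      · exact main t ⟨ht, ht'⟩
      · rw [h.qhalt ht'.le]; exact main T ⟨hT, le_rfl⟩
  intro t x y
  refine (key (t, x, y)).trans (le_of_eq ?_)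
  simp only [w]; ring
end QP

namespace QP
open MeasureTheory Filter Topology Metric
variable {n : ℕ}

lemma HB.mono {G : Type*} [NormedAddCommGroup G] {β K H K' H' : ℝ} {f : ℝ → ES n → G} (h : HB β K H f) (h1 : K ≤ K') (h2 : H ≤ H') : HB β K' H' f :=
  ⟨h.cont, fun t x => (h.bd t x).trans h1, fun t x y => (h.hol t x y).trans (mul_le_mul_of_nonneg_right h2 (by positivity))⟩

/-- linear solvability with estimates -/
def Solv (T β : ℝ) (S : ℝ → ES n → (ES n →L[ℝ] ES n)) (b : ℝ → ES n → ES n) : Prop :=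
  ∀ (A : ℝ) (f : ℝ → ES n → ℝ), 0 ≤ A → HB β A A f → ∃ u p q, Reg T β u p q ∧ Pde T S b f u p q

lemma Lop_tsum {S : ES n →L[ℝ] ES n} {q : ℕ → Bil n} (h : Summable q) : Lop S (∑' k, q k) = ∑' k, Lop S (q k) := by
  have := (LopL S).map_tsum h
  simpa only [LopL_apply] using this

lemma geom_summ (A : ℝ) : Summable fun k : ℕ => A * (1/2)^k := summable_geometric_two.mul_left A

/-- series lemma -/
lemma series_sol {T β : ℝ} {S0 S1 : ℝ → ES n → (ES n →L[ℝ] ES n)} {b0 b1 : ℝ → ES n → ES n}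
    {f : ℝ → ES n → ℝ} {F u : ℕ → ℝ → ES n → ℝ} {p : ℕ → ℝ → ES n → (ES n →L[ℝ] ℝ)} {q : ℕ → ℝ → ES n → Bil n} {ν Λ Q B : ℝ} (hν : 0 ≤ ν) (hΛ : 0 ≤ Λ)
    (hB : 0 ≤ B)
    (ell : ∀ t x, Ell ν Λ (S0 t x)) (bb : ∀ t x, ‖b0 t x‖ ≤ Q)
    (hR : ∀ k, Reg T β (u k) (p k) (q k)) (hP : ∀ k, Pde T S0 b0 (F k) (u k) (p k) (q k)) (hF0 : F 0 = f)
    (hFs : ∀ k t x, F (k+1) t x = Lop (S1 t x - S0 t x) (q k t x) + p k t x (b1 t x - b0 t x))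
    (hFb : ∀ k t x, |F k t x| ≤ B * (1/2)^k)
    (hu : ∀ k t x, |u k t x| ≤ B * (1/2)^k) (hp : ∀ k t x, ‖p k t x‖ ≤ B * (1/2)^k) (hq : ∀ k t x, ‖q k t x‖ ≤ B * (1/2)^k)
    (hh : ∀ k t x y, ‖q k t x - q k t y‖ ≤ B * (1/2)^k * ‖x - y‖ ^ β) :
    ∃ u p q, Reg T β u p q ∧ Pde T S1 b1 f u p q := by
  have hg := geom_summ B
  have su : ∀ t x, Summable fun k => u k t x := fun t x => Summable.of_norm_bounded hg fun k => hu k t x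
  have sp : ∀ t x, Summable fun k => p k t x := fun t x => Summable.of_norm_bounded hg fun k => hp k t x
  have sq : ∀ t x, Summable fun k => q k t x := fun t x => Summable.of_norm_bounded hg fun k => hq k t x
  have sF : ∀ t x, Summable fun k => F k t x := fun t x => Summable.of_norm_bounded hg fun k => hFb k t x
  have tb : ∀ {G : Type} [NormedAddCommGroup G] [NormedSpace ℝ G] {a : ℕ → G} {c : ℝ}, (∀ k, ‖a k‖ ≤ B * (1/2)^k * c) → ‖∑' k, a k‖ ≤ 2 * B * c := by
    intro G _ _ a c h
    have h1 : HasSum (fun k : ℕ => B * (1/2)^k * c) (2 * B * c) := by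
      have := (hasSum_geometric_two.mul_left B).mul_right c
      rwa [mul_comm B 2] at this
    exact tsum_of_norm_bounded h1 h
  refine ⟨fun t x => ∑' k, u k t x, fun t x => ∑' k, p k t x, fun t x => ∑' k, q k t x, ⟨?_, ?_, ?_, ?_, ?_, ?_, ?_, ?_, ?_⟩, ?_⟩
  · exact continuous_tsum (fun k => (hR k).cu) hg (fun k a => hu k a.1 a.2)
  · exact continuous_tsum (fun k => (hR k).cp) hg (fun k a => hp k a.1 a.2)
  · exact continuous_tsum (fun k => (hR k).cq) hg (fun k a => hq k a.1 a.2)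
  · intro t x
    exact hasFDerivAt_tsum hg (fun k y => (hR k).du t y) (fun k y => hp k t y) (su t x) x
  · intro t x
    exact hasFDerivAt_tsum hg (fun k y => (hR k).dp t y) (fun k y => hq k t y) (sp t x) x
  · intro t ht x
    simp [fun k => (hR k).zero t ht x]
  · intro t ht
    ext x
    simp only [fun k => (hR k).halt t ht]
  · refine ⟨2 * B * 1, fun t x => ⟨?_, ?_, ?_⟩⟩
    · rw [← Real.norm_eq_abs]; exact tb fun k => by rw [mul_one]; exact hu k t x
    · exact tb fun k => by rw [mul_one]; exact hp k t x
    · exact tb fun k => by rw [mul_one]; exact hq k t x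
  · refine ⟨2 * B, by positivity, fun t x y => ?_⟩
    rw [← (sq t x).tsum_sub (sq t y)]
    exact tb fun k => hh k t x y
  · intro t ht x
    have hd : ∀ k s, s ∈ Ioo 0 T → HasDerivAt (fun s => u k s x) (Lop (S0 s x) (q k s x) + p k s x (b0 s x) + F k s x) s := fun k s hs => hP k s hs x
    have hQ0 : 0 ≤ Q := (norm_nonneg _).trans (bb 0 0)
    have h1 := hasDerivAt_tsum_of_isPreconnected (u := fun k : ℕ => (n * Λ + Q + 1) * (B * (1/2)^k)) (hg.mul_left _) isOpen_Ioo isPreconnected_Ioo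
      (fun k s hs => hd k s hs) (fun k s hs => ?_) ht (su t x) ht
    · refine h1.congr_deriv ?_
      have e1 : ∑' k, (Lop (S0 t x) (q k t x) + p k t x (b0 t x) + F k t x) = Lop (S0 t x) (∑' k, q k t x) + (∑' k, p k t x) (b0 t x) + ∑' k, F k t x := by
        have s1 : Summable fun k => Lop (S0 t x) (q k t x) := by
          have := (LopL (S0 t x)).summable (sq t x)
          simpa only [LopL_apply] using this
        have s2 : Summable fun k => p k t x (b0 t x) := (ContinuousLinearMap.apply ℝ ℝ (b0 t x)).summable (sp t x)
        rw [(s1.add s2).tsum_add (sF t x), s1.tsum_add s2, Lop_tsum (sq t x)]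
        congr 2
        exact ((ContinuousLinearMap.apply ℝ ℝ (b0 t x)).map_tsum (sp t x)).symm
      have e2 : ∑' k, F k t x = f t x + (Lop (S1 t x - S0 t x) (∑' k, q k t x) + (∑' k, p k t x) (b1 t x - b0 t x)) := by
        have s1 : Summable fun k => Lop (S1 t x - S0 t x) (q k t x) := by
          have := (LopL (S1 t x - S0 t x)).summable (sq t x)
          simpa only [LopL_apply] using this
        have s2 : Summable fun k => p k t x (b1 t x - b0 t x) := (ContinuousLinearMap.apply ℝ ℝ (b1 t x - b0 t x)).summable (sp t x)
        rw [(sF t x).tsum_eq_zero_add, hF0]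
        simp only [hFs]
        rw [s1.tsum_add s2, Lop_tsum (sq t x)]
        congr 2
        exact ((ContinuousLinearMap.apply ℝ ℝ (b1 t x - b0 t x)).map_tsum (sp t x)).symm
      rw [e1, e2, Lop_sub_left, map_sub]; ring
    · have a1 := (ell s x).Lop_abs hν (q k s x)
      have a2 := (p k s x).le_opNorm (b0 s x)
      have a3 := hFb k s x
      have a4 : n * Λ * ‖q k s x‖ ≤ n * Λ * (B * (1/2)^k) := mul_le_mul_of_nonneg_left (hq k s x) (by positivity)
      have a5 : ‖p k s x‖ * ‖b0 s x‖ ≤ (B * (1/2)^k) * Q := mul_le_mul (hp k s x) (bb s x) (norm_nonneg _) (by positivity)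
      rw [Real.norm_eq_abs] at a2 ⊢
      refine (abs_add_le _ _).trans ((add_le_add_left (abs_add_le _ _) _).trans ?_)
      linarith

lemma cont_step {T β ν Λ Q C ε : ℝ} (hT : 0 < T) (hβ : 0 < β) (hβ1 : β < 1) (hν : 0 < ν) (hΛ : 0 ≤ Λ) (hC : 0 ≤ C) (hε : 0 ≤ ε)
    (hεC : 5 * ε * C ≤ 1/2)
    {S0 S1 : ℝ → ES n → (ES n →L[ℝ] ES n)} {b0 b1 : ℝ → ES n → ES n} (hc : Coef ν Λ β Q S0 b0) (hc1 : Coef ν Λ β Q S1 b1)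
    (est1 : ∀ f u p q A, 0 ≤ A → HB β A A f → Reg T β u p q → Pde T S0 b0 f u p q → ∀ t x, ‖p t x‖ ≤ C * A ∧ ‖q t x‖ ≤ C * A)
    (est2 : ∀ f u p q A, 0 ≤ A → HB β A A f → Reg T β u p q → Pde T S0 b0 f u p q → ∀ t x y, ‖q t x - q t y‖ ≤ C * A * ‖x - y‖ ^ β)
    (dS : ∀ t x q, |Lop (S1 t x - S0 t x) q| ≤ ε * ‖q‖) (dS' : ∀ t x y q, |Lop ((S1 t x - S0 t x) - (S1 t y - S0 t y)) q| ≤ ε * ‖x - y‖ ^ β * ‖q‖)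
    (db : ∀ t x, ‖b1 t x - b0 t x‖ ≤ ε) (db' : ∀ t x y, ‖(b1 t x - b0 t x) - (b1 t y - b0 t y)‖ ≤ ε * ‖x - y‖ ^ β)
    (hs : Solv T β S0 b0) : Solv T β S1 b1 := by
  intro A f hA hf
  have step : ∀ (A : ℝ) (f : ℝ → ES n → ℝ), 0 ≤ A → HB β A A f → ∃ u p q, Reg T β u p q ∧ Pde T S0 b0 f u p q ∧ 
      HB β (A*(1/2)) (A*(1/2)) (fun t x => Lop (S1 t x - S0 t x) (q t x) + p t x (b1 t x - b0 t x)) := by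
    intro A f hA hf
    obtain ⟨u, p, q, hR, hP⟩ := hs A f hA hf
    have e1 := est1 f u p q A hA hf hR hP
    have e2 := est2 f u p q A hA hf hR hP
    have hCA : 0 ≤ C * A := by positivity
    have m := mul_le_mul_of_nonneg_right hεC hA
    refine ⟨u, p, q, hR, hP, ?_, fun t x => ?_, fun t x y => ?_⟩
    · have h1 := hR.cq
      have h2 := hR.cp
      exact (Lop_cont.comp ((hc1.cS.sub hc.cS).prodMk h1)).add (h2.clm_apply (hc1.cb.sub hc.cb))
    · have i1 := (dS t x (q t x)).trans (mul_le_mul_of_nonneg_left (e1 t x).2 hε)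
      have i2 := ((p t x).le_opNorm (b1 t x - b0 t x)).trans (mul_le_mul (e1 t x).1 (db t x) (norm_nonneg _) hCA)
      rw [Real.norm_eq_abs] at i2 ⊢
      refine (abs_add_le _ _).trans ?_
      have : 0 ≤ ε * (C * A) := by positivity
      linarith
    · have hr : 0 ≤ ‖x - y‖ ^ β := by positivity
      have e : (Lop (S1 t x - S0 t x) (q t x) + p t x (b1 t x - b0 t x)) - (Lop (S1 t y - S0 t y) (q t y) + p t y (b1 t y - b0 t y))
        = Lop ((S1 t x - S0 t x) - (S1 t y - S0 t y)) (q t x) + Lop (S1 t y - S0 t y) (q t x - q t y) + ((p t x - p t y) (b1 t x - b0 t x) + p t y ((b1 t x - b0 t x) - (b1 t y - b0 t y))) := by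
        simp only [Lop_sub_left, Lop_sub, _root_.sub_apply, map_sub]; ring
      have i1 := (dS' t x y (q t x)).trans (mul_le_mul_of_nonneg_left (e1 t x).2 (by positivity))
      have i2 := (dS t y (q t x - q t y)).trans (mul_le_mul_of_nonneg_left (e2 t x y) hε)
      have i5 := hR.plip hβ hβ1.le (fun x => (e1 t x).1) (fun x => (e1 t x).2) x y
      have i3 := ((p t x - p t y).le_opNorm (b1 t x - b0 t x)).trans (mul_le_mul i5 (db t x) (norm_nonneg _) (by positivity))
      have i4 := ((p t y).le_opNorm ((b1 t x - b0 t x) - (b1 t y - b0 t y))).trans (mul_le_mul (e1 t y).1 (db' t x y) (norm_nonneg _) hCA)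
      have m2 := mul_le_mul_of_nonneg_right m hr
      rw [e, Real.norm_eq_abs]
      rw [Real.norm_eq_abs] at i3 i4
      refine (abs_add_le _ _).trans ((add_le_add (abs_add_le _ _) (abs_add_le _ _)).trans ?_)
      linarith
  have hAk : ∀ k : ℕ, 0 ≤ A * (1/2)^k := fun k => by positivity
  choose U P W hU hPd hN using step
  let F : ∀ k : ℕ, {f : ℝ → ES n → ℝ // HB β (A * (1/2)^k) (A * (1/2)^k) f} := fun k =>
    Nat.rec ⟨f, by simpa using hf⟩ (fun k g => ⟨fun t x => Lop (S1 t x - S0 t x) (W _ g.1 (hAk k) g.2 t x) + P _ g.1 (hAk k) g.2 t x (b1 t x - b0 t x), by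
      have := hN _ g.1 (hAk k) g.2
      rwa [mul_assoc, ← pow_succ] at this⟩) k
  have hF0 : (F 0).1 = f := rfl
  have hFs : ∀ k t x, (F (k+1)).1 t x = Lop (S1 t x - S0 t x) (W _ (F k).1 (hAk k) (F k).2 t x) + P _ (F k).1 (hAk k) (F k).2 t x (b1 t x - b0 t x) := fun k t x => rfl
  have hB : ∀ k c, 0 ≤ c → c ≤ (1 + T + C) → ∀ a, a ≤ c * (A * (1/2)^k) → a ≤ ((1 + T + C) * A) * (1/2)^k := by
    intro k c hc0 hc1 a ha
    refine ha.trans ?_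
    rw [mul_assoc]
    exact mul_le_mul_of_nonneg_right hc1 (hAk k)
  refine series_sol (B := (1 + T + C) * A) (F := fun k => (F k).1) hν.le hΛ (by positivity) hc.ell hc.bb (fun k => hU _ _ (hAk k) (F k).2) (fun k => hPd _ _ (hAk k) (F k).2) hF0 hFs
    (fun k t x => hB k 1 zero_le_one (by linarith) _ (by rw [one_mul]; exact (F k).2.bd t x)) (fun k t x => hB k T hT.le (by linarith) _ ?_) 
    (fun k t x => hB k C hC (by linarith) _ ?_) (fun k t x => hB k C hC (by linarith) _ ?_) (fun k t x y => ?_)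
  · have hR := hU _ _ (hAk k) (F k).2
    have := sup_le hν.le hT (F k).2.bd hc.ell hc.bb hR (hPd _ _ (hAk k) (F k).2)
    have main : ∀ s ∈ Icc 0 T, |U _ _ (hAk k) (F k).2 s x| ≤ T * (A * (1/2)^k) := by
      intro s hs
      refine (this s x).trans ?_
      rw [max_eq_left hs.1, mul_comm]
      exact mul_le_mul_of_nonneg_right hs.2 (hAk k)
    rcases le_or_gt t 0 with ht | ht
    · rw [hR.zero t ht, abs_zero]; exact mul_nonneg hT.le (hAk k)
    rcases le_or_gt t T with ht' | ht'
    · exact main t ⟨ht.le, ht'⟩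
    · rw [hR.halt t ht'.le]; exact main T ⟨hT.le, le_rfl⟩
  · exact (est1 _ _ _ _ _ (hAk k) (F k).2 (hU _ _ (hAk k) (F k).2) (hPd _ _ (hAk k) (F k).2) t x).1
  · exact (est1 _ _ _ _ _ (hAk k) (F k).2 (hU _ _ (hAk k) (F k).2) (hPd _ _ (hAk k) (F k).2) t x).2
  · refine (est2 _ _ _ _ _ (hAk k) (F k).2 (hU _ _ (hAk k) (F k).2) (hPd _ _ (hAk k) (F k).2) t x y).trans ?_
    refine mul_le_mul_of_nonneg_right (hB k C hC (by linarith) _ le_rfl) (by positivity)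

/-- linear theory -/
theorem linear_solv {T β ν Λ Q : ℝ} (hT : 0 < T) (hβ : 0 < β) (hβ1 : β < 1) (hν : 0 < ν) (hQ : 0 ≤ Q) (hΛ : 0 ≤ Λ)
    {S : ℝ → ES n → (ES n →L[ℝ] ES n)} {b : ℝ → ES n → ES n} (hc : Coef ν Λ β Q S b) : Solv T β S b := by
  set ν' := min ν 1
  set Λ' := max Λ 1
  have hν' : 0 < ν' := lt_min hν zero_lt_one
  have hΛ' : 0 ≤ Λ' := hΛ.trans (le_max_left _ _)
  obtain ⟨C1, hC1, est1⟩ := apriori_sup n T hT hβ hβ1 hν' hQ hΛ'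
  obtain ⟨C2, hC2, est2⟩ := apriori_hol n T hT hβ hβ1 hν' hQ hΛ'
  set C := max C1 C2
  have hC : 0 ≤ C := hC1.trans (le_max_left _ _)
  let Sj : ℝ → ℝ → ES n → (ES n →L[ℝ] ES n) := fun r t x => 1 + r • (S t x - 1)
  let bj : ℝ → ℝ → ES n → ES n := fun r t x => r • b t x
  have hcj : ∀ r ∈ Icc (0:ℝ) 1, Coef ν' Λ' β Q (Sj r) (bj r) := by
    intro r hr
    have cS := hc.cS
    have cb := hc.cb
    refine ⟨continuous_const.add ((cS.sub continuous_const).const_smul r), cb.const_smul r, fun t x => ⟨fun v w => ?_, fun v => ?_, fun v => ?_⟩, fun t x => ?_, fun t x s y => ?_, fun t x y => ?_⟩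
    · have := (hc.ell t x).sym v w
      simp only [Sj, _root_.add_apply, _root_.smul_apply, _root_.sub_apply, one_apply_eq_self, inner_add_left, inner_add_right, inner_smul_left, inner_smul_right, inner_sub_left, inner_sub_right, this]
      simp
    · have h1 := (hc.ell t x).lo v
      have h2 : ν' * ‖v‖^2 ≤ ν * ‖v‖^2 := mul_le_mul_of_nonneg_right (min_le_left _ _) (by positivity)
      have h3 : ν' * ‖v‖^2 ≤ 1 * ‖v‖^2 := mul_le_mul_of_nonneg_right (min_le_right _ _) (by positivity)
      simp only [Sj, _root_.add_apply, _root_.smul_apply, _root_.sub_apply, one_apply_eq_self, inner_add_left, inner_smul_left, inner_sub_left, real_inner_self_eq_norm_sq]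
      simp only [conj_trivial]
      nlinarith [hr.1, hr.2, mul_le_mul_of_nonneg_left (h2.trans h1) hr.1, mul_le_mul_of_nonneg_left h3 (sub_nonneg.2 hr.2)]
    · have h1 := (hc.ell t x).hi v
      have h2 : Λ * ‖v‖^2 ≤ Λ' * ‖v‖^2 := mul_le_mul_of_nonneg_right (le_max_left _ _) (by positivity)
      have h3 : 1 * ‖v‖^2 ≤ Λ' * ‖v‖^2 := mul_le_mul_of_nonneg_right (le_max_right _ _) (by positivity)
      simp only [Sj, _root_.add_apply, _root_.smul_apply, _root_.sub_apply, one_apply_eq_self, inner_add_left, inner_smul_left, inner_sub_left, real_inner_self_eq_norm_sq]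
      simp only [conj_trivial]
      nlinarith [hr.1, hr.2, mul_le_mul_of_nonneg_left (h1.trans h2) hr.1, mul_le_mul_of_nonneg_left h3 (sub_nonneg.2 hr.2)]
    · simp only [bj]
      rw [norm_smul, Real.norm_eq_abs, abs_of_nonneg hr.1]
      have := hc.bb t x
      nlinarith [norm_nonneg (b t x), hr.1, hr.2]
    · have e : Sj r t x - Sj r s y = r • (S t x - S s y) := by simp only [Sj]; module
      rw [e, norm_smul, Real.norm_eq_abs, abs_of_nonneg hr.1]
      have := hc.hS t x s y
      nlinarith [norm_nonneg (S t x - S s y), hr.1, hr.2]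
    · have e : bj r t x - bj r t y = r • (b t x - b t y) := by simp only [bj]; module
      rw [e, norm_smul, Real.norm_eq_abs, abs_of_nonneg hr.1]
      have := hc.hb t x y
      nlinarith [norm_nonneg (b t x - b t y), hr.1, hr.2]
  have base : Solv T β (Sj 0) (bj 0) := by
    intro A f hA hf
    have h := heat_sol hT hβ hβ1 hA hf
    refine ⟨_, _, _, h.1, ?_⟩
    have e1 : Sj 0 = fun _ _ => 1 := by
      ext1 t; ext1 x
      show (1 : ES n →L[ℝ] ES n) + (0:ℝ) • (S t x - 1) = 1
      module
    have e2 : bj 0 = fun _ _ => 0 := by ext1 t; ext1 x; simp [bj]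
    rw [e1, e2]; exact h.2
  set D := n * (Λ' + 1) + n * Q + Q + 1 with hD
  have hD0 : 0 < D := by positivity
  set ε := 1 / (10 * (C + 1)) with hε
  have hε0 : 0 < ε := by positivity
  obtain ⟨J, hJ⟩ := exists_nat_gt (D / ε)
  have hJ0 : (0:ℝ) < J := lt_trans (by positivity) hJ
  have hDJ : D / J ≤ ε := by
    rw [div_lt_iff₀ hε0] at hJ
    rw [div_le_iff₀ hJ0]; linarith
  have hs0 : ∀ a, 0 ≤ a → a ≤ D → 1 / (J:ℝ) * a ≤ ε := fun a h0 h1 => by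
    refine le_trans ?_ hDJ
    rw [div_mul_eq_mul_div, one_mul]; gcongr
  have main : ∀ j : ℕ, j ≤ J → Solv T β (Sj (j/J)) (bj (j/J)) := by
    intro j
    induction j with
    | zero => intro _; simpa using base
    | succ j ih =>
      intro hj
      have hj' : (j:ℝ) + 1 ≤ J := by exact_mod_cast hj
      have m0 : (j:ℝ)/J ∈ Icc (0:ℝ) 1 := ⟨by positivity, by rw [div_le_one hJ0]; linarith⟩
      have m1 : ((j+1:ℕ):ℝ)/J ∈ Icc (0:ℝ) 1 := ⟨by positivity, by rw [div_le_one hJ0]; push_cast; linarith⟩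
      have er : ((j+1:ℕ):ℝ)/J - (j:ℝ)/J = 1 / J := by push_cast; ring
      have eS : ∀ t x, Sj (((j+1:ℕ):ℝ)/J) t x - Sj ((j:ℝ)/J) t x = (1/(J:ℝ)) • (S t x - 1) := by
        intro t x; rw [← er]; simp only [Sj]; module
      have eb : ∀ t x, bj (((j+1:ℕ):ℝ)/J) t x - bj ((j:ℝ)/J) t x = (1/(J:ℝ)) • (b t x) := by
        intro t x; rw [← er]; simp only [bj]; module
      have one_ell : Ell 0 1 (1 : ES n →L[ℝ] ES n) := 
        ⟨fun v w => rfl, fun v => by simp, fun v => by simp [real_inner_self_eq_norm_sq]⟩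
      have hJi : (0:ℝ) ≤ 1 / J := by positivity
      have hnQ : 0 ≤ n * Q := by positivity
      have hnL : 0 ≤ n * (Λ' + 1) := by positivity
      refine cont_step hT hβ hβ1 hν' hΛ' hC hε0.le ?_ (hcj _ m0) (hcj _ m1) ?_ ?_ ?_ ?_ ?_ ?_ (ih (by omega))
      · rw [hε]
        rw [show 5 * (1 / (10 * (C + 1))) * C = C / (2 * (C+1)) by field_simp; ring, div_le_div_iff₀ (by positivity) (by norm_num)]
        linarith
      · intro f u p q A hA hf hR hP t x
        have := est1 _ _ f u p q A A hA (hcj _ m0) hf hR hP t x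
        have h2 : C1 * A ≤ C * A := mul_le_mul_of_nonneg_right (le_max_left _ _) hA
        exact ⟨this.1.trans h2, this.2.trans h2⟩
      · intro f u p q A hA hf hR hP t x y
        refine (est2 _ _ f u p q A A hA (hcj _ m0) hf hR hP t x y).trans ?_
        exact mul_le_mul_of_nonneg_right (mul_le_mul_of_nonneg_right (le_max_right _ _) hA) (by positivity)
      · intro t x q
        rw [eS, Lop_smul_left, Lop_sub_left, abs_mul, abs_of_nonneg hJi]
        have h1 := (hc.ell t x).Lop_abs hν.le q
        have h2 := one_ell.Lop_abs le_rfl q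
        have h3 : |Lop (S t x) q - Lop 1 q| ≤ n * (Λ' + 1) * ‖q‖ := by
          refine (abs_sub _ _).trans ((add_le_add h1 h2).trans ?_)
          rw [← add_mul, ← mul_add]
          exact mul_le_mul_of_nonneg_right (mul_le_mul_of_nonneg_left (by linarith [le_max_left Λ 1]) (by positivity)) (norm_nonneg _)
        calc _ ≤ 1 / (J:ℝ) * (n * (Λ' + 1) * ‖q‖) := mul_le_mul_of_nonneg_left h3 hJi
          _ = (1 / (J:ℝ) * (n * (Λ' + 1))) * ‖q‖ := by ring
          _ ≤ _ := mul_le_mul_of_nonneg_right (hs0 _ hnL (by rw [hD]; linarith)) (norm_nonneg _)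
      · intro t x y q
        have e : (1/(J:ℝ)) • (S t x - 1) - (1/(J:ℝ)) • (S t y - 1) = (1/(J:ℝ)) • (S t x - S t y) := by module
        rw [eS, eS, e, Lop_smul_left, abs_mul, abs_of_nonneg hJi]
        have h1 := abs_Lop_le (S t x - S t y) q
        have h2 := hc.hS t x t y
        rw [sub_self, abs_zero, Real.zero_rpow (by positivity), add_zero] at h2
        have h3 : (n:ℝ) * ‖S t x - S t y‖ * ‖q‖ ≤ n * (Q * ‖x - y‖ ^ β) * ‖q‖ := by gcongr
        calc _ ≤ 1 / (J:ℝ) * (n * (Q * ‖x - y‖ ^ β) * ‖q‖) := mul_le_mul_of_nonneg_left (h1.trans h3) hJi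
          _ = (1 / (J:ℝ) * (n * Q)) * (‖x - y‖ ^ β * ‖q‖) := by ring
          _ ≤ ε * (‖x - y‖ ^ β * ‖q‖) := mul_le_mul_of_nonneg_right (hs0 _ hnQ (by rw [hD]; linarith)) (by positivity)
          _ = _ := by ring
      · intro t x
        rw [eb, norm_smul, Real.norm_eq_abs, abs_of_nonneg hJi]
        exact (mul_le_mul_of_nonneg_left (hc.bb t x) hJi).trans (hs0 _ hQ (by rw [hD]; linarith))
      · intro t x y
        rw [eb, eb, ← smul_sub, norm_smul, Real.norm_eq_abs, abs_of_nonneg hJi]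
        refine (mul_le_mul_of_nonneg_left (hc.hb t x y) hJi).trans ?_
        rw [← mul_assoc]
        exact mul_le_mul_of_nonneg_right (hs0 _ hQ (by rw [hD]; linarith)) (by positivity)
  have := main J le_rfl
  rw [div_self hJ0.ne'] at this
  have e1 : Sj 1 = S := by ext1 t; ext1 x; simp [Sj]
  have e2 : bj 1 = b := by ext1 t; ext1 x; simp [bj]
  rwa [e1, e2] at this
end QP

namespace QP
open MeasureTheory Filter Topology Metric
variable {n : ℕ}

lemma det_le_norm_pow (A : ES n →L[ℝ] ES n) : |(A : ES n →ₗ[ℝ] ES n).det| ≤ ‖A‖ ^ n := by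
  have h1 := Measure.addHaar_image_linearMap (volume : Measure (ES n)) (A : ES n →ₗ[ℝ] ES n) (closedBall 0 1)
  have h2 : (A : ES n →ₗ[ℝ] ES n) '' closedBall 0 1 ⊆ closedBall 0 ‖A‖ := by
    rintro _ ⟨x, hx, rfl⟩
    rw [mem_closedBall_zero_iff] at hx ⊢
    calc ‖A x‖ ≤ ‖A‖ * ‖x‖ := A.le_opNorm x
      _ ≤ ‖A‖ * 1 := by gcongr
      _ = _ := mul_one _
  have h3 := measure_mono (μ := (volume : Measure (ES n))) h2
  rw [h1, Measure.addHaar_closedBall _ _ (norm_nonneg A), Measure.addHaar_closedBall _ _ zero_le_one] at h3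
  have e : Module.finrank ℝ (ES n) = n := by simp
  rw [e, one_pow, ENNReal.ofReal_one, one_mul] at h3
  have hb : (volume : Measure (ES n)) (ball 0 1) ≠ 0 := (measure_ball_pos _ _ one_pos).ne'
  have hb' : (volume : Measure (ES n)) (ball 0 1) ≠ ⊤ := measure_ball_lt_top.ne
  rw [ENNReal.mul_le_mul_iff_left hb hb'] at h3
  exact (ENNReal.ofReal_le_ofReal_iff (by positivity)).1 h3

lemma det_bd (L : (ℝ × ES n) →L[ℝ] (ℝ × ES n)) (c : ℝ) (e z : ES n) (A : ES n →L[ℝ] ES n)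
    (hL : ∀ τ y, L (τ, y) = (c * τ - inner ℝ z (τ • e + A y), τ • e + A y)) :
    |L.det| ≤ |c| * ‖A‖ ^ n := by
  let T1 : (ℝ × ES n) →ₗ[ℝ] (ℝ × ES n) :=
    LinearMap.transvection (-((innerSL ℝ z : ES n →ₗ[ℝ] ℝ).comp (LinearMap.snd ℝ ℝ (ES n)))) ((1:ℝ), (0 : ES n))
  let L2 : (ℝ × ES n) →ₗ[ℝ] (ℝ × ES n) :=
    (c • LinearMap.fst ℝ ℝ (ES n)).prod ((LinearMap.fst ℝ ℝ (ES n)).smulRight e + (A : ES n →ₗ[ℝ] ES n).comp (LinearMap.snd ℝ ℝ (ES n)))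
  have hL2 : ∀ τ y, L2 (τ, y) = (c * τ, τ • e + A y) := fun τ y => by simp [L2]
  have h1 : (L : (ℝ × ES n) →ₗ[ℝ] (ℝ × ES n)) = T1.comp L2 := by
    apply LinearMap.ext; rintro ⟨τ, y⟩
    rw [LinearMap.comp_apply, hL2]
    show L (τ, y) = _
    rw [hL]
    simp [T1, LinearMap.transvection.apply, sub_eq_add_neg]
  have hT1 : T1.det = 1 := by
    simp [T1, LinearMap.transvection.det]
  have e1 : L.det = L2.det := by
    show (L : (ℝ × ES n) →ₗ[ℝ] (ℝ × ES n)).det = _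
    rw [h1, LinearMap.det_comp, hT1, one_mul]
  rw [e1]
  by_cases hc : c = 0
  · have : L2.det = 0 := by
      by_contra h
      have hu : IsUnit L2.det := isUnit_iff_ne_zero.2 h
      have := (LinearMap.equivOfDetNeZero L2 h).surjective ((1:ℝ), (0 : ES n))
      obtain ⟨⟨τ, y⟩, hy⟩ := this
      have h4 : L2 (τ, y) = (1, 0) := hy
      rw [hL2, hc] at h4
      simp at h4
    rw [this, abs_zero]; positivity
  · let T2 : (ℝ × ES n) →ₗ[ℝ] (ℝ × ES n) :=
      LinearMap.transvection (c⁻¹ • LinearMap.fst ℝ ℝ (ES n)) ((0:ℝ), e)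
    have h2 : L2 = T2.comp ((c • (LinearMap.id : ℝ →ₗ[ℝ] ℝ)).prodMap (A : ES n →ₗ[ℝ] ES n)) := by
      apply LinearMap.ext; rintro ⟨τ, y⟩
      rw [hL2]
      simp only [T2, LinearMap.comp_apply, LinearMap.prodMap_apply, LinearMap.transvection.apply]
      simp [hc, add_comm]
    have hT2 : T2.det = 1 := by simp [T2, LinearMap.transvection.det]
    rw [h2, LinearMap.det_comp, hT2, one_mul, LinearMap.det_prodMap, abs_mul]
    have : (c • (LinearMap.id : ℝ →ₗ[ℝ] ℝ)).det = c := by simp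
    rw [this]
    exact mul_le_mul_of_nonneg_left (det_le_norm_pow A) (abs_nonneg _)

/-- norm bound of a symmetric nonpositive form -/
lemma neg_norm {q : Bil n} {κ : ℝ} (hκ : 0 ≤ κ) (hs : ∀ v w, q v w = q w v) (hq : ∀ v, q v v ≤ 0)
    (hk : ∀ v, ‖v‖ = 1 → -κ ≤ q v v) : ‖q‖ ≤ κ := by
  have hk' : ∀ v, -(κ * ‖v‖ ^ 2) ≤ q v v := by
    intro v
    by_cases hv : v = 0
    · simp [hv]
    have h0 : 0 < ‖v‖ := norm_pos_iff.2 hv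
    have := hk (‖v‖⁻¹ • v) (by rw [norm_smul, norm_inv, norm_norm, inv_mul_cancel₀ h0.ne'])
    simp only [map_smul, _root_.smul_apply, smul_eq_mul] at this
    have h2 : ‖v‖⁻¹ * (‖v‖⁻¹ * q v v) = q v v / ‖v‖ ^ 2 := by field_simp
    rw [h2, le_div_iff₀ (by positivity)] at this
    linarith
  refine ContinuousLinearMap.opNorm_le_of_unit_norm hκ fun v hv => ?_
  refine ContinuousLinearMap.opNorm_le_of_unit_norm hκ fun w hw => ?_
  have a1 := hq (v + w)
  have a2 := hq (v - w)
  have a3 := hk' (v + w)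
  have a4 := hk' (v - w)
  have p1 : ‖v + w‖ ^ 2 ≤ 4 := by
    have := norm_add_le v w; rw [hv, hw] at this; nlinarith [norm_nonneg (v + w)]
  have p2 : ‖v - w‖ ^ 2 ≤ 4 := by
    have := norm_sub_le v w; rw [hv, hw] at this; nlinarith [norm_nonneg (v - w)]
  have p3 := mul_le_mul_of_nonneg_left p1 hκ
  have p4 := mul_le_mul_of_nonneg_left p2 hκ
  simp only [map_add, map_sub, _root_.add_apply, _root_.sub_apply] at a1 a2 a3 a4
  rw [hs w v] at a1 a2 a3 a4
  rw [Real.norm_eq_abs, abs_le]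
  constructor <;> linarith
end QP

namespace QP
open MeasureTheory Filter Topology Metric
variable {n : ℕ}

lemma contact {t0 t1 R M h : ℝ} {x0 xh : ES n} (hR : 0 < R) (h10 : t1 ≤ t0) (hM : 0 < M)
    {v : ℝ → ES n → ℝ} {p : ℝ → ES n → (ES n →L[ℝ] ℝ)} {q : ℝ → ES n → Bil n} {vt : ℝ → ES n → ℝ}
    (cv : Continuous (Function.uncurry v))
    (hv : ∀ t x, HasFDerivAt (v t) (p t x) x) (hp : ∀ t x, HasFDerivAt (p t) (q t x) x)
    (hvt : ∀ t x, HasDerivAt (fun s => v s x) (vt t x) t)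
    (hbd : ∀ t ∈ Icc t1 t0, ∀ x ∈ closedBall x0 R, (t = t1 ∨ dist x x0 = R) → v t x ≤ 0)
    (hxh : xh ∈ closedBall x0 R) (hMv : M ≤ v t0 xh)
    (ξ : ES n →L[ℝ] ℝ) (hξ : ‖ξ‖ < M / (4 * R)) (hh1 : M / 4 < h) (hh2 : h < 3 * M / 4) :
    ∃ t ∈ Icc t1 t0, ∃ x ∈ closedBall x0 R, 0 < v t x ∧ 0 ≤ vt t x ∧ (∀ w, q t x w w ≤ 0) ∧
      p t x = ξ ∧ v t x - ξ (x - x0) = h := by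
  have hξx : ∀ x ∈ closedBall x0 R, |ξ (x - x0)| ≤ M / 4 := by
    intro x hx
    rw [mem_closedBall, dist_eq_norm] at hx
    calc |ξ (x - x0)| ≤ ‖ξ‖ * ‖x - x0‖ := ξ.le_opNorm _
      _ ≤ M / (4 * R) * R := by gcongr
      _ = M / 4 := by field_simp
  let ψ : ℝ × ES n → ℝ := fun a => v a.1 a.2 - ξ (a.2 - x0)
  have cψ : Continuous ψ := by
    have : Continuous fun a : ℝ × ES n => v a.1 a.2 := cv
    exact this.sub (ξ.continuous.comp (continuous_snd.sub continuous_const))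
  let K : Set (ℝ × ES n) := (Icc t1 t0 ×ˢ closedBall x0 R) ∩ {a | h ≤ ψ a}
  have hK : IsCompact K := (isCompact_Icc.prod (isCompact_closedBall _ _)).inter_right
    (isClosed_le continuous_const cψ)
  have hne : K.Nonempty := by
    refine ⟨(t0, xh), ⟨⟨h10, le_rfl⟩, hxh⟩, ?_⟩
    show h ≤ v t0 xh - ξ (xh - x0)
    have := hξx xh hxh
    linarith [(abs_le.1 this).2]
  obtain ⟨⟨t, x⟩, ⟨⟨ht, hx⟩, hψ⟩, hmin⟩ := hK.exists_isMinOn hne continuous_fst.continuousOn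
  simp only at ht hx
  have hψ' : h ≤ v t x - ξ (x - x0) := hψ
  have hpos : 0 < v t x := by
    have := hξx x hx
    linarith [(abs_le.1 this).1]
  have htne : t ≠ t1 := fun e => absurd (hbd t ht x hx (Or.inl e)) (not_le.2 hpos)
  have hxne : dist x x0 ≠ R := fun e => absurd (hbd t ht x hx (Or.inr e)) (not_le.2 hpos)
  have htl : t1 < t := lt_of_le_of_ne ht.1 (Ne.symm htne)
  have hxl : dist x x0 < R := lt_of_le_of_ne hx hxne
  have hless : ∀ s ∈ Ico t1 t, ∀ y ∈ closedBall x0 R, v s y - ξ (y - x0) < h := by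
    intro s hs y hy
    by_contra hcon
    push Not at hcon
    have : t ≤ s := hmin (show (s, y) ∈ K from ⟨⟨⟨hs.1, hs.2.le.trans ht.2⟩, hy⟩, hcon⟩)
    exact absurd hs.2 (not_lt.2 this)
  have hev : ∀ᶠ s in 𝓝[<] t, s ∈ Ico t1 t := by
    filter_upwards [Ioo_mem_nhdsLT htl] with s hs using ⟨hs.1.le, hs.2⟩
  have hle : ∀ y ∈ closedBall x0 R, v t y - ξ (y - x0) ≤ h := by
    intro y hy
    have c1 : Continuous fun s => ψ (s, y) := cψ.comp (continuous_id.prodMk continuous_const)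
    refine le_of_tendsto (f := fun s => ψ (s, y)) (x := 𝓝[<] t) (c1.tendsto t |>.mono_left nhdsWithin_le_nhds) ?_
    filter_upwards [hev] with s hs using (hless s hs y hy).le
  have heq : v t x - ξ (x - x0) = h := le_antisymm (hle x hx) hψ'
  have hd : ∀ y, HasFDerivAt (fun y => v t y - ξ (y - x0)) (p t y - ξ) y := by
    intro y
    exact (hv t y).sub (ξ.hasFDerivAt.comp y ((hasFDerivAt_id y).sub_const x0) |>.congr_fderiv (by ext; simp))
  have hd2 : HasFDerivAt (fun y => p t y - ξ) (q t x) x := (hp t x).sub_const ξ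
  have hlm : IsLocalMax (fun y => v t y - ξ (y - x0)) x := by
    filter_upwards [isOpen_ball.mem_nhds (show x ∈ ball x0 R from hxl)] with y hy
    rw [heq]; exact hle y (ball_subset_closedBall hy)
  obtain ⟨e1, e2⟩ := second_test hd hd2 hlm
  refine ⟨t, ht, x, hx, hpos, ?_, e2, sub_eq_zero.1 e1, heq⟩
  have hs := (hvt t x).hasDerivWithinAt (s := Iio t)
  rw [hasDerivWithinAt_iff_tendsto_slope' (by simp)] at hs
  refine ge_of_tendsto hs ?_
  filter_upwards [hev, self_mem_nhdsWithin] with s hs1 hs2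
  rw [slope_def_field]
  have := hless s hs1 x hx
  exact div_nonneg_of_nonpos (by linarith) (by have : s < t := hs2; linarith)

set_option maxHeartbeats 1000000 in
lemma abp_smooth {t0 t1 R M B F ν Λ : ℝ} {x0 xh : ES n} (hR : 0 < R) (h10 : t1 ≤ t0) (hM : 0 < M)
    (hν : 0 < ν) (hB : 0 ≤ B)
    {v : ℝ → ES n → ℝ} {p : ℝ → ES n → (ES n →L[ℝ] ℝ)} {q : ℝ → ES n → Bil n} {vt : ℝ → ES n → ℝ}
    {pt : ℝ → ES n → (ES n →L[ℝ] ℝ)} {S : ℝ → ES n → (ES n →L[ℝ] ES n)} {b : ℝ → ES n → ES n}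
    (cv : Continuous (Function.uncurry v)) (cp : Continuous (Function.uncurry p))
    (cq : Continuous (Function.uncurry q)) (cvt : Continuous (Function.uncurry vt)) 
    (cpt : Continuous (Function.uncurry pt))
    (hv : ∀ t x, HasFDerivAt (v t) (p t x) x) (hp : ∀ t x, HasFDerivAt (p t) (q t x) x)
    (hvt : ∀ t x, HasDerivAt (fun s => v s x) (vt t x) t)
    (hpt : ∀ t x, HasDerivAt (fun s => p s x) (pt t x) t)
    (hS : ∀ t x, Ell ν Λ (S t x)) (hb : ∀ t x, ‖b t x‖ ≤ B)
    (hin : ∀ t ∈ Icc t1 t0, ∀ x ∈ closedBall x0 R, vt t x ≤ Lop (S t x) (q t x) + p t x (b t x) + F)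
    (hbd : ∀ t ∈ Icc t1 t0, ∀ x ∈ closedBall x0 R, (t = t1 ∨ dist x x0 = R) → v t x ≤ 0)
    (hxh : xh ∈ closedBall x0 R) (hMv : M ≤ v t0 xh) :
    ENNReal.ofReal (M / 2) * (volume : Measure (ES n)) (ball 0 (M / (4 * R))) ≤
      ENNReal.ofReal ((F + B * (M / (4 * R))) * ((F + B * (M / (4 * R))) / ν) ^ n) *
        (volume : Measure (ℝ × ES n)) {a | a.1 ∈ Icc t1 t0 ∧ a.2 ∈ closedBall x0 R ∧ 0 < v a.1 a.2} := by
  set K := F + B * (M / (4 * R)) with hK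
  let J : (ES n →L[ℝ] ℝ) →L[ℝ] ES n := 
    LinearMap.mkContinuous
      { toFun := fun l => (InnerProductSpace.toDual ℝ (ES n)).symm l
        map_add' := fun a b => map_add _ a b
        map_smul' := fun r a => by simp } 1
      (fun l => by
        rw [one_mul]; exact ((InnerProductSpace.toDual ℝ (ES n)).symm.norm_map l).le)
  have hJ : ∀ (l : ES n →L[ℝ] ℝ) y, inner ℝ (J l) y = l y := fun l y =>
    InnerProductSpace.toDual_symm_apply
  have hJn : ∀ l : ES n →L[ℝ] ℝ, ‖J l‖ = ‖l‖ := fun l => (InnerProductSpace.toDual ℝ (ES n)).symm.norm_map l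
  have cv' : Continuous fun a : ℝ × ES n => v a.1 a.2 := cv
  have cp' : Continuous fun a : ℝ × ES n => p a.1 a.2 := cp
  have cq' : Continuous fun a : ℝ × ES n => q a.1 a.2 := cq
  have cvt' : Continuous fun a : ℝ × ES n => vt a.1 a.2 := cvt
  let Φ : ℝ × ES n → ℝ × ES n := fun a => (v a.1 a.2 - p a.1 a.2 (a.2 - x0), J (p a.1 a.2))
  let Φ' : ℝ × ES n → (ℝ × ES n) →L[ℝ] (ℝ × ES n) := fun a =>
    (((ContinuousLinearMap.toSpanSingleton ℝ (vt a.1 a.2)).coprod (p a.1 a.2)) -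
      ((p a.1 a.2).comp (ContinuousLinearMap.snd ℝ ℝ (ES n)) +
        ((ContinuousLinearMap.toSpanSingleton ℝ (pt a.1 a.2)).coprod (q a.1 a.2)).flip (a.2 - x0))).prod
    (J.comp ((ContinuousLinearMap.toSpanSingleton ℝ (pt a.1 a.2)).coprod (q a.1 a.2)))
  have hΦ : ∀ a, HasFDerivAt Φ (Φ' a) a := by
    intro a
    have c1 : Continuous fun a : ℝ × ES n => ContinuousLinearMap.toSpanSingleton ℝ (vt a.1 a.2) :=
      (ContinuousLinearMap.toSpanSingletonCLE (𝕜 := ℝ) (E := ℝ)).continuous.comp cvt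
    have c2 : Continuous fun a : ℝ × ES n => ContinuousLinearMap.toSpanSingleton ℝ (pt a.1 a.2) :=
      (ContinuousLinearMap.toSpanSingletonCLE (𝕜 := ℝ) (E := ES n →L[ℝ] ℝ)).continuous.comp cpt
    have d1 : HasFDerivAt (fun a : ℝ × ES n => v a.1 a.2)
        ((ContinuousLinearMap.toSpanSingleton ℝ (vt a.1 a.2)).coprod (p a.1 a.2)) a :=
      (hasStrictFDerivAt_uncurry_coprod (f := v) (f₁ := fun t x => ContinuousLinearMap.toSpanSingleton ℝ (vt t x)) (f₂ := p) (u := a)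
        (Eventually.of_forall fun w => (hvt w.1 w.2).hasFDerivAt) (Eventually.of_forall fun w => hv w.1 w.2)
        c1.continuousAt cp.continuousAt).hasFDerivAt
    have d2 : HasFDerivAt (fun a : ℝ × ES n => p a.1 a.2)
        ((ContinuousLinearMap.toSpanSingleton ℝ (pt a.1 a.2)).coprod (q a.1 a.2)) a :=
      (hasStrictFDerivAt_uncurry_coprod (f := p) (f₁ := fun t x => ContinuousLinearMap.toSpanSingleton ℝ (pt t x)) (f₂ := q) (u := a)
        (Eventually.of_forall fun w => (hpt w.1 w.2).hasFDerivAt) (Eventually.of_forall fun w => hp w.1 w.2)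
        c2.continuousAt cq.continuousAt).hasFDerivAt
    have d3 : HasFDerivAt (fun a : ℝ × ES n => a.2 - x0) (ContinuousLinearMap.snd ℝ ℝ (ES n)) a :=
      hasFDerivAt_snd.sub_const x0
    exact (d1.sub (d2.clm_apply d3)).prodMk (J.hasFDerivAt.comp a d2)
  have hdet : ∀ a, |(Φ' a).det| ≤ |vt a.1 a.2| * ‖q a.1 a.2‖ ^ n := by
    intro a
    refine (det_bd (Φ' a) (vt a.1 a.2) (J (pt a.1 a.2)) (a.2 - x0) (J.comp (q a.1 a.2)) ?_).trans ?_
    · intro τ y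
      have e : inner ℝ (a.2 - x0) (τ • J (pt a.1 a.2) + J (q a.1 a.2 y)) = τ * pt a.1 a.2 (a.2 - x0) + q a.1 a.2 y (a.2 - x0) := by
        rw [real_inner_comm, inner_add_left, inner_smul_left, hJ, hJ]; simp
      simp only [ContinuousLinearMap.comp_apply]
      rw [e]
      simp [Φ']
      ring
    · refine mul_le_mul_of_nonneg_left (pow_le_pow_left₀ (norm_nonneg _) ?_ n) (abs_nonneg _)
      refine ContinuousLinearMap.opNorm_le_bound _ (norm_nonneg _) fun y => ?_
      rw [ContinuousLinearMap.comp_apply, hJn]; exact (q a.1 a.2).le_opNorm y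
  let G : Set (ℝ × ES n) := {a | a.1 ∈ Icc t1 t0 ∧ a.2 ∈ closedBall x0 R ∧ 0 < v a.1 a.2 ∧ 0 ≤ vt a.1 a.2 ∧
    (∀ w, q a.1 a.2 w w ≤ 0) ∧ ‖p a.1 a.2‖ ≤ M / (4 * R)}
  have hGm : MeasurableSet G := by
    have m1 : MeasurableSet {a : ℝ × ES n | a.1 ∈ Icc t1 t0} := (isClosed_Icc.preimage continuous_fst).measurableSet
    have m2 : MeasurableSet {a : ℝ × ES n | a.2 ∈ closedBall x0 R} := (isClosed_closedBall.preimage continuous_snd).measurableSet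
    have m3 : MeasurableSet {a : ℝ × ES n | 0 < v a.1 a.2} := (isOpen_lt continuous_const cv').measurableSet
    have m4 : MeasurableSet {a : ℝ × ES n | 0 ≤ vt a.1 a.2} := (isClosed_le continuous_const cvt').measurableSet
    have m5 : MeasurableSet {a : ℝ × ES n | ∀ w, q a.1 a.2 w w ≤ 0} := by
      rw [Set.ofPred_forall]
      refine (isClosed_iInter fun w => isClosed_le ?_ continuous_const).measurableSet
      exact (cq'.clm_apply continuous_const).clm_apply continuous_const
    have m6 : MeasurableSet {a : ℝ × ES n | ‖p a.1 a.2‖ ≤ M / (4 * R)} := (isClosed_le cp'.norm continuous_const).measurableSet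
    exact m1.inter (m2.inter (m3.inter (m4.inter (m5.inter m6))))
  have himg : Ioo (M / 4) (3 * M / 4) ×ˢ ball (0 : ES n) (M / (4 * R)) ⊆ Φ '' G := by
    rintro ⟨h, ζ⟩ ⟨hh, hζ⟩
    have hn : ‖InnerProductSpace.toDual ℝ (ES n) ζ‖ < M / (4 * R) := by
      rw [(InnerProductSpace.toDual ℝ (ES n)).norm_map]; exact mem_ball_zero_iff.1 hζ
    obtain ⟨t, ht, x, hx, g1, g2, g3, g4, g5⟩ := contact hR h10 hM cv hv hp hvt hbd hxh hMv
      (InnerProductSpace.toDual ℝ (ES n) ζ) hn hh.1 hh.2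
    refine ⟨(t, x), ⟨ht, hx, g1, g2, g3, ?_⟩, ?_⟩
    · show ‖p t x‖ ≤ _
      rw [g4]; exact hn.le
    · show (v t x - p t x (x - x0), J (p t x)) = (h, ζ)
      rw [g4, g5]
      congr 1
      exact (InnerProductSpace.toDual ℝ (ES n)).symm_apply_apply ζ
  have hdG : ∀ a ∈ G, ENNReal.ofReal |(Φ' a).det| ≤ ENNReal.ofReal (K * (K / ν) ^ n) := by
    rintro ⟨t, x⟩ ⟨ht, hx, g1, g2, g3, g4⟩
    simp only at ht hx g1 g2 g3 g4
    apply ENNReal.ofReal_le_ofReal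
    have i1 := hin t ht x hx
    have i2 : p t x (b t x) ≤ B * (M / (4 * R)) := by
      calc p t x (b t x) ≤ |p t x (b t x)| := le_abs_self _
        _ ≤ ‖p t x‖ * ‖b t x‖ := (p t x).le_opNorm _
        _ ≤ M / (4 * R) * B := mul_le_mul g4 (hb t x) (norm_nonneg _) (by positivity)
        _ = _ := mul_comm _ _
    have i3 : 0 ≤ Lop (S t x) (-q t x) := ((hS t x).mono hν.le le_rfl).Lop_nonneg (fun w => by
      show 0 ≤ -(q t x w w); linarith [g3 w])
    have i3' := i3
    rw [Lop_neg] at i3'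
    have iK : vt t x ≤ K := by rw [hK]; linarith
    have iK2 : Lop (S t x) (-q t x) ≤ K := by rw [Lop_neg, hK]; linarith
    have K0 : 0 ≤ K := g2.trans iK
    have iq : ‖q t x‖ ≤ K / ν := by
      refine neg_norm (by positivity) (fun v' w' => second_derivative_symmetric (hv t) (hp t x) v' w') g3 fun w hw => ?_
      have := (hS t x).Lop_ge hν.le (q := -q t x) (fun w => by show 0 ≤ -(q t x w w); linarith [g3 w]) w hw
      have h5 : ν * -(q t x w w) ≤ K := this.trans iK2
      rw [← neg_le_neg_iff, neg_neg, le_div_iff₀ hν]; linarith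
    refine (hdet (t, x)).trans ?_
    simp only
    rw [abs_of_nonneg g2]
    gcongr
  haveI : (volume : Measure (ℝ × ES n)).IsAddHaarMeasure := by
    rw [Measure.volume_eq_prod]; infer_instance
  calc ENNReal.ofReal (M / 2) * (volume : Measure (ES n)) (ball 0 (M / (4 * R)))
      = volume (Ioo (M / 4) (3 * M / 4) ×ˢ ball (0 : ES n) (M / (4 * R))) := by
        rw [Measure.volume_eq_prod, Measure.prod_prod, Real.volume_Ioo]
        congr 2; ring
    _ ≤ volume (Φ '' G) := measure_mono himg
    _ ≤ ∫⁻ a in G, ENNReal.ofReal |(Φ' a).det| := 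
        addHaar_image_le_lintegral_abs_det_fderiv volume hGm fun a _ => (hΦ a).hasFDerivWithinAt
    _ ≤ ∫⁻ a in G, ENNReal.ofReal (K * (K / ν) ^ n) := setLIntegral_mono measurable_const hdG
    _ = ENNReal.ofReal (K * (K / ν) ^ n) * volume G := by rw [setLIntegral_const]
    _ ≤ _ := by
        gcongr
        intro a ha
        exact ⟨ha.1, ha.2.1, ha.2.2.1⟩
end QP

namespace QP
open MeasureTheory Filter Topology Metric
variable {n : ℕ} {G : Type*} [NormedAddCommGroup G] [NormedSpace ℝ G]

/-- Steklov average -/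
def stk (ε : ℝ) (f : ℝ → ES n → G) (t : ℝ) (x : ES n) : G := ∫ s in (0:ℝ)..1, f (t - ε * s) x

lemma stk_cont {f : ℝ → ES n → G} (hf : Continuous (Function.uncurry f)) (ε : ℝ) :
    Continuous (Function.uncurry (stk ε f)) := by
  have : Continuous (Function.uncurry fun (a : ℝ × ES n) (s : ℝ) => f (a.1 - ε * s) a.2) :=
    hf.comp (f := fun a : (ℝ × ES n) × ℝ => (a.1.1 - ε * a.2, a.1.2)) (by fun_prop)
  exact intervalIntegral.continuous_parametric_intervalIntegral_of_continuous' this 0 1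

lemma stk_x [CompleteSpace G] {f : ℝ → ES n → G} {f' : ℝ → ES n → (ES n →L[ℝ] G)} (hf : Continuous (Function.uncurry f))
    (hf' : Continuous (Function.uncurry f')) (h : ∀ t x, HasFDerivAt (f t) (f' t x) x) (ε t : ℝ) (x : ES n) :
    HasFDerivAt (stk ε f t) (stk ε f' t x) x := by
  have c1 : ∀ y, Continuous fun s => f (t - ε * s) y := fun y =>
    hf.comp (f := fun s : ℝ => (t - ε * s, y)) (by fun_prop)
  have c2 : ∀ y, Continuous fun s => f' (t - ε * s) y := fun y =>
    hf'.comp (f := fun s : ℝ => (t - ε * s, y)) (by fun_prop)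
  have c3 : Continuous fun a : ℝ × ES n => f' (t - ε * a.1) a.2 := 
    hf'.comp (f := fun a : ℝ × ES n => (t - ε * a.1, a.2)) (by fun_prop)
  obtain ⟨C, hC⟩ := ((isCompact_Icc (a := (0:ℝ)) (b := 1)).prod (isCompact_closedBall x 1)).exists_bound_of_continuousOn c3.continuousOn
  refine intervalIntegral.hasFDerivAt_integral_of_dominated_of_fderiv_le (s := closedBall x 1) (bound := fun _ => C)
    (F := fun y s => f (t - ε * s) y) (F' := fun y s => f' (t - ε * s) y)
    (closedBall_mem_nhds x one_pos) (Eventually.of_forall fun y => (c1 y).aestronglyMeasurable)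
    ((c1 x).intervalIntegrable _ _) (c2 x).aestronglyMeasurable ?_ (by simp) ?_
  · refine Eventually.of_forall fun s hs y hy => ?_
    rw [uIoc_of_le zero_le_one] at hs
    exact hC (s, y) ⟨⟨hs.1.le, hs.2⟩, hy⟩
  · exact Eventually.of_forall fun s _ y _ => h _ _

lemma stk_t [CompleteSpace G] {f : ℝ → ES n → G} (hf : Continuous (Function.uncurry f)) {ε : ℝ} (hε : ε ≠ 0) (t : ℝ) (x : ES n) :
    HasDerivAt (fun t => stk ε f t x) (ε⁻¹ • (f t x - f (t - ε) x)) t := by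
  have c : Continuous fun s => f s x := hf.comp (f := fun s : ℝ => (s, x)) (by fun_prop)
  have e : ∀ t, stk ε f t x = ε⁻¹ • ((∫ s in (0:ℝ)..t, f s x) - ∫ s in (0:ℝ)..(t - ε), f s x) := by
    intro t
    unfold stk
    rw [intervalIntegral.integral_comp_sub_mul (f := fun s => f s x) hε, mul_one, mul_zero, sub_zero,
      intervalIntegral.integral_interval_sub_left (c.intervalIntegrable _ _) (c.intervalIntegrable _ _)]
  simp only [e]
  have d1 : ∀ t, HasDerivAt (fun t => ∫ s in (0:ℝ)..t, f s x) (f t x) t := fun t =>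
    intervalIntegral.integral_hasDerivAt_right (c.intervalIntegrable _ _) (c.stronglyMeasurableAtFilter _ _) c.continuousAt
  refine ((d1 t).sub ?_).const_smul _
  have := (d1 (t - ε)).scomp t ((hasDerivAt_id t).sub_const ε)
  simpa [Function.comp_def] using this

set_option maxHeartbeats 1000000 in
/-- ABP estimate of Krylov--Tso -/
lemma abp {t0 t1 t2 R M B F ν Λ : ℝ} {x0 xh : ES n} (hR : 0 < R) (h21 : t2 < t1) (h10 : t1 ≤ t0) (hM : 0 < M)
    (hν : 0 < ν) (hB : 0 ≤ B) (hF : 0 < F)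
    {v : ℝ → ES n → ℝ} {p : ℝ → ES n → (ES n →L[ℝ] ℝ)} {q : ℝ → ES n → Bil n} {vt : ℝ → ES n → ℝ}
    {S : ℝ → ES n → (ES n →L[ℝ] ES n)} {b : ℝ → ES n → ES n}
    (cv : Continuous (Function.uncurry v)) (cp : Continuous (Function.uncurry p))
    (cq : Continuous (Function.uncurry q)) (cvt : Continuous (Function.uncurry vt)) 
    (cS : Continuous (Function.uncurry S)) (cb : Continuous (Function.uncurry b))
    (hv : ∀ t x, HasFDerivAt (v t) (p t x) x) (hp : ∀ t x, HasFDerivAt (p t) (q t x) x)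
    (hvt : ∀ t ∈ Icc t2 t0, ∀ x, HasDerivAt (fun s => v s x) (vt t x) t)
    (hS : ∀ t x, Ell ν Λ (S t x)) (hb : ∀ t x, ‖b t x‖ ≤ B)
    (hin : ∀ t ∈ Icc t2 t0, ∀ x ∈ closedBall x0 R, vt t x ≤ Lop (S t x) (q t x) + p t x (b t x) + F)
    (hbd : ∀ t ∈ Icc t1 t0, ∀ x ∈ closedBall x0 R, (t = t1 ∨ dist x x0 = R) → v t x ≤ 0)
    (hxh : xh ∈ closedBall x0 R) (hMv : M ≤ v t0 xh) :
    ENNReal.ofReal (M / 2 / 2) * (volume : Measure (ES n)) (ball 0 (M / 2 / (4 * R))) ≤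
      ENNReal.ofReal ((2 * F + B * (M / 2 / (4 * R))) * ((2 * F + B * (M / 2 / (4 * R))) / ν) ^ n) *
        (volume : Measure (ℝ × ES n)) {a | a.1 ∈ Icc t1 t0 ∧ a.2 ∈ closedBall x0 R ∧ 0 < v a.1 a.2} := by
  set δ := min (M / 4) F with hδ
  have hδ0 : 0 < δ := lt_min (by positivity) hF
  let Kc : Set (ℝ × ℝ × ES n) := Icc 0 1 ×ˢ (Icc t1 t0 ×ˢ closedBall x0 R)
  have hKc : IsCompact Kc := isCompact_Icc.prod (isCompact_Icc.prod (isCompact_closedBall _ _))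
  -- the freezing error
  let k : ℝ × ℝ × ℝ × ES n → ℝ := fun a =>
    Lop (S (a.2.2.1 - a.1 * a.2.1) a.2.2.2) (q (a.2.2.1 - a.1 * a.2.1) a.2.2.2)
      + p (a.2.2.1 - a.1 * a.2.1) a.2.2.2 (b (a.2.2.1 - a.1 * a.2.1) a.2.2.2)
      - (Lop (S a.2.2.1 a.2.2.2) (q (a.2.2.1 - a.1 * a.2.1) a.2.2.2)
      + p (a.2.2.1 - a.1 * a.2.1) a.2.2.2 (b a.2.2.1 a.2.2.2))
  let l : ℝ × ℝ × ℝ × ES n → ℝ := fun a => |v (a.2.2.1 - a.1 * a.2.1) a.2.2.2 - v a.2.2.1 a.2.2.2|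
  have sh : Continuous fun a : ℝ × ℝ × ℝ × ES n => (a.2.2.1 - a.1 * a.2.1, a.2.2.2) := by fun_prop
  have s0 : Continuous fun a : ℝ × ℝ × ℝ × ES n => (a.2.2.1, a.2.2.2) := by fun_prop
  have ck : Continuous k := by
    have a1 := cS.comp sh
    have a2 := cq.comp sh
    have a3 := cp.comp sh
    have a4 := cb.comp sh
    have a5 := cS.comp s0
    have a6 := cb.comp s0
    exact ((Lop_cont.comp (a1.prodMk a2)).add (a3.clm_apply a4)).sub ((Lop_cont.comp (a5.prodMk a2)).add (a3.clm_apply a6))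
  have cl : Continuous l := ((cv.comp sh).sub (cv.comp s0)).abs
  have ev1 : ∀ᶠ ε in 𝓝 (0:ℝ), ∀ y ∈ Kc, k (ε, y) < δ ∧ l (ε, y) < δ := by
    refine hKc.eventually_forall_of_forall_eventually fun y hy => ?_
    refine (ck.continuousAt.eventually_lt continuousAt_const ?_).and (cl.continuousAt.eventually_lt continuousAt_const ?_)
    · simp [k, hδ0]
    · simp [l, hδ0]
  obtain ⟨r, hr, hr'⟩ := Metric.eventually_nhds_iff.1 ev1
  set ε := min (r / 2) (t1 - t2) with hεd
  have hε : 0 < ε := lt_min (by positivity) (by linarith)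
  have hk := hr' (y := ε) (by
    rw [Real.dist_eq, sub_zero, abs_of_pos hε]
    exact (min_le_left _ _).trans_lt (by linarith))
  have hε2 : ε ≤ t1 - t2 := min_le_right _ _
  have hclose : ∀ t ∈ Icc t1 t0, ∀ x ∈ closedBall x0 R, |stk ε v t x - v t x| ≤ δ := by
    intro t ht x hx
    have c1 : Continuous fun s => v (t - ε * s) x := cv.comp (f := fun s : ℝ => (t - ε * s, x)) (by fun_prop)
    have e : stk ε v t x - v t x = ∫ s in (0:ℝ)..1, (v (t - ε * s) x - v t x) := by
      rw [intervalIntegral.integral_sub (c1.intervalIntegrable _ _) (by simp)]; simp [stk]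
    rw [e]
    have := intervalIntegral.norm_integral_le_of_norm_le_const (a := (0:ℝ)) (b := 1) (C := δ)
      (f := fun s => v (t - ε * s) x - v t x) (fun s hs => by
        rw [uIoc_of_le zero_le_one] at hs
        exact (hk (s, t, x) ⟨⟨hs.1.le, hs.2⟩, ht, hx⟩).2.le)
    simpa using this
  have hδM : δ ≤ M / 4 := min_le_left _ _
  have hδF : δ ≤ F := min_le_right _ _
  have sh' : Continuous fun a : ℝ × ES n => (a.1 - ε, a.2) := by fun_prop
  have cv' : Continuous (Function.uncurry fun t x => ε⁻¹ • (v t x - v (t - ε) x)) := by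
    have h1 := cv.comp sh'
    exact (cv.sub h1).const_smul ε⁻¹
  have cp' : Continuous (Function.uncurry fun t x => ε⁻¹ • (p t x - p (t - ε) x)) := by
    have h1 := cp.comp sh'
    exact (cp.sub h1).const_smul ε⁻¹
  have key := abp_smooth (n := n) (t0 := t0) (t1 := t1) (R := R) (M := M / 2) (B := B) (F := 2 * F) (ν := ν) (Λ := Λ) (x0 := x0) (xh := xh)
    (v := fun t x => stk ε v t x - δ) (p := stk ε p) (q := stk ε q)
    (vt := fun t x => ε⁻¹ • (v t x - v (t - ε) x)) (pt := fun t x => ε⁻¹ • (p t x - p (t - ε) x)) (S := S) (b := b)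
    hR h10 (by positivity) hν hB ((stk_cont cv ε).sub continuous_const) (stk_cont cp ε) (stk_cont cq ε)
    cv' cp'
    (fun t x => (stk_x cv cp hv ε t x).sub_const δ) (fun t x => stk_x cp cq hp ε t x)
    (fun t x => (stk_t cv hε.ne' t x).sub_const δ) (fun t x => stk_t cp hε.ne' t x) hS hb ?_ ?_ hxh ?_
  · refine key.trans ?_
    refine mul_le_mul' le_rfl (measure_mono ?_)
    rintro ⟨t, x⟩ ⟨ht, hx, h0⟩
    refine ⟨ht, hx, ?_⟩
    have := (abs_le.1 (hclose t ht x hx)).2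
    simp only at h0 ⊢
    linarith
  · intro t ht x hx
    have m : ∀ s ∈ Icc (0:ℝ) 1, t - ε * s ∈ Icc t2 t0 := fun s hs =>
      ⟨by nlinarith [hs.1, hs.2, ht.1], by nlinarith [hs.1, ht.2]⟩
    have cs : Continuous fun s : ℝ => (t - ε * s, x) := by fun_prop
    have c0 : Continuous fun s => vt (t - ε * s) x := cvt.comp cs
    have c1 : Continuous fun s => q (t - ε * s) x := cq.comp cs
    have c2 : Continuous fun s => p (t - ε * s) x := cp.comp cs
    have c3 : Continuous fun s => v (t - ε * s) x := cv.comp cs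
    have e0 : ε⁻¹ • (v t x - v (t - ε) x) = ∫ s in (0:ℝ)..1, vt (t - ε * s) x := by
      have := intervalIntegral.integral_eq_sub_of_hasDerivAt (a := (0:ℝ)) (b := 1) (f := fun s => v (t - ε * s) x)
        (f' := fun s => -ε * vt (t - ε * s) x) (fun s hs => by
          rw [uIcc_of_le zero_le_one] at hs
          have h1 := hvt _ (m s hs) x
          have h2 : HasDerivAt (fun s => t - ε * s) (-ε) s := by
            simpa using ((hasDerivAt_id s).const_mul ε).const_sub t
          exact (HasDerivAt.comp s h1 h2).congr_deriv (mul_comm _ _)) ((continuous_const.mul c0).intervalIntegrable _ _)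
      rw [intervalIntegral.integral_const_mul, mul_one, mul_zero, sub_zero] at this
      rw [smul_eq_mul, inv_mul_eq_iff_eq_mul₀ hε.ne']
      linarith
    have e1 : Lop (S t x) (stk ε q t x) + stk ε p t x (b t x) + 2 * F = 
        ∫ s in (0:ℝ)..1, (Lop (S t x) (q (t - ε * s) x) + p (t - ε * s) x (b t x) + 2 * F) := by
      have i1 : IntervalIntegrable (fun s => Lop (S t x) (q (t - ε * s) x)) volume 0 1 :=
        (((LopL (S t x)).continuous.comp c1)).intervalIntegrable _ _
      have i2 : IntervalIntegrable (fun s => p (t - ε * s) x (b t x)) volume 0 1 :=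
        (c2.clm_apply continuous_const).intervalIntegrable _ _
      rw [intervalIntegral.integral_add (i1.add i2) (by simp), intervalIntegral.integral_add i1 i2]
      have j1 := (LopL (S t x)).intervalIntegral_comp_comm (c1.intervalIntegrable (μ := volume) 0 1)
      have j2 := (ContinuousLinearMap.apply ℝ ℝ (b t x)).intervalIntegral_comp_comm (c2.intervalIntegrable (μ := volume) 0 1)
      simp only [LopL_apply, ContinuousLinearMap.apply_apply] at j1 j2
      rw [j1, j2]; simp [stk]
    rw [e0, e1]
    refine intervalIntegral.integral_mono_on zero_le_one (c0.intervalIntegrable _ _) (Continuous.intervalIntegrable ?_ _ _) fun s hs => ?_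
    · exact (((LopL (S t x)).continuous.comp c1).add (c2.clm_apply continuous_const)).add continuous_const
    · have h1 := hin _ (m s hs) x hx
      have h2 : Lop (S (t - ε * s) x) (q (t - ε * s) x) + p (t - ε * s) x (b (t - ε * s) x)
        - (Lop (S t x) (q (t - ε * s) x) + p (t - ε * s) x (b t x)) < δ := (hk (s, t, x) ⟨hs, ht, hx⟩).1
      linarith
  · intro t ht x hx h
    have h1 := hbd t ht x hx h
    have h2 := (abs_le.1 (hclose t ht x hx)).2
    linarith
  · have h2 := (abs_le.1 (hclose t0 ⟨h10, le_rfl⟩ xh hxh)).1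
    linarith
end QP

namespace QP
open MeasureTheory Filter Topology Metric
variable {n : ℕ}

/-- supersolution data -/
structure SupD (ν Λ B a c : ℝ) (w : ℝ → ES n → ℝ) (p : ℝ → ES n → (ES n →L[ℝ] ℝ)) (q : ℝ → ES n → Bil n) (wt : ℝ → ES n → ℝ)
    (S : ℝ → ES n → (ES n →L[ℝ] ES n)) (b : ℝ → ES n → ES n) : Prop where
  cw : Continuous (Function.uncurry w)
  cp : Continuous (Function.uncurry p)
  cq : Continuous (Function.uncurry q)
  ct : Continuous (Function.uncurry wt)
  cS : Continuous (Function.uncurry S)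
  cb : Continuous (Function.uncurry b)
  dw : ∀ t x, HasFDerivAt (w t) (p t x) x
  dp : ∀ t x, HasFDerivAt (p t) (q t x) x
  dt : ∀ t ∈ Icc a c, ∀ x, HasDerivAt (fun s => w s x) (wt t x) t
  ell : ∀ t x, Ell ν Λ (S t x)
  bb : ∀ t x, ‖b t x‖ ≤ B
  le : ∀ t ∈ Icc a c, ∀ x, Lop (S t x) (q t x) + p t x (b t x) ≤ wt t x

/-- supersolutions -/
def Sup (ν Λ B a c : ℝ) (w : ℝ → ES n → ℝ) : Prop := ∃ p q wt S b, SupD ν Λ B a c w p q wt S b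

lemma Sup.cont {ν Λ B a c : ℝ} {w : ℝ → ES n → ℝ} (h : Sup ν Λ B a c w) : Continuous (Function.uncurry w) := by
  obtain ⟨p, q, wt, S, b, h⟩ := h
  exact h.cw

lemma Sup.mono {ν Λ B a c a' c' : ℝ} {w : ℝ → ES n → ℝ} (h : Sup ν Λ B a c w) (ha : a ≤ a') (hc : c' ≤ c) : Sup ν Λ B a' c' w := by
  obtain ⟨p, q, wt, S, b, h⟩ := h
  have hs := Icc_subset_Icc ha hc
  exact ⟨p, q, wt, S, b, h.cw, h.cp, h.cq, h.ct, h.cS, h.cb, h.dw, h.dp, fun t ht => h.dt t (hs ht), h.ell, h.bb, fun t ht => h.le t (hs ht)⟩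

lemma Sup.smul {ν Λ B a c k : ℝ} {w : ℝ → ES n → ℝ} (h : Sup ν Λ B a c w) (hk : 0 ≤ k) : Sup ν Λ B a c (fun t x => k * w t x) := by
  obtain ⟨p, q, wt, S, b, h⟩ := h
  refine ⟨fun t x => k • p t x, fun t x => k • q t x, fun t x => k * wt t x, S, b, continuous_const.mul h.cw, h.cp.const_smul k, h.cq.const_smul k,
    continuous_const.mul h.ct, h.cS, h.cb, fun t x => (h.dw t x).const_mul k, fun t x => (h.dp t x).const_smul k,
    fun t ht x => (h.dt t ht x).const_mul k, h.ell, h.bb, fun t ht x => ?_⟩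
  rw [Lop_smul]
  simp only [_root_.smul_apply, smul_eq_mul]
  nlinarith [mul_le_mul_of_nonneg_left (h.le t ht x) hk]

lemma Sup.rescale {ν Λ B a c r t0 : ℝ} {x0 : ES n} {w : ℝ → ES n → ℝ} (h : Sup ν Λ B a c w) (hr : 0 < r) (hr1 : r ≤ 1) (hB : 0 ≤ B) {a' c' : ℝ}
    (ha : a ≤ t0 + r ^ 2 * a') (hc : t0 + r ^ 2 * c' ≤ c) :
    Sup ν Λ B a' c' (fun t x => w (t0 + r ^ 2 * t) (x0 + r • x)) := by
  obtain ⟨p, q, wt, S, b, h⟩ := h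
  have sh : Continuous fun a : ℝ × ES n => (t0 + r ^ 2 * a.1, x0 + r • a.2) := by fun_prop
  have hx : ∀ x : ES n, HasFDerivAt (fun x : ES n => x0 + r • x) (r • ContinuousLinearMap.id ℝ (ES n)) x := fun x =>
    ((hasFDerivAt_id x).const_smul r).const_add x0
  have ht : ∀ t : ℝ, HasDerivAt (fun t : ℝ => t0 + r ^ 2 * t) (r ^ 2) t := fun t => by
    simpa using ((hasDerivAt_id t).const_mul (r ^ 2)).const_add t0
  have hm : ∀ t ∈ Icc a' c', t0 + r ^ 2 * t ∈ Icc a c := fun t ht =>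
    ⟨ha.trans (by nlinarith [ht.1, sq_nonneg r]), le_trans (by nlinarith [ht.2, sq_nonneg r]) hc⟩
  refine ⟨fun t x => r • p (t0 + r ^ 2 * t) (x0 + r • x), fun t x => r ^ 2 • q (t0 + r ^ 2 * t) (x0 + r • x),
    fun t x => r ^ 2 * wt (t0 + r ^ 2 * t) (x0 + r • x), fun t x => S (t0 + r ^ 2 * t) (x0 + r • x), fun t x => r • b (t0 + r ^ 2 * t) (x0 + r • x),
    h.cw.comp sh, (h.cp.comp sh).const_smul r, (h.cq.comp sh).const_smul (r^2), (h.ct.comp sh).const_smul (r^2), h.cS.comp sh, (h.cb.comp sh).const_smul r,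
    fun t x => ?_, fun t x => ?_, fun t ht' x => ?_, fun t x => h.ell _ _, fun t x => ?_, fun t ht' x => ?_⟩
  · have := HasFDerivAt.comp x (h.dw (t0 + r ^ 2 * t) (x0 + r • x)) (hx x)
    refine this.congr_fderiv ?_
    ext v; simp
  · have := (HasFDerivAt.comp x (h.dp (t0 + r ^ 2 * t) (x0 + r • x)) (hx x)).const_smul r
    refine this.congr_fderiv ?_
    ext v w; simp; ring
  · have := HasDerivAt.comp t (h.dt _ (hm t ht') (x0 + r • x)) (ht t)
    exact this.congr_deriv (mul_comm _ _)
  · rw [norm_smul, Real.norm_eq_abs, abs_of_pos hr]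
    have := h.bb (t0 + r ^ 2 * t) (x0 + r • x)
    nlinarith [norm_nonneg (b (t0 + r ^ 2 * t) (x0 + r • x))]
  · have := h.le _ (hm t ht') (x0 + r • x)
    rw [Lop_smul]
    simp only [_root_.smul_apply, smul_eq_mul, map_smul]
    nlinarith [mul_le_mul_of_nonneg_left this (sq_nonneg r)]

lemma ball_vol_pos (n : ℕ) {r : ℝ} (hr : 0 < r) : 0 < (volume : Measure (ES n)) (ball 0 r) :=
  measure_ball_pos _ _ hr

set_option maxHeartbeats 1000000 in
/-- measure to pointwise, unit scale -/
lemma lem1 (n : ℕ) {ν Λ B : ℝ} (hν : 0 < ν) (hΛ : 0 ≤ Λ) (hB : 0 ≤ B) : ∃ ε : ℝ, 0 < ε ∧ ∀ w : ℝ → ES n → ℝ, Sup ν Λ B (-2) 0 w →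
    (volume : Measure (ℝ × ES n)) {a | a.1 ∈ Icc (-1) 0 ∧ a.2 ∈ closedBall 0 1 ∧ w a.1 a.2 < 1} ≤ ENNReal.ofReal ε →
    (∀ t ∈ Icc (-1:ℝ) 0, ∀ x ∈ closedBall (0 : ES n) 1, 0 ≤ w t x) →
    ∀ x : ES n, ‖x‖ ≤ 1/2 → 1/2 ≤ w 0 x := by
  set F : ℝ := 1 + 2 * (n * Λ) + 2 * B with hF
  have hF0 : 0 < F := by positivity
  set K : ℝ := (2 * F + B * (1/4 / 2 / (4 * 1))) * ((2 * F + B * (1/4 / 2 / (4 * 1))) / ν) ^ n with hK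
  have hK0 : 0 < K := by positivity
  set V := (volume : Measure (ES n)) (ball 0 (1/4 / 2 / (4 * 1))) with hV
  have hV0 : 0 < V := ball_vol_pos n (by norm_num)
  have hVt : V ≠ ⊤ := measure_ball_lt_top.ne
  have hVr : 0 < V.toReal := ENNReal.toReal_pos hV0.ne' hVt
  refine ⟨1/32 * V.toReal / K, by positivity, fun w hw hm hpos x hx => ?_⟩
  by_contra hcon
  push Not at hcon
  obtain ⟨p, q, wt, S, b, h⟩ := hw
  have c1 : Continuous (Function.uncurry fun (t : ℝ) (y : ES n) => (1 - ‖y‖ ^ 2 + t) - w t y) := by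
    have := h.cw
    have c0 : Continuous fun a : ℝ × ES n => (1 - ‖a.2‖ ^ 2 + a.1) := by fun_prop
    exact c0.sub this
  have c2 : Continuous (Function.uncurry fun (t : ℝ) (y : ES n) => -((2:ℝ) • ib n y) - p t y) := by
    have := h.cp
    have c0 : Continuous fun a : ℝ × ES n => -((2:ℝ) • ib n a.2) := by fun_prop
    exact c0.sub this
  have key := abp (n := n) (t0 := 0) (t1 := -1) (t2 := -2) (R := 1) (M := 1/4) (B := B) (F := F) (ν := ν) (Λ := Λ) (x0 := 0) (xh := x)
    (v := fun t y => (1 - ‖y‖ ^ 2 + t) - w t y) (p := fun t y => -((2:ℝ) • ib n y) - p t y) (q := fun t y => -((2:ℝ) • ib n) - q t y)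
    (vt := fun t y => 1 - wt t y) (S := S) (b := b)
    one_pos (by norm_num) (by norm_num) (by norm_num) hν hB hF0
    c1 c2
    (continuous_const.sub h.cq) ((continuous_const (y := (1:ℝ))).sub h.ct) h.cS h.cb
    (fun t y => (((hasFDerivAt_normSq y).const_sub 1).add_const t).sub (h.dw t y))
    (fun t y => (((ib n).hasFDerivAt.const_smul (2:ℝ)).neg).sub (h.dp t y))
    (fun t ht y => ((hasDerivAt_id t).const_add _).sub (h.dt t ht y)) h.ell h.bb ?_ ?_ (by simp; linarith) ?_
  · have h2 : volume {a : ℝ × ES n | a.1 ∈ Icc (-1:ℝ) 0 ∧ a.2 ∈ closedBall (0 : ES n) 1 ∧ 0 < (1 - ‖a.2‖ ^ 2 + a.1) - w a.1 a.2} ≤ ENNReal.ofReal (1/32 * V.toReal / K) := by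
      refine (measure_mono ?_).trans hm
      rintro ⟨t, y⟩ ⟨ht, hy, h0⟩
      refine ⟨ht, hy, ?_⟩
      have := ht.2
      simp only at h0 ⊢
      nlinarith [sq_nonneg ‖y‖, ht.2]
    have h3 := key.trans (mul_le_mul' le_rfl h2)
    rw [← hV, ← hK, ← ENNReal.ofReal_mul hK0.le, ← ENNReal.ofReal_toReal hVt, ← ENNReal.ofReal_mul (by norm_num), ENNReal.ofReal_le_ofReal_iff (by positivity),
      ENNReal.toReal_ofReal hVr.le] at h3
    have : K * (1/32 * V.toReal / K) = 1/32 * V.toReal := by field_simp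
    rw [this] at h3
    linarith
  · intro t ht y hy
    have h1 := h.le t ht y
    have h2 := Lop_ib (h.ell t y)
    have h3 : |inner ℝ y (b t y)| ≤ 1 * B := (abs_real_inner_le_norm _ _).trans 
      (mul_le_mul (by simpa using hy) (h.bb t y) (norm_nonneg _) zero_le_one)
    rw [Lop_sub, Lop_neg, Lop_smul]
    simp only [_root_.sub_apply, _root_.neg_apply, _root_.smul_apply, smul_eq_mul, ib_apply]
    have h4 := (abs_le.1 h3).1
    have h5 := (abs_le.1 h3).2
    linarith
  · intro t ht y hy hor
    have h1 := hpos t ht y hy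
    have h2 := ht.2
    rcases hor with rfl | hor
    · nlinarith [sq_nonneg ‖y‖]
    · rw [dist_zero_right] at hor
      rw [hor]; linarith
  · nlinarith [norm_nonneg x]
end QP

namespace QP
open MeasureTheory Filter Topology Metric
variable {n : ℕ}

lemma Ell.Lop_rank {ν Λ : ℝ} {S : ES n →L[ℝ] ES n} (h : Ell ν Λ S) (hν : 0 ≤ ν) (x : ES n) :
    ν * ‖x‖ ^ 2 ≤ Lop S ((ib n x).smulRight (ib n x)) := by
  have hq : ∀ v, 0 ≤ ((ib n x).smulRight (ib n x) : Bil n) v v := fun v => by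
    simp only [ContinuousLinearMap.smulRight_apply, _root_.smul_apply, smul_eq_mul]
    exact mul_self_nonneg _
  rcases eq_or_ne x 0 with rfl | hx
  · simpa using (h.mono hν le_rfl).Lop_nonneg hq
  · have hx' : ‖x‖ ≠ 0 := norm_ne_zero_iff.2 hx
    have := h.Lop_ge hν hq (‖x‖⁻¹ • x) (by rw [norm_smul, norm_inv, norm_norm, inv_mul_cancel₀ hx'])
    refine le_trans (le_of_eq ?_) this
    simp only [ContinuousLinearMap.smulRight_apply, _root_.smul_apply, smul_eq_mul, map_smul, ib_apply, real_inner_self_eq_norm_sq]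
    field_simp

lemma DD.bump (ρ κ lam A t : ℝ) (x : ES n) :
    DD (fun s y => A * Real.exp (-lam * s) * (ρ ^ 2 + κ * s - ‖y‖ ^ 2) ^ 2) t x
      (fun y => (-4 * (A * Real.exp (-lam * t)) * (ρ ^ 2 + κ * t - ‖y‖ ^ 2)) • ib n y)
      ((-4 * (A * Real.exp (-lam * t)) * (ρ ^ 2 + κ * t - ‖x‖ ^ 2)) • ib n + (8 * (A * Real.exp (-lam * t))) • (ib n x).smulRight (ib n x))
      (A * Real.exp (-lam * t) * (-lam * (ρ ^ 2 + κ * t - ‖x‖ ^ 2) ^ 2 + 2 * κ * (ρ ^ 2 + κ * t - ‖x‖ ^ 2))) := by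
  have hg : ∀ y : ES n, HasFDerivAt (fun y : ES n => ρ ^ 2 + κ * t - ‖y‖ ^ 2) (-((2:ℝ) • ib n y)) y := fun y =>
    (hasFDerivAt_normSq y).const_sub _
  refine ⟨fun y => ?_, ?_, ?_⟩
  · have := ((hg y).pow 2).const_mul (A * Real.exp (-lam * t))
    refine this.congr_fderiv ?_
    ext v; simp; ring
  · have := ((hg x).const_mul (-4 * (A * Real.exp (-lam * t)))).smul ((ib n).hasFDerivAt (x := x))
    refine this.congr_fderiv ?_
    ext v w; simp; ring
  · have h1 : HasDerivAt (fun s => A * Real.exp (-lam * s)) (A * (Real.exp (-lam * t) * (-lam * 1))) t :=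
      (((hasDerivAt_id t).const_mul (-lam)).exp).const_mul A
    have h2 : HasDerivAt (fun s => (ρ ^ 2 + κ * s - ‖x‖ ^ 2)) (κ * 1) t :=
      (((hasDerivAt_id t).const_mul κ).const_add _).sub_const _
    refine (h1.mul (h2.pow 2)).congr_deriv ?_
    simp; ring

set_option maxHeartbeats 1000000 in
/-- expansion of positivity -/
lemma lem2 (n : ℕ) {ν Λ B ρ κ T1 P : ℝ} (hν : 0 < ν) (hΛ : 0 ≤ Λ) (hB : 0 ≤ B) (hρ : 0 < ρ) (hκ : 0 < κ) (hP : 0 ≤ P) (hPs : ρ ^ 2 + κ * T1 ≤ P ^ 2) :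
    ∃ c : ℝ, 0 < c ∧ ∀ T2 ≤ T1, ∀ w : ℝ → ES n → ℝ, Sup ν Λ B 0 T2 w →
      (∀ t ∈ Icc 0 T2, ∀ x, ‖x‖ ≤ P → 0 ≤ w t x) → (∀ x, ‖x‖ ≤ ρ → 1 ≤ w 0 x) →
      ∀ t ∈ Icc 0 T2, ∀ x, 2 * ‖x‖ ^ 2 ≤ ρ ^ 2 + κ * t → c ≤ w t x := by
  set K : ℝ := 2 * κ + 4 * (n * Λ) + 4 * (P * B) with hK
  have hK0 : 0 ≤ K := by positivity
  set lam : ℝ := ((K + 8 * ν) ^ 2 + 1) / (32 * ν * ρ ^ 2) with hlam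
  have hlam0 : 0 < lam := by positivity
  have hlam1 : (K + 8 * ν) ^ 2 < 32 * ν * ρ ^ 2 * lam := by
    rw [hlam]; field_simp; linarith
  refine ⟨Real.exp (-lam * T1) / 4, by positivity, fun T2 hT2 w hw hpos h1 => ?_⟩
  obtain ⟨p, q, wt, S, b, h⟩ := hw
  set A : ℝ := (ρ ^ 4)⁻¹ with hA
  have hA0 : 0 < A := by positivity
  have hAρ : A * ρ ^ 4 = 1 := by rw [hA]; field_simp
  have main := lmp (n := n) (t0 := 0) (t1 := T2) (R := P) (x0 := 0) 
    (z := fun t x => A * Real.exp (-lam * t) * (max (ρ ^ 2 + κ * t - ‖x‖ ^ 2) 0) ^ 2 - w t x) ?_ ?_ ?_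
  · intro t ht x hx
    have hxP : ‖x‖ ≤ P := by
      refine (pow_le_pow_iff_left₀ (norm_nonneg x) hP two_ne_zero).1 ?_
      nlinarith [ht.2.trans hT2, sq_nonneg ‖x‖]
    have h2 := main t ht x (by simpa using hxP)
    have hg : ρ ^ 2 / 2 ≤ max (ρ ^ 2 + κ * t - ‖x‖ ^ 2) 0 := le_max_of_le_left (by nlinarith [ht.1])
    have h3 : Real.exp (-lam * T1) ≤ Real.exp (-lam * t) := Real.exp_le_exp.2 (by nlinarith [ht.2.trans hT2])
    have h4 : (ρ ^ 2 / 2) ^ 2 ≤ (max (ρ ^ 2 + κ * t - ‖x‖ ^ 2) 0) ^ 2 := pow_le_pow_left₀ (by positivity) hg 2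
    have h5 : A * Real.exp (-lam * T1) * (ρ ^ 2 / 2) ^ 2 ≤ A * Real.exp (-lam * t) * (max (ρ ^ 2 + κ * t - ‖x‖ ^ 2) 0) ^ 2 := 
      mul_le_mul (mul_le_mul_of_nonneg_left h3 hA0.le) h4 (by positivity) (by positivity)
    have h6 : A * Real.exp (-lam * T1) * (ρ ^ 2 / 2) ^ 2 = Real.exp (-lam * T1) / 4 := by
      linear_combination (Real.exp (-lam * T1) / 4) * hAρ
    linarith
  · have := h.cw
    have c0 : Continuous fun a : ℝ × ES n => A * Real.exp (-lam * a.1) * (max (ρ ^ 2 + κ * a.1 - ‖a.2‖ ^ 2) 0) ^ 2 := by fun_prop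
    exact (c0.sub this).continuousOn
  · intro t ht x hx hor
    have hx' : ‖x‖ ≤ P := by simpa using hx
    have hw0 := hpos t ht x hx'
    rcases hor with rfl | hor
    · rcases le_total ‖x‖ ρ with hxr | hxr
      · have := h1 x hxr
        have hm : max (ρ ^ 2 + κ * 0 - ‖x‖ ^ 2) 0 ≤ ρ ^ 2 := max_le (by nlinarith [sq_nonneg ‖x‖]) (by positivity)
        have hm2 : (max (ρ ^ 2 + κ * 0 - ‖x‖ ^ 2) 0) ^ 2 ≤ (ρ ^ 2) ^ 2 := pow_le_pow_left₀ (le_max_right _ _) hm 2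
        simp only [mul_zero, Real.exp_zero, mul_one] at hm2 ⊢
        nlinarith [mul_le_mul_of_nonneg_left hm2 hA0.le]
      · have := pow_le_pow_left₀ hρ.le hxr 2
        rw [max_eq_right (by linarith)]; simpa using hw0
    · rw [dist_zero_right] at hor
      rw [max_eq_right (by rw [hor]; nlinarith [ht.2.trans hT2])]; simpa using hw0
  · intro t ht x hx hz hmax
    have hx' : ‖x‖ < P := by simpa using hx
    have ht' : t ∈ Icc 0 T2 := ⟨ht.1.le, ht.2.le⟩
    have hw0 := hpos t ht' x hx'.le
    have hg : 0 < ρ ^ 2 + κ * t - ‖x‖ ^ 2 := by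
      by_contra hc
      rw [max_eq_right (not_lt.1 hc)] at hz
      norm_num at hz; linarith
    set g := ρ ^ 2 + κ * t - ‖x‖ ^ 2 with hgd
    set k := A * Real.exp (-lam * t) with hk
    have hk0 : 0 < k := by positivity
    have hdd := (DD.bump ρ κ lam A t x).sub (z' := w) (p' := p t) ⟨h.dw t, h.dp t x, h.dt t ht' x⟩
    have hmax' : IsLocalMax (fun y => A * Real.exp (-lam * t) * (ρ ^ 2 + κ * t - ‖y‖ ^ 2) ^ 2 - w t y) x := by
      refine hmax.congr ?_
      have c0 : Continuous fun y : ES n => ρ ^ 2 + κ * t - ‖y‖ ^ 2 := by fun_prop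
      filter_upwards [c0.continuousAt.eventually (eventually_gt_nhds hg)] with y hy
      rw [max_eq_left hy.le]
    obtain ⟨e1, e2⟩ := hdd.max hmax' ((h.ell t x).mono hν.le le_rfl)
    refine ⟨_, ?_, hdd.2.2.congr_of_eventuallyEq ?_⟩
    · have h2 := h.le t ht' x
      have e3 : (p t x) (b t x) = (-4 * k * g) * inner ℝ x (b t x) := by
        have := congrArg (fun l => l (b t x)) e1
        simp only [_root_.sub_apply, _root_.smul_apply, smul_eq_mul, ib_apply, _root_.zero_apply] at this
        linarith
      have h3 : |inner ℝ x (b t x)| ≤ P * B := (abs_real_inner_le_norm _ _).trans 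
        (mul_le_mul hx'.le (h.bb t x) (norm_nonneg _) hP)
      have h4 := (abs_le.1 h3).2
      rw [Lop_sub, Lop_add, Lop_smul, Lop_smul] at e2
      have h5 := Lop_ib (h.ell t x)
      have h6 := (h.ell t x).Lop_rank hν.le x
      have hkg : 0 < k * g := by positivity
      have i1 := mul_le_mul_of_nonneg_left h4 hkg.le
      have i2 := mul_le_mul_of_nonneg_left h5 hkg.le
      have i3 := mul_le_mul_of_nonneg_left h6 hk0.le
      have hxg : ‖x‖ ^ 2 = ρ ^ 2 + κ * t - g := by rw [hgd]; ring
      rw [hxg] at i3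
      have hs : ρ ^ 2 ≤ ρ ^ 2 + κ * t := by nlinarith [ht.1]
      have quad : -lam * g ^ 2 + (K + 8 * ν) * g - 8 * ν * (ρ ^ 2 + κ * t) < 0 := by
        have hh : -lam * g ^ 2 + (K + 8 * ν) * g - 8 * ν * ρ ^ 2 < 0 := by
          have := sq_nonneg (2 * lam * g - (K + 8 * ν))
          by_contra hc
          push Not at hc
          have := mul_nonneg (by positivity : 0 ≤ 4 * lam) hc
          linarith
        have := mul_nonneg (by positivity : 0 ≤ 8 * ν) (mul_nonneg hκ.le ht.1.le)
        linarith
      have quad' := mul_neg_of_pos_of_neg hk0 quad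
      have goal : k * (-lam * g ^ 2 + 2 * κ * g) - wt t x ≤ k * (-lam * g ^ 2 + (K + 8 * ν) * g - 8 * ν * (ρ ^ 2 + κ * t)) := by
        rw [hK]
        linarith
      exact goal.trans_lt quad'
    · have c0 : Continuous fun s : ℝ => ρ ^ 2 + κ * s - ‖x‖ ^ 2 := by fun_prop
      filter_upwards [c0.continuousAt.eventually (eventually_gt_nhds hg)] with y hy
      rw [max_eq_left hy.le]
end QP

namespace QP
open MeasureTheory Filter Topology Metric
variable {n : ℕ}

/-- parabolic cylinders -/
def Cyl (r : ℝ) (z : ℝ × ES n) : Set (ℝ × ES n) := Ioo (z.1 - r ^ 2) (z.1 + r ^ 2) ×ˢ ball z.2 r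

lemma Cyl_open (r : ℝ) (z : ℝ × ES n) : IsOpen (Cyl r z) := isOpen_Ioo.prod isOpen_ball

lemma Cyl_self {r : ℝ} (hr : 0 < r) (z : ℝ × ES n) : z ∈ Cyl r z :=
  ⟨⟨by nlinarith, by nlinarith⟩, mem_ball_self hr⟩

lemma vol_scale {r : ℝ} (hr : 0 < r) (t0 : ℝ) (x0 : ES n) (A : Set (ℝ × ES n)) :
    volume ((fun a : ℝ × ES n => (t0 + r ^ 2 * a.1, x0 + r • a.2)) ⁻¹' A) = ENNReal.ofReal ((r ^ (n + 2))⁻¹) * volume A := by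
  have : (volume : Measure (ℝ × ES n)).IsAddHaarMeasure := by rw [Measure.volume_eq_prod]; infer_instance
  let L : (ℝ × ES n) →ₗ[ℝ] (ℝ × ES n) := LinearMap.prodMap (r ^ 2 • LinearMap.id) (r • LinearMap.id)
  have hd : LinearMap.det L = r ^ (n + 2) := by
    rw [LinearMap.det_prodMap, LinearMap.det_smul, LinearMap.det_smul]
    simp; ring
  have e : (fun a : ℝ × ES n => (t0 + r ^ 2 * a.1, x0 + r • a.2)) ⁻¹' A = L ⁻¹' ((fun a => (t0, x0) + a) ⁻¹' A) := by
    ext a; simp [L]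
  have hd0 : LinearMap.det L ≠ 0 := by rw [hd]; positivity
  rw [e, Measure.addHaar_preimage_linearMap _ hd0, measure_preimage_add, hd, abs_of_pos (by positivity)]

lemma Cyl_vol {r : ℝ} (hr : 0 < r) (z : ℝ × ES n) :
    volume (Cyl r z) = ENNReal.ofReal (r ^ (n + 2)) * volume (Cyl 1 (0 : ℝ × ES n)) := by
  have e : (fun a : ℝ × ES n => (z.1 + r ^ 2 * a.1, z.2 + r • a.2)) ⁻¹' (Cyl r z) = Cyl 1 0 := by
    ext ⟨s, y⟩
    have h1 : ‖r • y‖ = r * ‖y‖ := by rw [norm_smul, Real.norm_eq_abs, abs_of_pos hr]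
    simp only [Cyl, mem_preimage, mem_prod, mem_Ioo, mem_ball, dist_eq_norm, add_sub_cancel_left, h1, Prod.fst_zero, Prod.snd_zero, sub_zero]
    have h2 : 0 < r ^ 2 := by positivity
    constructor
    · rintro ⟨⟨a, b⟩, c⟩
      refine ⟨⟨?_, ?_⟩, ?_⟩ <;> nlinarith
    · rintro ⟨⟨a, b⟩, c⟩
      refine ⟨⟨?_, ?_⟩, ?_⟩ <;> nlinarith
  have := vol_scale hr z.1 z.2 (Cyl r z)
  rw [e] at this
  rw [this, ← mul_assoc, ← ENNReal.ofReal_mul (by positivity), mul_inv_cancel₀ (by positivity), ENNReal.ofReal_one, one_mul]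

lemma Cyl1_pos : 0 < volume (Cyl 1 (0 : ℝ × ES n)) :=
  (Cyl_open 1 0).measure_pos volume ⟨0, Cyl_self one_pos 0⟩

lemma Cyl1_lt : volume (Cyl 1 (0 : ℝ × ES n)) < ⊤ := by
  have : Bornology.IsBounded (Cyl 1 (0 : ℝ × ES n)) := (Metric.isBounded_Ioo _ _).prod isBounded_ball
  exact this.measure_lt_top

/-- Vitali step -/
lemma vitali_step {ι : Type*} (I : Finset ι) (z : ι → ℝ × ES n) (ρ : ι → ℝ) (hρ : ∀ i ∈ I, 0 < ρ i) (E : Set (ℝ × ES n)) (hE : MeasurableSet E) {ε : ℝ} (hε : 0 < ε)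
    (h : ∀ i ∈ I, ENNReal.ofReal ε * volume (Cyl (ρ i) (z i)) ≤ volume (Cyl (ρ i) (z i) \ E)) :
    ENNReal.ofReal (ε / 5 ^ (n + 2)) * volume (⋃ i ∈ I, Cyl (ρ i) (z i)) ≤ volume ((⋃ i ∈ I, Cyl (ρ i) (z i)) \ E) := by
  obtain ⟨R, hR⟩ : ∃ R, ∀ i ∈ I, ρ i ≤ R := by
    obtain ⟨R, hR⟩ := (I.image ρ).exists_le
    exact ⟨R, fun i hi => hR _ (Finset.mem_image_of_mem _ hi)⟩
  obtain ⟨u, hu, hdis, hcov⟩ := Vitali.exists_disjoint_subfamily_covering_enlargement (fun i => Cyl (ρ i) (z i)) (I : Set ι) ρ 2 (by norm_num)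
    (fun i hi => (hρ i hi).le) R hR (fun i hi => ⟨z i, Cyl_self (hρ i hi) _⟩)
  have hfin : u.Finite := I.finite_toSet.subset hu
  obtain ⟨J, rfl⟩ := hfin.exists_finset_coe
  have hJ : ∀ j ∈ J, j ∈ I := fun j hj => hu hj
  have sub : (⋃ i ∈ I, Cyl (ρ i) (z i)) ⊆ ⋃ j ∈ J, Cyl (5 * ρ j) (z j) := by
    intro a ha
    simp only [mem_iUnion] at ha ⊢
    obtain ⟨i, hi, ha⟩ := ha
    obtain ⟨j, hj, ⟨y, hy1, hy2⟩, hle⟩ := hcov i hi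
    refine ⟨j, hj, ?_⟩
    have h1 := hρ i hi
    have h2 := hρ j (hJ j hj)
    obtain ⟨⟨a1, a2⟩, a3⟩ := ha
    obtain ⟨⟨b1, b2⟩, b3⟩ := hy1
    obtain ⟨⟨c1, c2⟩, c3⟩ := hy2
    have hsq : ρ i ^ 2 ≤ 4 * ρ j ^ 2 := by nlinarith
    refine ⟨⟨by nlinarith, by nlinarith⟩, ?_⟩
    rw [mem_ball] at a3 b3 c3 ⊢
    have t1 := dist_triangle a.2 (z i).2 (z j).2
    have t2 := dist_triangle (z i).2 y.2 (z j).2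
    rw [dist_comm] at b3
    linarith
  have h5 : ∀ j ∈ J, ENNReal.ofReal (ε / 5 ^ (n + 2)) * volume (Cyl (5 * ρ j) (z j)) ≤ volume (Cyl (ρ j) (z j) \ E) := by
    intro j hj
    refine le_trans (le_of_eq ?_) (h j (hJ j hj))
    have h2 := hρ j (hJ j hj)
    rw [Cyl_vol (by positivity), Cyl_vol h2, ← mul_assoc, ← mul_assoc, ← ENNReal.ofReal_mul (by positivity), ← ENNReal.ofReal_mul (by positivity)]
    congr 2
    field_simp
    rw [mul_pow]

  calc ENNReal.ofReal (ε / 5 ^ (n + 2)) * volume (⋃ i ∈ I, Cyl (ρ i) (z i)) 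
      ≤ ENNReal.ofReal (ε / 5 ^ (n + 2)) * ∑ j ∈ J, volume (Cyl (5 * ρ j) (z j)) := 
        mul_le_mul' le_rfl ((measure_mono sub).trans (measure_biUnion_finset_le _ _))
    _ = ∑ j ∈ J, ENNReal.ofReal (ε / 5 ^ (n + 2)) * volume (Cyl (5 * ρ j) (z j)) := Finset.mul_sum _ _ _
    _ ≤ ∑ j ∈ J, volume (Cyl (ρ j) (z j) \ E) := Finset.sum_le_sum h5
    _ = volume (⋃ j ∈ J, Cyl (ρ j) (z j) \ E) := by
        rw [measure_biUnion_finset (fun i hi j hj hij => (hdis hi hj hij).mono sdiff_le sdiff_le) (fun j _ => (Cyl_open _ _).measurableSet.diff hE)]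
    _ ≤ _ := by
        refine measure_mono (iUnion₂_subset fun j hj a ha => ⟨?_, ha.2⟩)
        exact mem_biUnion (hJ j hj) ha.1

lemma one_d {ι : Type*} [DecidableEq ι] (a b e : ι → ℝ) {k : ℝ} (hk : 1 ≤ k) (I : Finset ι) :
    (∀ i ∈ I, a i ≤ b i ∧ b i ≤ e i ∧ e i - a i ≤ k * (e i - b i)) →
    ∀ s, volume ((⋃ i ∈ I, Ioo (a i) (e i)) ∩ Ioi s) ≤ ENNReal.ofReal k * volume ((⋃ i ∈ I, Ioo (b i) (e i)) ∩ Ioi s) := by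
  induction I using Finset.induction_on_min_value (f := a) with
  | empty => intro _ s; simp
  | insert i I hi hmin ih =>
    intro h s
    obtain ⟨h1, h2, h3⟩ := h i (Finset.mem_insert_self _ _)
    have ih := ih (fun j hj => h j (Finset.mem_insert_of_mem hj))
    rcases le_or_gt (e i) s with hs | hs
    · refine (measure_mono ?_).trans ((ih s).trans (mul_le_mul' le_rfl (measure_mono ?_)))
      · rintro x ⟨hx, hxs⟩
        refine ⟨?_, hxs⟩
        rw [Finset.set_biUnion_insert] at hx
        rcases hx with hx | hx
        · exact absurd (hx.2.trans_le hs) (not_lt.2 (le_of_lt hxs))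
        · exact hx
      · refine inter_subset_inter_left _ ?_
        rw [Finset.set_biUnion_insert]; exact subset_union_right
    · have s1 : (⋃ j ∈ insert i I, Ioo (a j) (e j)) ∩ Ioi s ⊆ Ioc (max s (a i)) (e i) ∪ ((⋃ j ∈ I, Ioo (a j) (e j)) ∩ Ioi (e i)) := by
        rintro x ⟨hx, hxs⟩
        rw [Finset.set_biUnion_insert] at hx
        rcases hx with hx | hx
        · exact Or.inl ⟨max_lt hxs hx.1, hx.2.le⟩
        · rcases le_or_gt x (e i) with hxe | hxe
          · obtain ⟨j, hj, hx'⟩ := mem_iUnion₂.1 hx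
            exact Or.inl ⟨max_lt hxs ((hmin j hj).trans_lt hx'.1), hxe⟩
          · exact Or.inr ⟨hx, hxe⟩
      have s2 : Ioo (max s (b i)) (e i) ∪ ((⋃ j ∈ I, Ioo (b j) (e j)) ∩ Ioi (e i)) ⊆ (⋃ j ∈ insert i I, Ioo (b j) (e j)) ∩ Ioi s := by
        rw [Finset.set_biUnion_insert]
        rintro x (hx | hx)
        · exact ⟨Or.inl ⟨(le_max_right _ _).trans_lt hx.1, hx.2⟩, (le_max_left _ _).trans_lt hx.1⟩
        · exact ⟨Or.inr hx.1, hs.trans hx.2⟩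
      have d : Disjoint (Ioo (max s (b i)) (e i)) ((⋃ j ∈ I, Ioo (b j) (e j)) ∩ Ioi (e i)) := 
        Set.disjoint_left.2 fun x hx hx' => lt_asymm hx.2 hx'.2
      have m : volume (Ioo (max s (b i)) (e i)) + volume ((⋃ j ∈ I, Ioo (b j) (e j)) ∩ Ioi (e i)) ≤ volume ((⋃ j ∈ insert i I, Ioo (b j) (e j)) ∩ Ioi s) := by
        rw [← measure_union' d measurableSet_Ioo]; exact measure_mono s2
      refine (measure_mono s1).trans ((measure_union_le _ _).trans (le_trans ?_ (mul_le_mul' le_rfl m)))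
      rw [mul_add]
      refine add_le_add ?_ (ih _)
      rw [Real.volume_Ioc, Real.volume_Ioo, ← ENNReal.ofReal_mul (by linarith)]
      refine ENNReal.ofReal_le_ofReal ?_
      rcases le_total s (b i) with hb | hb
      · rw [max_eq_right hb]
        linarith [le_max_right s (a i)]
      · rw [max_eq_left hb, max_eq_left (h1.trans hb)]
        nlinarith

lemma stack_step {ι : Type*} (I : Finset ι) (z : ι → ℝ × ES n) (ρ : ι → ℝ) {m : ℝ} (hm : 0 < m) :
    volume (⋃ i ∈ I, Cyl (ρ i) (z i)) ≤ ENNReal.ofReal (1 + 1 / m) * 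
      volume (⋃ i ∈ I, Ioo ((z i).1 + ρ i ^ 2) ((z i).1 + ρ i ^ 2 + m * (2 * ρ i ^ 2)) ×ˢ ball (z i).2 (ρ i)) := by
  classical
  have mU : MeasurableSet (⋃ i ∈ I, Cyl (ρ i) (z i)) := I.measurableSet_biUnion fun i _ => (Cyl_open _ _).measurableSet
  have mA : MeasurableSet (⋃ i ∈ I, Ioo ((z i).1 + ρ i ^ 2) ((z i).1 + ρ i ^ 2 + m * (2 * ρ i ^ 2)) ×ˢ ball (z i).2 (ρ i)) := 
    I.measurableSet_biUnion fun i _ => (isOpen_Ioo.prod isOpen_ball).measurableSet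
  rw [Measure.volume_eq_prod, Measure.prod_apply_symm mU, Measure.prod_apply_symm mA, ← lintegral_const_mul' _ _ ENNReal.ofReal_ne_top]
  refine lintegral_mono fun x => ?_
  set J := I.filter fun i => x ∈ ball (z i).2 (ρ i) with hJ
  obtain ⟨s, hs⟩ : ∃ s, ∀ i ∈ J, s ≤ (z i).1 - ρ i ^ 2 := by
    obtain ⟨R, hR⟩ := (J.image fun i => -((z i).1 - ρ i ^ 2)).exists_le
    exact ⟨-R, fun i hi => neg_le.1 (hR _ (Finset.mem_image_of_mem _ hi))⟩
  have := one_d (fun i => (z i).1 - ρ i ^ 2) (fun i => (z i).1 + ρ i ^ 2) (fun i => (z i).1 + ρ i ^ 2 + m * (2 * ρ i ^ 2)) (k := 1 + 1 / m)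
    (by have : 0 < 1 / m := by positivity
        linarith) J (fun i _ => ⟨by nlinarith [sq_nonneg (ρ i)], by nlinarith [mul_nonneg hm.le (sq_nonneg (ρ i))], by field_simp; nlinarith⟩) s
  refine (measure_mono ?_).trans (this.trans (mul_le_mul' le_rfl (measure_mono ?_)))
  · intro t ht
    obtain ⟨i, hi, ht⟩ := mem_iUnion₂.1 (show (t, x) ∈ _ from ht)
    have hiJ : i ∈ J := Finset.mem_filter.2 ⟨hi, ht.2⟩
    refine ⟨mem_biUnion (show i ∈ (J : Set ι) from hiJ) ⟨ht.1.1, ht.1.2.trans_le ?_⟩, (hs i hiJ).trans_lt ht.1.1⟩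
    nlinarith [mul_nonneg hm.le (sq_nonneg (ρ i))]
  · rintro t ⟨ht, -⟩
    obtain ⟨i, hi, ht⟩ := mem_iUnion₂.1 ht
    obtain ⟨hi1, hi2⟩ := Finset.mem_filter.1 hi
    exact mem_biUnion (show i ∈ (I : Set ι) from hi1) (show (t, x) ∈ _ from ⟨ht, hi2⟩)
end QP

namespace QP
open MeasureTheory Filter Topology Metric
variable {n : ℕ}

lemma lem1s (n : ℕ) {ν Λ B : ℝ} (hν : 0 < ν) (hΛ : 0 ≤ Λ) (hB : 0 ≤ B) : ∃ ε : ℝ, 0 < ε ∧ ε ≤ 1 ∧ 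
    ∀ (w : ℝ → ES n → ℝ) (r h : ℝ) (z : ℝ × ES n), 0 < r → r ≤ 1 → 0 < h → Sup ν Λ B z.1 (z.1 + r ^ 2 / 2) w →
    (∀ t ∈ Icc z.1 (z.1 + r ^ 2 / 2), ∀ x, dist x z.2 ≤ r → 0 ≤ w t x) →
    volume (Cyl r z \ {a | h < w a.1 a.2}) ≤ ENNReal.ofReal ε * volume (Cyl r z) →
    ∀ x, dist x z.2 ≤ r / 4 → h / 2 ≤ w (z.1 + r ^ 2 / 2) x := by
  obtain ⟨ε, hε, H⟩ := lem1 n hν hΛ hB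
  set V := volume (Cyl 1 (0 : ℝ × ES n)) with hV
  have hVt : V ≠ ⊤ := Cyl1_lt.ne
  have hVr : 0 < V.toReal := ENNReal.toReal_pos Cyl1_pos.ne' hVt
  refine ⟨min 1 (ε / (2 ^ (n + 2) * V.toReal)), by positivity, min_le_left _ _, fun w r h z hr hr1 hh hS hpos hv x hx => ?_⟩
  have hr2 : 0 < r / 2 := by positivity
  have hS' := (hS.rescale (x0 := z.2) hr2 (by linarith) hB (t0 := z.1 + r ^ 2 / 2) (a' := -2) (c' := 0) (by linarith) (by linarith)).smul (inv_nonneg.2 hh.le)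
  have hn : ∀ y : ES n, dist (z.2 + (r / 2) • y) z.2 = r / 2 * ‖y‖ := fun y => by
    rw [dist_eq_norm, add_sub_cancel_left, norm_smul, Real.norm_eq_abs, abs_of_pos hr2]
  have h1 := H _ hS' ?_ ?_ ((r / 2)⁻¹ • (x - z.2)) ?_
  · have e : z.2 + (r / 2) • (r / 2)⁻¹ • (x - z.2) = x := by
      rw [smul_smul, mul_inv_cancel₀ hr2.ne', one_smul, add_sub_cancel]
    rw [e, mul_zero, add_zero] at h1
    have := mul_le_mul_of_nonneg_left h1 hh.le
    rw [← mul_assoc, mul_inv_cancel₀ hh.ne', one_mul] at this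
    linarith
  · refine le_trans (measure_mono (t := (fun a : ℝ × ES n => (z.1 + r ^ 2 / 2 + (r / 2) ^ 2 * a.1, z.2 + (r / 2) • a.2)) ⁻¹' (Cyl r z \ {a | h < w a.1 a.2})) ?_) ?_
    · rintro ⟨s, y⟩ ⟨hs, hy, hw⟩
      refine ⟨⟨⟨?_, ?_⟩, ?_⟩, ?_⟩
      · simp only; nlinarith [hs.1, hs.2]
      · simp only; nlinarith [hs.1, hs.2]
      · rw [mem_closedBall_zero_iff] at hy
        rw [mem_ball, hn]; nlinarith
      · simp only [mem_setOf_eq, not_lt] at hw ⊢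
        have := mul_le_mul_of_nonneg_left hw.le hh.le
        rw [← mul_assoc, mul_inv_cancel₀ hh.ne', one_mul] at this
        linarith
    · rw [vol_scale hr2]
      refine (mul_le_mul' le_rfl hv).trans ?_
      rw [Cyl_vol hr, ← hV, ← ENNReal.ofReal_toReal hVt, ← ENNReal.ofReal_mul (by positivity), ← ENNReal.ofReal_mul (by positivity), ← ENNReal.ofReal_mul (by positivity)]
      refine ENNReal.ofReal_le_ofReal ?_
      rw [ENNReal.toReal_ofReal hVr.le]
      have i1 : min 1 (ε / (2 ^ (n + 2) * V.toReal)) ≤ ε / (2 ^ (n + 2) * V.toReal) := min_le_right _ _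
      have e1 : ((r / 2) ^ (n + 2))⁻¹ * (ε / (2 ^ (n + 2) * V.toReal) * (r ^ (n + 2) * V.toReal)) = ε := by
        rw [div_pow]; field_simp
      refine le_trans ?_ e1.le
      gcongr
  · intro t ht y hy
    rw [mem_closedBall_zero_iff] at hy
    refine mul_nonneg (inv_nonneg.2 hh.le) (hpos _ ⟨?_, ?_⟩ _ ?_)
    · nlinarith [ht.1, ht.2]
    · nlinarith [ht.1, ht.2]
    · rw [hn]; nlinarith
  · rw [norm_smul, norm_inv, Real.norm_eq_abs, abs_of_pos hr2, ← dist_eq_norm]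
    rw [inv_mul_le_iff₀ hr2]; linarith

lemma lem2s (n : ℕ) {ν Λ B ρ κ T1 P : ℝ} (hν : 0 < ν) (hΛ : 0 ≤ Λ) (hB : 0 ≤ B) (hρ : 0 < ρ) (hκ : 0 < κ) (hP : 0 ≤ P) (hPs : ρ ^ 2 + κ * T1 ≤ P ^ 2) :
    ∃ c : ℝ, 0 < c ∧ ∀ T2 ≤ T1, ∀ (w : ℝ → ES n → ℝ) (r h t0 : ℝ) (x0 : ES n), 0 < r → r ≤ 1 → 0 < h → Sup ν Λ B t0 (t0 + r ^ 2 * T2) w →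
      (∀ t ∈ Icc t0 (t0 + r ^ 2 * T2), ∀ x, dist x x0 ≤ r * P → 0 ≤ w t x) → (∀ x, dist x x0 ≤ r * ρ → h ≤ w t0 x) →
      ∀ t ∈ Icc t0 (t0 + r ^ 2 * T2), ∀ x, 2 * dist x x0 ^ 2 ≤ r ^ 2 * ρ ^ 2 + κ * (t - t0) → c * h ≤ w t x := by
  obtain ⟨c, hc, H⟩ := lem2 n hν hΛ hB hρ hκ hP hPs
  refine ⟨c, hc, fun T2 hT2 w r h t0 x0 hr hr1 hh hS hpos h1 t ht x hx => ?_⟩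
  have hS' := (hS.rescale (x0 := x0) hr hr1 hB (t0 := t0) (a' := 0) (c' := T2) (by linarith) (by linarith)).smul (inv_nonneg.2 hh.le)
  have hn : ∀ y : ES n, dist (x0 + r • y) x0 = r * ‖y‖ := fun y => by
    rw [dist_eq_norm, add_sub_cancel_left, norm_smul, Real.norm_eq_abs, abs_of_pos hr]
  have hr2 : 0 < r ^ 2 := by positivity
  have key := H T2 hT2 _ hS' (fun s hs y hy => ?_) (fun y hy => ?_) ((r ^ 2)⁻¹ * (t - t0)) ⟨?_, ?_⟩ (r⁻¹ • (x - x0)) ?_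
  · rw [smul_smul, mul_inv_cancel₀ hr.ne', one_smul, add_sub_cancel, ← mul_assoc (r ^ 2), mul_inv_cancel₀ hr2.ne', one_mul, add_sub_cancel] at key
    have := mul_le_mul_of_nonneg_left key hh.le
    rw [← mul_assoc, mul_inv_cancel₀ hh.ne', one_mul] at this
    linarith
  · refine mul_nonneg (inv_nonneg.2 hh.le) (hpos _ ⟨?_, ?_⟩ _ ?_)
    · nlinarith [hs.1]
    · nlinarith [hs.2]
    · rw [hn]; nlinarith
  · have := h1 (x0 + r • y) (by rw [hn]; nlinarith)
    rw [mul_zero, add_zero, le_inv_mul_iff₀ hh]; linarith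
  · exact mul_nonneg (inv_nonneg.2 hr2.le) (by linarith [ht.1])
  · rw [inv_mul_le_iff₀ hr2]; linarith [ht.2]
  · rw [norm_smul, norm_inv, Real.norm_eq_abs, abs_of_pos hr, ← dist_eq_norm]
    have e1 : 2 * (r⁻¹ * dist x x0) ^ 2 = (r ^ 2)⁻¹ * (2 * dist x x0 ^ 2) := by field_simp
    have e2 : ρ ^ 2 + κ * ((r ^ 2)⁻¹ * (t - t0)) = (r ^ 2)⁻¹ * (r ^ 2 * ρ ^ 2 + κ * (t - t0)) := by field_simp
    rw [e1, e2]
    exact mul_le_mul_of_nonneg_left hx (inv_nonneg.2 hr2.le)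

/-- from density to the stack above -/
lemma lem3 (n : ℕ) {ν Λ B : ℝ} (hν : 0 < ν) (hΛ : 0 ≤ Λ) (hB : 0 ≤ B) {ε : ℝ}
    (H1 : ∀ (w : ℝ → ES n → ℝ) (r h : ℝ) (z : ℝ × ES n), 0 < r → r ≤ 1 → 0 < h → Sup ν Λ B z.1 (z.1 + r ^ 2 / 2) w →
    (∀ t ∈ Icc z.1 (z.1 + r ^ 2 / 2), ∀ x, dist x z.2 ≤ r → 0 ≤ w t x) →
    volume (Cyl r z \ {a | h < w a.1 a.2}) ≤ ENNReal.ofReal ε * volume (Cyl r z) →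
    ∀ x, dist x z.2 ≤ r / 4 → h / 2 ≤ w (z.1 + r ^ 2 / 2) x) {m : ℝ} (hm : 0 < m) :
    ∃ c : ℝ, 0 < c ∧ ∀ (w : ℝ → ES n → ℝ) (r h : ℝ) (z : ℝ × ES n), 0 < r → r ≤ 1 → 0 < h → Sup ν Λ B z.1 (z.1 + r ^ 2 * (5 + 8 * m)) w →
    (∀ t ∈ Icc z.1 (z.1 + r ^ 2 * (5 + 8 * m)), ∀ x, dist x z.2 ≤ r * (14 + 24 * m) → 0 ≤ w t x) →
    volume (Cyl r z \ {a | h < w a.1 a.2}) ≤ ENNReal.ofReal ε * volume (Cyl r z) →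
    ∀ t ∈ Icc (z.1 + (2 * r) ^ 2) (z.1 + (2 * r) ^ 2 + m * (2 * (2 * r) ^ 2)), ∀ x, dist x z.2 ≤ 2 * r → c * h ≤ w t x := by
  obtain ⟨c, hc, H2⟩ := lem2s n (ρ := 1/4) (κ := 3) (T1 := 4 + 8 * m) (P := 14 + 24 * m) hν hΛ hB (by norm_num) (by norm_num) (by positivity) (by nlinarith)
  refine ⟨c / 2, by positivity, fun w r h z hr hr1 hh hS hpos hv t ht x hx => ?_⟩
  have hr2 : 0 < r ^ 2 := by positivity
  have hmr : 0 < r ^ 2 * m := by positivity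
  have h1 := H1 w r h z hr hr1 hh (hS.mono le_rfl (by nlinarith)) (fun t ht x hx => hpos t ⟨ht.1, ht.2.trans (by nlinarith)⟩ x (hx.trans (by nlinarith))) hv
  have h2 := H2 (4 + 8 * m) le_rfl w r (h / 2) (z.1 + r ^ 2 / 2) z.2 hr hr1 (by positivity) (hS.mono (by linarith) (by nlinarith))
    (fun t ht x hx => hpos t ⟨by linarith [ht.1], ht.2.trans (by nlinarith)⟩ x hx) (fun x hx => h1 x (by linarith)) t ⟨by nlinarith [ht.1], by nlinarith [ht.2]⟩ x ?_
  · linarith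
  · have := pow_le_pow_left₀ dist_nonneg hx 2
    nlinarith [ht.1]
end QP

namespace QP
open MeasureTheory Filter Topology Metric
variable {n : ℕ}

lemma Cyl_small {E : Set (ℝ × ES n)} (hE : IsOpen E) {z : ℝ × ES n} (hz : z ∈ E) {r : ℝ} (hr : 0 < r) :
    ∃ k : ℕ, Cyl (r / 2 ^ k) z ⊆ E := by
  obtain ⟨e, he, hs⟩ := Metric.isOpen_iff.1 hE z hz
  have h1 : Tendsto (fun k : ℕ => r / 2 ^ k) atTop (𝓝 0) := by
    have := (tendsto_pow_atTop_nhds_zero_of_lt_one (r := (1/2 : ℝ)) (by norm_num) (by norm_num)).const_mul r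
    rw [mul_zero] at this
    refine this.congr fun k => ?_
    rw [one_div, inv_pow, div_eq_mul_inv]
  obtain ⟨k, hk, hk1⟩ := ((h1.eventually (gt_mem_nhds he)).and (h1.eventually (gt_mem_nhds one_pos))).exists
  have hp : 0 < r / 2 ^ k := by positivity
  refine ⟨k, fun a ha => hs ?_⟩
  set q := r / 2 ^ k
  have hq : q ^ 2 < e := by nlinarith
  rw [mem_ball, Prod.dist_eq, max_lt_iff, Real.dist_eq, abs_lt]
  obtain ⟨⟨h2, h3⟩, h4⟩ := ha
  exact ⟨⟨by linarith, by linarith⟩, (mem_ball.1 h4).trans hk⟩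

lemma growth {ε m c0 rs : ℝ} (hε : 0 < ε) (hm : 0 < m) (hc0 : c0 = ε / 5 ^ (n + 2)) (hc1 : c0 ≤ 1) (hr : 0 < rs)
    (hmc : (1 - c0) * (1 + 1 / m) ≤ 1 - c0 / 2) {E E' : Set (ℝ × ES n)} (hE : IsOpen E)
    (hno : ∀ z ∈ E, ¬ volume (Cyl rs z \ E) ≤ ENNReal.ofReal ε * volume (Cyl rs z))
    (H : ∀ z ∈ E, ∀ r, 0 < r → r ≤ rs / 2 → volume (Cyl r z \ E) ≤ ENNReal.ofReal ε * volume (Cyl r z) →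
      Ioo (z.1 + (2 * r) ^ 2) (z.1 + (2 * r) ^ 2 + m * (2 * (2 * r) ^ 2)) ×ˢ ball z.2 (2 * r) ⊆ E') :
    volume E ≤ ENNReal.ofReal (1 - c0 / 2) * volume E' := by
  classical
  have hc0p : 0 < c0 := by rw [hc0]; positivity
  have key : ∀ z : E, ∃ r, 0 < r ∧ r ≤ rs / 2 ∧ volume (Cyl r (z : ℝ × ES n) \ E) ≤ ENNReal.ofReal ε * volume (Cyl r (z : ℝ × ES n)) ∧
      ¬ volume (Cyl (2 * r) (z : ℝ × ES n) \ E) ≤ ENNReal.ofReal ε * volume (Cyl (2 * r) (z : ℝ × ES n)) := by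
    rintro ⟨z, hz⟩
    have ex : ∃ k : ℕ, volume (Cyl (rs / 2 ^ k) z \ E) ≤ ENNReal.ofReal ε * volume (Cyl (rs / 2 ^ k) z) := by
      obtain ⟨k, hk⟩ := Cyl_small hE hz hr
      refine ⟨k, ?_⟩
      rw [sdiff_eq_bot_iff.2 hk]; simp
    obtain ⟨j, hj⟩ : ∃ j, Nat.find ex = j + 1 := by
      refine Nat.exists_eq_succ_of_ne_zero fun h0 => ?_
      have := Nat.find_spec ex
      rw [h0, pow_zero, div_one] at this
      exact hno z hz this
    refine ⟨rs / 2 ^ (j + 1), by positivity, ?_, hj ▸ Nat.find_spec ex, ?_⟩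
    · rw [pow_succ, ← div_div]
      gcongr
      exact div_le_self hr.le (one_le_pow₀ (by norm_num))
    · have : 2 * (rs / 2 ^ (j + 1)) = rs / 2 ^ j := by rw [pow_succ]; field_simp
      simp only [this]
      exact Nat.find_min ex (by omega)
  choose r hr0 hr1 hr2 hr3 using key
  rw [hE.measure_eq_iSup_isCompact]
  refine iSup₂_le fun K hK => iSup_le fun hKc => ?_
  obtain ⟨I, hI⟩ := hKc.elim_finite_subcover (fun z : E => Cyl (2 * r z) (z : ℝ × ES n)) (fun z => Cyl_open _ _)
    (fun z hz => mem_iUnion.2 ⟨⟨z, hK hz⟩, Cyl_self (by linarith [hr0 ⟨z, hK hz⟩]) _⟩)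
  set U := ⋃ z ∈ I, Cyl (2 * r z) (z : ℝ × ES n) with hU
  have hv := vitali_step I (fun z : E => (z : ℝ × ES n)) (fun z => 2 * r z) (fun i _ => by linarith [hr0 i]) E hE.measurableSet hε
    (fun i _ => (not_le.1 (hr3 i)).le)
  have hs := stack_step I (fun z : E => (z : ℝ × ES n)) (fun z => 2 * r z) hm
  rw [← hc0] at hv
  have hUf : volume U ≠ ⊤ := by
    refine ((measure_biUnion_finset_le I _).trans_lt (ENNReal.sum_lt_top.2 fun i _ => ?_)).ne
    rw [Cyl_vol (by linarith [hr0 i])]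
    exact ENNReal.mul_lt_top ENNReal.ofReal_lt_top Cyl1_lt
  have h1 : volume (U ∩ E) ≤ ENNReal.ofReal (1 - c0) * volume U := by
    have e1 := measure_inter_add_diff (μ := volume) U hE.measurableSet
    have e2 : ENNReal.ofReal (1 - c0) * volume U + ENNReal.ofReal c0 * volume U = volume U := by
      rw [← add_mul, ← ENNReal.ofReal_add (by linarith) hc0p.le]; simp
    have e3 : volume (U ∩ E) + ENNReal.ofReal c0 * volume U ≤ ENNReal.ofReal (1 - c0) * volume U + ENNReal.ofReal c0 * volume U := by
      rw [e2]; refine le_trans ?_ e1.le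
      gcongr
    exact (ENNReal.add_le_add_iff_right (ENNReal.mul_ne_top ENNReal.ofReal_ne_top hUf)).1 e3
  refine (measure_mono (subset_inter hI hK)).trans (h1.trans ?_)
  refine (mul_le_mul' le_rfl hs).trans ?_
  rw [← mul_assoc, ← ENNReal.ofReal_mul (by linarith)]
  refine mul_le_mul' (ENNReal.ofReal_le_ofReal hmc) (measure_mono ?_)
  exact iUnion₂_subset fun z _ => H z z.2 (r z) (hr0 z) (hr1 z) (hr2 z)
end QP

namespace QP
open MeasureTheory Filter Topology Metric
variable {n : ℕ}

set_option maxHeartbeats 1000000 in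
lemma expand (n : ℕ) {ν Λ B : ℝ} (hν : 0 < ν) (hΛ : 0 ≤ Λ) (hB : 0 ≤ B) : ∃ η : ℝ, 0 < η ∧
    ∀ (w : ℝ → ES n → ℝ), Sup ν Λ B 0 4 w → (∀ t ∈ Icc (0 : ℝ) 4, ∀ x, ‖x‖ ≤ 16 → 0 ≤ w t x) →
    ENNReal.ofReal (1 / 2) * volume (Ioo (0 : ℝ) 1 ×ˢ ball (0 : ES n) 1) ≤ volume ((Ioo (0 : ℝ) 1 ×ˢ ball (0 : ES n) 1) ∩ {a | 1 < w a.1 a.2}) →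
    ∀ t ∈ Icc (3 : ℝ) 4, ∀ x, ‖x‖ ≤ 1 → η ≤ w t x := by
  obtain ⟨ε, hε, hε1, H1⟩ := lem1s n hν hΛ hB
  set c0 := ε / 5 ^ (n + 2) with hc0
  have hc0p : 0 < c0 := by positivity
  have hc1 : c0 ≤ 1 := (div_le_self hε.le (one_le_pow₀ (by norm_num))).trans hε1
  set m := 2 / c0 with hmd
  have hm : 0 < m := by positivity
  have hmc : (1 - c0) * (1 + 1 / m) ≤ 1 - c0 / 2 := by
    have : 1 / m = c0 / 2 := by rw [hmd, one_div_div]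
    rw [this]; nlinarith
  obtain ⟨c, hc, H3⟩ := lem3 n hν hΛ hB H1 hm
  set c1 := min 1 (c / 2) with hcd
  have hc1p : 0 < c1 := by positivity
  have hc11 : c1 ≤ 1 := min_le_left _ _
  have hc1c : c1 ≤ c / 2 := min_le_right _ _
  set V1 := volume (Ioo (0 : ℝ) 1 ×ˢ ball (0 : ES n) 1) with hV1
  set V2 := volume (Ioo (0 : ℝ) 2 ×ˢ ball (0 : ES n) 2) with hV2
  have hvp : ∀ r : ℝ, volume (Ioo (0 : ℝ) r ×ˢ ball (0 : ES n) r) ≠ ⊤ := fun r => by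
    rw [Measure.volume_eq_prod, Measure.prod_prod]
    exact ENNReal.mul_ne_top measure_Ioo_lt_top.ne measure_ball_lt_top.ne
  have hV1p : 0 < V1 := by
    rw [hV1, Measure.volume_eq_prod, Measure.prod_prod]
    exact ENNReal.mul_pos (by simp) (measure_ball_pos _ _ one_pos).ne'
  have hV1r : 0 < V1.toReal := ENNReal.toReal_pos hV1p.ne' (hvp 1)
  obtain ⟨N, hN⟩ : ∃ N : ℕ, (1 - c0 / 2) ^ N * V2.toReal < 1 / 2 * V1.toReal := by
    have := (tendsto_pow_atTop_nhds_zero_of_lt_one (r := 1 - c0 / 2) (by linarith) (by linarith)).mul_const V2.toReal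
    rw [zero_mul] at this
    exact (this.eventually (gt_mem_nhds (by positivity))).exists
  have hNp : (0 : ℝ) < N + 1 := by positivity
  set rs := 1 / ((N + 1) * (14 + 24 * m)) with hrs
  have hrsp : 0 < rs := by positivity
  have hrs1 : rs * (14 + 24 * m) = 1 / (N + 1) := by rw [hrs]; field_simp
  have hN1 : 1 / ((N : ℝ) + 1) ≤ 1 := by rw [div_le_one hNp]; linarith [(Nat.cast_nonneg N : (0 : ℝ) ≤ N)]
  have hrm : 0 < rs * m := by positivity
  have hrs14 : rs * 14 ≤ 1 := by linarith
  have hrsq : rs ^ 2 * (14 + 24 * m) ≤ 1 / (N + 1) := by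
    rw [← hrs1, pow_two]
    exact mul_le_mul_of_nonneg_right (mul_le_of_le_one_left hrsp.le (by linarith)) (by positivity)
  obtain ⟨c2, hc2, H2⟩ := lem2s n (ρ := rs / 4) (κ := 36) (T1 := 4) (P := 13) hν hΛ hB (by positivity) (by norm_num) (by norm_num) (by have := pow_le_one₀ hrsp.le (show rs ≤ 1 by linarith) (n := 2); linarith)
  refine ⟨c2 * (c1 ^ N / 2), by positivity, fun w hS hpos hv => ?_⟩
  have hwc : Continuous (fun a : ℝ × ES n => w a.1 a.2) := hS.cont
  set D : ℕ → Set (ℝ × ES n) := fun k => Ioo (0 : ℝ) (1 + k * (1 / (N + 1))) ×ˢ ball (0 : ES n) (1 + k * (1 / (N + 1))) with hD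
  set E : ℕ → Set (ℝ × ES n) := fun k => D k ∩ {a | c1 ^ k < w a.1 a.2} with hE
  have hEo : ∀ k, IsOpen (E k) := fun k => (isOpen_Ioo.prod isOpen_ball).inter (isOpen_lt continuous_const hwc)
  have hk2 : ∀ k ≤ N, 1 + (k : ℝ) * (1 / (N + 1)) ≤ 2 := fun k hk => by
    have : (k : ℝ) ≤ N := by exact_mod_cast hk
    have : (k : ℝ) * (1 / (N + 1)) ≤ (N + 1) * (1 / (N + 1)) := by gcongr; linarith
    rw [mul_one_div_cancel hNp.ne'] at this
    linarith
  have hck : ∀ k ≤ N, c1 ^ N ≤ c1 ^ k := fun k hk => pow_le_pow_of_le_one hc1p.le hc11 hk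
  have case1 : ∃ k < N, ∃ z ∈ E k, volume (Cyl rs z \ E k) ≤ ENNReal.ofReal ε * volume (Cyl rs z) := by
    by_contra! hcon
    have step : ∀ k < N, volume (E k) ≤ ENNReal.ofReal (1 - c0 / 2) * volume (E (k + 1)) := by
      intro k hk
      refine growth hε hm hc0 hc1 hrsp hmc (hEo k) (fun z hz => not_le.2 (hcon k hk z hz)) ?_
      rintro z ⟨⟨⟨hz1, hz2⟩, hz3⟩, hz4⟩ r hr hr2 hvr ⟨t, x⟩ ⟨⟨ht1, ht2⟩, hx⟩
      have hr2s : 4 * r ^ 2 ≤ rs ^ 2 := by have := pow_le_pow_left₀ hr.le hr2 2; rw [div_pow] at this; linarith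
      have hr2m : 4 * r ^ 2 * m ≤ rs ^ 2 * m := mul_le_mul_of_nonneg_right hr2s hm.le
      have hrsm : 0 < rs ^ 2 * m := by positivity
      have hrs2 : 0 < rs ^ 2 := by positivity
      have hk' := hk2 k hk.le
      rw [mem_ball_zero_iff] at hz3
      rw [mem_ball] at hx
      have hxz : ∀ y : ES n, ‖y‖ ≤ dist y z.2 + ‖z.2‖ := fun y => by
        rw [dist_eq_norm]; have := norm_add_le (y - z.2) z.2; rwa [sub_add_cancel] at this
      simp only at ht1 ht2 hx
      have := H3 w r (c1 ^ k) z hr (by linarith) (by positivity) (hS.mono hz1.le (by linarith)) (fun t ht y hy => hpos t ⟨hz1.le.trans ht.1, ht.2.trans (by linarith)⟩ y ?_)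
        (le_trans (measure_mono (sdiff_subset_sdiff_right inter_subset_right)) hvr) t ⟨ht1.le, ht2.le⟩ x hx.le
      · refine ⟨⟨⟨?_, ?_⟩, ?_⟩, ?_⟩
        · simp only; have := sq_nonneg (2 * r); linarith
        · simp only; push_cast; linarith
        · rw [mem_ball_zero_iff]; push_cast
          have := hxz x
          linarith
        · have hp : 0 < c1 ^ k := by positivity
          have h2 : c1 ^ (k + 1) ≤ c / 2 * c1 ^ k := by rw [pow_succ, mul_comm]; gcongr
          show c1 ^ (k + 1) < w t x
          have := mul_pos hc hp; linarith
      · have h1 := hxz y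
        have h2 : r * (14 + 24 * m) ≤ rs * (14 + 24 * m) := by gcongr; linarith
        linarith
    have all : ∀ k ≤ N, volume (E 0) ≤ ENNReal.ofReal ((1 - c0 / 2) ^ k) * volume (E k) := by
      intro k
      induction k with
      | zero => intro _; simp
      | succ k ih =>
        intro hk
        refine (ih (by omega)).trans ((mul_le_mul' le_rfl (step k (by omega))).trans ?_)
        rw [← mul_assoc, ← ENNReal.ofReal_mul (pow_nonneg (by linarith) _), ← pow_succ]
    have h1 := all N le_rfl
    have h2 : volume (E N) ≤ V2 := measure_mono (inter_subset_left.trans (prod_mono (Ioo_subset_Ioo_right (hk2 N le_rfl)) (ball_subset_ball (hk2 N le_rfl))))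
    have h3 : ENNReal.ofReal (1 / 2) * V1 ≤ ENNReal.ofReal ((1 - c0 / 2) ^ N) * V2 := by
      refine le_trans hv (le_trans (le_of_eq ?_) (h1.trans (mul_le_mul' le_rfl h2)))
      simp [hE, hD]
    have h4 := ENNReal.toReal_mono (ENNReal.mul_ne_top ENNReal.ofReal_ne_top (hvp 2)) h3
    rw [ENNReal.toReal_mul, ENNReal.toReal_mul, ENNReal.toReal_ofReal (by norm_num), ENNReal.toReal_ofReal (pow_nonneg (by linarith) _)] at h4
    linarith
  obtain ⟨k, hk, z, ⟨⟨⟨hz1, hz2⟩, hz3⟩, hz4⟩, hvr⟩ := case1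
  have hk' := hk2 k hk.le
  rw [mem_ball_zero_iff] at hz3
  have hxz : ∀ y : ES n, ‖y‖ ≤ dist y z.2 + ‖z.2‖ := fun y => by
    rw [dist_eq_norm]; have := norm_add_le (y - z.2) z.2; rwa [sub_add_cancel] at this
  have hrs2 : 0 < rs ^ 2 := by positivity
  have hrs3 : rs ^ 2 ≤ 1 := by exact pow_le_one₀ hrsp.le (by linarith)
  have h1 := H1 w rs (c1 ^ k) z hrsp (by linarith) (by positivity) (hS.mono hz1.le (by linarith)) (fun t ht y hy => hpos t ⟨hz1.le.trans ht.1, ht.2.trans (by linarith)⟩ y (by have := hxz y; linarith))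
    (le_trans (measure_mono (sdiff_subset_sdiff_right inter_subset_right)) hvr)
  intro t ht x hx
  have hck' := hck k hk.le
  refine H2 (4 - (z.1 + rs ^ 2 / 2)) (by linarith) w 1 (c1 ^ N / 2) (z.1 + rs ^ 2 / 2) z.2 one_pos le_rfl (by positivity) (hS.mono (by linarith) (by linarith))
    (fun t ht y hy => hpos t ⟨by linarith [ht.1], by linarith [ht.2]⟩ y (by have := hxz y; linarith)) (fun y hy => (h1 y (by linarith)).trans' (by linarith)) t
    ⟨by linarith [ht.1], by linarith [ht.2]⟩ x ?_
  have d1 : dist x z.2 ≤ 3 := by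
    rw [dist_eq_norm]; have := norm_sub_le x z.2; linarith
  have d2 : dist x z.2 ^ 2 ≤ 9 := by have := pow_le_pow_left₀ dist_nonneg d1 2; linarith
  have := sq_nonneg (rs / 4)
  linarith [ht.1]
end QP

namespace QP
open MeasureTheory Filter Topology Metric
variable {n : ℕ}

section
variable {T β ν Λ Q K : ℝ} {u : ℝ → ES n → ℝ} {p : ℝ → ES n → (ES n →L[ℝ] ℝ)} {q : ℝ → ES n → Bil n}
  {S : ℝ → ES n → (ES n →L[ℝ] ES n)} {b : ℝ → ES n → ES n} {f : ℝ → ES n → ℝ}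

lemma Sup_of (cS : Continuous (Function.uncurry S)) (cb : Continuous (Function.uncurry b)) (ell : ∀ t x, Ell ν Λ (S t x))
    (bb : ∀ t x, ‖b t x‖ ≤ Q) (cf : Continuous (Function.uncurry f)) (hf : ∀ t x, |f t x| ≤ K)
    (h : Reg T β u p q) (hp : Pde T S b f u p q) {σ : ℝ} (hσ : |σ| = 1) (e : ℝ) {a c : ℝ} (ha : 0 < a) (hc : c < T) :
    Sup ν Λ Q a c (fun t x => σ * u t x + e + K * t) := by
  have cl : Continuous (Function.uncurry fun t x => Lop (S t x) (q t x) + p t x (b t x) + f t x) := by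
    have h1 : Continuous (Function.uncurry fun t x => Lop (S t x) (q t x)) := Lop_cont.comp (cS.prodMk h.cq)
    have h2 : Continuous (Function.uncurry fun t x => p t x (b t x)) := h.cp.clm_apply cb
    exact (h1.add h2).add cf
  refine ⟨fun t x => σ • p t x, fun t x => σ • q t x, fun t x => σ * (Lop (S t x) (q t x) + p t x (b t x) + f t x) + K, S, b, ?_, h.cp.const_smul σ, h.cq.const_smul σ,
    ?_, cS, cb, fun t x => ?_, fun t x => (h.dp t x).const_smul σ, fun t ht x => ?_, ell, bb, fun t ht x => ?_⟩
  · have h1 : Continuous (Function.uncurry fun t x => σ * u t x) := continuous_const.mul h.cu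
    have h2 : Continuous (Function.uncurry fun (t : ℝ) (x : ES n) => K * t) := continuous_const.mul continuous_fst
    exact (h1.add (continuous_const (y := e))).add h2
  · have h1 : Continuous (Function.uncurry fun t x => σ * (Lop (S t x) (q t x) + p t x (b t x) + f t x)) := continuous_const.mul cl
    exact h1.add continuous_const
  · exact (((h.du t x).const_mul σ).add_const e).add_const _
  · have h1 := hp t ⟨ha.trans_le ht.1, ht.2.trans_lt hc⟩ x
    exact ((((h1.const_mul σ).add_const e).add ((hasDerivAt_id t).const_mul K))).congr_deriv (by rw [mul_one])
  · rw [Lop_smul, _root_.smul_apply, smul_eq_mul]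
    have : |σ * f t x| ≤ K := by rw [abs_mul, hσ, one_mul]; exact hf t x
    have := (abs_le.1 this).1
    linarith

lemma decay (n : ℕ) {ν Λ Q : ℝ} (hν : 0 < ν) (hΛ : 0 ≤ Λ) (hQ : 0 ≤ Q) : ∃ η : ℝ, 0 < η ∧ η ≤ 1 ∧
    ∀ (T β K : ℝ) (u : ℝ → ES n → ℝ) (p : ℝ → ES n → (ES n →L[ℝ] ℝ)) (q : ℝ → ES n → Bil n)
      (S : ℝ → ES n → (ES n →L[ℝ] ES n)) (b : ℝ → ES n → ES n) (f : ℝ → ES n → ℝ),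
    Continuous (Function.uncurry S) → Continuous (Function.uncurry b) → (∀ t x, Ell ν Λ (S t x)) → (∀ t x, ‖b t x‖ ≤ Q) →
    Continuous (Function.uncurry f) → (∀ t x, |f t x| ≤ K) → Reg T β u p q → Pde T S b f u p q →
    ∀ (r a : ℝ) (x0 : ES n) (m O : ℝ), 0 < r → r ≤ 1 → 0 < a → a + 4 * r ^ 2 < T → 0 < O →
    (∀ t ∈ Icc a (a + 4 * r ^ 2), ∀ x, dist x x0 ≤ 16 * r → m ≤ u t x ∧ u t x ≤ m + O) →
    ∃ m', ∀ t ∈ Icc (a + 3 * r ^ 2) (a + 4 * r ^ 2), ∀ x, dist x x0 ≤ r → 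
      m' ≤ u t x ∧ u t x ≤ m' + ((1 - η / 4) * O + 4 * K * r ^ 2) := by
  obtain ⟨η, hη, H⟩ := expand n hν hΛ hQ
  have hη' : 0 < min 1 η := by positivity
  refine ⟨min 1 η, hη', min_le_left _ _, fun T β K u p q S b f cS cb ell bb cf hf h hp r a x0 m O hr hr1 ha haT hO hu => ?_⟩
  have hr2 : 0 < r ^ 2 := by positivity
  have hK : 0 ≤ K := (abs_nonneg _).trans (hf 0 0)
  have hdist : ∀ y : ES n, dist (x0 + r • y) x0 = r * ‖y‖ := fun y => by
    rw [dist_eq_norm, add_sub_cancel_left, norm_smul, Real.norm_eq_abs, abs_of_pos hr]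
  set D := Ioo (0 : ℝ) 1 ×ˢ ball (0 : ES n) 1 with hD
  have hDm : MeasurableSet D := (isOpen_Ioo.prod isOpen_ball).measurableSet
  have main : ∀ σ e : ℝ, |σ| = 1 → (∀ t ∈ Icc a (a + 4 * r ^ 2), ∀ x, dist x x0 ≤ 16 * r → 0 ≤ σ * u t x + e) →
      ENNReal.ofReal (1 / 2) * volume D ≤ volume (D ∩ {z | O / 2 ≤ σ * u (a + r ^ 2 * z.1) (x0 + r • z.2) + e}) →
      ∀ t ∈ Icc (a + 3 * r ^ 2) (a + 4 * r ^ 2), ∀ x, dist x x0 ≤ r → min 1 η * O / 4 - 4 * K * r ^ 2 ≤ σ * u t x + e := by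
    intro σ e hσ hpos hvol t ht x hx
    have hS := ((Sup_of cS cb ell bb cf hf h hp hσ (e - K * a) (a := a) (c := a + 4 * r ^ 2) ha haT).rescale (x0 := x0) (t0 := a) (a' := 0) (c' := 4) hr hr1 hQ (by simp) (by linarith)).smul
      (k := 4 / O) (by positivity)
    have hOp : 0 < 4 / O := by positivity
    have := H _ hS ?_ ?_ ((t - a) / r ^ 2) ⟨?_, ?_⟩ (r⁻¹ • (x - x0)) ?_
    · have e1 : a + r ^ 2 * ((t - a) / r ^ 2) = t := by field_simp; ring
      have e2 : x0 + r • r⁻¹ • (x - x0) = x := by rw [smul_smul, mul_inv_cancel₀ hr.ne', one_smul, add_sub_cancel]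
      rw [e1, e2, div_mul_eq_mul_div, le_div_iff₀ hO] at this
      have h3 : K * (t - a) ≤ K * (4 * r ^ 2) := by gcongr; linarith [ht.2]
      have h4 : min 1 η * O ≤ η * O := by gcongr; exact min_le_right _ _
      linarith
    · intro s hs y hy
      have h5 : 0 ≤ s * r ^ 2 := mul_nonneg hs.1 hr2.le
      have h6 : s * r ^ 2 ≤ 4 * r ^ 2 := by gcongr; exact hs.2
      have h1 := hpos (a + r ^ 2 * s) ⟨by linarith, by linarith⟩ (x0 + r • y) (by rw [hdist, mul_comm]; gcongr)
      refine mul_nonneg hOp.le ?_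
      have h2 : 0 ≤ K * (r ^ 2 * s) := by rw [mul_comm (r ^ 2)]; positivity
      linarith
    · refine hvol.trans (measure_mono ?_)
      rintro ⟨s, y⟩ ⟨hz, hz2⟩
      refine ⟨hz, ?_⟩
      simp only [mem_setOf_eq] at hz2 ⊢
      have h2 : 0 ≤ K * (r ^ 2 * s) := mul_nonneg hK (mul_nonneg hr2.le hz.1.1.le)
      rw [div_mul_eq_mul_div, lt_div_iff₀ hO]
      linarith
    · rw [le_div_iff₀ hr2]; linarith [ht.1]
    · rw [div_le_iff₀ hr2]; linarith [ht.2]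
    · rw [norm_smul, norm_inv, Real.norm_eq_abs, abs_of_pos hr, ← dist_eq_norm, inv_mul_le_iff₀ hr]; linarith
  have hsplit : volume D ≤ volume (D ∩ {z | O / 2 ≤ 1 * u (a + r ^ 2 * z.1) (x0 + r • z.2) + -m}) + volume (D ∩ {z | O / 2 ≤ (-1) * u (a + r ^ 2 * z.1) (x0 + r • z.2) + (m + O)}) := by
    refine le_trans (measure_mono ?_) (measure_union_le _ _)
    intro z hz
    rcases le_total (O / 2) (1 * u (a + r ^ 2 * z.1) (x0 + r • z.2) + -m) with h1 | h1
    · exact Or.inl ⟨hz, h1⟩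
    · refine Or.inr ⟨hz, ?_⟩
      simp only [mem_setOf_eq]; linarith
  have hhalf : ENNReal.ofReal (1 / 2) * volume D + ENNReal.ofReal (1 / 2) * volume D = volume D := by
    rw [← add_mul, ← ENNReal.ofReal_add (by norm_num) (by norm_num)]; norm_num
  have h12 : ENNReal.ofReal (1 / 2) * volume D ≤ volume (D ∩ {z | O / 2 ≤ 1 * u (a + r ^ 2 * z.1) (x0 + r • z.2) + -m}) ∨ 
      ENNReal.ofReal (1 / 2) * volume D ≤ volume (D ∩ {z | O / 2 ≤ (-1) * u (a + r ^ 2 * z.1) (x0 + r • z.2) + (m + O)}) := by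
    by_contra! hcon
    have := ENNReal.add_lt_add hcon.1 hcon.2
    rw [hhalf] at this
    exact absurd hsplit (not_le.2 this)
  have hsm : ∀ t ∈ Icc (a + 3 * r ^ 2) (a + 4 * r ^ 2), ∀ x, dist x x0 ≤ r → m ≤ u t x ∧ u t x ≤ m + O := fun t ht x hx =>
    hu t ⟨by linarith [ht.1], ht.2⟩ x (by linarith)
  rcases h12 with h1 | h1
  · refine ⟨m + min 1 η * O / 4 - 4 * K * r ^ 2, fun t ht x hx => ?_⟩
    have := main 1 (-m) (by simp) (fun t ht x hx => by linarith [hu t ht x hx]) h1 t ht x hx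
    exact ⟨by linarith, by linarith [hsm t ht x hx]⟩
  · refine ⟨m, fun t ht x hx => ⟨(hsm t ht x hx).1, ?_⟩⟩
    have := main (-1) (m + O) (by simp) (fun t ht x hx => by linarith [hu t ht x hx]) h1 t ht x hx
    linarith
end
end QP

namespace QP
open MeasureTheory Filter Topology Metric
variable {n : ℕ}

set_option maxHeartbeats 1000000 in
lemma ks_holder (n : ℕ) {ν Λ Q T K : ℝ} (hν : 0 < ν) (hΛ : 0 ≤ Λ) (hQ : 0 ≤ Q) (hT : 0 < T) (hK : 0 ≤ K) : ∃ α A : ℝ, 0 < α ∧ α ≤ 1 ∧ 0 ≤ A ∧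
    ∀ (β : ℝ) (u : ℝ → ES n → ℝ) (p : ℝ → ES n → (ES n →L[ℝ] ℝ)) (q : ℝ → ES n → Bil n)
      (S : ℝ → ES n → (ES n →L[ℝ] ES n)) (b : ℝ → ES n → ES n) (f : ℝ → ES n → ℝ),
    Continuous (Function.uncurry S) → Continuous (Function.uncurry b) → (∀ t x, Ell ν Λ (S t x)) → (∀ t x, ‖b t x‖ ≤ Q) →
    Continuous (Function.uncurry f) → (∀ t x, |f t x| ≤ K) → Reg T β u p q → Pde T S b f u p q →
    ∀ t x s y, |u t x - u s y| ≤ A * (‖x - y‖ ^ α + |t - s| ^ (α / 2)) := by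
  obtain ⟨η, hη, hη1, H⟩ := decay n hν hΛ hQ
  set γ := 1 - η / 8 with hγ
  have hγ0 : 0 < γ := by linarith
  have hγ1 : γ < 1 := by linarith
  set A := 32 * K / η + 2 * K * T + 1 with hA
  have hKT : 0 ≤ 2 * K * T := by positivity
  have hKη : 0 ≤ 32 * K / η := by positivity
  have hAp : 0 < A := by linarith
  have hA1 : 4 * K ≤ A * (η / 8) := by
    have : 32 * K / η * (η / 8) = 4 * K := by field_simp; ring
    have h2 : 0 ≤ (2 * K * T + 1) * (η / 8) := by positivity
    have h3 : A * (η / 8) = 32 * K / η * (η / 8) + (2 * K * T + 1) * (η / 8) := by rw [hA]; ring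
    linarith
  have hA2 : 8 * K ≤ A * γ := by
    have h1 : A * (η / 8) ≤ A * (1 / 8) := by gcongr
    have h2 : A * (7 / 8) ≤ A * γ := by gcongr; linarith
    linarith
  set α := Real.log γ / Real.log (1 / 16) with hα
  have hl : Real.log (1 / 16) < 0 := Real.log_neg (by norm_num) (by norm_num)
  have hα0 : 0 < α := div_pos_of_neg_of_neg (Real.log_neg hγ0 hγ1) hl
  have hα1 : α ≤ 1 := by
    rw [hα, div_le_one_of_neg hl]
    exact Real.log_le_log (by norm_num) (by linarith)
  have hγα : ((1 / 16 : ℝ)) ^ α = γ := by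
    rw [Real.rpow_def_of_pos (by norm_num), hα, mul_div_cancel₀ _ hl.ne, Real.exp_log hγ0]
  refine ⟨α, 8 * A, hα0, hα1, by positivity, fun β u p q S b f cS cb ell bb cf hf h hp => ?_⟩
  have hub := sup_le hν.le hT hf ell bb h hp
  -- decay of oscillation
  have osc : ∀ s < T, ∀ (x0 : ES n) (k : ℕ), ∃ m, ∀ t ∈ Icc (s - 4 * ((1 / 16 : ℝ) ^ k) ^ 2) s, ∀ x, dist x x0 ≤ 16 * (1 / 16 : ℝ) ^ k → m ≤ u t x ∧ u t x ≤ m + A * γ ^ k := by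
    intro s hs x0 k
    induction k with
    | zero =>
      refine ⟨-(K * T), fun t ht x _ => ?_⟩
      have h1 := hub t x
      have h2 : K * max t 0 ≤ K * T := by gcongr; exact max_le (ht.2.trans hs.le) hT.le
      rw [abs_le] at h1
      rw [pow_zero, mul_one]
      exact ⟨by linarith, by linarith⟩
    | succ k ih =>
      obtain ⟨m, hm⟩ := ih
      set r := (1 / 16 : ℝ) ^ k with hr
      have hrp : 0 < r := by positivity
      have hr1 : r ≤ 1 := pow_le_one₀ (by norm_num) (by norm_num)
      have hr2 : 0 < r ^ 2 := by positivity
      have hrγ : r ^ 2 ≤ γ ^ k := by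
        have : r ≤ γ ^ k := pow_le_pow_left₀ (by norm_num) (by linarith) k
        have h2 : r ^ 2 ≤ r := by rw [pow_two]; exact mul_le_of_le_one_left hrp.le hr1
        exact h2.trans this
      have e1 : (1 / 16 : ℝ) ^ (k + 1) = r / 16 := by rw [pow_succ, ← hr]; ring
      have hγk : 0 < γ ^ k := by positivity
      rw [e1, pow_succ γ k]
      have h6 : K * r ^ 2 ≤ K * γ ^ k := by gcongr
      have h7 : 4 * K * γ ^ k ≤ A * (η / 8) * γ ^ k := by gcongr
      have h8 : 8 * K * γ ^ k ≤ A * γ * γ ^ k := by gcongr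
      rcases lt_or_ge (4 * r ^ 2) s with h4 | h4
      · obtain ⟨m', hm'⟩ := H T β K u p q S b f cS cb ell bb cf hf h hp r (s - 4 * r ^ 2) x0 m (A * γ ^ k) hrp hr1 (by linarith) (by linarith) (by positivity)
          (by rw [sub_add_cancel]; exact hm)
        refine ⟨m', fun t ht x hx => ?_⟩
        have h5 := hm' t ⟨by linarith [ht.1], by linarith [ht.2]⟩ x (by linarith)
        refine ⟨h5.1, h5.2.trans ?_⟩
        have e2 : A * (γ ^ k * γ) = (1 - η / 4) * (A * γ ^ k) + A * (η / 8) * γ ^ k := by rw [hγ]; ring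
        rw [e2]
        linarith
      · refine ⟨-(4 * K * r ^ 2), fun t ht x _ => ?_⟩
        have h1 := hub t x
        have h2 : K * max t 0 ≤ K * (4 * r ^ 2) := by gcongr; exact max_le (ht.2.trans h4) (by positivity)
        rw [abs_le] at h1
        exact ⟨by linarith, by linarith⟩
  have near : ∀ s < T, ∀ t ≤ s, ∀ x y : ES n, ∀ ρ, 0 < ρ → dist y x ≤ ρ → s - t ≤ ρ ^ 2 / 64 → |u s x - u t y| ≤ A * ρ ^ α := by
    intro s hs t hts x y ρ hρ hxy hst
    rcases le_total ρ 16 with h16 | h16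
    · obtain ⟨k, hk1, hk2⟩ := exists_nat_pow_near_of_lt_one (x := ρ / 16) (y := (1 / 16 : ℝ)) (by positivity) (by linarith) (by norm_num) (by norm_num)
      rw [pow_succ] at hk1
      obtain ⟨m, hm⟩ := osc s hs x k
      have hρ2 : ρ ^ 2 / 64 ≤ 4 * ((1 / 16 : ℝ) ^ k) ^ 2 := by
        have := pow_le_pow_left₀ (by positivity) hk2 2
        rw [div_pow] at this; linarith
      have hk0 : (0 : ℝ) < (1 / 16) ^ k := by positivity
      have h1 := hm s ⟨by linarith [sq_nonneg ((1 / 16 : ℝ) ^ k)], le_rfl⟩ x (by rw [dist_self]; positivity)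
      have h2 := hm t ⟨by linarith, hts⟩ y (by linarith)
      have e : γ ^ k ≤ ρ ^ α := by
        rw [← hγα, ← Real.rpow_natCast, ← Real.rpow_mul (by norm_num), mul_comm, Real.rpow_mul (by norm_num), Real.rpow_natCast]
        exact Real.rpow_le_rpow hk0.le (by linarith) hα0.le
      have e' : A * γ ^ k ≤ A * ρ ^ α := by gcongr
      rw [abs_le]; exact ⟨by linarith, by linarith⟩
    · have h1 := hub s x
      have h2 := hub t y
      have h3 : K * max s 0 ≤ K * T := by gcongr; exact max_le hs.le hT.le
      have h4 : K * max t 0 ≤ K * T := by gcongr; exact max_le (hts.trans hs.le) hT.le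
      have h5 : A * 1 ≤ A * ρ ^ α := by gcongr; exact Real.one_le_rpow (by linarith) hα0.le
      have := abs_sub (u s x) (u t y)
      linarith
  have one : ∀ s < T, ∀ t ≤ s, ∀ x y : ES n, |u s x - u t y| ≤ 8 * A * (‖x - y‖ ^ α + |s - t| ^ (α / 2)) := by
    intro s hs t hts x y
    have hst : 0 ≤ s - t := by linarith
    set d := ‖x - y‖ with hd
    have hd0 : 0 ≤ d := norm_nonneg _
    set σ := Real.sqrt (s - t) with hσ
    have hσ0 : 0 ≤ σ := Real.sqrt_nonneg _
    have hσ2 : σ ^ 2 = s - t := Real.sq_sqrt hst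
    have e1 : |s - t| ^ (α / 2) = σ ^ α := by
      rw [abs_of_nonneg hst, hσ, Real.sqrt_eq_rpow, ← Real.rpow_mul hst]; congr 1; ring
    rw [e1]
    rcases (add_nonneg hd0 (mul_nonneg (by norm_num : (0:ℝ) ≤ 8) hσ0)).eq_or_lt with h0 | h0
    · have hdz : d = 0 := by linarith
      have hσz : σ = 0 := by linarith
      have hxy : x = y := by rwa [hd, norm_eq_zero, sub_eq_zero] at hdz
      have : s = t := by rw [hσz] at hσ2; linarith
      rw [hxy, this, sub_self, abs_zero]; positivity
    · have h1 := near s hs t hts x y (d + 8 * σ) h0 (by rw [dist_comm, dist_eq_norm]; linarith)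
        (by rw [← hσ2]; have := mul_nonneg hd0 hσ0; have := sq_nonneg d; rw [le_div_iff₀ (by norm_num)]; ring_nf; linarith)
      have h2 : (d + 8 * σ) ^ α ≤ d ^ α + (8 * σ) ^ α := Real.rpow_add_le_add_rpow hd0 (by positivity) hα0.le hα1
      have h3 : (8 * σ) ^ α ≤ 8 * σ ^ α := by
        rw [Real.mul_rpow (by norm_num) hσ0]
        gcongr
        calc (8 : ℝ) ^ α ≤ 8 ^ (1 : ℝ) := Real.rpow_le_rpow_of_exponent_le (by norm_num) hα1
          _ = 8 := Real.rpow_one 8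
      have h4 : 0 ≤ d ^ α := by positivity
      calc _ ≤ _ := h1
        _ ≤ A * (8 * (d ^ α + σ ^ α)) := by gcongr; linarith
        _ = _ := by ring
  have two : ∀ s < T, ∀ t < T, ∀ x y : ES n, |u s x - u t y| ≤ 8 * A * (‖x - y‖ ^ α + |s - t| ^ (α / 2)) := by
    intro s hs t ht x y
    rcases le_total t s with h1 | h1
    · exact one s hs t h1 x y
    · rw [abs_sub_comm, abs_sub_comm s t, norm_sub_rev]; exact one t ht s h1 y x
  have three : ∀ s ≤ T, ∀ t ≤ T, ∀ x y : ES n, |u s x - u t y| ≤ 8 * A * (‖x - y‖ ^ α + |s - t| ^ (α / 2)) := by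
    intro s hs t ht x y
    have hc : Continuous fun e : ℝ => |u (s - e) x - u (t - e) y| := by
      have h1 : Continuous fun e : ℝ => u (s - e) x := h.cu.comp (f := fun e : ℝ => (s - e, x)) (by fun_prop)
      have h2 : Continuous fun e : ℝ => u (t - e) y := h.cu.comp (f := fun e : ℝ => (t - e, y)) (by fun_prop)
      exact (h1.sub h2).abs
    have ht' := (hc.tendsto 0).mono_left (nhdsWithin_le_nhds (s := Ioi 0))
    simp only [sub_zero] at ht'
    refine le_of_tendsto ht' ?_
    filter_upwards [self_mem_nhdsWithin] with e he
    have he' : 0 < e := he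
    have := two (s - e) (by linarith) (t - e) (by linarith) x y
    rwa [sub_sub_sub_cancel_right] at this
  have hmin : ∀ t, u t = u (min t T) := fun t => by
    rcases le_total t T with h1 | h1
    · rw [min_eq_left h1]
    · rw [min_eq_right h1]; exact h.halt t h1
  intro t x s y
  rw [hmin t, hmin s]
  refine (three _ (min_le_right _ _) _ (min_le_right _ _) x y).trans ?_
  have : |min t T - min s T| ≤ |t - s| := by
    have := abs_min_sub_min_le_max t T s T
    rwa [sub_self, abs_zero, max_eq_left (abs_nonneg _)] at this
  gcongr
end QP

namespace QP
open MeasureTheory Filter Topology Metric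
variable {n m : ℕ}

lemma barrier {T Λ B K N lam : ℝ} {z : ℝ → ES n → ℝ}
    (hc : ContinuousOn (fun a : ℝ × ES n => z a.1 a.2) (Icc 0 T ×ˢ univ))
    (hK : ∀ t ∈ Icc 0 T, ∀ x, |z t x| ≤ K) (hN : 0 ≤ N) (h0 : ∀ x, |z 0 x| ≤ N)
    (h : ∀ t ∈ Ioo 0 T, ∀ x, ∃ p q zt S b, DD z t x p q zt ∧ Ell 0 Λ S ∧
      ‖b‖ ≤ B ∧ |zt - Lop S q - p x b| ≤ lam * N * Real.exp (lam * t)) :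
    ∀ t ∈ Icc 0 T, ∀ x, |z t x| ≤ N * Real.exp (lam * t) := by
  have one : ∀ σ : ℝ, |σ| = 1 → ∀ t ∈ Icc 0 T, ∀ x, σ * z t x - N * Real.exp (lam * t) ≤ 0 := by
    intro σ hσ
    have hσz : ∀ a : ℝ, σ * a ≤ |a| := fun a => by
      refine (le_abs_self _).trans ?_
      rw [abs_mul, hσ, one_mul]
    refine wmp (Λ := Λ) (B := B) (K := K) ?_ ?_ ?_ ?_
    · have h2 : Continuous fun a : ℝ × ES n => N * Real.exp (lam * a.1) := by fun_prop
      exact (continuousOn_const.mul hc).sub h2.continuousOn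
    · intro t ht x
      have h1 := hK t ht x
      have := hσz (z t x)
      have : 0 ≤ N * Real.exp (lam * t) := by positivity
      linarith
    · intro x
      have := hσz (z 0 x)
      have := h0 x
      simp only [mul_zero, Real.exp_zero, mul_one]; linarith
    · intro t ht x _
      obtain ⟨p, q, zt, S, b, d1, hS, hb, hle⟩ := h t ht x
      have h1 : HasDerivAt (fun s => N * Real.exp (lam * s)) (lam * N * Real.exp (lam * t)) t :=
        ((((hasDerivAt_id t).const_mul lam).exp).const_mul N).congr_deriv (by simp; ring)
      have d2 := (d1.const_mul σ).sub (DD.time x h1)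
      refine ⟨_, _, _, S, b, d2, hS, hb, ?_⟩
      simp only [sub_zero, Lop_smul, _root_.smul_apply, smul_eq_mul]
      have := hσz (zt - Lop S q - p x b)
      rw [mul_sub, mul_sub] at this
      linarith
  intro t ht x
  have a := one 1 (by simp) t ht x
  have b := one (-1) (by simp) t ht x
  rw [abs_le]; constructor <;> linarith

lemma hconv {α β N L r τ d : ℝ} (hβ : 0 < β) (hβα : β ≤ α) (hα : α ≤ 1) (hN : 0 ≤ N) (hL : 0 ≤ L) (hr : 0 ≤ r) (hτ : 0 ≤ τ)
    (h1 : d ≤ N) (h2 : d ≤ L * (r + τ + r ^ α + τ ^ (α / 2))) : d ≤ (N + 2 * L) * (r ^ β + τ ^ (β / 2)) := by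
  have p1 : 0 ≤ r ^ β := by positivity
  have p2 : 0 ≤ τ ^ (β / 2) := by positivity
  have p3 : 0 ≤ L * (r ^ β + τ ^ (β / 2)) := by positivity
  have p4 : 0 ≤ N * (r ^ β + τ ^ (β / 2)) := by positivity
  have big : 1 ≤ r ^ β + τ ^ (β / 2) → d ≤ (N + 2 * L) * (r ^ β + τ ^ (β / 2)) := fun h => by
    have := mul_le_mul_of_nonneg_left h hN
    linarith
  rcases le_or_gt 1 r with hr1 | hr1
  · exact big (by linarith [Real.one_le_rpow hr1 hβ.le])
  rcases le_or_gt 1 τ with ht1 | ht1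
  · exact big (by linarith [Real.one_le_rpow ht1 (half_pos hβ).le])
  have e : ∀ {r a b : ℝ}, 0 ≤ r → r ≤ 1 → 0 < b → b ≤ a → r ^ a ≤ r ^ b := fun {r a b} h0 h1 hb hab => by
    rcases h0.eq_or_lt with h | h
    · rw [← h, Real.zero_rpow hb.ne', Real.zero_rpow (hb.trans_le hab).ne']
    · exact Real.rpow_le_rpow_of_exponent_ge h h1 hab
  have e1 := e hr hr1.le hβ hβα
  have e2 := e hτ ht1.le (half_pos hβ) (by linarith : β / 2 ≤ α / 2)
  have e3 := e hr hr1.le hβ (hβα.trans hα)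
  have e4 := e hτ ht1.le (half_pos hβ) (by linarith : β / 2 ≤ 1)
  rw [Real.rpow_one] at e3 e4
  have : L * (r + τ + r ^ α + τ ^ (α / 2)) ≤ L * (2 * (r ^ β + τ ^ (β / 2))) := by gcongr; linarith
  linarith

lemma ES_norm_le {y : ES m} {c : ℝ} (hc : 0 ≤ c) (h : ∀ k, |y k| ≤ c) : ‖y‖ ≤ m * c := by
  have h1 : y = ∑ k, y k • EuclideanSpace.single k (1 : ℝ) := by
    ext j; simp [Finset.sum_apply, Pi.single_apply]
  rw [h1]
  refine (norm_sum_le _ _).trans ?_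
  calc _ ≤ ∑ k : Fin m, c := Finset.sum_le_sum fun k _ => by
        rw [norm_smul]; simpa using h k
    _ = _ := by simp

lemma ES_abs_le (y : ES m) (k : Fin m) : |y k| ≤ ‖y‖ := PiLp.norm_apply_le y k

/-- data of the nonlinear problem -/
structure NLD (L C Λ K δ : ℝ) (S : ℝ → ES n → ES m → (ES n →L[ℝ] ES n)) (b : ℝ → ES n → ES m → ES n) (f : ℝ → ES n → ES m → ES m)
    (g : Fin m → ES n → ℝ) (gp : Fin m → ES n → (ES n →L[ℝ] ℝ)) (gq : Fin m → ES n → Bil n) : Prop where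
  nn : 0 ≤ L ∧ 0 ≤ C ∧ 0 ≤ Λ ∧ 0 ≤ K
  hδ : 0 < δ ∧ δ < 1
  lS : ∀ t x y s x' y', ‖S t x y - S s x' y'‖ ≤ L * (|t - s| + ‖x - x'‖ + ‖y - y'‖)
  lb : ∀ t x y s x' y', ‖b t x y - b s x' y'‖ ≤ L * (|t - s| + ‖x - x'‖ + ‖y - y'‖)
  lf : ∀ t x y s x' y', ‖f t x y - f s x' y'‖ ≤ L * (|t - s| + ‖x - x'‖ + ‖y - y'‖)
  Sb : ∀ t x y, ‖S t x y‖ ≤ Λ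
  ell : ∀ R, ∃ ν, 0 < ν ∧ ∀ t x y, ‖y‖ ≤ R → Ell ν Λ (S t x y)
  b0 : ∀ t x, ‖b t x 0‖ ≤ C
  f0 : ∀ t x, ‖f t x 0‖ ≤ C
  gb : ∀ k x, |g k x| ≤ K ∧ ‖gp k x‖ ≤ K ∧ ‖gq k x‖ ≤ K
  dg : ∀ k x, HasFDerivAt (g k) (gp k x) x
  dgp : ∀ k x, HasFDerivAt (gp k) (gq k x) x
  hq : ∀ k x y, ‖gq k x - gq k y‖ ≤ K * ‖x - y‖ ^ δ

lemma lip_cont {G : Type*} [NormedAddCommGroup G] {L : ℝ} {S : ℝ → ES n → ES m → G} (hL : 0 ≤ L)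
    (h : ∀ t x y s x' y', ‖S t x y - S s x' y'‖ ≤ L * (|t - s| + ‖x - x'‖ + ‖y - y'‖)) {v : ℝ → ES n → ES m} (hv : Continuous (Function.uncurry v)) :
    Continuous (Function.uncurry fun t x => S t x (v t x)) := by
  have h1 : Continuous fun a : ℝ × ES n × ES m => S a.1 a.2.1 a.2.2 := by
    refine (LipschitzWith.of_dist_le_mul (K := ⟨3 * L, by positivity⟩) fun a c => ?_).continuous
    rw [dist_eq_norm]
    refine (h _ _ _ _ _ _).trans ?_
    rw [← Real.dist_eq, ← dist_eq_norm, ← dist_eq_norm]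
    have e1 : dist a.1 c.1 ≤ dist a c := le_max_left _ _
    have e0 : dist a.2 c.2 ≤ dist a c := le_max_right _ _
    have e2 : dist a.2.1 c.2.1 ≤ dist a c := (le_max_left _ _).trans e0
    have e3 : dist a.2.2 c.2.2 ≤ dist a c := (le_max_right _ _).trans e0
    calc _ ≤ L * (dist a c + dist a c + dist a c) := by gcongr
      _ = 3 * L * dist a c := by ring
  exact h1.comp (f := fun a : ℝ × ES n => (a.1, a.2, v a.1 a.2)) (continuous_fst.prodMk (continuous_snd.prodMk hv))

/-- the full unknown -/
def tht (g : Fin m → ES n → ℝ) (v : Fin m → ℝ → ES n → ℝ) (t : ℝ) (x : ES n) : ES m := WithLp.toLp 2 fun k => g k x + v k t x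

lemma tht_apply (g : Fin m → ES n → ℝ) (v : Fin m → ℝ → ES n → ℝ) (t : ℝ) (x : ES n) (k : Fin m) : tht g v t x k = g k x + v k t x := rfl

/-- source term -/
def Src (S : ℝ → ES n → ES m → (ES n →L[ℝ] ES n)) (b : ℝ → ES n → ES m → ES n) (f : ℝ → ES n → ES m → ES m)
    (g : Fin m → ES n → ℝ) (gp : Fin m → ES n → (ES n →L[ℝ] ℝ)) (gq : Fin m → ES n → Bil n) (v : Fin m → ℝ → ES n → ℝ) (k : Fin m) (t : ℝ) (x : ES n) : ℝ :=
  Lop (S t x (tht g v t x)) (gq k x) + gp k x (b t x (tht g v t x)) + f t x (tht g v t x) k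

/-- time clamp -/
def cl (T t : ℝ) : ℝ := max 0 (min t T)

lemma cl_mem {T : ℝ} (hT : 0 ≤ T) (t : ℝ) : cl T t ∈ Icc 0 T := ⟨le_max_left _ _, max_le hT (min_le_right _ _)⟩

lemma cl_of {T t : ℝ} (ht : t ∈ Icc 0 T) : cl T t = t := by rw [cl, min_eq_left ht.2, max_eq_right ht.1]

lemma Reg.cl {T β : ℝ} {u p} {q : ℝ → ES n → Bil n} (h : Reg T β u p q) (hT : 0 ≤ T) (t : ℝ) : u t = u (cl T t) := by
  rcases le_total t 0 with h0 | h0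
  · have : QP.cl T t = 0 := by rw [QP.cl, min_eq_left (h0.trans hT), max_eq_left h0]
    ext x
    rw [this, h.zero t h0, h.zero 0 le_rfl]
  rcases le_total t T with h1 | h1
  · rw [cl_of ⟨h0, h1⟩]
  · have : QP.cl T t = T := by rw [QP.cl, min_eq_right h1, max_eq_right hT]
    rw [this]; exact h.halt t h1

end QP

namespace QP
open MeasureTheory Filter Topology Metric
variable {n m : ℕ} {L C Λ K δ : ℝ} {S : ℝ → ES n → ES m → (ES n →L[ℝ] ES n)} {b : ℝ → ES n → ES m → ES n} {f : ℝ → ES n → ES m → ES m}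
    {g : Fin m → ES n → ℝ} {gp : Fin m → ES n → (ES n →L[ℝ] ℝ)} {gq : Fin m → ES n → Bil n}

/-- admissible functions -/
structure Adm (T M lam α A : ℝ) (g : Fin m → ES n → ℝ) (v : Fin m → ℝ → ES n → ℝ) : Prop where
  bar : ∀ k t x, |g k x + v k t x| ≤ M * Real.exp (lam * cl T t)
  hol : ∀ k t x s y, |v k t x - v k s y| ≤ A * (‖x - y‖ ^ α + |t - s| ^ (α / 2))

lemma mvt {G : Type*} [NormedAddCommGroup G] [NormedSpace ℝ G] {K : ℝ} {g : ES n → G} {gp : ES n → (ES n →L[ℝ] G)} (h : ∀ x, HasFDerivAt g (gp x) x) (hK : ∀ x, ‖gp x‖ ≤ K) (x y : ES n) :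
    ‖g x - g y‖ ≤ K * ‖x - y‖ :=
  convex_univ.norm_image_sub_le_of_norm_hasFDerivWithin_le (fun x _ => (h x).hasFDerivWithinAt) (fun x _ => hK x) (mem_univ y) (mem_univ x)

lemma NLD.bbd (h : NLD L C Λ K δ S b f g gp gq) {R : ℝ} {y : ES m} (hy : ‖y‖ ≤ R) (t : ℝ) (x : ES n) : ‖b t x y‖ ≤ C + L * R ∧ ‖f t x y‖ ≤ C + L * R := by
  have h1 := h.lb t x y t x 0
  have h2 := h.lf t x y t x 0
  simp only [sub_self, abs_zero, norm_zero, zero_add, sub_zero] at h1 h2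
  have h3 : L * ‖y‖ ≤ L * R := mul_le_mul_of_nonneg_left hy h.nn.1
  have h4 := norm_sub_norm_le (b t x y) (b t x 0)
  have h5 := norm_sub_norm_le (f t x y) (f t x 0)
  have := h.b0 t x
  have := h.f0 t x
  constructor <;> linarith

lemma src_bd (h : NLD L C Λ K δ S b f g gp gq) {R : ℝ} {v : Fin m → ℝ → ES n → ℝ} {t : ℝ} {x : ES n} (hR : ‖tht g v t x‖ ≤ R) (k : Fin m) :
    |Src S b f g gp gq v k t x| ≤ n * Λ * K + K * (C + L * R) + (C + L * R) := by
  obtain ⟨hL, hC, hΛ, hK⟩ := h.nn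
  obtain ⟨h1, h2⟩ := h.bbd hR t x
  have e1 : |Lop (S t x (tht g v t x)) (gq k x)| ≤ n * Λ * K := (abs_Lop_le _ _).trans (by gcongr; exacts [h.Sb _ _ _, (h.gb k x).2.2])
  have e2 : |gp k x (b t x (tht g v t x))| ≤ K * (C + L * R) := ((gp k x).le_opNorm _).trans (mul_le_mul (h.gb k x).2.1 h1 (norm_nonneg _) hK)
  have e3 := (ES_abs_le (f t x (tht g v t x)) k).trans h2
  refine (abs_add_le _ _).trans (add_le_add ((abs_add_le _ _).trans (add_le_add e1 e2)) e3)

lemma hconv0 {α β N L r d : ℝ} (hβ : 0 < β) (hβα : β ≤ α) (hα : α ≤ 1) (hN : 0 ≤ N) (hL : 0 ≤ L) (hr : 0 ≤ r)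
    (h1 : d ≤ N) (h2 : d ≤ L * (r + r ^ α)) : d ≤ (N + 2 * L) * r ^ β := by
  have := hconv hβ hβα hα hN hL hr le_rfl h1 (by rw [Real.zero_rpow (by linarith), add_zero, add_zero]; exact h2)
  rwa [Real.zero_rpow (by linarith), add_zero] at this

section
variable {T M lam α A : ℝ} {v : Fin m → ℝ → ES n → ℝ}

lemma Adm.bd (ha : Adm T M lam α A g v) (hT : 0 ≤ T) (hM : 0 ≤ M) (hl : 0 ≤ lam) (t : ℝ) (x : ES n) : ‖tht g v t x‖ ≤ m * (M * Real.exp (lam * T)) := by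
  refine ES_norm_le (by positivity) fun k => (ha.bar k t x).trans ?_
  have := (cl_mem hT t).2
  gcongr

lemma Adm.diff (ha : Adm T M lam α A g v) (h : NLD L C Λ K δ S b f g gp gq) (hA : 0 ≤ A) (t : ℝ) (x : ES n) (s : ℝ) (y : ES n) :
    L * (|t - s| + ‖x - y‖ + ‖tht g v t x - tht g v s y‖) ≤ L * (1 + m * (K + A)) * (‖x - y‖ + |t - s| + ‖x - y‖ ^ α + |t - s| ^ (α / 2)) := by
  obtain ⟨hL, hC, hΛ, hK⟩ := h.nn
  have h1 : ‖tht g v t x - tht g v s y‖ ≤ m * ((K + A) * (‖x - y‖ + |t - s| + ‖x - y‖ ^ α + |t - s| ^ (α / 2))) := by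
    refine ES_norm_le (by positivity) fun k => ?_
    have e : (tht g v t x - tht g v s y) k = (g k x - g k y) + (v k t x - v k s y) := by
      rw [PiLp.sub_apply, tht_apply, tht_apply]; ring
    rw [e]
    have e1 : |g k x - g k y| ≤ K * ‖x - y‖ := mvt (h.dg k) (fun x => (h.gb k x).2.1) x y
    have e2 := ha.hol k t x s y
    have e3 : K * ‖x - y‖ ≤ K * (‖x - y‖ + |t - s| + ‖x - y‖ ^ α + |t - s| ^ (α / 2)) := by
      gcongr
      have : 0 ≤ |t - s| + ‖x - y‖ ^ α + |t - s| ^ (α / 2) := by positivity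
      linarith
    have e4 : A * (‖x - y‖ ^ α + |t - s| ^ (α / 2)) ≤ A * (‖x - y‖ + |t - s| + ‖x - y‖ ^ α + |t - s| ^ (α / 2)) := by
      gcongr
      have : 0 ≤ ‖x - y‖ + |t - s| := by positivity
      linarith
    have := abs_add_le (g k x - g k y) (v k t x - v k s y)
    linarith
  have h2 : |t - s| + ‖x - y‖ ≤ ‖x - y‖ + |t - s| + ‖x - y‖ ^ α + |t - s| ^ (α / 2) := by
    have : 0 ≤ ‖x - y‖ ^ α + |t - s| ^ (α / 2) := by positivity
    linarith
  rw [mul_assoc]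
  refine mul_le_mul_of_nonneg_left ?_ hL
  linarith

lemma Adm.cont (ha : Adm T M lam α A g v) (h : NLD L C Λ K δ S b f g gp gq) (hα : 0 < α) : Continuous (Function.uncurry (tht g v)) := by
  have hv : ∀ k, Continuous (Function.uncurry (v k)) := fun k => by
    rw [continuous_iff_continuousAt]
    rintro ⟨s, y⟩
    rw [ContinuousAt, tendsto_iff_norm_sub_tendsto_zero]
    have hc : Continuous fun a : ℝ × ES n => A * (‖a.2 - y‖ ^ α + |a.1 - s| ^ (α / 2)) := by
      have h1 : Continuous fun a : ℝ × ES n => ‖a.2 - y‖ ^ α := (by fun_prop : Continuous fun a : ℝ × ES n => ‖a.2 - y‖).rpow_const fun _ => Or.inr hα.le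
      have h2 : Continuous fun a : ℝ × ES n => |a.1 - s| ^ (α / 2) := (by fun_prop : Continuous fun a : ℝ × ES n => |a.1 - s|).rpow_const fun _ => Or.inr (half_pos hα).le
      exact continuous_const.mul (h1.add h2)
    have ht := hc.tendsto (s, y)
    simp only [sub_self, norm_zero, abs_zero, Real.zero_rpow hα.ne', Real.zero_rpow (half_pos hα).ne', add_zero, mul_zero] at ht
    exact squeeze_zero (fun _ => norm_nonneg _) (fun a => ha.hol k a.1 a.2 s y) ht
  have hg : ∀ k, Continuous (g k) := fun k => continuous_iff_continuousAt.2 fun x => (h.dg k x).continuousAt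
  refine (PiLp.continuous_toLp 2 _).comp (continuous_pi fun k => ?_)
  exact ((hg k).comp continuous_snd).add (hv k)

set_option maxHeartbeats 1000000 in
lemma coef_of (h : NLD L C Λ K δ S b f g gp gq) {R β : ℝ} (hR : 0 ≤ R) (hα0 : 0 < α) (hα : α ≤ 1) (hA : 0 ≤ A) (hβ : 0 < β) (hβα : β ≤ α) (hβδ : β ≤ δ) {ν : ℝ}
    (ell : ∀ t x y, ‖y‖ ≤ R → Ell ν Λ (S t x y)) :
    ∃ Q, 0 ≤ Q ∧ C + L * R ≤ Q ∧ ∀ v, Adm T M lam α A g v → (∀ t x, ‖tht g v t x‖ ≤ R) → 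
      Coef ν Λ β Q (fun t x => S t x (tht g v t x)) (fun t x => b t x (tht g v t x)) ∧
      ∀ k, HB β Q Q (Src S b f g gp gq v k) := by
  obtain ⟨hL, hC, hΛ, hK⟩ := h.nn
  set L1 := L * (1 + m * (K + A)) with hL1
  have hL1p : 0 ≤ L1 := by positivity
  set B := C + L * R with hB
  have hBp : 0 ≤ B := by positivity
  set QS := 2 * Λ + 2 * L1 with hQS
  set Qb := 2 * B + 2 * L1 with hQb
  have hQSp : 0 ≤ QS := by positivity
  have hQbp : 0 ≤ Qb := by positivity
  set K1 := n * Λ * K + K * B + B with hK1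
  set H1 := n * QS * K + n * Λ * (2 * K + 2 * K) + (2 * K + 2 * K) * B + K * Qb + Qb with hH1
  have hK1p : 0 ≤ K1 := by positivity
  have hH1p : 0 ≤ H1 := by positivity
  refine ⟨QS + Qb + B + K1 + H1, by positivity, by linarith, fun v ha hv => ?_⟩
  have hc := ha.cont h hα0
  have cS := lip_cont hL h.lS hc
  have cb := lip_cont hL h.lb hc
  have cf := lip_cont hL h.lf hc
  have dS : ∀ t x s y, ‖S t x (tht g v t x) - S s y (tht g v s y)‖ ≤ QS * (‖x - y‖ ^ β + |t - s| ^ (β / 2)) := fun t x s y =>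
    hconv hβ hβα hα (by positivity) hL1p (norm_nonneg _) (abs_nonneg _) ((norm_sub_le _ _).trans (by linarith [h.Sb t x (tht g v t x), h.Sb s y (tht g v s y)]))
      ((h.lS _ _ _ _ _ _).trans (ha.diff h hA t x s y))
  have dB : ∀ t x s y, ‖b t x (tht g v t x) - b s y (tht g v s y)‖ ≤ Qb * (‖x - y‖ ^ β + |t - s| ^ (β / 2)) := fun t x s y =>
    hconv hβ hβα hα (by positivity) hL1p (norm_nonneg _) (abs_nonneg _) ((norm_sub_le _ _).trans (by linarith [(h.bbd (hv t x) t x).1, (h.bbd (hv s y) s y).1]))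
      ((h.lb _ _ _ _ _ _).trans (ha.diff h hA t x s y))
  have dF : ∀ t x s y, ‖f t x (tht g v t x) - f s y (tht g v s y)‖ ≤ Qb * (‖x - y‖ ^ β + |t - s| ^ (β / 2)) := fun t x s y =>
    hconv hβ hβα hα (by positivity) hL1p (norm_nonneg _) (abs_nonneg _) ((norm_sub_le _ _).trans (by linarith [(h.bbd (hv t x) t x).2, (h.bbd (hv s y) s y).2]))
      ((h.lf _ _ _ _ _ _).trans (ha.diff h hA t x s y))
  have z0 : ∀ t : ℝ, |t - t| ^ (β / 2) = 0 := fun t => by rw [sub_self, abs_zero, Real.zero_rpow (by linarith)]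
  refine ⟨⟨cS, cb, fun t x => ell t x _ (hv t x), fun t x => ((h.bbd (hv t x) t x).1).trans (by linarith), fun t x s y => (dS t x s y).trans ?_, fun t x y => ?_⟩, fun k => ⟨?_, fun t x => (src_bd h (hv t x) k).trans (by linarith), fun t x y => ?_⟩⟩
  · gcongr; linarith
  · have := dB t x t y
    rw [z0, add_zero] at this
    refine this.trans ?_
    gcongr; linarith
  · have hgq : Continuous fun a : ℝ × ES n => gq k a.2 := by
      have : Continuous (gq k) := by
        rw [continuous_iff_continuousAt]
        intro y
        rw [ContinuousAt, tendsto_iff_norm_sub_tendsto_zero]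
        have hc : Continuous fun a : ES n => K * ‖a - y‖ ^ δ := 
          continuous_const.mul ((by fun_prop : Continuous fun a : ES n => ‖a - y‖).rpow_const fun _ => Or.inr h.hδ.1.le)
        have ht := hc.tendsto y
        simp only [sub_self, norm_zero, Real.zero_rpow h.hδ.1.ne', mul_zero] at ht
        exact squeeze_zero (fun _ => norm_nonneg _) (fun a => h.hq k a y) ht
      exact this.comp continuous_snd
    have hgp : Continuous fun a : ℝ × ES n => gp k a.2 := 
      (continuous_iff_continuousAt.2 fun x => (h.dgp k x).continuousAt).comp continuous_snd
    have c1 : Continuous (Function.uncurry fun t x => Lop (S t x (tht g v t x)) (gq k x)) := Lop_cont.comp (cS.prodMk hgq)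
    have c2 : Continuous (Function.uncurry fun t x => gp k x (b t x (tht g v t x))) := hgp.clm_apply cb
    have c3 : Continuous (Function.uncurry fun t x => f t x (tht g v t x) k) := by
      have : Continuous fun y : ES m => y k := by fun_prop
      exact this.comp cf
    exact (c1.add c2).add c3
  · have r0 : 0 ≤ ‖x - y‖ ^ β := by positivity
    have r1 := norm_nonneg (x - y)
    have e1 := dS t x t y
    have e2 := dB t x t y
    have e3 := dF t x t y
    rw [z0, add_zero] at e1 e2 e3
    have e4 : ‖gq k x - gq k y‖ ≤ (2 * K + 2 * K) * ‖x - y‖ ^ β := hconv0 hβ hβδ h.hδ.2.le (by positivity) hK r1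
      ((norm_sub_le _ _).trans (by linarith [(h.gb k x).2.2, (h.gb k y).2.2])) ((h.hq k x y).trans (by gcongr; linarith))
    have e5 : ‖gp k x - gp k y‖ ≤ (2 * K + 2 * K) * ‖x - y‖ ^ β := hconv0 hβ (hβα.trans hα) le_rfl (by positivity) hK r1
      ((norm_sub_le _ _).trans (by linarith [(h.gb k x).2.1, (h.gb k y).2.1])) ((mvt (h.dgp k) (fun x => (h.gb k x).2.2) x y).trans (by gcongr; rw [Real.rpow_one]; linarith))
    set θx := tht g v t x
    set θy := tht g v t y
    have t1 : |Lop (S t x θx - S t y θy) (gq k x)| ≤ n * (QS * ‖x - y‖ ^ β) * K := (abs_Lop_le _ _).trans (by gcongr; exact (h.gb k x).2.2)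
    have t2 : |Lop (S t y θy) (gq k x - gq k y)| ≤ n * Λ * ((2 * K + 2 * K) * ‖x - y‖ ^ β) := (abs_Lop_le _ _).trans (by gcongr; exact h.Sb _ _ _)
    have t3 : |(gp k x - gp k y) (b t x θx)| ≤ ((2 * K + 2 * K) * ‖x - y‖ ^ β) * B := ((gp k x - gp k y).le_opNorm _).trans 
      (mul_le_mul e5 (h.bbd (hv t x) t x).1 (norm_nonneg _) (by positivity))
    have t4 : |gp k y (b t x θx - b t y θy)| ≤ K * (Qb * ‖x - y‖ ^ β) := ((gp k y).le_opNorm _).trans (mul_le_mul (h.gb k y).2.1 e2 (norm_nonneg _) hK)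
    have t5 : |(f t x θx - f t y θy) k| ≤ Qb * ‖x - y‖ ^ β := (ES_abs_le _ k).trans e3
    have e : Src S b f g gp gq v k t x - Src S b f g gp gq v k t y = Lop (S t x θx - S t y θy) (gq k x) + Lop (S t y θy) (gq k x - gq k y) +
        (gp k x - gp k y) (b t x θx) + gp k y (b t x θx - b t y θy) + (f t x θx - f t y θy) k := by
      rw [Lop_sub_left, Lop_sub, _root_.sub_apply, map_sub, PiLp.sub_apply, Src, Src]; ring
    have htot : |Src S b f g gp gq v k t x - Src S b f g gp gq v k t y| ≤ H1 * ‖x - y‖ ^ β := by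
      rw [e]
      refine (abs_add_le _ _).trans ((add_le_add ((abs_add_le _ _).trans (add_le_add ((abs_add_le _ _).trans (add_le_add ((abs_add_le _ _).trans (add_le_add t1 t2)) t3)) t4)) t5).trans (le_of_eq ?_))
      rw [hH1]; ring
    exact htot.trans (mul_le_mul_of_nonneg_right (by linarith) r0)
end
end QP

namespace QP
open MeasureTheory Filter Topology Metric
variable {n m : ℕ} {L C Λ K δ : ℝ} {S : ℝ → ES n → ES m → (ES n →L[ℝ] ES n)} {b : ℝ → ES n → ES m → ES n} {f : ℝ → ES n → ES m → ES m}
    {g : Fin m → ES n → ℝ} {gp : Fin m → ES n → (ES n →L[ℝ] ℝ)} {gq : Fin m → ES n → Bil n}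

/-- right-hand side of the forward quasilinear equation -/
def Rhs (S : ℝ → ES n → ES m → (ES n →L[ℝ] ES n)) (b : ℝ → ES n → ES m → ES n) (f : ℝ → ES n → ES m → ES m)
    (k : Fin m) (t : ℝ) (x : ES n) (y : ES m) (p : ES n →L[ℝ] ℝ) (q : Bil n) : ℝ :=
  Lop (S t x y) q + p (b t x y) + f t x y k

lemma rhs_diff (h : NLD L C Λ K δ S b f g gp gq) {Γ : ℝ} {p p' : ES n →L[ℝ] ℝ} {q q' : Bil n} (hp : ‖p'‖ ≤ Γ) (hq : ‖q'‖ ≤ Γ) (k : Fin m) (t : ℝ) (x : ES n) (y y' : ES m) :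
    |Rhs S b f k t x y p q - Rhs S b f k t x y' p' q' - Lop (S t x y) (q - q') - (p - p') (b t x y)| ≤ L * ((n + 1) * Γ + 1) * ‖y - y'‖ := by
  have hΓ : 0 ≤ Γ := (norm_nonneg _).trans hp
  have hL := h.nn.1
  have e : Rhs S b f k t x y p q - Rhs S b f k t x y' p' q' - Lop (S t x y) (q - q') - (p - p') (b t x y)
      = Lop (S t x y - S t x y') q' + p' (b t x y - b t x y') + (f t x y - f t x y') k := by
    rw [Rhs, Rhs, Lop_sub, Lop_sub_left, map_sub, PiLp.sub_apply, _root_.sub_apply]; ring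
  rw [e]
  have l1 := h.lS t x y t x y'
  have l2 := h.lb t x y t x y'
  have l3 := h.lf t x y t x y'
  simp only [sub_self, abs_zero, norm_zero, zero_add] at l1 l2 l3
  have e1 : |Lop (S t x y - S t x y') q'| ≤ n * (L * ‖y - y'‖) * Γ := (abs_Lop_le _ _).trans (by gcongr)
  have e2 : |p' (b t x y - b t x y')| ≤ Γ * (L * ‖y - y'‖) := (p'.le_opNorm _).trans (mul_le_mul hp l2 (norm_nonneg _) hΓ)
  have e3 := (ES_abs_le (f t x y - f t x y') k).trans l3
  refine (abs_add_le _ _).trans ((add_le_add ((abs_add_le _ _).trans (add_le_add e1 e2)) e3).trans (le_of_eq ?_))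
  ring

lemma comp_step (h : NLD L C Λ K δ S b f g gp gq) {T K0 Γ R N : ℝ} (hN : 0 ≤ N) (k : Fin m) {z z' : ℝ → ES n → ℝ} {y y' : ℝ → ES n → ES m}
    (hc : ContinuousOn (fun a : ℝ × ES n => z a.1 a.2 - z' a.1 a.2) (Icc 0 T ×ˢ univ))
    (hK : ∀ t ∈ Icc 0 T, ∀ x, |z t x - z' t x| ≤ K0) (h0 : ∀ x, z 0 x = z' 0 x)
    (hR : ∀ t ∈ Ioo 0 T, ∀ x, ‖y t x‖ ≤ R)
    (hy : ∀ t ∈ Ioo 0 T, ∀ x, ‖y t x - y' t x‖ ≤ m * (N * Real.exp (2 * (L * ((n + 1) * Γ + 1) * m) * t)))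
    (hz : ∀ t ∈ Ioo 0 T, ∀ x, ∃ p q, DD z t x p q (Rhs S b f k t x (y t x) (p x) q))
    (hz' : ∀ t ∈ Ioo 0 T, ∀ x, ∃ p q, DD z' t x p q (Rhs S b f k t x (y' t x) (p x) q) ∧ ‖p x‖ ≤ Γ ∧ ‖q‖ ≤ Γ) :
    ∀ t ∈ Icc 0 T, ∀ x, |z t x - z' t x| ≤ N / 2 * Real.exp (2 * (L * ((n + 1) * Γ + 1) * m) * t) := by
  obtain ⟨ν, hν, ell⟩ := h.ell R
  refine barrier (z := fun t x => z t x - z' t x) (Λ := Λ) (B := C + L * R) (K := K0) hc hK (by positivity) (fun x => by rw [h0 x, sub_self, abs_zero]; positivity) ?_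
  intro t ht x
  obtain ⟨p, q, d⟩ := hz t ht x
  obtain ⟨p', q', d', hp, hq⟩ := hz' t ht x
  have hΓ : 0 ≤ Γ := (norm_nonneg _).trans hp
  refine ⟨_, _, _, S t x (y t x), b t x (y t x), d.sub d', (ell t x _ (hR t ht x)).mono hν.le le_rfl, (h.bbd (hR t ht x) t x).1, ?_⟩
  refine (rhs_diff h hp hq k t x _ _).trans ?_
  have hL := h.nn.1
  refine (mul_le_mul_of_nonneg_left (hy t ht x) (by positivity)).trans (le_of_eq ?_)
  ring

lemma full_DD (h : NLD L C Λ K δ S b f g gp gq) {T β : ℝ} {v : Fin m → ℝ → ES n → ℝ} {k : Fin m} {u p q} (hr : Reg T β u p q)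
    (hp : Pde T (fun t x => S t x (tht g v t x)) (fun t x => b t x (tht g v t x)) (Src S b f g gp gq v k) u p q) {t : ℝ} (ht : t ∈ Ioo 0 T) (x : ES n) :
    DD (fun t x => g k x + u t x) t x (fun y => gp k y + p t y) (gq k x + q t x) (Rhs S b f k t x (tht g v t x) (gp k x + p t x) (gq k x + q t x)) := by
  refine ⟨fun y => (h.dg k y).add (hr.du t y), (h.dgp k x).add (hr.dp t x), ?_⟩
  refine ((hp t ht x).const_add (g k x)).congr_deriv ?_
  rw [Rhs, Src, Lop_add, _root_.add_apply]; ring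

lemma Reg.ccl {T β : ℝ} {u p} {q : ℝ → ES n → Bil n} (h : Reg T β u p q) : Continuous fun a : ℝ × ES n => u a.1 a.2 := h.cu

set_option maxHeartbeats 1000000 in
lemma step_exists (h : NLD L C Λ K δ S b f g gp gq) {T : ℝ} (hT : 0 < T) : ∃ M lam α A β R C1 : ℝ, 0 ≤ M ∧ 0 ≤ lam ∧ 0 < α ∧ 0 ≤ A ∧ 0 ≤ C1 ∧ Adm T M lam α A g (fun _ _ _ => 0) ∧
    ∀ v, Adm T M lam α A g v → (∀ t x, ‖tht g v t x‖ ≤ R) ∧ ∃ (u : Fin m → ℝ → ES n → ℝ) (p : Fin m → ℝ → ES n → (ES n →L[ℝ] ℝ)) (q : Fin m → ℝ → ES n → Bil n), Adm T M lam α A g u ∧ ∀ k, Reg T β (u k) (p k) (q k) ∧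
      Pde T (fun t x => S t x (tht g v t x)) (fun t x => b t x (tht g v t x)) (Src S b f g gp gq v k) (u k) (p k) (q k) ∧
      ∀ t x, ‖p k t x‖ ≤ C1 ∧ ‖q k t x‖ ≤ C1 := by
  obtain ⟨hL, hC, hΛ, hK⟩ := h.nn
  set M := max K 1 with hM
  have hM1 : 1 ≤ M := le_max_right _ _
  have hMK : K ≤ M := le_max_left _ _
  have hM0 : 0 ≤ M := by linarith
  set lam := L * m + C with hlam
  have hl0 : 0 ≤ lam := by positivity
  set R := m * (M * Real.exp (lam * T)) with hR
  have hR0 : 0 ≤ R := by positivity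
  obtain ⟨ν, hν, ell⟩ := h.ell R
  have hB0 : 0 ≤ C + L * R := by positivity
  obtain ⟨α, A, hα0, hα1, hA, KS⟩ := ks_holder n (T := T) hν hΛ hB0 hT (K := n * Λ * K + K * (C + L * R) + (C + L * R)) (by positivity)
  set β := min α δ with hβ
  have hβ0 : 0 < β := lt_min hα0 h.hδ.1
  have hβα : β ≤ α := min_le_left _ _
  have hβδ : β ≤ δ := min_le_right _ _
  have hβ1 : β < 1 := hβδ.trans_lt h.hδ.2
  obtain ⟨Q, hQ0, hBQ, cf⟩ := coef_of (T := T) (M := M) (lam := lam) h hR0 hα0 hα1 hA hβ0 hβα hβδ ell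
  obtain ⟨C2, hC2, ap⟩ := apriori_sup n T hT hβ0 hβ1 hν hQ0 hΛ
  have gM : ∀ k t x, |g k x| ≤ M * Real.exp (lam * cl T t) := fun k t x => by
    have h1 : 1 ≤ Real.exp (lam * cl T t) := Real.one_le_exp (mul_nonneg hl0 (cl_mem hT.le t).1)
    have h2 := mul_le_mul_of_nonneg_left h1 hM0
    linarith [(h.gb k x).1]
  refine ⟨M, lam, α, A, β, R, C2 * Q, hM0, hl0, hα0, hA, by positivity, ⟨fun k t x => by simpa using gM k t x, fun k t x s y => by simp only [sub_self, abs_zero]; positivity⟩, fun v ha => ?_⟩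
  have hv := ha.bd hT.le hM0 hl0
  refine ⟨hv, ?_⟩
  obtain ⟨hco, hsrc⟩ := cf v ha hv
  have sol := fun k => linear_solv hT hβ0 hβ1 hν hQ0 hΛ hco Q _ hQ0 (hsrc k)
  choose u p q hr hp using sol
  refine ⟨u, p, q, ⟨fun k t x => ?_, fun k => ?_⟩, fun k => ⟨hr k, hp k, ap _ _ _ _ _ _ Q Q hQ0 hco (hsrc k) (hr k) (hp k)⟩⟩
  · rw [(hr k).cl hT.le t]
    refine barrier (z := fun t x => g k x + u k t x) (Λ := Λ) (B := C + L * R) (K := K + (hr k).bd.choose) ?_ ?_ hM0 ?_ ?_ _ (cl_mem hT.le t) x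
    · have hg : Continuous (g k) := continuous_iff_continuousAt.2 fun x => (h.dg k x).continuousAt
      exact ((hg.comp continuous_snd).add (hr k).ccl).continuousOn
    · intro t ht x
      exact (abs_add_le _ _).trans (add_le_add (h.gb k x).1 ((hr k).bd.choose_spec t x).1)
    · intro x
      rw [(hr k).zero 0 le_rfl, add_zero]
      exact (h.gb k x).1.trans hMK
    · intro t ht x
      refine ⟨_, _, _, _, _, full_DD h (hr k) (hp k) ht x, (ell t x _ (hv t x)).mono hν.le le_rfl, (h.bbd (hv t x) t x).1, ?_⟩
      have e : ‖tht g v t x‖ ≤ m * (M * Real.exp (lam * t)) := ES_norm_le (by positivity) fun k => by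
        have := ha.bar k t x
        rwa [cl_of ⟨ht.1.le, ht.2.le⟩] at this
      have e1 := (ES_abs_le _ k).trans (h.bbd e t x).2
      rw [Rhs]
      have e2 : ∀ a b c : ℝ, a + b + c - a - b = c := fun a b c => by ring
      rw [e2]
      refine e1.trans ?_
      have e3 : 1 ≤ M * Real.exp (lam * t) := one_le_mul_of_one_le_of_one_le hM1 (Real.one_le_exp (mul_nonneg hl0 ht.1.le))
      have e4 := mul_le_mul_of_nonneg_left e3 hC
      rw [hlam] at *
      linarith
  · exact KS β (u k) (p k) (q k) _ _ _ hco.cS hco.cb hco.ell (fun t x => (h.bbd (hv t x) t x).1) (hsrc k).cont (fun t x => src_bd h (hv t x) k) (hr k) (hp k)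
end QP

namespace QP
open MeasureTheory Filter Topology Metric
variable {n m : ℕ} {L C Λ K δ : ℝ} {S : ℝ → ES n → ES m → (ES n →L[ℝ] ES n)} {b : ℝ → ES n → ES m → ES n} {f : ℝ → ES n → ES m → ES m}
    {g : Fin m → ES n → ℝ} {gp : Fin m → ES n → (ES n →L[ℝ] ℝ)} {gq : Fin m → ES n → Bil n}

/-- `u` with derivatives `p`, `q` is the output of the linearized step with frozen coefficients at `v` -/
def StepOut (T β C1 : ℝ) (S : ℝ → ES n → ES m → (ES n →L[ℝ] ES n)) (b : ℝ → ES n → ES m → ES n) (f : ℝ → ES n → ES m → ES m)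
    (g : Fin m → ES n → ℝ) (gp : Fin m → ES n → (ES n →L[ℝ] ℝ)) (gq : Fin m → ES n → Bil n) (v u : Fin m → ℝ → ES n → ℝ)
    (p : Fin m → ℝ → ES n → (ES n →L[ℝ] ℝ)) (q : Fin m → ℝ → ES n → Bil n) : Prop :=
  ∀ k, Reg T β (u k) (p k) (q k) ∧
      Pde T (fun t x => S t x (tht g v t x)) (fun t x => b t x (tht g v t x)) (Src S b f g gp gq v k) (u k) (p k) (q k) ∧
      ∀ t x, ‖p k t x‖ ≤ C1 ∧ ‖q k t x‖ ≤ C1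

lemma contr (h : NLD L C Λ K δ S b f g gp gq) {T β C1 R N : ℝ} (hT : 0 < T) (hN : 0 ≤ N) {v u v' u' : Fin m → ℝ → ES n → ℝ} {p q p' q'}
    (hR : ∀ t x, ‖tht g v t x‖ ≤ R) (h1 : StepOut T β C1 S b f g gp gq v u p q) (h2 : StepOut T β C1 S b f g gp gq v' u' p' q')
    (hv : ∀ k t x, |v k t x - v' k t x| ≤ N * Real.exp (2 * (L * ((n + 1) * (K + C1) + 1) * m) * cl T t)) (k : Fin m) (t : ℝ) (x : ES n) :
    |u k t x - u' k t x| ≤ N / 2 * Real.exp (2 * (L * ((n + 1) * (K + C1) + 1) * m) * cl T t) := by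
  rw [(h1 k).1.cl hT.le t, (h2 k).1.cl hT.le t]
  obtain ⟨K1, hK1⟩ := (h1 k).1.bd
  obtain ⟨K2, hK2⟩ := (h2 k).1.bd
  have e := comp_step h (T := T) (K0 := K1 + K2) (Γ := K + C1) (R := R) hN k (z := fun t x => g k x + u k t x) (z' := fun t x => g k x + u' k t x)
    (y := tht g v) (y' := tht g v') ?_ ?_ ?_ (fun t _ x => hR t x) ?_ ?_ ?_ (cl T t) (cl_mem hT.le t) x
  · simpa using e
  · simp only [add_sub_add_left_eq_sub]
    exact ((h1 k).1.ccl.sub (h2 k).1.ccl).continuousOn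
  · intro t _ x
    rw [add_sub_add_left_eq_sub]
    exact (abs_sub _ _).trans (add_le_add (hK1 t x).1 (hK2 t x).1)
  · intro x
    rw [(h1 k).1.zero 0 le_rfl, (h2 k).1.zero 0 le_rfl]
  · intro t ht x
    refine ES_norm_le (by positivity) fun k => ?_
    have := hv k t x
    rw [cl_of ⟨ht.1.le, ht.2.le⟩] at this
    rwa [PiLp.sub_apply, tht_apply, tht_apply, add_sub_add_left_eq_sub]
  · intro t ht x
    exact ⟨_, _, full_DD h (h1 k).1 (h1 k).2.1 ht x⟩
  · intro t ht x
    exact ⟨_, _, full_DD h (h2 k).1 (h2 k).2.1 ht x, (norm_add_le _ _).trans (add_le_add (h.gb k x).2.1 ((h2 k).2.2 t x).1),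
      (norm_add_le _ _).trans (add_le_add (h.gb k x).2.2 ((h2 k).2.2 t x).2)⟩

set_option maxHeartbeats 1000000 in
lemma fixed_point (h : NLD L C Λ K δ S b f g gp gq) {T : ℝ} (hT : 0 < T) : ∃ (β R C1 : ℝ) (v : Fin m → ℝ → ES n → ℝ)
    (p : Fin m → ℝ → ES n → (ES n →L[ℝ] ℝ)) (q : Fin m → ℝ → ES n → Bil n),
    (∀ t x, ‖tht g v t x‖ ≤ R) ∧ StepOut T β C1 S b f g gp gq v v p q := by
  obtain ⟨M, lam, α, A, β, R, C1, hM, hl, hα, hA, hC1, adm0, step⟩ := step_exists h hT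
  choose hR Φ P Q hΦ hS using step
  obtain ⟨hL, hC, hΛ, hK⟩ := h.nn
  set μ := 2 * (L * ((n + 1) * (K + C1) + 1) * m) with hμ
  have hμ0 : 0 ≤ μ := by positivity
  let V : ℕ → {v // Adm T M lam α A g v} := fun j => Nat.rec ⟨_, adm0⟩ (fun _ v => ⟨Φ v.1 v.2, hΦ v.1 v.2⟩) j
  have Vs : ∀ j, (V (j+1)).1 = Φ (V j).1 (V j).2 := fun j => rfl
  set N0 := 2 * (M * Real.exp (lam * T)) with hN0
  have hN00 : 0 ≤ N0 := by positivity
  have E1 : ∀ t, 1 ≤ Real.exp (μ * cl T t) := fun t => Real.one_le_exp (mul_nonneg hμ0 (cl_mem hT.le t).1)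
  have bdd : ∀ w, Adm T M lam α A g w → ∀ k t x, |g k x + w k t x| ≤ M * Real.exp (lam * T) := fun w hw k t x => by
    refine (hw.bar k t x).trans ?_
    have := (cl_mem hT.le t).2
    gcongr
  have geo : ∀ j k t x, |(V j).1 k t x - (V (j+1)).1 k t x| ≤ N0 / 2 ^ j * Real.exp (μ * cl T t) := by
    intro j
    induction j with
    | zero =>
      intro k t x
      have h1 := bdd _ (V 0).2 k t x
      have h2 := bdd _ (V (0+1)).2 k t x
      have h3 := abs_sub (g k x + (V 0).1 k t x) (g k x + (V (0+1)).1 k t x)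
      rw [add_sub_add_left_eq_sub] at h3
      have h4 := mul_le_mul_of_nonneg_left (E1 t) hN00
      rw [pow_zero, div_one]
      linarith
    | succ j ih =>
      intro k t x
      have := contr h hT (N := N0 / 2 ^ j) (by positivity) (hR _ (V j).2) (hS _ (V j).2) (hS _ (V (j+1)).2) ih k t x
      rw [Vs j, Vs (j+1)]
      rw [pow_succ, ← div_div]
      exact this
  have geo' : ∀ k t x j, dist ((V j).1 k t x) ((V (j+1)).1 k t x) ≤ (2 * N0 * Real.exp (μ * cl T t)) / 2 / 2 ^ j := fun k t x j => by
    rw [Real.dist_eq]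
    refine (geo j k t x).trans (le_of_eq ?_)
    ring
  have lim : ∀ k t x, ∃ w, Tendsto (fun j => (V j).1 k t x) atTop (𝓝 w) := fun k t x =>
    cauchySeq_tendsto_of_complete (cauchySeq_of_le_geometric_two (geo' k t x))
  choose w hw using lim
  have dw : ∀ j k t x, |(V j).1 k t x - w k t x| ≤ 2 * N0 / 2 ^ j * Real.exp (μ * cl T t) := fun j k t x => by
    have := dist_le_of_le_geometric_two_of_tendsto (geo' k t x) (hw k t x) j
    rw [Real.dist_eq] at this
    refine this.trans (le_of_eq ?_)
    ring
  have aw : Adm T M lam α A g w := ⟨fun k t x => le_of_tendsto ((tendsto_const_nhds.add (hw k t x)).abs) (Eventually.of_forall fun j => (V j).2.bar k t x),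
    fun k t x s y => le_of_tendsto (((hw k t x).sub (hw k s y)).abs) (Eventually.of_forall fun j => (V j).2.hol k t x s y)⟩
  have fix : Φ w aw = w := by
    funext k t x
    refine tendsto_nhds_unique ?_ ((tendsto_add_atTop_iff_nat 1).2 (hw k t x))
    rw [tendsto_iff_dist_tendsto_zero]
    have hz : Tendsto (fun j : ℕ => (N0 * Real.exp (μ * cl T t)) * (1 / 2 : ℝ) ^ j) atTop (𝓝 0) := by
      simpa using (tendsto_pow_atTop_nhds_zero_of_lt_one (by norm_num : (0:ℝ) ≤ 1/2) (by norm_num)).const_mul (N0 * Real.exp (μ * cl T t))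
    refine squeeze_zero (fun _ => dist_nonneg) (fun j => ?_) hz
    have := contr h hT (N := 2 * N0 / 2 ^ j) (by positivity) (hR _ (V j).2) (hS _ (V j).2) (hS _ aw) (dw j) k t x
    rw [Real.dist_eq, Vs j]
    refine this.trans (le_of_eq ?_)
    rw [← hμ, one_div, inv_pow]
    ring
  have := hS w aw
  rw [fix] at this
  exact ⟨β, R, C1, w, _, _, hR w aw, this⟩
end QP

namespace QP
open MeasureTheory Filter Topology Metric
variable {n m d : ℕ}

/-- a square matrix as an operator on Euclidean space -/
def mC (A : Matrix (Fin n) (Fin n) ℝ) : ES n →L[ℝ] ES n := Matrix.toEuclideanCLM (𝕜 := ℝ) (n := Fin n) A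

lemma mC_apply (A : Matrix (Fin n) (Fin n) ℝ) (v : ES n) (i : Fin n) : mC A v i = ∑ j, A i j * v j := by
  have := congrFun (Matrix.ofLp_toEuclideanCLM (𝕜 := ℝ) A v) i
  exact this

lemma mC_sub (A B : Matrix (Fin n) (Fin n) ℝ) : mC (A - B) = mC A - mC B := map_sub _ _ _

lemma inner_dot (v w : ES n) : inner ℝ v w = w.ofLp ⬝ᵥ v.ofLp := by
  rw [EuclideanSpace.inner_eq_star_dotProduct, star_trivial]

lemma mC_inner (A : Matrix (Fin n) (Fin n) ℝ) (v w : ES n) : inner ℝ (mC A v) w = w.ofLp ⬝ᵥ A *ᵥ v.ofLp := by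
  rw [inner_dot, mC, Matrix.ofLp_toEuclideanCLM]

lemma mC_norm (A : Matrix (Fin n) (Fin n) ℝ) : ‖mC A‖ ≤ n * (n * ‖A‖) := by
  refine ContinuousLinearMap.opNorm_le_bound _ (by positivity) fun v => ?_
  rw [mul_assoc]
  refine ES_norm_le (by positivity) fun i => ?_
  rw [mC_apply]
  refine (Finset.abs_sum_le_sum_abs _ _).trans ?_
  have : ∀ j ∈ Finset.univ, |A i j * v j| ≤ ‖A‖ * ‖v‖ := fun j _ => by
    rw [abs_mul]
    exact mul_le_mul (Matrix.norm_entry_le_entrywise_sup_norm A) (ES_abs_le v j) (abs_nonneg _) (norm_nonneg _)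
  refine (Finset.sum_le_sum this).trans (le_of_eq ?_)
  simp; ring

lemma mulT_norm (A B : Matrix (Fin n) (Fin d) ℝ) : ‖A * Bᵀ‖ ≤ d * (‖A‖ * ‖B‖) := by
  rw [Matrix.norm_le_iff (by positivity)]
  intro i j
  rw [Matrix.mul_apply]
  refine (norm_sum_le _ _).trans ?_
  have : ∀ k ∈ Finset.univ, ‖A i k * Bᵀ k j‖ ≤ ‖A‖ * ‖B‖ := fun k _ => by
    rw [norm_mul]
    exact mul_le_mul (Matrix.norm_entry_le_entrywise_sup_norm A) (Matrix.norm_entry_le_entrywise_sup_norm B) (norm_nonneg _) (norm_nonneg _)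
  refine (Finset.sum_le_sum this).trans (le_of_eq ?_)
  simp

/-- the diffusion operator -/
def sO (A : Matrix (Fin n) (Fin d) ℝ) : ES n →L[ℝ] ES n := mC ((2 : ℝ)⁻¹ • (A * Aᵀ))

lemma sO_norm {A : Matrix (Fin n) (Fin d) ℝ} {C : ℝ} (h : ‖A‖ ≤ C) : ‖sO A‖ ≤ n * (n * (d * (C * C))) := by
  have hC := (norm_nonneg _).trans h
  refine (mC_norm _).trans ?_
  gcongr
  rw [norm_smul]
  have h1 := mulT_norm A A
  have h2 : (d:ℝ) * (‖A‖ * ‖A‖) ≤ d * (C * C) := by gcongr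
  have h3 : ‖(2:ℝ)⁻¹‖ ≤ 1 := by norm_num
  calc _ ≤ 1 * ‖A * Aᵀ‖ := by gcongr
    _ ≤ _ := by rw [one_mul]; exact h1.trans h2

lemma sO_lip {A B : Matrix (Fin n) (Fin d) ℝ} {C : ℝ} (h : ‖A‖ ≤ C) (h' : ‖B‖ ≤ C) : ‖sO A - sO B‖ ≤ n * (n * (d * (2 * C))) * ‖A - B‖ := by
  have hC := (norm_nonneg _).trans h
  rw [sO, sO, ← mC_sub]
  refine (mC_norm _).trans ?_
  have e : (2 : ℝ)⁻¹ • (A * Aᵀ) - (2 : ℝ)⁻¹ • (B * Bᵀ) = (2 : ℝ)⁻¹ • (A * (A - B)ᵀ + (A - B) * Bᵀ) := by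
    rw [← smul_sub, Matrix.transpose_sub, Matrix.mul_sub, Matrix.sub_mul]; congr 1; abel
  rw [e, norm_smul]
  have h1 : ‖A * (A - B)ᵀ‖ ≤ d * (C * ‖A - B‖) := (mulT_norm A (A - B)).trans (by gcongr)
  have h2 : ‖(A - B) * Bᵀ‖ ≤ d * (‖A - B‖ * C) := (mulT_norm (A - B) B).trans (by gcongr)
  have h3 : ‖(2:ℝ)⁻¹‖ ≤ 1 := by norm_num
  have h4 : ‖(2:ℝ)⁻¹‖ * ‖A * (A - B)ᵀ + (A - B) * Bᵀ‖ ≤ 1 * (d * (C * ‖A - B‖) + d * (‖A - B‖ * C)) := by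
    gcongr
    exact (norm_add_le _ _).trans (add_le_add h1 h2)
  calc _ ≤ (n:ℝ) * (n * (1 * (d * (C * ‖A - B‖) + d * (‖A - B‖ * C)))) := by gcongr
    _ = _ := by ring

lemma sO_ell {A : Matrix (Fin n) (Fin d) ℝ} {C ν : ℝ} (h : ‖A‖ ≤ C) (hp : (A * Aᵀ - ν • (1 : Matrix (Fin n) (Fin n) ℝ)).PosSemidef) :
    Ell (ν / 2) (n * (n * (d * (C * C)))) (sO A) := by
  refine ⟨fun v w => ?_, fun v => ?_, fun v => ?_⟩
  · rw [sO, mC_inner, real_inner_comm, mC_inner, Matrix.dotProduct_mulVec, ← Matrix.mulVec_transpose, dotProduct_comm]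
    congr 2
    rw [Matrix.transpose_smul, Matrix.transpose_mul, Matrix.transpose_transpose]
  · have h1 := hp.dotProduct_mulVec_nonneg v.ofLp
    rw [star_trivial, Matrix.sub_mulVec, dotProduct_sub, Matrix.smul_mulVec, Matrix.one_mulVec, dotProduct_smul, smul_eq_mul, ← inner_dot v v, real_inner_self_eq_norm_sq] at h1
    rw [sO, mC_inner, Matrix.smul_mulVec, dotProduct_smul, smul_eq_mul]
    linarith
  · refine (real_inner_le_norm _ _).trans ?_
    have := (sO A).le_opNorm v
    have h1 := sO_norm h
    calc ‖sO A v‖ * ‖v‖ ≤ (n * (n * (d * (C * C))) * ‖v‖) * ‖v‖ := by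
          gcongr; exact this.trans (by gcongr)
      _ = _ := by ring

lemma Lop_mC (A : Matrix (Fin n) (Fin n) ℝ) (q : Bil n) : Lop (mC A) q = ∑ i, ∑ j, A i j * q (ee i) (ee j) := by
  rw [Lop, Finset.sum_comm]
  refine Finset.sum_congr rfl fun j _ => ?_
  have : mC A (ee j) = ∑ i, A i j • ee i := by
    ext i
    rw [mC_apply]
    simp [ee, PiLp.single_apply, Pi.single_apply]
  rw [this, map_sum, _root_.sum_apply]
  simp [map_smul]

lemma dual_sum (p : ES n →L[ℝ] ℝ) (v : ES n) : ∑ i, p (ee i) * v i = p v := by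
  have : v = ∑ i, v i • ee i := by
    ext i
    simp [ee, PiLp.single_apply, Pi.single_apply]
  conv_rhs => rw [this]
  simp [mul_comm]

lemma C1Bdd_lip {F : Type*} [NormedAddCommGroup F] [NormedSpace ℝ F] {G : ℝ → ES n → ES m → F} (h : C1Bdd (fun p : ℝ × ES n × ES m => G p.1 p.2.1 p.2.2)) :
    ∃ L, 0 ≤ L ∧ ∀ t x y s x' y', ‖G t x y - G s x' y'‖ ≤ L * (|t - s| + ‖x - x'‖ + ‖y - y'‖) := by
  obtain ⟨hd, K, hK⟩ := h
  have hK0 : 0 ≤ K := (norm_nonneg _).trans (hK 0)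
  refine ⟨K, hK0, fun t x y s x' y' => ?_⟩
  have := convex_univ.norm_image_sub_le_of_norm_fderiv_le (𝕜 := ℝ) (f := fun p : ℝ × ES n × ES m => G p.1 p.2.1 p.2.2) (C := K) (x := (s, x', y')) (y := (t, x, y)) (fun p _ => (hd.differentiable one_ne_zero) p) (fun p _ => hK p) (mem_univ _) (mem_univ _)
  refine this.trans (mul_le_mul_of_nonneg_left ?_ hK0)
  have a := abs_nonneg (t - s)
  have b := norm_nonneg (x - x')
  have c := norm_nonneg (y - y')
  simp only [Prod.norm_def, Prod.fst_sub, Prod.snd_sub, Real.norm_eq_abs]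
  exact max_le (by linarith) (max_le (by linarith) (by linarith))

/-- reversed and clamped time -/
def rt (T t : ℝ) : ℝ := cl T (T - t)

lemma rt_lip (T t s : ℝ) : |rt T t - rt T s| ≤ |t - s| := by
  rw [rt, rt, cl, cl]
  have h1 := abs_max_sub_max_le_max 0 (min (T - t) T) 0 (min (T - s) T)
  have h2 := abs_min_sub_min_le_max (T - t) T (T - s) T
  rw [sub_self, abs_zero, max_eq_right (abs_nonneg (min (T - t) T - min (T - s) T))] at h1
  rw [sub_self, abs_zero, max_eq_left (abs_nonneg (T - t - (T - s)))] at h2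
  refine (h1.trans h2).trans (le_of_eq ?_)
  rw [abs_sub_comm]
  congr 1
  ring

lemma rt_mem {T : ℝ} (hT : 0 < T) (t : ℝ) : rt T t ∈ Icc 0 T := cl_mem hT.le _

lemma rt_of {T t : ℝ} (ht : t ∈ Icc 0 T) : rt T t = T - t := cl_of ⟨by linarith [ht.2], by linarith [ht.1]⟩

/-- coordinate functional -/
def prj (k : Fin m) : ES m →L[ℝ] ℝ := EuclideanSpace.proj k

lemma prj_apply (k : Fin m) (y : ES m) : prj k y = y k := rfl

lemma prj_norm (k : Fin m) : ‖(prj k : ES m →L[ℝ] ℝ)‖ ≤ 1 :=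
  ContinuousLinearMap.opNorm_le_bound _ zero_le_one fun y => by rw [one_mul]; exact ES_abs_le y k

lemma prj_comp (k : Fin m) (A : ES n →L[ℝ] ES m) : ‖(prj k).comp A‖ ≤ ‖A‖ := by
  refine (ContinuousLinearMap.opNorm_comp_le _ _).trans ?_
  have := mul_le_mul_of_nonneg_right (prj_norm k) (norm_nonneg A)
  linarith

/-- second derivative of a coordinate -/
def prj2 (k : Fin m) (A : ES n →L[ℝ] ES n →L[ℝ] ES m) : Bil n := (ContinuousLinearMap.compL ℝ (ES n) (ES m) ℝ (prj k)).comp A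

lemma prj2_norm (k : Fin m) (A : ES n →L[ℝ] ES n →L[ℝ] ES m) : ‖prj2 k A‖ ≤ ‖A‖ := by
  refine ContinuousLinearMap.opNorm_le_bound _ (norm_nonneg A) fun v => ?_
  exact (prj_comp k (A v)).trans (A.le_opNorm v)

lemma prj2_sub (k : Fin m) (A B : ES n →L[ℝ] ES n →L[ℝ] ES m) : prj2 k (A - B) = prj2 k A - prj2 k B :=
  ContinuousLinearMap.comp_sub _ _ _

set_option maxHeartbeats 1000000 in
lemma mk_NLD {T : ℝ} (hT : 0 < T)
    {b : ℝ → ES n → ES m → ES n}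
    {σ : ℝ → ES n → ES m → Matrix (Fin n) (Fin d) ℝ}
    {bh : ℝ → ES n → ES m → ES m}
    {σh : ℝ → ES n → ES m → Matrix (Fin m) (Fin d) ℝ → Matrix (Fin m) (Fin d) ℝ}
    {g : ES n → ES m} {η ν : ℝ → ℝ} {δ C : ℝ}
    (hA1 : AssumptionA1 b σ bh σh g δ)
    (hA2 : AssumptionA2 T σ ν C)
    (hA4 : AssumptionA4 T b bh η C) :
    ∃ L C' Λ K, NLD L C' Λ K δ (fun t x y => sO (σ (rt T t) x y)) (fun t x y => b (rt T t) x y) (fun t x y => bh (rt T t) x y)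
      (fun k x => g x k) (fun k x => (prj k).comp (fderiv ℝ g x)) (fun k x => prj2 k (fderiv ℝ (fderiv ℝ g) x)) := by
  obtain ⟨h1, h2, h3, _, _, hδ, hg2, K, hgK, hgH⟩ := hA1
  obtain ⟨L1, hL1, l1⟩ := C1Bdd_lip h1
  obtain ⟨L2, hL2, l2⟩ := C1Bdd_lip h2
  obtain ⟨L3, hL3, l3⟩ := C1Bdd_lip h3
  obtain ⟨hC, cν, pν, hσ⟩ := hA2
  obtain ⟨hη, hbη, hbC⟩ := hA4
  have hK : 0 ≤ K := (norm_nonneg _).trans (hgK 0).1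
  set D : ℝ := n * (n * (d * (2 * C))) with hD
  have hD0 : 0 ≤ D := by positivity
  have hDL : 0 ≤ D * L3 := by positivity
  have hη0 := hη 0
  have rb : ∀ t s (x x' : ES n) (y y' : ES m), |rt T t - rt T s| + ‖x - x'‖ + ‖y - y'‖ ≤ |t - s| + ‖x - x'‖ + ‖y - y'‖ := fun t s x x' y y' => by
    have := rt_lip T t s
    linarith
  have gen : ∀ {a L0 : ℝ} {t s : ℝ} {x x' : ES n} {y y' : ES m}, 0 ≤ L0 → L0 ≤ L1 + L2 + D * L3 → a ≤ L0 * (|rt T t - rt T s| + ‖x - x'‖ + ‖y - y'‖) →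
      a ≤ (L1 + L2 + D * L3) * (|t - s| + ‖x - x'‖ + ‖y - y'‖) := fun h0 hle ha =>
    ha.trans (mul_le_mul hle (rb _ _ _ _ _ _) (by positivity) (by linarith))
  refine ⟨L1 + L2 + D * L3, η 0 + C, n * (n * (d * (C * C))), K, ⟨by positivity, by positivity, by positivity, hK⟩, hδ, ?_, ?_, ?_, ?_, ?_, ?_, ?_, ?_, ?_, ?_, ?_⟩
  · intro t x y s x' y'
    refine gen hDL (by linarith) ?_
    refine (sO_lip (hσ _ (rt_mem hT t) x y).1 (hσ _ (rt_mem hT s) x' y').1).trans ?_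
    rw [mul_assoc D L3]
    exact mul_le_mul_of_nonneg_left (l3 _ _ _ _ _ _) hD0
  · intro t x y s x' y'
    exact gen hL1 (by linarith) (l1 _ _ _ _ _ _)
  · intro t x y s x' y'
    exact gen hL2 (by linarith) (l2 _ _ _ _ _ _)
  · intro t x y
    exact sO_norm (hσ _ (rt_mem hT t) x y).1
  · intro R
    obtain ⟨r, hr, hmin⟩ := (isCompact_Icc (a := (0:ℝ)) (b := |R|)).exists_isMinOn ⟨0, le_rfl, abs_nonneg _⟩ cν.continuousOn
    refine ⟨ν r / 2, by linarith [pν r], fun t x y hy => ?_⟩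
    refine (sO_ell (hσ _ (rt_mem hT t) x y).1 (hσ _ (rt_mem hT t) x y).2).mono ?_ le_rfl
    have : ν r ≤ ν ‖y‖ := hmin ⟨norm_nonneg _, hy.trans (le_abs_self _)⟩
    linarith
  · intro t x
    have := hbη _ (rt_mem hT t) x 0
    rw [norm_zero] at this
    linarith
  · intro t x
    have := hbC _ (rt_mem hT t) x
    linarith
  · intro k x
    obtain ⟨a1, a2, a3⟩ := hgK x
    exact ⟨(ES_abs_le _ _).trans a1, (prj_comp _ _).trans a2, (prj2_norm _ _).trans a3⟩
  · intro k x
    exact (prj k).hasFDerivAt.comp x ((hg2.differentiable two_ne_zero) x).hasFDerivAt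
  · intro k x
    have hd : Differentiable ℝ (fderiv ℝ g) := (hg2.fderiv_right (m := 1) (by norm_num)).differentiable one_ne_zero
    exact ((ContinuousLinearMap.compL ℝ (ES n) (ES m) ℝ (prj k)).hasFDerivAt).comp x (hd x).hasFDerivAt
  · intro k x y
    rw [← prj2_sub]
    exact (prj2_norm _ _).trans (hgH x y)
end QP

namespace QP
open MeasureTheory Filter Topology Metric
variable {n m d : ℕ}

lemma pd_of {f : ES n → ℝ} {p : ES n → (ES n →L[ℝ] ℝ)} (h : ∀ y, HasFDerivAt f (p y) y) (j : Fin n) : pd j f = fun y => p y (ee j) := by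
  funext y
  rw [pd, (h y).fderiv, ee]

lemma pd_diff {f : ES n → ℝ} {p : ES n → (ES n →L[ℝ] ℝ)} {q : Bil n} {x : ES n} (h : ∀ y, HasFDerivAt f (p y) y) (h2 : HasFDerivAt p q x) (j : Fin n) :
    HasFDerivAt (pd j f) ((ContinuousLinearMap.apply ℝ ℝ (ee j)).comp q) x := by
  rw [pd_of h]
  exact (ContinuousLinearMap.apply ℝ ℝ (ee j : ES n)).hasFDerivAt.comp x h2

lemma pd2_of {f : ES n → ℝ} {p : ES n → (ES n →L[ℝ] ℝ)} {q : Bil n} {x : ES n} (h : ∀ y, HasFDerivAt f (p y) y) (h2 : HasFDerivAt p q x) (i j : Fin n) :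
    pd2 i j f x = q (ee i) (ee j) := by
  rw [pd2, pd, (pd_diff h h2 j).fderiv, ← ee]
  rfl

lemma reg_to {f : ES n → ℝ} {x : ES n} (hj : ∀ j, DifferentiableAt ℝ (pd j f) x) : ∃ q : Bil n, HasFDerivAt (fderiv ℝ f) q x := by
  have e : fderiv ℝ f = fun y => ∑ j, pd j f y • (prj j : ES n →L[ℝ] ℝ) := by
    funext y
    ext v
    rw [_root_.sum_apply]
    simp only [_root_.smul_apply, prj_apply, smul_eq_mul]
    exact (dual_sum (fderiv ℝ f y) v).symm
  rw [e]
  have : DifferentiableAt ℝ (fun y => ∑ j, pd j f y • (prj j : ES n →L[ℝ] ℝ)) x :=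
    DifferentiableAt.fun_sum fun j _ => (hj j).smul_const _
  exact ⟨_, this.hasFDerivAt⟩

lemma rev_deriv {a : ℝ → ℝ} {a' T t : ℝ} (h : HasDerivAt a a' (T - t)) : HasDerivAt (fun s => a (T - s)) (-a') t := by
  have h1 : HasDerivAt (fun s => T - s) (-1) t := (hasDerivAt_id t).const_sub T
  exact (h.comp t h1).congr_deriv (by ring)

/-- the equation in reversed time -/
lemma sat_iff {b : ℝ → ES n → ES m → ES n} {σ : ℝ → ES n → ES m → Matrix (Fin n) (Fin d) ℝ} {bh : ℝ → ES n → ES m → ES m} {T s : ℝ} (hs : s ∈ Icc 0 T) (x : ES n) (y : ES m) (k : Fin m) (p : ES n →L[ℝ] ℝ) (q : Bil n) :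
    Rhs (fun t x y => sO (σ (rt T t) x y)) (fun t x y => b (rt T t) x y) (fun t x y => bh (rt T t) x y) k s x y p q =
    ∑ i, ∑ j, halfSigmaSigmaT σ (T - s) x y i j * q (ee i) (ee j) + ∑ i, p (ee i) * (b (T - s) x y) i + bh (T - s) x y k := by
  rw [Rhs, rt_of hs, dual_sum, ← Lop_mC]
  rfl

lemma icc_bound {T K : ℝ} (hT : 0 < T) {θ : ℝ → ES n → ES m} (hc : ContinuousOn (fun p : ℝ × ES n => θ p.1 p.2) (Icc 0 T ×ˢ closure (univ : Set (ES n))))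
    (h : ∀ t ∈ Ioo 0 T, ∀ x, ‖θ t x‖ ≤ K) : ∀ t ∈ Icc 0 T, ∀ x, ‖θ t x‖ ≤ K := by
  intro t ht x
  have hc1 : ContinuousOn (fun s => ‖θ s x‖) (Icc 0 T) := by
    refine (hc.comp (f := fun s => (s, x)) (by fun_prop) ?_).norm
    intro s hs
    exact ⟨hs, by simp⟩
  have hcl : closure (Ioo 0 T) = Icc 0 T := closure_Ioo hT.ne
  rw [← hcl] at ht hc1
  exact le_on_closure (fun s hs => h s hs x) hc1 continuousOn_const ht

set_option maxHeartbeats 1000000 in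
lemma main_result {T : ℝ} (hT : 0 < T)
    {b : ℝ → ES n → ES m → ES n}
    {σ : ℝ → ES n → ES m → Matrix (Fin n) (Fin d) ℝ}
    {bh : ℝ → ES n → ES m → ES m}
    {g : ES n → ES m} {L C Λ K δ : ℝ} {gp gq}
    (h : NLD L C Λ K δ (fun t x y => sO (σ (rt T t) x y)) (fun t x y => b (rt T t) x y) (fun t x y => bh (rt T t) x y)
      (fun k x => g x k) gp gq) :
    ∃ θ : ℝ → ES n → ES m,
      IsFullSpaceSolution T b σ bh g θ ∧
      ∀ θ' : ℝ → ES n → ES m, IsFullSpaceSolution T b σ bh g θ' →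
        ∀ t ∈ Icc (0 : ℝ) T, ∀ x : ES n, θ' t x = θ t x := by
  obtain ⟨β, R, C1, v, p, q, hR, hst⟩ := fixed_point h hT
  obtain ⟨hL, hC, hΛ, hK⟩ := h.nn
  have hgc : ∀ k, Continuous fun x => g x k := fun k => continuous_iff_continuousAt.2 fun x => (h.dg k x).continuousAt
  have hcont : Continuous fun a : ℝ × ES n => tht (fun k x => g x k) v (T - a.1) a.2 := by
    refine (PiLp.continuous_toLp 2 _).comp (continuous_pi fun k => ?_)
    exact ((hgc k).comp continuous_snd).add ((hst k).1.ccl.comp (f := fun a : ℝ × ES n => (T - a.1, a.2)) (by fun_prop))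
  have dd : ∀ k, ∀ s ∈ Ioo 0 T, ∀ x, _ := fun k s hs x => full_DD h (hst k).1 (hst k).2.1 hs x
  have pb : ∀ k s x, ‖gp k x + p k s x‖ ≤ K + C1 := fun k s x => (norm_add_le _ _).trans (add_le_add (h.gb k x).2.1 ((hst k).2.2 s x).1)
  have qb : ∀ k s x, ‖gq k x + q k s x‖ ≤ K + C1 := fun k s x => (norm_add_le _ _).trans (add_le_add (h.gb k x).2.2 ((hst k).2.2 s x).2)
  refine ⟨fun t x => tht (fun k x => g x k) v (T - t) x, ⟨⟨hcont.continuousOn, fun t ht x _ => ?_⟩, fun x => ?_, ?_⟩, ?_⟩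
  · have hs : T - t ∈ Ioo 0 T := ⟨by linarith [ht.2], by linarith [ht.1]⟩
    refine ⟨fun k => ?_, fun k => ?_⟩
    · obtain ⟨d1, d2, d3⟩ := dd k _ hs x
      exact ⟨(rev_deriv d3).differentiableAt, (d1 x).differentiableAt, fun j => (pd_diff d1 d2 j).differentiableAt⟩
    · obtain ⟨d1, d2, d3⟩ := dd k _ hs x
      have e1 := (rev_deriv d3).deriv
      rw [sat_iff ⟨hs.1.le, hs.2.le⟩, sub_sub_cancel] at e1
      have e2 := fun i j => pd2_of d1 d2 i j
      have e3 := pd_of d1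
      simp only [tht_apply]
      rw [e1]
      simp only [e2, e3]
      ring
  · beta_reduce
    rw [sub_self]
    ext k
    rw [tht_apply, (hst k).1.zero 0 le_rfl, add_zero]
  · refine ⟨R + (n * Λ * (K + C1) + (K + C1) * (C + L * R) + (C + L * R)) + (K + C1) + n * (K + C1), fun t ht x _ k => ?_⟩
    have hs : T - t ∈ Ioo 0 T := ⟨by linarith [ht.2], by linarith [ht.1]⟩
    obtain ⟨d1, d2, d3⟩ := dd k _ hs x
    have hR0 : 0 ≤ R := (norm_nonneg _).trans (hR 0 0)
    have hKC : 0 ≤ K + C1 := (norm_nonneg _).trans (pb k 0 0)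
    have hCR : 0 ≤ C + L * R := by positivity
    have n1 : 0 ≤ n * Λ * (K + C1) + (K + C1) * (C + L * R) + (C + L * R) := by positivity
    have n2 : 0 ≤ n * (K + C1) := by positivity
    refine ⟨(hR _ _).trans (by linarith), ?_, fun i => ?_, ?_⟩
    · have e1 := (rev_deriv d3).deriv
      simp only [tht_apply]
      rw [e1, abs_neg]
      obtain ⟨f1, f2⟩ := h.bbd (hR (T - t) x) (T - t) x
      have g1 := (abs_Lop_le (sO (σ (rt T (T - t)) x (tht (fun k x => g x k) v (T - t) x))) (gq k x + q k (T - t) x)).trans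
        (mul_le_mul (mul_le_mul_of_nonneg_left (h.Sb (T - t) x _) (Nat.cast_nonneg n)) (qb k (T - t) x) (norm_nonneg _) (by positivity))
      have g2 := ((gp k x + p k (T - t) x).le_opNorm (b (rt T (T - t)) x (tht (fun k x => g x k) v (T - t) x))).trans (mul_le_mul (pb k (T - t) x) f1 (norm_nonneg _) hKC)
      have g3 := (ES_abs_le _ k).trans f2
      refine ((abs_add_le _ _).trans (add_le_add ((abs_add_le _ _).trans (add_le_add g1 g2)) g3)).trans ?_
      linarith
    · have e3 := pd_of d1
      simp only [tht_apply]
      rw [e3]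
      have := ((gp k x + p k (T - t) x).le_opNorm (ee i)).trans (mul_le_mul_of_nonneg_right (pb k (T - t) x) (norm_nonneg _))
      rw [norm_ee, mul_one] at this
      refine this.trans ?_
      linarith
    · have e2 := fun i j => pd2_of d1 d2 i j
      simp only [tht_apply, e2]
      refine (Finset.abs_sum_le_sum_abs _ _).trans ?_
      have : ∀ i ∈ Finset.univ, |(gq k x + q k (T - t) x) (ee i) (ee i)| ≤ K + C1 := fun i _ => by
        have := (gq k x + q k (T - t) x).le_opNorm₂ (ee i) (ee i)
        rw [norm_ee, mul_one, mul_one] at this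
        exact this.trans (qb k _ x)
      refine (Finset.sum_le_sum this).trans ?_
      simp only [Finset.sum_const, Finset.card_univ, Fintype.card_fin, nsmul_eq_mul]
      linarith
  · rintro θ' ⟨⟨hc', hsol⟩, hT', K', hK'⟩
    have key : ∀ t ∈ Icc 0 T, ∀ x k, θ' (T - t) x k = g x k + v k t x := by
      intro t ht x k0
      have bd : ∀ t ∈ Icc 0 T, ∀ x, ‖θ' t x‖ ≤ K' := icc_bound hT hc' fun t ht x => (hK' t ht x (mem_univ _) k0).1
      have hK0 : 0 ≤ K' := (norm_nonneg _).trans (bd 0 ⟨le_rfl, hT.le⟩ 0)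
      have hR0 : 0 ≤ R := (norm_nonneg _).trans (hR 0 0)
      have hKC : 0 ≤ K + C1 := (norm_nonneg _).trans (pb k0 0 0)
      have rev : ∀ {t}, t ∈ Icc 0 T → T - t ∈ Icc 0 T := fun ht => ⟨by linarith [ht.2], by linarith [ht.1]⟩
      have b0 : ∀ k, ∀ t ∈ Icc 0 T, ∀ x, |θ' (T - t) x k - (g x k + v k t x)| ≤ K' + R := fun k t ht x =>
        (abs_sub _ _).trans (add_le_add ((ES_abs_le _ k).trans (bd _ (rev ht) x)) ((ES_abs_le _ k).trans (hR t x)))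
      set μ := 2 * (L * ((n + 1) * (K + C1) + 1) * m) with hμ
      have hμ0 : 0 ≤ μ := by positivity
      have it : ∀ j : ℕ, ∀ k, ∀ t ∈ Icc 0 T, ∀ x, |θ' (T - t) x k - (g x k + v k t x)| ≤ (K' + R) / 2 ^ j * Real.exp (μ * t) := by
        intro j
        induction j with
        | zero =>
          intro k t ht x
          have h1 : 1 ≤ Real.exp (μ * t) := Real.one_le_exp (mul_nonneg hμ0 ht.1)
          have h2 := mul_le_mul_of_nonneg_left h1 (add_nonneg hK0 hR0)
          rw [pow_zero, div_one]
          linarith [b0 k t ht x]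
        | succ j ih =>
          intro k
          rw [pow_succ, ← div_div]
          refine comp_step h (T := T) (K0 := K' + R) (Γ := K + C1) (R := K') (N := (K' + R) / 2 ^ j) (by positivity) k (z := fun s x => θ' (T - s) x k) (z' := fun s x => g x k + v k s x)
            (y := fun s x => θ' (T - s) x) (y' := tht (fun k x => g x k) v) ?_ (b0 k) ?_ (fun s hs x => bd _ (rev ⟨hs.1.le, hs.2.le⟩) x) ?_ ?_ ?_
          · have c1 : ContinuousOn (fun a : ℝ × ES n => θ' (T - a.1) a.2) (Icc 0 T ×ˢ univ) := by
              refine hc'.comp (f := fun a : ℝ × ES n => (T - a.1, a.2)) (by fun_prop) fun a ha => ⟨rev ha.1, by simp⟩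
            have c2 : ContinuousOn (fun a : ℝ × ES n => θ' (T - a.1) a.2 k) (Icc 0 T ×ˢ univ) := (prj k).continuous.comp_continuousOn c1
            exact c2.sub (((hgc k).comp continuous_snd).add (hst k).1.ccl).continuousOn
          · intro x
            rw [(hst k).1.zero 0 le_rfl, add_zero, sub_zero, hT']
          · intro s hs x
            refine ES_norm_le (by positivity) fun k => ?_
            rw [PiLp.sub_apply, tht_apply]
            exact ih k s ⟨hs.1.le, hs.2.le⟩ x
          · intro s hs x
            have hs' : T - s ∈ Ioo 0 T := ⟨by linarith [hs.2], by linarith [hs.1]⟩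
            have r : ∀ y, RegAt θ' (T - s) y := fun y => (hsol _ hs' y (mem_univ _)).1
            have d1 : ∀ y, HasFDerivAt (fun x' => θ' (T - s) x' k) (fderiv ℝ (fun x' => θ' (T - s) x' k) y) y := fun y => (r y k).2.1.hasFDerivAt
            obtain ⟨q', d2⟩ := reg_to (r x k).2.2
            refine ⟨_, q', d1, d2, ?_⟩
            have d3 := rev_deriv (a := fun s => θ' s x k) (r x k).1.hasDerivAt
            refine d3.congr_deriv ?_
            have e := (hsol _ hs' x (mem_univ _)).2 k
            have e2 := fun i j => pd2_of d1 d2 i j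
            have e3 := pd_of d1
            simp only [e2, e3] at e
            rw [sat_iff ⟨hs.1.le, hs.2.le⟩]
            linarith
          · intro s hs x
            exact ⟨_, _, dd k s hs x, pb k s x, qb k s x⟩
      have lim : Tendsto (fun j : ℕ => (K' + R) / 2 ^ j * Real.exp (μ * t)) atTop (𝓝 0) := by
        have := (tendsto_pow_atTop_nhds_zero_of_lt_one (by norm_num : (0:ℝ) ≤ 1/2) (by norm_num)).const_mul ((K' + R) * Real.exp (μ * t))
        rw [mul_zero] at this
        refine this.congr fun j => ?_
        rw [one_div, inv_pow]; ring
      have := ge_of_tendsto lim (Eventually.of_forall fun j => it j k0 t ht x)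
      exact sub_eq_zero.1 (abs_nonpos_iff.1 this)
    intro t ht x
    ext k
    have := key (T - t) ⟨by linarith [ht.2], by linarith [ht.1]⟩ x k
    rw [sub_sub_cancel] at this
    exact this
end QP

/-- **Existence and uniqueness for the decoupling PDE (Proposition 2.2).**
Under assumptions (A1)–(A4), the terminal-value problem
`∂θ/∂t + Σ aᵢⱼ(t,x,θ) ∂²θ/∂xᵢ∂xⱼ + ⟨∇θ, b(t,x,θ)⟩ + b̂(t,x,θ) = 0` on `(0,T) × ℝⁿ`,
`θ(T,·) = g`, with `a = ½σσᵀ`, admits a unique classical solution `θ` such that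
`θ`, `∂θ/∂t`, `∇θ` and `Δθ` are bounded on `(0,T) × ℝⁿ`. -/
theorem decoupling_pde_existence_uniqueness {n m d : ℕ} {T : ℝ} (hT : 0 < T)
    (b : ℝ → ES n → ES m → ES n)
    (σ : ℝ → ES n → ES m → Matrix (Fin n) (Fin d) ℝ)
    (bh : ℝ → ES n → ES m → ES m)
    (σh σinv : ℝ → ES n → ES m → Matrix (Fin m) (Fin d) ℝ → Matrix (Fin m) (Fin d) ℝ)
    (g : ES n → ES m) (κ lam η ν : ℝ → ℝ) (α δ C : ℝ)
    (hA1 : AssumptionA1 b σ bh σh g δ)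
    (hA2 : AssumptionA2 T σ ν C)
    (hA3 : AssumptionA3 T σh σinv κ lam α)
    (hA4 : AssumptionA4 T b bh η C) :
    ∃ θ : ℝ → ES n → ES m,
      IsFullSpaceSolution T b σ bh g θ ∧
      ∀ θ' : ℝ → ES n → ES m, IsFullSpaceSolution T b σ bh g θ' →
        ∀ t ∈ Icc (0 : ℝ) T, ∀ x : ES n, θ' t x = θ t x := by
  obtain ⟨L, C', Λ, K, h⟩ := QP.mk_NLD hT hA1 hA2 hA4
  exact QP.main_result hT h
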